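/- In the DaC model on the triangular lattice 𝕋, for every p < 2 sin(π/18) (the critical probability for Bernoulli bond percolation on 𝕋), the critical colouring density satisfies r_c(p) = 1/2. -/

import Mathlib

/-!
Common definitions for the Divide-and-Colour (DaC) model of
Bálint, Camia and Meester, "Sharp phase transition and critical
behaviour in 2D divide and colour models".

The model is built concretely: a single uniform random variable on `(0,1]`
is decomposed into countably many i.i.d. uniform random variables (via its
binary digits); one family of uniforms drives the Bernoulli(p) bond
percolation (the edge configuration), and an independent family of uniforms
attaches an independent Bernoulli(r) colour to each bond cluster (the colour
of a cluster is determined by the uniform label of its canonical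
representative, the vertex of minimal encoding).  The DaC measure
`ℙ_{p,r}` is the pushforward of Lebesgue measure on `(0,1]` under the map
producing the pair (edge configuration, colour configuration).
-/

open MeasureTheory ENNReal

namespace DaC

/-- Vertices of the lattice. -/
abbrev V : Type := ℤ × ℤ

/-- Square lattice adjacency: Euclidean distance `1`. -/
def SqAdj (u v : V) : Prop := (u.1 - v.1) ^ 2 + (u.2 - v.2) ^ 2 = 1

/-- `*`-adjacency (matching graph of the square lattice):
Euclidean distance `1` or `√2`. -/
def StarAdj (u v : V) : Prop :=
  (u.1 - v.1) ^ 2 + (u.2 - v.2) ^ 2 = 1 ∨ (u.1 - v.1) ^ 2 + (u.2 - v.2) ^ 2 = 2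

/-- Triangular lattice adjacency. -/
def TriAdj (u v : V) : Prop :=
  (u.1 - v.1, u.2 - v.2) ∈
    ({(1, 0), (-1, 0), (0, 1), (0, -1), (1, 1), (-1, -1)} : Set (ℤ × ℤ))

/-- Classical indicator of a proposition, as a boolean. -/
noncomputable def boolOf (P : Prop) : Bool := @decide P (Classical.propDecidable P)

/-- The `n`-th binary digit of a real number `x ∈ (0,1]`. -/
noncomputable def bit (n : ℕ) (x : ℝ) : Bool := boolOf (⌊x * 2 ^ (n + 1)⌋ % 2 = 1)

/-- A countable family of i.i.d. uniform random variables on `[0,1]`, extracted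
from a single uniform sample `x` by splitting its binary digits. -/
noncomputable def unif (i : ℕ) (x : ℝ) : ℝ :=
  ∑' k : ℕ, if bit (Nat.pair i k) x then ((2 : ℝ)⁻¹) ^ (k + 1) else 0

/-- A symmetric encoding of (unordered) pairs of vertices. -/
noncomputable def eIdx (u v : V) : ℕ :=
  min (Encodable.encode (u, v)) (Encodable.encode (v, u))

/-- The uniform label attached to the edge `{u,v}`. -/
noncomputable def edgeU (u v : V) (x : ℝ) : ℝ := unif (2 * eIdx u v) x

/-- The uniform label attached to the vertex `v` (independent of the edge labels). -/
noncomputable def vtxU (v : V) (x : ℝ) : ℝ := unif (2 * Encodable.encode v + 1) x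

/-- Edge configurations: a boolean (open/closed) for each (ordered) pair of
vertices; configurations arising from the model are symmetric and are
supported on pairs of adjacent vertices. -/
abbrev EdgeCfg : Type := V → V → Bool

/-- Colour configurations: a colour (black = `true`, white = `false`) for each vertex. -/
abbrev ColourCfg : Type := V → Bool

/-- Full configurations of the DaC model: an edge configuration together with
a colour configuration. -/
abbrev Config : Type := EdgeCfg × ColourCfg

/-- The Bernoulli(p) edge configuration determined by the uniform sample `x`,
on the lattice with adjacency `adj`: an edge `{u,v}` of the lattice is open
iff its uniform label is `< p`. -/
noncomputable def edgeCfg (adj : V → V → Prop) (p : ℝ) (x : ℝ) : EdgeCfg :=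
  fun u v => boolOf (adj u v) && boolOf (edgeU u v x < p)

/-- Connectivity through open edges of the edge configuration `η`. -/
def Conn (η : EdgeCfg) (u v : V) : Prop :=
  Relation.ReflTransGen (fun a b => η a b = true) u v

/-- The `p`-cluster of the vertex `v`: its connected component in the graph
retaining only open edges. -/
def pCluster (η : EdgeCfg) (v : V) : Set V := {w | Conn η v w}

/-- Canonical representative of the `p`-cluster of `v`: the vertex of the
cluster with minimal encoding. -/
noncomputable def clusterRep (η : EdgeCfg) (v : V) : V :=
  (Encodable.decode (α := V) (sInf (Encodable.encode '' pCluster η v))).getD v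

/-- The colour configuration with parameters `p, r` determined by the uniform
sample `x`: every `p`-cluster is coloured black (with probability `r`)
or white, independently of all other `p`-clusters, according to the uniform
label of its canonical representative. -/
noncomputable def colourCfg (adj : V → V → Prop) (p r : ℝ) (x : ℝ) : ColourCfg :=
  fun v => boolOf (vtxU (clusterRep (edgeCfg adj p x) v) x < r)

/-- The uniform sample: Lebesgue measure on `(0,1]`. -/
noncomputable def base : Measure ℝ := volume.restrict (Set.Ioc 0 1)

/-- `ν_p`: the product Bernoulli(p) measure on edge configurations of the
lattice with adjacency `adj`. -/
noncomputable def edgeMeasure (adj : V → V → Prop) (p : ℝ) : Measure EdgeCfg :=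
  base.map (edgeCfg adj p)

/-- `ℙ_{p,r}`: the DaC measure on pairs (edge configuration, colour
configuration) for the lattice with adjacency `adj`. -/
noncomputable def DaCMeasure (adj : V → V → Prop) (p r : ℝ) : Measure Config :=
  base.map (fun x => (edgeCfg adj p x, colourCfg adj p r x))

/-- Monochromatic connectivity: `u` and `v` are joined by a path (for the
adjacency `adj`) all of whose vertices have colour `c`. -/
def MonoConn (adj : V → V → Prop) (ξ : ColourCfg) (c : Bool) (u v : V) : Prop :=
  Relation.ReflTransGen (fun a b => adj a b ∧ ξ a = c ∧ ξ b = c) u v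

/-- The colour-`c` cluster of `v` (for the adjacency `adj`): empty if `v` does
not have colour `c`, and otherwise the maximal `adj`-connected set of
`c`-coloured vertices containing `v`. -/
def monoCluster (adj : V → V → Prop) (ξ : ColourCfg) (c : Bool) (v : V) : Set V :=
  {w | ξ v = c ∧ MonoConn adj ξ c v w}

/-- The origin. -/
def origin : V := (0, 0)

/-- The size (cardinality) of a set of vertices, with values in `ℝ≥0∞`. -/
noncomputable def sizeE (S : Set V) : ℝ≥0∞ := S.encard

/-- The probability, under the DaC measure with edge adjacency `eadj` and
parameters `p, r`, that the origin lies in an infinite colour-`c` cluster for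
the adjacency `cadj`. -/
noncomputable def percProb (eadj cadj : V → V → Prop) (c : Bool) (p r : ℝ) : ℝ≥0∞ :=
  DaCMeasure eadj p r {ω | (monoCluster cadj ω.2 c origin).Infinite}

/-- `Θ(p,r)` for the square lattice: probability that the origin lies in an
infinite black `r`-cluster. -/
noncomputable def thetaSq (p r : ℝ) : ℝ≥0∞ := percProb SqAdj SqAdj true p r

/-- `Θ*(p,s)` for the square lattice: the `ℙ_{p,1-s}`-probability that the
origin lies in an infinite white `*`-cluster. -/
noncomputable def thetaStarSq (p s : ℝ) : ℝ≥0∞ := percProb SqAdj StarAdj false p (1 - s)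

/-- `Θ(p,r)` for the triangular lattice. -/
noncomputable def thetaTri (p r : ℝ) : ℝ≥0∞ := percProb TriAdj TriAdj true p r

/-- The critical colouring density `r_c(p)` of the square lattice DaC model. -/
noncomputable def rcSq (p : ℝ) : ℝ :=
  sSup {r : ℝ | r ∈ Set.Icc (0 : ℝ) 1 ∧ thetaSq p r = 0}

/-- The critical colouring density `r_c*(p)` for white `*`-percolation. -/
noncomputable def rcStarSq (p : ℝ) : ℝ :=
  sSup {s : ℝ | s ∈ Set.Icc (0 : ℝ) 1 ∧ thetaStarSq p s = 0}

/-- The critical colouring density `r_c(p)` of the triangular lattice DaC model. -/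
noncomputable def rcTri (p : ℝ) : ℝ :=
  sSup {r : ℝ | r ∈ Set.Icc (0 : ℝ) 1 ∧ thetaTri p r = 0}

/-! ### Rectangles and crossings -/

/-- The rectangle `S_{n,m} = ([0,n] × [0,m]) ∩ ℤ²`. -/
def Rect (n m : ℕ) : Set V :=
  {v | 0 ≤ v.1 ∧ v.1 ≤ (n : ℤ) ∧ 0 ≤ v.2 ∧ v.2 ≤ (m : ℤ)}

/-- The top side of `S_{n,m}`. -/
def TopSide (n m : ℕ) : Set V := {v | v ∈ Rect n m ∧ v.2 = (m : ℤ)}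

/-- The bottom side of `S_{n,m}`. -/
def BotSide (n m : ℕ) : Set V := {v | v ∈ Rect n m ∧ v.2 = 0}

/-- The left side of `S_{n,m}`. -/
def LeftSide (n m : ℕ) : Set V := {v | v ∈ Rect n m ∧ v.1 = 0}

/-- The right side of `S_{n,m}`. -/
def RightSide (n m : ℕ) : Set V := {v | v ∈ Rect n m ∧ v.1 = (n : ℤ)}

/-- There is a path (for the adjacency `adj`), all of whose vertices lie in the
region `R` and satisfy the predicate `good`, from the set `A` to the set `B`. -/
def HasCrossing (adj : V → V → Prop) (good : V → Prop) (R A B : Set V) : Prop :=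
  ∃ (k : ℕ) (f : Fin (k + 1) → V),
    (∀ i, f i ∈ R ∧ good (f i)) ∧
    (∀ i : Fin k, adj (f i.castSucc) (f i.succ)) ∧
    f 0 ∈ A ∧ f (Fin.last k) ∈ B

/-- `V^b_{n,m}` as a set of colour configurations: there is a black vertical
crossing of `S_{n,m}` (for the adjacency `adj`). -/
def VertBC (adj : V → V → Prop) (n m : ℕ) : Set ColourCfg :=
  {ξ | HasCrossing adj (fun v => ξ v = true) (Rect n m) (TopSide n m) (BotSide n m)}

/-- `V^{w*}_{n,m}` as a set of colour configurations: there is a white vertical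
`*`-crossing of `S_{n,m}`. -/
def VertWStarC (n m : ℕ) : Set ColourCfg :=
  {ξ | HasCrossing StarAdj (fun v => ξ v = false) (Rect n m) (TopSide n m) (BotSide n m)}

/-- `H^{w*}_{n,m}` as a set of colour configurations: there is a white
horizontal `*`-crossing of `S_{n,m}`. -/
def HorizWStarC (n m : ℕ) : Set ColourCfg :=
  {ξ | HasCrossing StarAdj (fun v => ξ v = false) (Rect n m) (LeftSide n m) (RightSide n m)}

/-- The event (set of full configurations) determined by a set of colour
configurations. -/
def colourEvent (C : Set ColourCfg) : Set Config := {ω | ω.2 ∈ C}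

/-! ### Events depending on colours, increasing events, pivotal clusters -/

/-- The event `A` is defined in terms of the colours of the vertices in `W`. -/
def DependsOnColoursIn (A : Set Config) (W : Set V) : Prop :=
  ∀ ω ω' : Config, (∀ v ∈ W, ω.2 v = ω'.2 v) → (ω ∈ A ↔ ω' ∈ A)

/-- The event `A` is increasing (for the partial order comparing colour
configurations pointwise, black = `true` above white = `false`). -/
def IncreasingColourEvent (A : Set Config) : Prop :=
  ∀ ω ω' : Config, (∀ v : V, ω.2 v = true → ω'.2 v = true) → ω ∈ A → ω' ∈ A

/-- Flip the colours of the vertices of `C`. -/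
noncomputable def flipOn (C : Set V) (ξ : ColourCfg) : ColourCfg :=
  fun v => @ite _ (v ∈ C) (Classical.propDecidable _) (!ξ v) (ξ v)

/-- The set `C` is a pivotal `p`-cluster for the event `A` in the
configuration `ω`: `C` is a `p`-cluster of the edge configuration of `ω`, and
flipping the colour of (all the vertices of) `C` changes whether the
configuration belongs to `A`. -/
def IsPivotal (A : Set Config) (ω : Config) (C : Set V) : Prop :=
  (∃ v : V, C = pCluster ω.1 v) ∧ ¬ (ω ∈ A ↔ (ω.1, flipOn C ω.2) ∈ A)

/-- `n(A)`: the number of pivotal `p`-clusters for the event `A`, with values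
in `ℝ≥0∞`. -/
noncomputable def numPivotal (A : Set Config) (ω : Config) : ℝ≥0∞ :=
  {C : Set V | IsPivotal A ω C}.encard

/-! ### Barriers -/

/-- Connectivity in the square lattice avoiding the edges of `E`. -/
def AvoidConn (E : Set (V × V)) (u v : V) : Prop :=
  Relation.ReflTransGen (fun a b => SqAdj a b ∧ (a, b) ∉ E ∧ (b, a) ∉ E) u v

/-- `E` is a barrier: a set of edges of the square lattice whose removal
(keeping the end-vertices) separates `ℤ²` into two or more connected
components, exactly one of which is infinite. -/
def IsBarrier (E : Set (V × V)) : Prop :=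
  (∀ e ∈ E, SqAdj e.1 e.2) ∧
  (∃ v, {w | AvoidConn E v w}.Infinite) ∧
  (∀ v w, {x | AvoidConn E v x}.Infinite → {x | AvoidConn E w x}.Infinite → AvoidConn E v w) ∧
  (∃ v, {w | AvoidConn E v w}.Finite)

/-- The exterior of a barrier: its unique infinite complementary component. -/
def barrierExt (E : Set (V × V)) : Set V := {v | {w | AvoidConn E v w}.Infinite}

/-- The interior of a barrier: the union of the finite complementary components. -/
def barrierInt (E : Set (V × V)) : Set V := {v | {w | AvoidConn E v w}.Finite}

/-- The event `A ⊆ EdgeCfg` is increasing (opening edges preserves it). -/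
def IncreasingEdgeEvent (A : Set EdgeCfg) : Prop :=
  ∀ η η' : EdgeCfg, (∀ a b : V, η a b = true → η' a b = true) → η ∈ A → η' ∈ A

/-- The event `A ⊆ EdgeCfg` depends only on the states of the edges both of
whose endpoints lie in `W`. -/
def DependsOnEdgesIn (A : Set EdgeCfg) (W : Set V) : Prop :=
  ∀ η η' : EdgeCfg, (∀ a b : V, a ∈ W → b ∈ W → η a b = η' a b) → (η ∈ A ↔ η' ∈ A)

/-! ### Translations -/

/-- Translation of configurations by the vector `u`. -/
def shift (u : V) (ω : Config) : Config :=
  (fun a b => ω.1 (a + u) (b + u), fun a => ω.2 (a + u))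

end DaC

namespace DaC

section Product
open Function
variable {ι : Type*} [DecidableEq ι]

/-- average over one coordinate -/
noncomputable def avg (q : ι → ℝ) (i : ι) (f : (ι → Bool) → ℝ) : (ι → Bool) → ℝ :=
  fun ω => q i * f (update ω i true) + (1 - q i) * f (update ω i false)

/-- iterated average over a list of coordinates -/
noncomputable def EL (q : ι → ℝ) (l : List ι) (f : (ι → Bool) → ℝ) : (ι → Bool) → ℝ :=
  l.foldr (avg q) f

/-- discrete derivative -/
def Dif (i : ι) (f : (ι → Bool) → ℝ) : (ι → Bool) → ℝ :=
  fun ω => f (update ω i true) - f (update ω i false)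

/-- the function does not depend on coordinate `i` -/
def Ind (i : ι) (f : (ι → Bool) → ℝ) : Prop := ∀ ω b, f (update ω i b) = f ω

variable {q : ι → ℝ}

lemma avg_add (i : ι) (f g : (ι → Bool) → ℝ) : avg q i (f + g) = avg q i f + avg q i g := by
  funext ω; simp [avg]; ring

lemma avg_smul (i : ι) (c : ℝ) (f : (ι → Bool) → ℝ) : avg q i (c • f) = c • avg q i f := by
  funext ω; simp [avg]; ring

lemma avg_of_ind {i : ι} {f : (ι → Bool) → ℝ} (h : Ind i f) : avg q i f = f := by
  funext ω; simp only [avg, h ω]; ring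

lemma ind_avg (i : ι) (f : (ι → Bool) → ℝ) : Ind i (avg q i f) := by
  intro ω b; simp [avg]

lemma avg_mul_of_ind {i : ι} {f g : (ι → Bool) → ℝ} (h : Ind i f) :
    avg q i (f * g) = f * avg q i g := by
  funext ω; simp only [avg, Pi.mul_apply, h ω]; ring

lemma avg_comm (i j : ι) (f : (ι → Bool) → ℝ) : avg q i (avg q j f) = avg q j (avg q i f) := by
  by_cases hij : i = j
  · subst hij; rfl
  · funext ω
    simp only [avg]
    rw [update_comm hij, update_comm hij, update_comm hij, update_comm hij]
    ring

lemma avg_mono (h0 : ∀ i, 0 ≤ q i) (h1 : ∀ i, q i ≤ 1) (i : ι) {f g : (ι → Bool) → ℝ} (h : f ≤ g) :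
    avg q i f ≤ avg q i g := by
  intro ω
  simp only [avg]
  have a := h (update ω i true)
  have b := h (update ω i false)
  have c := h0 i
  have d := sub_nonneg.2 (h1 i)
  gcongr

lemma ind_avg_of_ind {i j : ι} {f : (ι → Bool) → ℝ} (h : Ind i f) : Ind i (avg q j f) := by
  intro ω b
  by_cases hij : i = j
  · subst hij; simp [avg]
  · simp only [avg]
    rw [update_comm hij, update_comm hij, h, h]

@[simp] lemma EL_nil (f : (ι → Bool) → ℝ) : EL q [] f = f := rfl
@[simp] lemma EL_cons (i : ι) (l : List ι) (f : (ι → Bool) → ℝ) :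
    EL q (i :: l) f = avg q i (EL q l f) := rfl

lemma EL_add (l : List ι) (f g : (ι → Bool) → ℝ) : EL q l (f + g) = EL q l f + EL q l g := by
  induction l with
  | nil => rfl
  | cons i l ih => simp [ih, avg_add]

lemma EL_smul (l : List ι) (c : ℝ) (f : (ι → Bool) → ℝ) : EL q l (c • f) = c • EL q l f := by
  induction l with
  | nil => rfl
  | cons i l ih => simp [ih, avg_smul]

lemma EL_neg (l : List ι) (f : (ι → Bool) → ℝ) : EL q l (-f) = - EL q l f := by
  have := EL_smul (q := q) l (-1) f
  simpa using this

lemma EL_sub (l : List ι) (f g : (ι → Bool) → ℝ) : EL q l (f - g) = EL q l f - EL q l g := by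
  rw [sub_eq_add_neg, EL_add, EL_neg, sub_eq_add_neg]

lemma EL_mono (h0 : ∀ i, 0 ≤ q i) (h1 : ∀ i, q i ≤ 1) (l : List ι) {f g : (ι → Bool) → ℝ}
    (h : f ≤ g) : EL q l f ≤ EL q l g := by
  induction l with
  | nil => exact h
  | cons i l ih => exact avg_mono h0 h1 i ih

lemma EL_const (l : List ι) (c : ℝ) : EL q l (fun _ => c) = fun _ => c := by
  induction l with
  | nil => rfl
  | cons i l ih => rw [EL_cons, ih]; exact avg_of_ind (fun _ _ => rfl)

lemma ind_EL_of_ind {i : ι} {f : (ι → Bool) → ℝ} (h : Ind i f) (l : List ι) : Ind i (EL q l f) := by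
  induction l with
  | nil => exact h
  | cons j l ih => exact ind_avg_of_ind ih

lemma ind_EL_of_mem {i : ι} {l : List ι} (hi : i ∈ l) (f : (ι → Bool) → ℝ) : Ind i (EL q l f) := by
  induction l with
  | nil => simp at hi
  | cons j l ih =>
    by_cases hij : i = j
    · subst hij; exact ind_avg _ _
    · exact ind_avg_of_ind (ih (by simpa [hij] using hi))

lemma EL_avg_comm (i : ι) (l : List ι) (f : (ι → Bool) → ℝ) :
    EL q l (avg q i f) = avg q i (EL q l f) := by
  induction l with
  | nil => rfl
  | cons j l ih => rw [EL_cons, EL_cons, ih, avg_comm]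

lemma EL_avg_of_mem {i : ι} {l : List ι} (hi : i ∈ l) (f : (ι → Bool) → ℝ) :
    EL q l (avg q i f) = EL q l f := by
  rw [EL_avg_comm]; exact avg_of_ind (ind_EL_of_mem hi f)

lemma EL_update (l : List ι) (i : ι) (hi : i ∉ l) (b : Bool) (f : (ι → Bool) → ℝ) (ω : ι → Bool) :
    EL q l f (update ω i b) = EL q l (fun ω => f (update ω i b)) ω := by
  induction l generalizing ω with
  | nil => rfl
  | cons j l ih =>
    simp only [List.mem_cons, not_or] at hi
    simp only [EL_cons, avg]
    rw [update_comm hi.1, update_comm hi.1, ih hi.2, ih hi.2]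

/-- Harris inequality for iterated averages -/
lemma EL_harris (h0 : ∀ i, 0 ≤ q i) (h1 : ∀ i, q i ≤ 1) (l : List ι) {f g : (ι → Bool) → ℝ}
    (hf : Monotone f) (hg : Monotone g) :
    Monotone (EL q l f) ∧ Monotone (EL q l g) ∧ EL q l f * EL q l g ≤ EL q l (f * g) := by
  have mono_avg : ∀ (i : ι) {h : (ι → Bool) → ℝ}, Monotone h → Monotone (avg q i h) := by
    intro i h hh ω ω' hω
    simp only [avg]
    have a := hh (update_le_update_iff.2 ⟨le_refl true, fun j _ => hω j⟩ : update ω i true ≤ update ω' i true)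
    have b := hh (update_le_update_iff.2 ⟨le_refl false, fun j _ => hω j⟩ : update ω i false ≤ update ω' i false)
    have c := h0 i
    have d := sub_nonneg.2 (h1 i)
    gcongr
  induction l with
  | nil => exact ⟨hf, hg, le_refl _⟩
  | cons i l ih =>
    obtain ⟨a, b, c⟩ := ih
    refine ⟨mono_avg i a, mono_avg i b, ?_⟩
    refine le_trans ?_ (avg_mono h0 h1 i c)
    intro ω
    have hle : update ω i false ≤ update ω i true := update_le_update_iff.2 ⟨by decide, fun j _ => le_refl _⟩
    have ha := a hle
    have hb := b hle
    simp only [EL_cons, avg, Pi.mul_apply]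
    have c := h0 i
    have d := sub_nonneg.2 (h1 i)
    nlinarith [mul_nonneg (mul_nonneg c d) (mul_nonneg (sub_nonneg.2 ha) (sub_nonneg.2 hb))]

/-- Russo's formula for iterated averages -/
lemma EL_russo (Q : ℝ → ι → ℝ) (Q' : ι → ℝ) (t : ℝ) (hQ : ∀ i, HasDerivAt (fun s => Q s i) (Q' i) t)
    (l : List ι) (hl : l.Nodup) (f : (ι → Bool) → ℝ) (ω : ι → Bool) :
    HasDerivAt (fun s => EL (Q s) l f ω) ((l.map (fun i => Q' i * EL (Q t) l (Dif i f) ω)).sum) t := by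
  induction l generalizing ω with
  | nil => simpa using hasDerivAt_const t (f ω)
  | cons i l ih =>
    obtain ⟨hi, hl'⟩ := List.nodup_cons.1 hl
    have h1 := ih hl' (update ω i true)
    have h0 := ih hl' (update ω i false)
    have hd := ((hQ i).mul h1).add (((hQ i).const_sub 1).mul h0)
    refine HasDerivAt.congr_deriv hd ?_
    have e1 : EL (Q t) (i :: l) (Dif i f) ω
        = EL (Q t) l f (update ω i true) - EL (Q t) l f (update ω i false) := by
      have hind : Ind i (Dif i f) := by intro ω b; simp [Dif]
      rw [EL_cons, avg_of_ind (ind_EL_of_ind hind l), EL_update l i hi, EL_update l i hi]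
      have := congrFun (EL_sub (q := Q t) l (fun ω => f (update ω i true)) (fun ω => f (update ω i false))) ω
      exact this
    have e2 : (l.map (fun j => Q' j * EL (Q t) (i :: l) (Dif j f) ω)).sum
        = Q t i * (l.map (fun j => Q' j * EL (Q t) l (Dif j f) (update ω i true))).sum
          + (1 - Q t i) * (l.map (fun j => Q' j * EL (Q t) l (Dif j f) (update ω i false))).sum := by
      rw [← List.sum_map_mul_left, ← List.sum_map_mul_left, ← List.sum_map_add]
      congr 1
      apply List.map_congr_left
      intro j _
      simp only [EL_cons, avg]; ring
    rw [List.map_cons, List.sum_cons, e1, e2]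
    ring

end Product

end DaC

namespace DaC

section Expect
open Function Classical
variable {ι : Type*} [Fintype ι]

/-- weight of a configuration -/
noncomputable def Wt (q : ι → ℝ) (ω : ι → Bool) : ℝ := ∏ i, if ω i then q i else 1 - q i

/-- expectation with respect to the product of Bernoulli variables -/
noncomputable def Ex (q : ι → ℝ) (f : (ι → Bool) → ℝ) : ℝ := ∑ ω, Wt q ω * f ω

/-- real indicator -/
noncomputable def ind (P : Prop) : ℝ := if P then 1 else 0

/-- probability -/
noncomputable def Pr (q : ι → ℝ) (A : (ι → Bool) → Prop) : ℝ := Ex q (fun ω => ind (A ω))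

/-- parameters are probabilities -/
def IsP (q : ι → ℝ) : Prop := ∀ i, 0 ≤ q i ∧ q i ≤ 1

lemma ind_nonneg (P : Prop) : 0 ≤ ind P := by unfold ind; split_ifs <;> norm_num
lemma ind_le_one (P : Prop) : ind P ≤ 1 := by unfold ind; split_ifs <;> norm_num
lemma ind_of {P : Prop} (h : P) : ind P = 1 := by simp [ind, h]
lemma ind_of_not {P : Prop} (h : ¬ P) : ind P = 0 := by simp [ind, h]
lemma ind_mono {P Q : Prop} (h : P → Q) : ind P ≤ ind Q := by
  by_cases hp : P
  · rw [ind_of hp, ind_of (h hp)]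
  · rw [ind_of_not hp]; exact ind_nonneg _
lemma ind_and (P Q : Prop) : ind (P ∧ Q) = ind P * ind Q := by
  by_cases hp : P <;> by_cases hq : Q <;> simp [ind, hp, hq]
lemma ind_not (P : Prop) : ind (¬ P) = 1 - ind P := by
  by_cases hp : P <;> simp [ind, hp]
lemma ind_or_le (P Q : Prop) : ind (P ∨ Q) ≤ ind P + ind Q := by
  by_cases hp : P <;> by_cases hq : Q <;> simp [ind, hp, hq]
lemma ind_exists_le {α : Type*} (s : Finset α) (P : α → Prop) :
    ind (∃ a ∈ s, P a) ≤ ∑ a ∈ s, ind (P a) := by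
  by_cases h : ∃ a ∈ s, P a
  · obtain ⟨a, ha, hp⟩ := h
    rw [ind_of ⟨a, ha, hp⟩, ← ind_of hp]
    exact Finset.single_le_sum (f := fun a => ind (P a)) (fun i _ => ind_nonneg _) ha
  · rw [ind_of_not h]; exact Finset.sum_nonneg (fun i _ => ind_nonneg _)

variable {q : ι → ℝ}

lemma Wt_nonneg (hq : IsP q) (ω : ι → Bool) : 0 ≤ Wt q ω := by
  unfold Wt
  apply Finset.prod_nonneg
  intro i _
  split_ifs
  · exact (hq i).1
  · exact sub_nonneg.2 (hq i).2

lemma sum_Wt (q : ι → ℝ) : ∑ ω, Wt q ω = 1 := by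
  unfold Wt
  have := Fintype.prod_sum (fun (i : ι) (b : Bool) => if b then q i else 1 - q i)
  rw [← this]
  simp

lemma Ex_add (f g : (ι → Bool) → ℝ) : Ex q (fun ω => f ω + g ω) = Ex q f + Ex q g := by
  simp [Ex, mul_add, Finset.sum_add_distrib]
lemma Ex_sub (f g : (ι → Bool) → ℝ) : Ex q (fun ω => f ω - g ω) = Ex q f - Ex q g := by
  simp [Ex, mul_sub, Finset.sum_sub_distrib]
lemma Ex_mul_left (c : ℝ) (f : (ι → Bool) → ℝ) : Ex q (fun ω => c * f ω) = c * Ex q f := by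
  simp only [Ex, Finset.mul_sum]; congr 1; funext ω; ring
lemma Ex_mul_right (c : ℝ) (f : (ι → Bool) → ℝ) : Ex q (fun ω => f ω * c) = Ex q f * c := by
  simp only [Ex, Finset.sum_mul]; congr 1; funext ω; ring
lemma Ex_const (c : ℝ) : Ex q (fun _ => c) = c := by
  simp only [Ex, ← Finset.sum_mul, sum_Wt]; simp
lemma Ex_sum {α : Type*} (s : Finset α) (f : α → (ι → Bool) → ℝ) :
    Ex q (fun ω => ∑ a ∈ s, f a ω) = ∑ a ∈ s, Ex q (f a) := by
  simp only [Ex, Finset.mul_sum]; rw [Finset.sum_comm]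
lemma Ex_mono (hq : IsP q) {f g : (ι → Bool) → ℝ} (h : ∀ ω, f ω ≤ g ω) : Ex q f ≤ Ex q g :=
  Finset.sum_le_sum fun ω _ => mul_le_mul_of_nonneg_left (h ω) (Wt_nonneg hq ω)
lemma Ex_nonneg (hq : IsP q) {f : (ι → Bool) → ℝ} (h : ∀ ω, 0 ≤ f ω) : 0 ≤ Ex q f :=
  Finset.sum_nonneg fun ω _ => mul_nonneg (Wt_nonneg hq ω) (h ω)
lemma abs_Ex_le (hq : IsP q) (f : (ι → Bool) → ℝ) : |Ex q f| ≤ Ex q (fun ω => |f ω|) := by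
  refine (Finset.abs_sum_le_sum_abs _ _).trans (le_of_eq ?_)
  refine Finset.sum_congr rfl fun ω _ => ?_
  rw [abs_mul, abs_of_nonneg (Wt_nonneg hq ω)]

lemma Pr_nonneg (hq : IsP q) (A : (ι → Bool) → Prop) : 0 ≤ Pr q A := Ex_nonneg hq fun _ => ind_nonneg _
lemma Pr_mono (hq : IsP q) {A B : (ι → Bool) → Prop} (h : ∀ ω, A ω → B ω) : Pr q A ≤ Pr q B :=
  Ex_mono hq fun ω => ind_mono (h ω)
lemma Pr_le_one (hq : IsP q) (A : (ι → Bool) → Prop) : Pr q A ≤ 1 := by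
  have := Ex_mono hq (fun ω => ind_le_one (A ω)); rwa [Ex_const] at this
lemma Pr_not (A : (ι → Bool) → Prop) : Pr q (fun ω => ¬ A ω) = 1 - Pr q A := by
  simp only [Pr, ind_not, Ex_sub, Ex_const]
lemma Pr_or_le (hq : IsP q) (A B : (ι → Bool) → Prop) : Pr q (fun ω => A ω ∨ B ω) ≤ Pr q A + Pr q B := by
  unfold Pr; rw [← Ex_add]; exact Ex_mono hq fun ω => ind_or_le _ _
lemma Pr_exists_le (hq : IsP q) {α : Type*} (s : Finset α) (A : α → (ι → Bool) → Prop) :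
    Pr q (fun ω => ∃ a ∈ s, A a ω) ≤ ∑ a ∈ s, Pr q (A a) := by
  unfold Pr; rw [← Ex_sum]; exact Ex_mono hq fun ω => ind_exists_le _ _
lemma Pr_congr {A B : (ι → Bool) → Prop} (h : ∀ ω, A ω ↔ B ω) : Pr q A = Pr q B := by
  have : A = B := funext fun ω => propext (h ω)
  rw [this]

/-- splitting off one coordinate -/
lemma Wt_update (ω : ι → Bool) (i : ι) (b : Bool) :
    Wt q (update ω i b) = (if b then q i else 1 - q i) * ∏ j ∈ Finset.univ.erase i, (if ω j then q j else 1 - q j) := by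
  unfold Wt
  rw [← Finset.mul_prod_erase Finset.univ _ (Finset.mem_univ i)]
  congr 1
  · simp
  · refine Finset.prod_congr rfl fun j hj => ?_
    rw [update_of_ne (Finset.ne_of_mem_erase hj)]

lemma Ex_avg (i : ι) (f : (ι → Bool) → ℝ) : Ex q (avg q i f) = Ex q f := by
  -- flip coordinate i
  have hinv : Function.Involutive (fun ω : ι → Bool => update ω i (!ω i)) := by
    intro ω; simp
  have key : ∀ g : (ι → Bool) → ℝ, 2 * ∑ ω, g ω = ∑ ω, (g (update ω i true) + g (update ω i false)) := by
    intro g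
    have h1 : ∑ ω, g (update ω i (!ω i)) = ∑ ω, g ω :=
      (Equiv.sum_comp (hinv.toPerm) g)
    have : ∀ ω : ι → Bool, g (update ω i true) + g (update ω i false) = g ω + g (update ω i (!ω i)) := by
      intro ω
      have h2 : update ω i (ω i) = ω := update_eq_self i ω
      cases h : ω i
      · rw [h] at h2; simp [h2, add_comm]
      · rw [h] at h2; simp [h2]
    rw [Finset.sum_congr rfl fun ω _ => this ω, Finset.sum_add_distrib, h1]; ring
  have e1 := key (fun ω => Wt q ω * avg q i f ω)
  have e2 := key (fun ω => Wt q ω * f ω)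
  unfold Ex
  have : ∀ ω : ι → Bool, Wt q (update ω i true) * avg q i f (update ω i true)
      + Wt q (update ω i false) * avg q i f (update ω i false)
      = Wt q (update ω i true) * f (update ω i true) + Wt q (update ω i false) * f (update ω i false) := by
    intro ω
    rw [ind_avg, ind_avg, Wt_update, Wt_update]
    simp only [avg, if_true, Bool.false_eq_true, if_false]
    ring
  rw [Finset.sum_congr rfl fun ω _ => this ω] at e1
  linarith

lemma Ex_EL (l : List ι) (f : (ι → Bool) → ℝ) : Ex q (EL q l f) = Ex q f := by
  induction l with
  | nil => rfl
  | cons i l ih => rw [EL_cons, Ex_avg, ih]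

lemma const_of_Ind {f : (ι → Bool) → ℝ} (h : ∀ i, Ind i f) (ω ω' : ι → Bool) : f ω = f ω' := by
  have : ∀ s : Finset ι, f (fun i => if i ∈ s then ω i else ω' i) = f ω' := by
    intro s
    induction s using Finset.induction_on with
    | empty => simp
    | insert a s ha ih =>
      rw [← ih, ← h a (fun i => if i ∈ s then ω i else ω' i) (ω a)]
      congr 1; funext i
      by_cases hi : i = a
      · subst hi; simp
      · simp [hi]
  simpa using this Finset.univ

lemma Ex_eq_EL (f : (ι → Bool) → ℝ) (ω : ι → Bool) : Ex q f = EL q Finset.univ.toList f ω := by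
  have h : ∀ ω', EL q Finset.univ.toList f ω' = EL q Finset.univ.toList f ω := fun ω' =>
    const_of_Ind (fun i => ind_EL_of_mem (by simp) f) ω' ω
  rw [← Ex_EL Finset.univ.toList f, show EL q Finset.univ.toList f = fun _ => EL q Finset.univ.toList f ω from funext h, Ex_const]

lemma Ex_harris (hq : IsP q) {f g : (ι → Bool) → ℝ} (hf : Monotone f) (hg : Monotone g) :
    Ex q f * Ex q g ≤ Ex q (fun ω => f ω * g ω) := by
  have := (EL_harris (fun i => (hq i).1) (fun i => (hq i).2) Finset.univ.toList hf hg).2.2 (fun _ => false)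
  rw [Ex_eq_EL f (fun _ => false), Ex_eq_EL g (fun _ => false), Ex_eq_EL _ (fun _ => false)]
  exact this

lemma Ex_russo (Q : ℝ → ι → ℝ) (Q' : ι → ℝ) (t : ℝ) (hQ : ∀ i, HasDerivAt (fun s => Q s i) (Q' i) t)
    (f : (ι → Bool) → ℝ) :
    HasDerivAt (fun s => Ex (Q s) f) (∑ i, Q' i * Ex (Q t) (Dif i f)) t := by
  have := EL_russo Q Q' t hQ Finset.univ.toList (Finset.nodup_toList _) f (fun _ => false)
  simp only [← Ex_eq_EL] at this
  rwa [Finset.sum_map_toList] at this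

/-- `f` only depends on the coordinates in `S` -/
def Dep {α : Type*} (S : Set ι) (f : (ι → Bool) → α) : Prop :=
  ∀ ω ω' : ι → Bool, (∀ i ∈ S, ω i = ω' i) → f ω = f ω'

lemma Dep.mono {α : Type*} {S T : Set ι} {f : (ι → Bool) → α} (h : Dep S f) (hST : S ⊆ T) : Dep T f :=
  fun ω ω' hh => h ω ω' fun i hi => hh i (hST hi)

lemma Dep.comp {α β : Type*} {S : Set ι} {f : (ι → Bool) → α} (h : Dep S f) (g : α → β) :
    Dep S (fun ω => g (f ω)) := fun ω ω' hh => congrArg g (h ω ω' hh)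

lemma Dep.ind {S : Set ι} {f : (ι → Bool) → ℝ} (h : Dep S f) {i : ι} (hi : i ∉ S) : Ind i f := by
  intro ω b
  apply h
  intro j hj
  rw [update_of_ne]
  rintro rfl; exact hi hj

lemma EL_mul_of_ind {l : List ι} {f g : (ι → Bool) → ℝ} (h : ∀ i ∈ l, Ind i f) :
    EL q l (f * g) = f * EL q l g := by
  induction l with
  | nil => rfl
  | cons i l ih =>
    rw [EL_cons, ih (fun j hj => h j (by simp [hj])), avg_mul_of_ind (h i (by simp)), EL_cons]

lemma EL_of_ind {l : List ι} {f : (ι → Bool) → ℝ} (h : ∀ i ∈ l, Ind i f) : EL q l f = f := by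
  induction l with
  | nil => rfl
  | cons i l ih => rw [EL_cons, ih (fun j hj => h j (by simp [hj])), avg_of_ind (h i (by simp))]

lemma Ex_indep {S T : Set ι} (hST : Disjoint S T) {f g : (ι → Bool) → ℝ} (hf : Dep S f) (hg : Dep T g) :
    Ex q (fun ω => f ω * g ω) = Ex q f * Ex q g := by
  set l : List ι := (Finset.univ.filter (fun i => i ∉ S)).toList with hl
  have hmem : ∀ i, i ∈ l ↔ i ∉ S := by intro i; simp [hl]
  have h1 : EL q l (f * g) = f * EL q l g := EL_mul_of_ind fun i hi => hf.ind ((hmem i).1 hi)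
  have h2 : ∀ i, Ind i (EL q l g) := by
    intro i
    by_cases hi : i ∈ S
    · exact ind_EL_of_ind (hg.ind (fun h => Set.disjoint_left.1 hST hi h)) l
    · exact ind_EL_of_mem ((hmem i).2 hi) g
  have h3 : EL q l g = fun _ => Ex q g := by
    funext ω
    rw [← Ex_EL l g, show EL q l g = fun _ => EL q l g ω from funext fun ω' => const_of_Ind h2 ω' ω, Ex_const]
  have : Ex q (f * g) = Ex q (f * EL q l g) := by rw [← h1, Ex_EL]
  rw [h3] at this
  exact this.trans (Ex_mul_right _ _)

lemma Pr_indep {S T : Set ι} (hST : Disjoint S T) {A B : (ι → Bool) → Prop} (hA : Dep S A) (hB : Dep T B) :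
    Pr q (fun ω => A ω ∧ B ω) = Pr q A * Pr q B := by
  simp only [Pr, ind_and]
  exact Ex_indep hST (hA.comp ind) (hB.comp ind)

/-- events which are increasing -/
def IncE (A : (ι → Bool) → Prop) : Prop := ∀ ω ω' : ι → Bool, ω ≤ ω' → A ω → A ω'

lemma Pr_harris (hq : IsP q) {A B : (ι → Bool) → Prop} (hA : IncE A) (hB : IncE B) :
    Pr q A * Pr q B ≤ Pr q (fun ω => A ω ∧ B ω) := by
  simp only [Pr, ind_and]
  exact Ex_harris hq (fun x y hxy => ind_mono (hA x y hxy)) (fun x y hxy => ind_mono (hB x y hxy))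

/-- Harris for an increasing and a decreasing event. -/
lemma Pr_harris_dec (hq : IsP q) {A B : (ι → Bool) → Prop} (hA : IncE A) (hB : IncE (fun ω => ¬ B ω)) :
    Pr q (fun ω => A ω ∧ B ω) ≤ Pr q A * Pr q B := by
  have h1 := Pr_harris hq hA hB
  rw [Pr_not] at h1
  have h2 : Pr q A = Pr q (fun ω => A ω ∧ ¬ B ω) + Pr q (fun ω => A ω ∧ B ω) := by
    unfold Pr; rw [← Ex_add]; congr 1; funext ω
    rw [ind_and, ind_and, ind_not]; ring
  nlinarith

/-- weight preserving bijection -/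
lemma Ex_equiv (e : (ι → Bool) ≃ (ι → Bool)) (he : ∀ ω, Wt q (e ω) = Wt q ω) (f : (ι → Bool) → ℝ) :
    Ex q (fun ω => f (e ω)) = Ex q f := by
  unfold Ex
  rw [← Equiv.sum_comp e (fun ω => Wt q ω * f ω)]
  exact Finset.sum_congr rfl fun ω _ => by rw [he]

lemma Ex_perm (σ : ι ≃ ι) (hσ : ∀ i, q (σ i) = q i) (f : (ι → Bool) → ℝ) :
    Ex q (fun ω => f (ω ∘ σ)) = Ex q f := by
  refine Ex_equiv (Equiv.arrowCongr σ.symm (Equiv.refl Bool)) ?_ f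
  intro ω
  unfold Wt
  rw [← Equiv.prod_comp σ (fun i => if ω i then q i else 1 - q i)]
  refine Finset.prod_congr rfl fun i _ => ?_
  simp [hσ]

lemma Pr_perm (σ : ι ≃ ι) (hσ : ∀ i, q (σ i) = q i) (A : (ι → Bool) → Prop) :
    Pr q (fun ω => A (ω ∘ σ)) = Pr q A := Ex_perm σ hσ (fun ω => ind (A ω))

end Expect

section OSSS
open Function Classical
variable {ι : Type*}

/-- decision trees -/
inductive DT (ι : Type*) : Type _
  | leaf (c : ℝ) : DT ι
  | node (i : ι) (t1 t0 : DT ι) : DT ι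

namespace DT
/-- evaluation -/
def eval : DT ι → (ι → Bool) → ℝ
  | leaf c, _ => c
  | node i t1 t0, ω => if ω i then t1.eval ω else t0.eval ω
/-- visited coordinates -/
def vis : DT ι → ι → (ι → Bool) → Prop
  | leaf _, _, _ => False
  | node i t1 t0, j, ω => j = i ∨ (if ω i then t1.vis j ω else t0.vis j ω)
/-- occurring coordinates -/
def occ : DT ι → ι → Prop
  | leaf _, _ => False
  | node i t1 t0, j => j = i ∨ t1.occ j ∨ t0.occ j
/-- read once -/
def ro : DT ι → Prop
  | leaf _ => True
  | node i t1 t0 => ¬ t1.occ i ∧ ¬ t0.occ i ∧ t1.ro ∧ t0.ro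

lemma eval_dep (t : DT ι) : Dep {i | t.occ i} t.eval := by
  induction t with
  | leaf c => intro ω ω' _; rfl
  | node i t1 t0 h1 h0 =>
    intro ω ω' h
    have hi : ω i = ω' i := h i (Or.inl rfl)
    simp only [eval, hi]
    rw [h1 ω ω' fun j hj => h j (Or.inr (Or.inl hj)), h0 ω ω' fun j hj => h j (Or.inr (Or.inr hj))]

lemma vis_dep (t : DT ι) (j : ι) : Dep {i | t.occ i} (t.vis j) := by
  induction t with
  | leaf c => intro ω ω' _; rfl
  | node i t1 t0 h1 h0 =>
    intro ω ω' h
    have hi : ω i = ω' i := h i (Or.inl rfl)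
    simp only [vis, hi]
    rw [h1 ω ω' fun j hj => h j (Or.inr (Or.inl hj)), h0 ω ω' fun j hj => h j (Or.inr (Or.inr hj))]
end DT

variable [Fintype ι] {q : ι → ℝ}

/-- influence -/
noncomputable def Inf (q : ι → ℝ) (g : (ι → Bool) → ℝ) (j : ι) : ℝ := Ex q (fun ω => |g ω - avg q j g ω|)

lemma Inf_nonneg (hq : IsP q) (g : (ι → Bool) → ℝ) (j : ι) : 0 ≤ Inf q g j := Ex_nonneg hq fun _ => abs_nonneg _

lemma Inf_avg_self (g : (ι → Bool) → ℝ) (i : ι) : Inf q (avg q i g) i = 0 := by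
  unfold Inf
  rw [avg_of_ind (ind_avg i g)]; simp [Ex_const]

lemma Inf_avg_le (hq : IsP q) (g : (ι → Bool) → ℝ) (i j : ι) : Inf q (avg q i g) j ≤ Inf q g j := by
  unfold Inf
  rw [avg_comm, ← Ex_avg i (fun ω => |g ω - avg q j g ω|)]
  refine Ex_mono hq fun ω => ?_
  simp only [avg]
  have h0 := (hq i).1
  have h1 := sub_nonneg.2 (hq i).2
  calc _ = |q i * (g (update ω i true) - avg q j g (update ω i true))
        + (1 - q i) * (g (update ω i false) - avg q j g (update ω i false))| := by
        simp only [avg]; congr 1; ring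
    _ ≤ _ := (abs_add_le _ _).trans (by rw [abs_mul, abs_mul, abs_of_nonneg h0, abs_of_nonneg h1]; simp only [avg]; exact le_refl _)

lemma osss_tree (hq : IsP q) (t : DT ι) (ht : t.ro) (hb : ∀ ω, |t.eval ω| ≤ 1) (g : (ι → Bool) → ℝ) :
    |Ex q (fun ω => t.eval ω * (g ω - Ex q g))| ≤ ∑ j, Pr q (t.vis j) * Inf q g j := by
  induction t generalizing g with
  | leaf c =>
    simp only [DT.eval]
    rw [Ex_mul_left, Ex_sub, Ex_const, sub_self, mul_zero, abs_zero]
    exact Finset.sum_nonneg fun j _ => mul_nonneg (Pr_nonneg hq _) (Inf_nonneg hq _ _)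
  | node i t1 t0 ih1 ih0 =>
    obtain ⟨n1, n0, r1, r0⟩ := ht
    have b1 : ∀ ω, |t1.eval ω| ≤ 1 := by
      intro ω
      have := hb (update ω i true)
      simp only [DT.eval, update_self, if_true] at this
      rwa [t1.eval_dep (update ω i true) ω (fun j hj => by
        rw [update_of_ne]; rintro rfl; exact n1 hj)] at this
    have b0 : ∀ ω, |t0.eval ω| ≤ 1 := by
      intro ω
      have := hb (update ω i false)
      simp only [DT.eval, update_self, Bool.false_eq_true, if_false] at this
      rwa [t0.eval_dep (update ω i false) ω (fun j hj => by
        rw [update_of_ne]; rintro rfl; exact n0 hj)] at this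
    have I1 : Ind i t1.eval := t1.eval_dep.ind n1
    have I0 : Ind i t0.eval := t0.eval_dep.ind n0
    set m := avg q i g with hm
    have hEm : Ex q m = Ex q g := Ex_avg i g
    have c1 := ih1 r1 b1 m
    have c0 := ih0 r0 b0 m
    rw [hEm] at c1 c0
    -- decomposition
    have dec : Ex q (fun ω => (DT.node i t1 t0).eval ω * (g ω - Ex q g))
        = Ex q (fun ω => (DT.node i t1 t0).eval ω * (g ω - m ω))
        + (q i * Ex q (fun ω => t1.eval ω * (m ω - Ex q g))
          + (1 - q i) * Ex q (fun ω => t0.eval ω * (m ω - Ex q g))) := by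
      have e1 : Ex q (fun ω => (DT.node i t1 t0).eval ω * (m ω - Ex q g))
          = Ex q (fun ω => q i * (t1.eval ω * (m ω - Ex q g)) + (1 - q i) * (t0.eval ω * (m ω - Ex q g))) := by
        rw [← Ex_avg i]
        congr 1; funext ω
        simp only [avg, DT.eval, update_self, if_true, Bool.false_eq_true, if_false]
        rw [I1, I0, hm, ind_avg i g, ind_avg i g]
      rw [← Ex_mul_left, ← Ex_mul_left, ← Ex_add, ← e1, ← Ex_add]
      congr 1; funext ω; ring
    have h0 := (hq i).1
    have h1 := sub_nonneg.2 (hq i).2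
    have first : |Ex q (fun ω => (DT.node i t1 t0).eval ω * (g ω - m ω))| ≤ Inf q g i := by
      refine (abs_Ex_le hq _).trans (Ex_mono hq fun ω => ?_)
      rw [abs_mul]
      calc _ ≤ 1 * |g ω - m ω| := mul_le_mul_of_nonneg_right (hb ω) (abs_nonneg _)
        _ = _ := one_mul _
    have visP : ∀ j, j ≠ i → Pr q ((DT.node i t1 t0).vis j) = q i * Pr q (t1.vis j) + (1 - q i) * Pr q (t0.vis j) := by
      intro j hj
      unfold Pr
      rw [← Ex_avg i, ← Ex_mul_left, ← Ex_mul_left, ← Ex_add]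
      congr 1; funext ω
      simp only [avg, DT.vis, update_self, if_true, Bool.false_eq_true, if_false, hj, false_or]
      rw [t1.vis_dep j (update ω i true) ω (fun k hk => by
        rw [update_of_ne]; rintro rfl; exact n1 hk), t0.vis_dep j (update ω i false) ω (fun k hk => by
        rw [update_of_ne]; rintro rfl; exact n0 hk)]
    have visI : Pr q ((DT.node i t1 t0).vis i) = 1 := by
      rw [show (DT.node i t1 t0).vis i = fun _ => True from funext fun ω => by simp [DT.vis]]
      simp [Pr, ind, Ex_const]
    rw [dec, ← Finset.add_sum_erase _ _ (Finset.mem_univ i), visI, one_mul]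
    refine (abs_add_le _ _).trans (add_le_add first ?_)
    refine (abs_add_le _ _).trans ?_
    rw [abs_mul, abs_mul, abs_of_nonneg h0, abs_of_nonneg h1]
    refine (add_le_add (mul_le_mul_of_nonneg_left c1 h0) (mul_le_mul_of_nonneg_left c0 h1)).trans ?_
    rw [← Finset.add_sum_erase _ _ (Finset.mem_univ i), ← Finset.add_sum_erase Finset.univ (fun j => Pr q (t0.vis j) * Inf q m j) (Finset.mem_univ i)]
    rw [hm, Inf_avg_self, mul_zero, mul_zero, zero_add, zero_add, Finset.mul_sum, Finset.mul_sum, ← Finset.sum_add_distrib]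
    refine Finset.sum_le_sum fun j hj => ?_
    rw [visP j (Finset.ne_of_mem_erase hj)]
    have p1 := Pr_nonneg hq (t1.vis j)
    have p0 := Pr_nonneg hq (t0.vis j)
    have := Inf_avg_le hq g i j
    nlinarith [mul_le_mul_of_nonneg_left this (mul_nonneg h0 p1), mul_le_mul_of_nonneg_left this (mul_nonneg h1 p0)]

/-- next coordinate -/
noncomputable def nxt (K : Finset ι) (S : Set ι) : Option ι :=
  if h : ∃ i, i ∈ S ∧ i ∉ K then some h.choose else none

lemma nxt_some {K : Finset ι} {S : Set ι} {i : ι} (h : nxt K S = some i) : i ∈ S ∧ i ∉ K := by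
  unfold nxt at h
  split_ifs at h with hh
  · cases h; exact hh.choose_spec

lemma nxt_none {K : Finset ι} {S : Set ι} (h : nxt K S = none) : ∀ i ∈ S, i ∈ K := by
  unfold nxt at h
  split_ifs at h with hh
  intro i hi; by_contra hk; exact hh ⟨i, hi, hk⟩

/-- tree builder -/
noncomputable def build (av : Finset ι → (ι → Bool) → Set ι) (f : (ι → Bool) → ℝ) :
    ℕ → Finset ι → (ι → Bool) → DT ι
  | 0, _, ω => DT.leaf (f ω)
  | n + 1, K, ω => match nxt K (av K ω) with
    | none => DT.leaf (f ω)
    | some i => DT.node i (build av f n (insert i K) (update ω i true)) (build av f n (insert i K) (update ω i false))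

lemma build_spec (av : Finset ι → (ι → Bool) → Set ι) (f : (ι → Bool) → ℝ)
    (D : ι → (ι → Bool) → Prop)
    (hav : ∀ K : Finset ι, Dep (K : Set ι) (av K))
    (hD : ∀ K ω, ∀ j ∈ av K ω, D j ω)
    (hdet : ∀ (K : Finset ι) ω, (∀ i ∈ av K ω, i ∈ K) → ∀ ω', (∀ i ∈ K, ω' i = ω i) → f ω' = f ω)
    (n : ℕ) (K : Finset ι) (ω0 : ι → Bool) (hn : Fintype.card ι ≤ n + K.card) :
    (build av f n K ω0).ro ∧ (∀ i ∈ K, ¬ (build av f n K ω0).occ i) ∧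
    (∀ ω, (∀ i ∈ K, ω i = ω0 i) → (build av f n K ω0).eval ω = f ω ∧
      ∀ j, (build av f n K ω0).vis j ω → D j ω) := by
  induction n generalizing K ω0 with
  | zero =>
    have hK : K = Finset.univ := by
      apply Finset.eq_univ_of_card; exact le_antisymm (Finset.card_le_univ K) (by simpa using hn)
    refine ⟨trivial, fun i _ h => h, fun ω hω => ⟨?_, fun j h => h.elim⟩⟩
    have : ω = ω0 := funext fun i => hω i (by simp [hK])
    rw [this]; rfl
  | succ n ih =>
    unfold build
    cases h : nxt K (av K ω0) with
    | none =>
      refine ⟨trivial, fun i _ h => h, fun ω hω => ⟨?_, fun j h => h.elim⟩⟩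
      exact (hdet K ω0 (nxt_none h) ω hω).symm
    | some i =>
      obtain ⟨hi, hiK⟩ := nxt_some h
      have hc : Fintype.card ι ≤ n + (insert i K).card := by
        rw [Finset.card_insert_of_notMem hiK]; omega
      obtain ⟨a1, a2, a3⟩ := ih (insert i K) (update ω0 i true) hc
      obtain ⟨b1, b2, b3⟩ := ih (insert i K) (update ω0 i false) hc
      refine ⟨⟨a2 i (by simp), b2 i (by simp), a1, b1⟩, ?_, ?_⟩
      · rintro k hk (rfl | h | h)
        · exact hiK hk
        · exact a2 k (by simp [hk]) h
        · exact b2 k (by simp [hk]) h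
      · intro ω hω
        have agree : ∀ b, ω i = b → ∀ k ∈ insert i K, ω k = update ω0 i b k := by
          intro b hb k hk
          by_cases hki : k = i
          · subst hki; simp [hb]
          · rw [update_of_ne hki]; exact hω k (by simpa [hki] using hk)
        have hDi : D i ω := hD K ω i (by rw [hav K ω ω0 fun k hk => hω k (by simpa using hk)]; exact hi)
        cases hb : ω i with
        | true =>
          obtain ⟨c1, c2⟩ := a3 ω (agree true hb)
          refine ⟨by simp [DT.eval, hb, c1], ?_⟩
          rintro j (rfl | h)
          · exact hDi
          · rw [hb] at h; exact c2 j h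
        | false =>
          obtain ⟨c1, c2⟩ := b3 ω (agree false hb)
          refine ⟨by simp [DT.eval, hb, c1], ?_⟩
          rintro j (rfl | h)
          · exact hDi
          · rw [hb] at h; exact c2 j h

lemma osss (hq : IsP q) (av : Finset ι → (ι → Bool) → Set ι) (f : (ι → Bool) → ℝ)
    (D : ι → (ι → Bool) → Prop) (hb : ∀ ω, |f ω| ≤ 1)
    (hav : ∀ K : Finset ι, Dep (K : Set ι) (av K))
    (hD : ∀ K ω, ∀ j ∈ av K ω, D j ω)
    (hdet : ∀ (K : Finset ι) ω, (∀ i ∈ av K ω, i ∈ K) → ∀ ω', (∀ i ∈ K, ω' i = ω i) → f ω' = f ω)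
    (g : (ι → Bool) → ℝ) :
    |Ex q (fun ω => f ω * g ω) - Ex q f * Ex q g| ≤ ∑ j, Pr q (D j) * Inf q g j := by
  obtain ⟨h1, -, h3⟩ := build_spec av f D hav hD hdet (Fintype.card ι) ∅ (fun _ => false) (by simp)
  set t := build av f (Fintype.card ι) ∅ (fun _ => false)
  have he : ∀ ω, t.eval ω = f ω := fun ω => (h3 ω (by simp)).1
  have := osss_tree hq t h1 (fun ω => by rw [he]; exact hb ω) g
  simp only [he] at this
  have e : Ex q (fun ω => f ω * g ω) - Ex q f * Ex q g = Ex q (fun ω => f ω * (g ω - Ex q g)) := by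
    rw [← Ex_mul_right, ← Ex_sub]; congr 1; funext ω; ring
  rw [e]
  refine this.trans (Finset.sum_le_sum fun j _ => mul_le_mul_of_nonneg_right ?_ (Inf_nonneg hq _ _))
  exact Pr_mono hq fun ω => (h3 ω (by simp)).2 j

end OSSS
end DaC

namespace DaC
open Relation

section Conn

/-- connection inside `S` -/
def Cn {X : Type*} (A : X → X → Prop) (S : Set X) (u v : X) : Prop :=
  u ∈ S ∧ ReflTransGen (fun a b => A a b ∧ b ∈ S) u v

variable {X : Type*} {A B : X → X → Prop} {S T : Set X} {u v w : X}

lemma Cn.refl (h : u ∈ S) : Cn A S u u := ⟨h, ReflTransGen.refl⟩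

lemma Cn.left (h : Cn A S u v) : u ∈ S := h.1

lemma Cn.right (h : Cn A S u v) : v ∈ S := by
  obtain ⟨h1, h2⟩ := h
  cases h2 with
  | refl => exact h1
  | tail _ h => exact h.2

lemma Cn.tail (h : Cn A S u v) (hA : A v w) (hw : w ∈ S) : Cn A S u w := ⟨h.1, h.2.tail ⟨hA, hw⟩⟩

lemma Cn.trans (h : Cn A S u v) (h' : Cn A S v w) : Cn A S u w := ⟨h.1, h.2.trans h'.2⟩

lemma Cn.mono (h : Cn A S u v) (hAB : ∀ a b, A a b → B a b) (hST : S ⊆ T) : Cn B T u v :=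
  ⟨hST h.1, ReflTransGen.mono (fun a b hab => ⟨hAB a b hab.1, hST hab.2⟩) _ _ h.2⟩

@[elab_as_elim]
lemma Cn.ind {P : X → Prop} (h : Cn A S u v) (h0 : P u)
    (hs : ∀ b c, Cn A S u b → A b c → c ∈ S → P b → P c) : P v := by
  obtain ⟨h1, h2⟩ := h
  induction h2 with
  | refl => exact h0
  | tail hb hc ih => exact hs _ _ ⟨h1, hb⟩ hc.1 hc.2 ih

lemma Cn.single (hu : u ∈ S) (hA : A u v) (hv : v ∈ S) : Cn A S u v := (Cn.refl hu).tail hA hv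

lemma Cn.symm (hA : ∀ a b, A a b → A b a) (h : Cn A S u v) : Cn A S v u := by
  refine h.ind (P := fun z => Cn A S z u) (Cn.refl h.1) ?_
  intro b c hb hbc hc ih
  exact (Cn.single hc (hA _ _ hbc) hb.right).trans ih

/-- a connection stays inside the set of reached points -/
lemma Cn.strong (h : Cn A S u v) : Cn (fun a b => A a b) {z | Cn A S u z} u v := by
  refine h.ind (P := fun z => Cn (fun a b => A a b) {z | Cn A S u z} u z) (Cn.refl (Cn.refl h.1)) ?_
  intro b c hb hbc hc ih
  exact ih.tail hbc (hb.tail hbc hc)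

lemma Cn.map {Y : Type*} {A' : Y → Y → Prop} {S' : Set Y} (f : X → Y) (h : Cn A S u v)
    (hA : ∀ a b, a ∈ S → b ∈ S → A a b → A' (f a) (f b)) (hS : ∀ a ∈ S, f a ∈ S') :
    Cn A' S' (f u) (f v) := by
  refine h.ind (P := fun z => Cn A' S' (f u) (f z)) (Cn.refl (hS _ h.1)) ?_
  intro b c hb hbc hc ih
  exact ih.tail (hA _ _ hb.right hc hbc) (hS _ hc)

/-- first hitting of a level set -/
lemma Cn.level (h : Cn A S u v) (ht : X → ℤ) (hstep : ∀ a b, A a b → ht b ≤ ht a + 1) (k : ℤ)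
    (h1 : ht u ≤ k) (h2 : k ≤ ht v) :
    ∃ w, ht w = k ∧ Cn A (S ∩ {z | ht z ≤ k}) u w ∧ Cn A S w v := by
  have key : (Cn A (S ∩ {z | ht z ≤ k}) u v) ∨
      ∃ w, ht w = k ∧ Cn A (S ∩ {z | ht z ≤ k}) u w ∧ Cn A S w v := by
    refine h.ind (P := fun v => (Cn A (S ∩ {z | ht z ≤ k}) u v) ∨
      ∃ w, ht w = k ∧ Cn A (S ∩ {z | ht z ≤ k}) u w ∧ Cn A S w v) (Or.inl (Cn.refl ⟨h.1, h1⟩)) ?_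
    intro b c hb hbc hc ih
    rcases ih with ih | ⟨w, hw, h3, h4⟩
    · by_cases hck : ht c ≤ k
      · exact Or.inl (ih.tail hbc ⟨hc, hck⟩)
      · right
        have h5 : ht b ≤ k := ih.right.2
        have h6 := hstep b c hbc
        refine ⟨b, by omega, ih, Cn.single hb.right hbc hc⟩
    · exact Or.inr ⟨w, hw, h3, h4.tail hbc hc⟩
  rcases key with hk | hk
  · exact ⟨v, le_antisymm hk.right.2 h2, hk, Cn.refl h.right⟩
  · exact hk

/-- Two relations agreeing along everything reached. -/
lemma Cn.transfer (h : Cn A S u v) (hAB : ∀ a b, Cn B S u a → b ∈ S → A a b → B a b) : Cn B S u v := by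
  refine h.ind (P := fun z => Cn B S u z) (Cn.refl h.1) ?_
  intro b c hb hbc hc ih
  exact ih.tail (hAB b c ih hc hbc) hc

end Conn

/-- sup norm -/
def nrm (v : V) : ℤ := max (max v.1 (-v.1)) (max v.2 (-v.2))

lemma triAdj_iff (u v : V) : TriAdj u v ↔ ((u.1 - v.1 = 1 ∧ u.2 - v.2 = 0) ∨ (u.1 - v.1 = -1 ∧ u.2 - v.2 = 0) ∨
    (u.1 - v.1 = 0 ∧ u.2 - v.2 = 1) ∨ (u.1 - v.1 = 0 ∧ u.2 - v.2 = -1) ∨ (u.1 - v.1 = 1 ∧ u.2 - v.2 = 1) ∨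
    (u.1 - v.1 = -1 ∧ u.2 - v.2 = -1)) := by
  simp [TriAdj, Prod.ext_iff]

lemma TriAdj.symm {u v : V} (h : TriAdj u v) : TriAdj v u := by
  rw [triAdj_iff] at *; omega

lemma nrm_step {u v : V} (x : V) (h : TriAdj u v) : nrm (v - x) ≤ nrm (u - x) + 1 := by
  rw [triAdj_iff] at h
  simp only [nrm, Prod.fst_sub, Prod.snd_sub]; omega

/-- arm event -/
def Arm (A : V → V → Prop) (x : V) (n : ℤ) : Prop :=
  ∃ y, nrm (y - x) = n ∧ Cn A {z | nrm (z - x) ≤ n} x y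

lemma arm_of_cn {A : V → V → Prop} (hA : ∀ a b, A a b → TriAdj a b) {S : Set V} {x y : V} {n : ℤ} (hn : 0 ≤ n)
    (h : Cn A S x y) (hy : n ≤ nrm (y - x)) : Arm A x n := by
  obtain ⟨w, hw, h1, -⟩ := h.level (fun z => nrm (z - x)) (fun a b hab => nrm_step x (hA a b hab)) n
    (by simpa [nrm] using hn) hy
  exact ⟨w, hw, h1.mono (fun _ _ h => h) (fun z hz => hz.2)⟩

lemma Arm.anti {A : V → V → Prop} (hA : ∀ a b, A a b → TriAdj a b) {x : V} {n m : ℤ} (hm : 0 ≤ m) (hmn : m ≤ n)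
    (h : Arm A x n) : Arm A x m := by
  obtain ⟨y, hy, h⟩ := h
  exact arm_of_cn hA hm h (by omega)

lemma Arm.mono {A B : V → V → Prop} (hAB : ∀ a b, A a b → B a b) {x : V} {n : ℤ} (h : Arm A x n) : Arm B x n := by
  obtain ⟨y, hy, h⟩ := h
  exact ⟨y, hy, h.mono hAB (le_refl _)⟩

/-- boxes as finsets -/
noncomputable def Bx (n : ℤ) : Finset V := Finset.Icc (-n) n ×ˢ Finset.Icc (-n) n

lemma mem_Bx {n : ℤ} {v : V} : v ∈ Bx n ↔ nrm v ≤ n := by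
  simp [Bx, nrm]; omega

section ArmOSSS
open Classical
variable {ι : Type*} [Fintype ι] {q : ι → ℝ}

lemma sum_abs_le (U : ℕ → ℝ) (hU : ∀ i, 0 ≤ U i) (n m : ℕ) (hm : m ≤ n) :
    ∑ k ∈ Finset.Icc 1 n, U ((m : ℤ) - (k : ℤ)).natAbs ≤ 2 * ∑ i ∈ Finset.range (n + 1), U i := by
  have h1 : ∑ k ∈ Finset.Icc 1 n, U ((m : ℤ) - (k : ℤ)).natAbs
      ≤ ∑ k ∈ Finset.Icc 1 n, ((if k ≤ m then U (m - k) else 0) + (if m ≤ k then U (k - m) else 0)) := by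
    refine Finset.sum_le_sum fun k hk => ?_
    rcases le_total k m with h | h
    · have : ((m : ℤ) - k).natAbs = m - k := by omega
      rw [this, if_pos h]
      have : 0 ≤ (if m ≤ k then U (k - m) else 0) := by split_ifs; exact hU _; exact le_refl _
      linarith
    · have : ((m : ℤ) - k).natAbs = k - m := by omega
      rw [this, if_pos h]
      have : 0 ≤ (if k ≤ m then U (m - k) else 0) := by split_ifs; exact hU _; exact le_refl _
      linarith
  refine h1.trans ?_
  rw [Finset.sum_add_distrib, two_mul]
  rw [← Finset.sum_filter, ← Finset.sum_filter]
  apply add_le_add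
  · rw [← Finset.sum_image (s := (Finset.Icc 1 n).filter (fun k => k ≤ m)) (g := fun k => m - k) (f := U)]
    · apply Finset.sum_le_sum_of_subset_of_nonneg
      · intro i hi; simp only [Finset.mem_image, Finset.mem_filter, Finset.mem_Icc] at hi; simp; omega
      · intros; exact hU _
    · intro a ha b hb hab
      simp only [Finset.coe_filter, Set.mem_ofPred_eq] at ha hb
      simp only at hab; omega
  · rw [← Finset.sum_image (s := (Finset.Icc 1 n).filter (fun k => m ≤ k)) (g := fun k => k - m) (f := U)]
    · apply Finset.sum_le_sum_of_subset_of_nonneg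
      · intro i hi; simp only [Finset.mem_image, Finset.mem_filter, Finset.mem_Icc] at hi; simp; omega
      · intros; exact hU _
    · intro a ha b hb hab
      simp only [Finset.coe_filter, Set.mem_ofPred_eq] at ha hb
      simp only at hab; omega

/-- The OSSS inequality for one-arm events. -/
lemma osss_arm (hq : IsP q) (A : (ι → Bool) → V → V → Prop)
    (hsym : ∀ ω a b, A ω a b → A ω b a) (hT : ∀ ω a b, A ω a b → TriAdj a b)
    (N : V → V → Finset ι) (hN : ∀ a b, Dep (N a b : Set ι) (fun ω => A ω a b))
    (n : ℕ) (hn : 1 ≤ n) (U : ℕ → ℝ) (hU0 : ∀ i, 0 ≤ U i)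
    (hU : ∀ x (m : ℕ), Pr q (fun ω => Arm (A ω) x m) ≤ U m)
    (M : ℕ) (hM : ∀ j, (((Bx n ×ˢ Bx n).filter (fun e => TriAdj e.1 e.2 ∧ j ∈ N e.1 e.2)).card ≤ M)) :
    n * (Pr q (fun ω => Arm (A ω) 0 n) * (1 - Pr q (fun ω => Arm (A ω) 0 n)))
      ≤ 2 * M * (∑ i ∈ Finset.range (n + 1), U i) * ∑ j, Inf q (fun ω => ind (Arm (A ω) 0 n)) j := by
  set f : (ι → Bool) → ℝ := fun ω => ind (Arm (A ω) 0 n) with hf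
  set B : Set V := {z | nrm z ≤ n} with hB
  -- the revealed events
  let D : ℕ → ι → (ι → Bool) → Prop := fun k j ω =>
    ∃ e ∈ ((Bx n ×ˢ Bx n).filter (fun e => TriAdj e.1 e.2 ∧ j ∈ N e.1 e.2)), ∃ w, nrm w = k ∧ Cn (A ω) B w e.1
  have hcov : ∀ k ∈ Finset.Icc 1 n, Pr q (fun ω => Arm (A ω) 0 n) * (1 - Pr q (fun ω => Arm (A ω) 0 n))
      ≤ ∑ j, Pr q (D k j) * Inf q f j := by
    intro k hk
    rw [Finset.mem_Icc] at hk
    let AK : Finset ι → (ι → Bool) → V → V → Prop := fun K ω a b => A ω a b ∧ N a b ⊆ K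
    let av : Finset ι → (ι → Bool) → Set ι := fun K ω =>
      {j | ∃ e ∈ ((Bx n ×ˢ Bx n).filter (fun e => TriAdj e.1 e.2 ∧ j ∈ N e.1 e.2)),
        ∃ w, nrm w = k ∧ Cn (AK K ω) B w e.1}
    have hAK : ∀ K ω ω', (∀ i ∈ K, ω i = ω' i) → AK K ω = AK K ω' := by
      intro K ω ω' h
      funext a b
      simp only [AK, eq_iff_iff]
      constructor
      · rintro ⟨h1, h2⟩; exact ⟨(hN a b ω ω' fun i hi => h i (h2 hi)).mp h1, h2⟩
      · rintro ⟨h1, h2⟩; exact ⟨(hN a b ω' ω fun i hi => (h i (h2 hi)).symm).mp h1, h2⟩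
    have hav : ∀ K : Finset ι, Dep (K : Set ι) (av K) := by
      intro K ω ω' h
      simp only [av, hAK K ω ω' (fun i hi => h i hi)]
    have hD : ∀ K ω, ∀ j ∈ av K ω, D k j ω := by
      rintro K ω j ⟨e, he, w, hw, hc⟩
      exact ⟨e, he, w, hw, hc.mono (fun a b h => h.1) (le_refl _)⟩
    have half : ∀ (K : Finset ι) ω, (∀ i ∈ av K ω, i ∈ K) → ∀ ω', (∀ i ∈ K, ω' i = ω i) →
        Arm (A ω') 0 n → Arm (A ω) 0 n := by
      intro K ω hK ω' hω harm
      obtain ⟨y, hy, hc⟩ := harm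
      simp only [sub_zero] at hy hc
      obtain ⟨w, hw, h1, h2⟩ := hc.level nrm (fun a b hab => by simpa using nrm_step 0 (hT _ a b hab)) k
        (by simp [nrm]) (by rw [hy]; exact_mod_cast hk.2)
      have h1' : Cn (A ω') B w 0 := (h1.mono (fun _ _ h => h) (fun z hz => hz.1)).symm (hsym ω')
      have tr : ∀ z, Cn (A ω') B w z → Cn (AK K ω) B w z := by
        intro z hz
        refine hz.transfer ?_
        intro a b ha hb hab
        have hsub : N a b ⊆ K := by
          intro j hj
          apply hK
          refine ⟨(a, b), ?_, w, hw, ha⟩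
          simp only [Finset.mem_filter, Finset.mem_product, mem_Bx]
          exact ⟨⟨ha.right, hb⟩, hT _ _ _ hab, hj⟩
        exact ⟨(hN a b ω' ω fun i hi => hω i (hsub hi)).mp hab, hsub⟩
      have t1 := (tr 0 h1').mono (B := A ω) (fun a b h => h.1) (le_refl B)
      have t2 := (tr y h2).mono (B := A ω) (fun a b h => h.1) (le_refl B)
      refine ⟨y, by simpa using hy, ?_⟩
      simp only [sub_zero]
      exact (t1.symm (hsym ω)).trans t2
    have hdet : ∀ (K : Finset ι) ω, (∀ i ∈ av K ω, i ∈ K) → ∀ ω', (∀ i ∈ K, ω' i = ω i) → f ω' = f ω := by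
      intro K ω hK ω' hω
      have e : av K ω = av K ω' := hav K ω ω' fun i hi => (hω i hi).symm
      have : Arm (A ω') 0 n ↔ Arm (A ω) 0 n :=
        ⟨half K ω hK ω' hω, half K ω' (e ▸ hK) ω fun i hi => (hω i hi).symm⟩
      simp only [hf, this]
    have := osss hq av f (D k) (fun ω => by
      rw [abs_of_nonneg (ind_nonneg _)]; exact ind_le_one _) hav hD hdet f
    refine le_trans (le_of_eq ?_) ((le_abs_self _).trans this)
    have e2 : (fun ω => f ω * f ω) = f := by
      funext ω; simp only [hf, ← ind_and, and_self]
    rw [e2]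
    simp only [Pr, hf]; ring
  have hDk : ∀ k ∈ Finset.Icc 1 n, ∀ j, Pr q (D k j) ≤
      ∑ e ∈ ((Bx n ×ˢ Bx n).filter (fun e => TriAdj e.1 e.2 ∧ j ∈ N e.1 e.2)),
        U (((nrm e.1).toNat : ℤ) - (k : ℤ)).natAbs := by
    intro k hk j
    refine (Pr_exists_le hq _ _).trans (Finset.sum_le_sum fun e _ => ?_)
    refine le_trans (Pr_mono hq ?_) (hU e.1 _)
    rintro ω ⟨w, hw, hc⟩
    refine arm_of_cn (hT ω) (by positivity) (hc.symm (hsym ω)) ?_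
    have h0 : 0 ≤ nrm e.1 := by simp [nrm]; omega
    have : nrm (w - e.1) ≥ nrm w - nrm e.1 ∧ nrm (w - e.1) ≥ nrm e.1 - nrm w := by
      simp only [nrm, Prod.fst_sub, Prod.snd_sub]; omega
    omega
  have hsumD : ∀ j, ∑ k ∈ Finset.Icc 1 n, Pr q (D k j) ≤ 2 * M * ∑ i ∈ Finset.range (n + 1), U i := by
    intro j
    refine (Finset.sum_le_sum fun k hk => hDk k hk j).trans ?_
    rw [Finset.sum_comm]
    have hS : 0 ≤ ∑ i ∈ Finset.range (n + 1), U i := Finset.sum_nonneg fun i _ => hU0 i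
    refine (Finset.sum_le_sum (g := fun _ => 2 * ∑ i ∈ Finset.range (n + 1), U i) fun e he => ?_).trans ?_
    · apply sum_abs_le U hU0
      simp only [Finset.mem_filter, Finset.mem_product, mem_Bx] at he
      have := he.1.1
      omega
    · rw [Finset.sum_const, nsmul_eq_mul]
      have : ((((Bx n ×ˢ Bx n).filter (fun e => TriAdj e.1 e.2 ∧ j ∈ N e.1 e.2)).card : ℕ) : ℝ) ≤ M := by
        exact_mod_cast hM j
      nlinarith
  have tot := Finset.sum_le_sum hcov
  rw [Finset.sum_const, nsmul_eq_mul] at tot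
  simp only [Nat.card_Icc, Nat.add_sub_cancel] at tot
  refine tot.trans ?_
  rw [Finset.sum_comm, Finset.mul_sum]
  refine Finset.sum_le_sum fun j _ => ?_
  rw [← Finset.sum_mul]
  exact mul_le_mul_of_nonneg_right (hsumD j) (Inf_nonneg hq _ _)

end ArmOSSS
end DaC

namespace DaC
open Relation

section Topo
open Classical

/-- flux through the half line below `w` of the step `s → t` -/
noncomputable def gflux (s t w : V) : ℤ :=
  (if s.1 = w.1 ∧ t.1 = w.1 + 1 ∧ s.2 < w.2 then 1 else 0)
  - (if t.1 = w.1 ∧ s.1 = w.1 + 1 ∧ t.2 < w.2 then 1 else 0)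

/-- indicator of the column below `w` -/
noncomputable def phiCol (w z : V) : ℤ := if z.1 = w.1 ∧ z.2 < w.2 then 1 else 0

lemma gflux_vert (s t w : V) (hst : TriAdj s t) (hs : s ≠ w) (ht : t ≠ w) :
    gflux s t w - gflux s t (w + (0, 1)) = 0 := by
  rw [triAdj_iff] at hst
  rw [ne_eq, Prod.ext_iff] at hs ht
  simp only [gflux, Prod.fst_add, Prod.snd_add]
  split_ifs <;> omega

set_option maxHeartbeats 2000000 in
lemma gflux_horiz (s t w w' : V) (hst : TriAdj s t) (hs : s ≠ w) (ht : t ≠ w) (hs' : s ≠ w') (ht' : t ≠ w')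
    (hw : w' = w + (1, 0) ∨ w' = w + (1, 1)) :
    gflux s t w - gflux s t w' = phiCol w' t - phiCol w' s := by
  rw [triAdj_iff] at hst
  rw [ne_eq, Prod.ext_iff] at hs ht hs' ht'
  have h1 : w'.1 = w.1 + 1 := by rcases hw with rfl | rfl <;> simp
  have h2 : w'.2 = w.2 ∨ w'.2 = w.2 + 1 := by rcases hw with rfl | rfl <;> simp
  simp only [gflux, phiCol, h1]
  rcases hst with hst | hst | hst | hst | hst | hst <;> split_ifs <;> omega

lemma exists_flux (S : Set V) (c d : ℤ) (hS : ∀ z ∈ S, c < z.2 ∧ z.2 < d) {u v : V} (h : Cn TriAdj S u v) :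
    ∃ N : V → ℤ, (∀ w, w ∉ S → w + (0, 1) ∉ S → N w = N (w + (0, 1))) ∧
      (∀ w w', w ∉ S → w' ∉ S → (w' = w + (1, 0) ∨ w' = w + (1, 1)) → N w - N w' = phiCol w' v - phiCol w' u) ∧
      (∀ w : V, d ≤ w.2 → N w = (if w.1 < v.1 then 1 else 0) - (if w.1 < u.1 then 1 else 0)) ∧
      (∀ w : V, w.2 ≤ c → N w = 0) := by
  refine h.ind (P := fun v => ∃ N : V → ℤ, (∀ w, w ∉ S → w + (0, 1) ∉ S → N w = N (w + (0, 1))) ∧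
      (∀ w w', w ∉ S → w' ∉ S → (w' = w + (1, 0) ∨ w' = w + (1, 1)) → N w - N w' = phiCol w' v - phiCol w' u) ∧
      (∀ w : V, d ≤ w.2 → N w = (if w.1 < v.1 then 1 else 0) - (if w.1 < u.1 then 1 else 0)) ∧
      (∀ w : V, w.2 ≤ c → N w = 0)) ?_ ?_
  · exact ⟨fun _ => 0, by simp, by simp, by simp, by simp⟩
  · rintro s t hs hst ht ⟨N, h1, h2, h3, h4⟩
    have hsS := hs.right
    refine ⟨fun w => N w + gflux s t w, ?_, ?_, ?_, ?_⟩
    · intro w hw hw'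
      have := gflux_vert s t w hst (by rintro rfl; exact hw hsS) (by rintro rfl; exact hw ht)
      have := h1 w hw hw'
      simp only; linarith
    · intro w w' hw hw' hww
      have := gflux_horiz s t w w' hst (by rintro rfl; exact hw hsS) (by rintro rfl; exact hw ht)
        (by rintro rfl; exact hw' hsS) (by rintro rfl; exact hw' ht) hww
      have := h2 w w' hw hw' hww
      simp only; linarith
    · intro w hw
      have a := h3 w hw
      have b1 := hS s hsS
      have b2 := hS t ht
      rw [triAdj_iff] at hst
      simp only [a, gflux]
      split_ifs <;> omega
    · intro w hw
      have a := h4 w hw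
      have b1 := hS s hsS
      have b2 := hS t ht
      simp only [a, gflux]
      split_ifs <;> omega

/-- A horizontal crossing and a vertical crossing meet. -/
lemma cross_sets {S T : Set V} {a b c d : ℤ} (hS : ∀ z ∈ S, c < z.2 ∧ z.2 < d)
    (hT : ∀ z ∈ T, a < z.1 ∧ z.1 < b) {u v u' v' : V} (h : Cn TriAdj S u v) (h' : Cn TriAdj T u' v')
    (hu : u.1 ≤ a) (hv : b ≤ v.1) (hu' : d ≤ u'.2) (hv' : v'.2 ≤ c) : ∃ z, z ∈ S ∧ z ∈ T := by
  by_contra hne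
  push Not at hne
  have hd : ∀ z ∈ T, z ∉ S := fun z hz hz' => hne z hz' hz
  obtain ⟨N, h1, h2, h3, h4⟩ := exists_flux S c d hS h
  have hstep : ∀ w w', w ∈ T → w' ∈ T → (w' = w + (0, 1) ∨ w' = w + (1, 0) ∨ w' = w + (1, 1)) → N w = N w' := by
    intro w w' hw hw' hww
    rcases hww with e | e
    · subst e; exact h1 w (hd _ hw) (hd _ hw')
    · have := h2 w w' (hd _ hw) (hd _ hw') e
      have b' := hT w' hw'
      simp only [phiCol] at this
      rw [if_neg (by omega), if_neg (by omega)] at this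
      omega
  have hconst : N v' = N u' := by
    refine h'.ind (P := fun z => N z = N u') rfl ?_
    intro s t hs hst ht ih
    rw [← ih]
    rw [triAdj_iff] at hst
    have : (t = s + (0, 1) ∨ t = s + (1, 0) ∨ t = s + (1, 1)) ∨ (s = t + (0, 1) ∨ s = t + (1, 0) ∨ s = t + (1, 1)) := by
      simp only [Prod.ext_iff, Prod.fst_add, Prod.snd_add]; omega
    rcases this with e | e
    · exact (hstep s t hs.right ht e).symm
    · exact hstep t s ht hs.right e
  rw [h4 v' hv', h3 u' hu'] at hconst
  have := hT u' h'.left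
  rw [if_pos (by omega), if_neg (by omega)] at hconst
  omega

/-- crossing lemma for general relations -/
lemma cross_paths {A B : V → V → Prop} (hA : ∀ a b, A a b → TriAdj a b) (hB : ∀ a b, B a b → TriAdj a b)
    {S T : Set V} {a b c d : ℤ} (hS : ∀ z ∈ S, c < z.2 ∧ z.2 < d)
    (hT : ∀ z ∈ T, a < z.1 ∧ z.1 < b) {u v u' v' : V} (h : Cn A S u v) (h' : Cn B T u' v')
    (hu : u.1 ≤ a) (hv : b ≤ v.1) (hu' : d ≤ u'.2) (hv' : v'.2 ≤ c) : ∃ z, Cn A S u z ∧ Cn B T u' z := by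
  have hlast : v'.2 ≤ c := hv'
  exact cross_sets (S := {z | Cn A S u z}) (T := {z | Cn B T u' z}) (fun z hz => hS z hz.right) (fun z hz => hT z hz.right)
    (h.strong.mono hA (le_refl _)) (h'.strong.mono hB (le_refl _)) hu hv hu' hlast

/-- rectangle -/
def Rc (a b c d : ℤ) : Set V := {z | a ≤ z.1 ∧ z.1 ≤ b ∧ c ≤ z.2 ∧ z.2 ≤ d}

lemma rainbow_free (a1 a2 b1 b2 c1 c2 : Prop) (ha : a1 → a2 → False) (hb : b1 → b2 → False) (hc : c1 → c2 → False)
    (k1 : b1 → c2 → a1 ∨ a2) (k2 : c1 → b2 → a1 ∨ a2) (k3 : a1 → c2 → b1 ∨ b2) (k4 : c1 → a2 → b1 ∨ b2)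
    (k5 : a1 → b2 → c1 ∨ c2) (k6 : b1 → a2 → c1 ∨ c2) :
    ((if a1 ∧ b2 then 1 else 0) - (if a2 ∧ b1 then 1 else 0) : ℤ) +
    ((if b1 ∧ c2 then 1 else 0) - (if b2 ∧ c1 then 1 else 0)) +
    ((if c1 ∧ a2 then 1 else 0) - (if c2 ∧ a1 then 1 else 0)) = 0 := by
  by_cases x1 : a1 <;> by_cases x2 : a2 <;> by_cases y1 : b1 <;> by_cases y2 : b2 <;>
      by_cases z1 : c1 <;> by_cases z2 : c2 <;> simp [x1, x2, y1, y2, z1, z2] at *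

set_option maxHeartbeats 2000000 in
/-- The Hex lemma. -/
lemma hex (s : V → Prop) (a b c d : ℤ) (hab : a ≤ b) (hcd : c ≤ d) :
    (∃ u v, u.1 = a ∧ v.1 = b ∧ Cn TriAdj (Rc a b c d ∩ {z | s z}) u v) ∨
    (∃ u v, u.2 = c ∧ v.2 = d ∧ Cn TriAdj (Rc a b c d ∩ {z | ¬ s z}) u v) := by
  by_contra hcon
  rw [not_or] at hcon
  obtain ⟨hLR, hTB⟩ := hcon
  let L1 : V → Prop := fun z => z.1 = a - 1 ∨ ∃ u, u.1 = a ∧ Cn TriAdj (Rc a b c d ∩ {z | s z}) u z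
  let L2 : V → Prop := fun z => ¬ L1 z ∧ (z.2 = c - 1 ∨ ∃ u, u.2 = c ∧ Cn TriAdj (Rc a b c d ∩ {z | ¬ s z}) u z)
  have hL1 : ∀ z, L1 z → z.1 = a - 1 ∨ z ∈ Rc a b c d := by
    rintro z (h | ⟨u, hu, h⟩)
    · exact Or.inl h
    · exact Or.inr h.right.1
  have hL2 : ∀ z, L2 z → z.2 = c - 1 ∨ z ∈ Rc a b c d := by
    rintro z ⟨_, h | ⟨u, hu, h⟩⟩
    · exact Or.inl h
    · exact Or.inr h.right.1
  -- no rainbow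
  have key : ∀ v w1 w2, v ∈ Rc (a-1) (b+1) (c-1) (d+1) → TriAdj w1 v → TriAdj w2 v → L1 w1 → L2 w2 →
      L1 v ∨ L2 v := by
    intro v w1 w2 hv t1 t2 l1 l2
    by_contra hc
    rw [not_or] at hc
    obtain ⟨n1, n2⟩ := hc
    have n1' : ¬ v.1 = a - 1 := fun h => n1 (Or.inl h)
    have n2' : ¬ v.2 = c - 1 := fun h => n2 ⟨n1, Or.inl h⟩
    obtain ⟨v1, v2, v3, v4⟩ := hv
    have t1' := t1
    have t2' := t2
    rw [triAdj_iff] at t1' t2'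
    by_cases hbox : v ∈ Rc a b c d
    · by_cases hs : s v
      · apply n1
        right
        rcases l1 with h | ⟨u, hu, h⟩
        · exact ⟨v, by have := hbox.1; omega, Cn.refl ⟨hbox, hs⟩⟩
        · exact ⟨u, hu, h.tail t1 ⟨hbox, hs⟩⟩
      · apply n2
        refine ⟨n1, Or.inr ?_⟩
        rcases l2.2 with h | ⟨u, hu, h⟩
        · exact ⟨v, by have := hbox.2.2.1; omega, Cn.refl ⟨hbox, hs⟩⟩
        · exact ⟨u, hu, h.tail t2 ⟨hbox, hs⟩⟩
    · have : v.1 = b + 1 ∨ v.2 = d + 1 := by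
        by_contra hh; apply hbox; simp only [Rc, Set.mem_ofPred_eq]; omega
      rcases this with hv' | hv'
      · rcases l1 with h | ⟨u, hu, h⟩
        · omega
        · apply hLR; refine ⟨u, w1, hu, ?_, h⟩
          have := h.right.1.2.1; omega
      · rcases l2.2 with h | ⟨u, hu, h⟩
        · omega
        · apply hTB; refine ⟨u, w2, hu, ?_, h⟩
          have := h.right.1.2.2.2; omega
  let om : V → V → ℤ := fun u v => (if L1 u ∧ L2 v then 1 else 0) - (if L2 u ∧ L1 v then 1 else 0)
  have disj : ∀ z, L1 z → L2 z → False := fun z h1 h2 => h2.1 h1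
  have tri : ∀ u v w, u ∈ Rc (a-1) (b+1) (c-1) (d+1) → v ∈ Rc (a-1) (b+1) (c-1) (d+1) →
      w ∈ Rc (a-1) (b+1) (c-1) (d+1) → TriAdj u v → TriAdj v w → TriAdj w u → om u v + om v w + om w u = 0 := by
    intro u v w hu hv hw t1 t2 t3
    simp only [om]
    convert rainbow_free _ _ _ _ _ _ (disj u) (disj v) (disj w) (key u v w hu t1.symm t3) (key u w v hu t3 t1.symm)
      (key v u w hv t1 t2.symm) (key v w u hv t2.symm t1) (key w u v hw t3.symm t2) (key w v u hw t2 t3.symm)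
  have omskew : ∀ u v, om u v = - om v u := by
    intro u v; simp only [om]
    by_cases a1 : L1 u <;> by_cases a2 : L2 u <;> by_cases b1 : L1 v <;> by_cases b2 : L2 v <;> simp only [a1, a2, b1, b2] <;> rfl
  -- rows
  let m : ℕ := (b - a + 2).toNat
  let h : ℤ → ℤ := fun y => ∑ i ∈ Finset.range m, om (a - 1 + i, y) (a - 1 + i + 1, y)
  have hm : (m : ℤ) = b - a + 2 := by simp only [m]; omega
  have left1 : ∀ y, L1 (a - 1, y) := fun y => Or.inl rfl
  have omleft : ∀ y, om (a - 1, y) (a - 1, y + 1) = 0 := by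
    intro y; simp only [om]
    rw [if_neg (fun h => disj _ (left1 _) h.2), if_neg (fun h => disj _ (left1 _) h.1)]; rfl
  have right1 : ∀ y, ¬ L1 (b + 1, y) := by
    intro y h
    rcases hL1 _ h with h | h
    · simp at h; omega
    · have := h.2.1; simp at this
  have omright : ∀ y, om (b + 1, y) (b + 1, y + 1) = 0 := by
    intro y; simp only [om]
    rw [if_neg (fun h => right1 _ h.1), if_neg (fun h => right1 _ h.2)]; rfl
  have row : ∀ y, c - 1 ≤ y → y ≤ d → h y = h (y + 1) := by
    intro y hy1 hy2
    have hsq : ∀ i ∈ Finset.range m, om (a - 1 + (i:ℤ), y) (a - 1 + i + 1, y) - om (a - 1 + (i:ℤ), y + 1) (a - 1 + i + 1, y + 1)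
        = om (a - 1 + (i:ℤ), y) (a - 1 + i, y + 1) - om (a - 1 + ((i + 1 : ℕ):ℤ), y) (a - 1 + ((i + 1 : ℕ) : ℤ), y + 1) := by
      intro i hi
      rw [Finset.mem_range] at hi
      have q1 : ((a - 1 + (i:ℤ), y) : V) ∈ Rc (a-1) (b+1) (c-1) (d+1) := by
        simp only [Rc, Set.mem_ofPred_eq]; omega
      have q2 : ((a - 1 + (i:ℤ) + 1, y) : V) ∈ Rc (a-1) (b+1) (c-1) (d+1) := by
        simp only [Rc, Set.mem_ofPred_eq]; omega
      have q3 : ((a - 1 + (i:ℤ), y + 1) : V) ∈ Rc (a-1) (b+1) (c-1) (d+1) := by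
        simp only [Rc, Set.mem_ofPred_eq]; omega
      have q4 : ((a - 1 + (i:ℤ) + 1, y + 1) : V) ∈ Rc (a-1) (b+1) (c-1) (d+1) := by
        simp only [Rc, Set.mem_ofPred_eq]; omega
      have e1 := tri _ _ _ q1 q2 q4 (by rw [triAdj_iff]; simp) (by rw [triAdj_iff]; simp) (by rw [triAdj_iff]; simp)
      have e2 := tri _ _ _ q1 q4 q3 (by rw [triAdj_iff]; simp) (by rw [triAdj_iff]; simp) (by rw [triAdj_iff]; simp)
      have s1 := omskew (a - 1 + (i:ℤ) + 1, y + 1) (a - 1 + (i:ℤ), y)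
      have s2 := omskew (a - 1 + (i:ℤ) + 1, y + 1) (a - 1 + (i:ℤ), y + 1)
      have s3 := omskew (a - 1 + (i:ℤ), y + 1) (a - 1 + (i:ℤ), y)
      push_cast
      rw [← add_assoc]
      linarith
    have hs := Finset.sum_congr rfl hsq
    rw [Finset.sum_sub_distrib, Finset.sum_range_sub' (fun i : ℕ => om (a - 1 + (i:ℤ), y) (a - 1 + i, y + 1))] at hs
    have e3 : a - 1 + (m : ℤ) = b + 1 := by omega
    rw [e3] at hs
    have o1 := omleft y
    have o2 := omright y
    simp only [Nat.cast_zero, add_zero] at hs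
    simp only [h]; linarith
  have rows : ∀ k : ℕ, c - 1 + k ≤ d + 1 → h (c - 1) = h (c - 1 + k) := by
    intro k
    induction k with
    | zero => intro _; simp
    | succ k ih =>
      intro hk
      push_cast at hk ⊢
      rw [ih (by omega), row _ (by omega) (by omega), add_assoc]
  have hbot : h (c - 1) = 1 := by
    have hm1 : m = (m - 1) + 1 := by omega
    simp only [h]
    have b2 : ∀ x, a ≤ x → L2 (x, c - 1) := by
      intro x hx
      refine ⟨?_, Or.inl rfl⟩
      intro hl
      rcases hL1 _ hl with h | h
      · simp only at h; omega
      · have := h.2.2.1; simp only at this; omega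
    rw [hm1, Finset.sum_range_succ', Finset.sum_eq_zero]
    · simp only [om, zero_add]
      rw [if_pos ⟨by simpa using left1 _, b2 _ (by simp)⟩, if_neg (fun h => disj _ (by simpa using left1 _) h.1)]; rfl
    · intro i hi
      simp only [om]
      rw [if_neg (fun h => disj _ h.1 (b2 _ (by push_cast; omega))), if_neg (fun h => disj _ h.2 (b2 _ (by push_cast; omega)))]; rfl
  have htop : h (d + 1) = 0 := by
    simp only [h]
    apply Finset.sum_eq_zero
    have t2 : ∀ x, ¬ L2 (x, d + 1) := by
      intro x hl
      rcases hL2 _ hl with h | h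
      · simp only at h; omega
      · have := h.2.2.2; simp only at this; omega
    intro i hi
    simp only [om]
    rw [if_neg (fun h => t2 _ h.2), if_neg (fun h => t2 _ h.1)]; rfl
  have := rows (d + 2 - c).toNat (by omega)
  rw [show c - 1 + ((d + 2 - c).toNat : ℤ) = d + 1 by omega, hbot, htop] at this
  omega

end Topo
end DaC

namespace DaC
open Relation

section RSWdet

/-- pull back of a relation -/
def pull (g : V → V) (A : V → V → Prop) : V → V → Prop := fun a b => A (g a) (g b)

/-- box with centre `c` -/
def BoxC (c : V) (m : ℤ) : Set V := {z | nrm (z - c) ≤ m}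

lemma mem_BoxC {c : V} {m : ℤ} {z : V} :
    z ∈ BoxC c m ↔ c.1 - m ≤ z.1 ∧ z.1 ≤ c.1 + m ∧ c.2 - m ≤ z.2 ∧ z.2 ≤ c.2 + m := by
  simp only [BoxC, nrm, Set.mem_ofPred_eq, Prod.fst_sub, Prod.snd_sub]; omega

/-- crossing event -/
def Cr (S U W : Set V) (A : V → V → Prop) : Prop := ∃ u ∈ U, ∃ v ∈ W, Cn A S u v

lemma seg_vert (x lo hi : ℤ) (h : lo ≤ hi) :
    Cn TriAdj {z : V | z.1 = x ∧ lo ≤ z.2 ∧ z.2 ≤ hi} (x, lo) (x, hi) := by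
  obtain ⟨k, rfl⟩ : ∃ k : ℕ, hi = lo + k := ⟨(hi - lo).toNat, by omega⟩
  have : ∀ j : ℕ, j ≤ k → Cn TriAdj {z : V | z.1 = x ∧ lo ≤ z.2 ∧ z.2 ≤ lo + k} (x, lo) (x, lo + j) := by
    intro j
    induction j with
    | zero => intro _; simpa using Cn.refl (A := TriAdj) (S := {z : V | z.1 = x ∧ lo ≤ z.2 ∧ z.2 ≤ lo + k}) (u := (x, lo)) ⟨rfl, le_refl _, by simp⟩
    | succ j ih =>
      intro hj
      refine (ih (by omega)).tail ?_ ⟨rfl, ?_, ?_⟩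
      · rw [triAdj_iff]; simp
      · simp only; omega
      · push_cast; omega
  exact this k (le_refl _)

variable {A : V → V → Prop}

/-- A left-right and a bottom-top crossing of a rectangle meet. -/
lemma cross_rect (hA : ∀ a b, A a b → TriAdj a b) {B : V → V → Prop} (hB : ∀ a b, B a b → TriAdj a b) {a b c d : ℤ} {S T : Set V}
    (hS : S ⊆ Rc a b c d) (hT : T ⊆ Rc a b c d)
    {l r u e : V} (h : Cn A S l r) (hl : l.1 = a) (hr : r.1 = b)
    (h' : Cn B T u e) (hu : u.2 = c) (he : e.2 = d) : ∃ z, Cn A S l z ∧ Cn B T u z := by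
  let S' : Set V := {z | Cn A S l z} ∪ {(a - 1, l.2), (b + 1, r.2)}
  let T' : Set V := {z | Cn B T u z} ∪ {(u.1, c - 1), (e.1, d + 1)}
  have c1 : Cn TriAdj S' (a - 1, l.2) (b + 1, r.2) := by
    have h1 : Cn TriAdj S' l r := h.strong.mono hA (fun z hz => Or.inl hz)
    refine Cn.trans (Cn.single (by simp [S']) ?_ h1.left) (h1.tail ?_ (by simp [S']))
    · rw [triAdj_iff]; simp [hl]
    · rw [triAdj_iff]; simp [hr]
  have c2 : Cn TriAdj T' (e.1, d + 1) (u.1, c - 1) := by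
    have h1 : Cn TriAdj T' u e := h'.strong.mono hB (fun z hz => Or.inl hz)
    have h2 := h1.symm (fun a b => TriAdj.symm)
    refine Cn.trans (Cn.single (by simp [T']) ?_ h2.left) (h2.tail ?_ (by simp [T']))
    · rw [triAdj_iff]; simp [he]
    · rw [triAdj_iff]; simp [hu]
  have bS : ∀ z, Cn A S l z → a ≤ z.1 ∧ z.1 ≤ b ∧ c ≤ z.2 ∧ z.2 ≤ d := fun z hz => hS hz.right
  have bT : ∀ z, Cn B T u z → a ≤ z.1 ∧ z.1 ≤ b ∧ c ≤ z.2 ∧ z.2 ≤ d := fun z hz => hT hz.right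
  have bl := bS l (Cn.refl h.left)
  have br := bS r h
  have bu := bT u (Cn.refl h'.left)
  have be := bT e h'
  obtain ⟨z, z1, z2⟩ := cross_sets (S := S') (T := T') (a := a - 1) (b := b + 1) (c := c - 1) (d := d + 1)
    (by
      rintro z (hz | hz | hz)
      · have := bS z hz; omega
      · subst hz; simp only; omega
      · rw [Set.mem_singleton_iff] at hz; subst hz; simp only; omega)
    (by
      rintro z (hz | hz | hz)
      · have := bT z hz; omega
      · subst hz; simp only; omega
      · rw [Set.mem_singleton_iff] at hz; subst hz; simp only; omega) c1 c2 (by simp) (by simp) (by simp) (by simp)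
  rcases z1 with z1 | z1 | z1
  · rcases z2 with z2 | z2 | z2
    · exact ⟨z, z1, z2⟩
    · subst z2; have := bS _ z1; simp at this
    · rw [Set.mem_singleton_iff] at z2; subst z2; have := bS _ z1; simp at this
  · exfalso; subst z1
    rcases z2 with z2 | z2 | z2
    · have := bT _ z2; simp at this
    · simp only [Prod.ext_iff] at z2; omega
    · simp only [Set.mem_singleton_iff, Prod.ext_iff] at z2; omega
  · exfalso; rw [Set.mem_singleton_iff] at z1; subst z1
    rcases z2 with z2 | z2 | z2
    · have := bT _ z2; simp at this
    · simp only [Prod.ext_iff] at z2; omega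
    · simp only [Set.mem_singleton_iff, Prod.ext_iff] at z2; omega

lemma BoxC_subset (c : V) (m : ℤ) : BoxC c m ⊆ Rc (c.1 - m) (c.1 + m) (c.2 - m) (c.2 + m) := by
  intro z hz; rw [mem_BoxC] at hz; exact hz

lemma joinBox (hs : ∀ a b, A a b → A b a) (hA : ∀ a b, A a b → TriAdj a b) {c : V} {m : ℤ} {l r u e : V}
    (h : Cn A (BoxC c m) l r) (hl : l.1 = c.1 - m) (hr : r.1 = c.1 + m)
    (h' : Cn A (BoxC c m) u e) (hu : u.2 = c.2 - m) (he : e.2 = c.2 + m) : Cn A (BoxC c m) l u := by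
  obtain ⟨z, z1, z2⟩ := cross_rect hA hA (BoxC_subset c m) (BoxC_subset c m) h hl hr h' hu he
  exact z1.trans (z2.symm hs)

lemma halfLink (hs : ∀ a b, A a b → A b a) (hA : ∀ a b, A a b → TriAdj a b) {c c' : V} {m s w g0 g8 t t' : ℤ}
    (hc1 : c'.1 = c.1 + (m - s)) (hc2 : c'.2 = c.2 + w) (hsm : 2 * s ≤ m) (hm : 1 ≤ m)
    (hg0 : g0 + w ≤ t) (hg8 : t' ≤ g8 + w) {l r x1 y1 x2 y2 u e : V}
    (h : Cn A (BoxC c m) l r) (hl : l.1 = c.1 - m) (hr : r.1 = c.1 + m) (hr1 : t ≤ r.2 - c.2) (hr2 : r.2 - c.2 ≤ t')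
    (p1 : Cn A (BoxC c' s) x1 y1) (hx1 : x1.1 = c'.1 - s) (hy1 : y1.1 = c'.1 + s) (hy1' : g8 ≤ y1.2 - c'.2)
    (p2 : Cn A (BoxC c' s) x2 y2) (hx2 : x2.1 = c'.1 - s) (hy2 : y2.1 = c'.1 + s) (hy2' : y2.2 - c'.2 ≤ g0)
    (p3 : Cn A (BoxC c' s) u e) (hu : u.2 = c'.2 - s) (he : e.2 = c'.2 + s) :
    Cn A (BoxC c m ∪ BoxC c' s) l u := by
  have j1 : Cn A (BoxC c' s) u y1 := ((joinBox hs hA p1 hx1 hy1 p3 hu he).symm hs).trans p1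
  have j2 : Cn A (BoxC c' s) u y2 := ((joinBox hs hA p2 hx2 hy2 p3 hu he).symm hs).trans p2
  suffices hz : ∃ z, Cn A (BoxC c m) l z ∧ Cn A (BoxC c' s) u z by
    obtain ⟨z, z1, z2⟩ := hz
    exact (z1.mono (fun _ _ h => h) Set.subset_union_left).trans
      ((z2.symm hs).mono (fun _ _ h => h) Set.subset_union_right)
  by_cases e1 : y1.2 = r.2
  · have : y1 = r := Prod.ext (by omega) e1
    exact ⟨r, h, this ▸ j1⟩
  by_cases e2 : y2.2 = r.2
  · have : y2 = r := Prod.ext (by omega) e2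
    exact ⟨r, h, this ▸ j2⟩
  set hi : ℤ := max (c.2 + m) (c'.2 + s) + 1 with hhi
  set lo : ℤ := min (c.2 - m) (c'.2 - s) - 1 with hlo
  let S' : Set V := {z | Cn A (BoxC c m) l z} ∪ {(c.1 + m + 1, r.2), (c.1 + m + 2, r.2)}
  let T' : Set V := {z | Cn A (BoxC c' s) u z} ∪ ({z | z.1 = c.1 + m + 1 ∧ y1.2 ≤ z.2 ∧ z.2 ≤ hi} ∪
    {z | z.1 = c.1 + m + 1 ∧ lo ≤ z.2 ∧ z.2 ≤ y2.2})
  have bS : ∀ z, Cn A (BoxC c m) l z → c.1 - m ≤ z.1 ∧ z.1 ≤ c.1 + m ∧ c.2 - m ≤ z.2 ∧ z.2 ≤ c.2 + m :=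
    fun z hz => mem_BoxC.1 hz.right
  have bT : ∀ z, Cn A (BoxC c' s) u z → c'.1 - s ≤ z.1 ∧ z.1 ≤ c'.1 + s ∧ c'.2 - s ≤ z.2 ∧ z.2 ≤ c'.2 + s :=
    fun z hz => mem_BoxC.1 hz.right
  have br := bS r h
  have by1 := bT y1 j1
  have by2 := bT y2 j2
  have c1 : Cn TriAdj S' l (c.1 + m + 2, r.2) := by
    have h1 : Cn TriAdj S' l r := h.strong.mono hA (fun z hz => Or.inl hz)
    refine (h1.tail (w := (c.1 + m + 1, r.2)) ?_ (by simp [S'])).tail ?_ (by simp [S'])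
    · rw [triAdj_iff]; simp [hr]
    · rw [triAdj_iff]; simp
  have c2 : Cn TriAdj T' (c.1 + m + 1, hi) (c.1 + m + 1, lo) := by
    have h1 : Cn TriAdj T' u y1 := j1.strong.mono hA (fun z hz => Or.inl hz)
    have h2 : Cn TriAdj T' u y2 := j2.strong.mono hA (fun z hz => Or.inl hz)
    have s1 : Cn TriAdj T' (c.1 + m + 1, y1.2) (c.1 + m + 1, hi) :=
      (seg_vert (c.1 + m + 1) y1.2 hi (by omega)).mono (fun _ _ h => h) (fun z hz => Or.inr (Or.inl hz))
    have s2 : Cn TriAdj T' (c.1 + m + 1, lo) (c.1 + m + 1, y2.2) :=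
      (seg_vert (c.1 + m + 1) lo y2.2 (by omega)).mono (fun _ _ h => h) (fun z hz => Or.inr (Or.inr hz))
    have sy := fun a b => TriAdj.symm (u := a) (v := b)
    refine (s1.symm sy).trans (Cn.trans (Cn.single s1.left ?_ h1.right) ((h1.symm sy).trans (h2.trans
      ((Cn.single h2.right ?_ s2.right).trans (s2.symm sy)))))
    · rw [triAdj_iff]; simp only; omega
    · rw [triAdj_iff]; simp only; omega
  obtain ⟨z, z1, z2⟩ := cross_sets (S := S') (T := T') (a := c.1 - m) (b := c.1 + m + 2) (c := lo) (d := hi)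
    (by
      rintro z (hz | hz | hz)
      · have := bS z hz; omega
      · subst hz; simp only; omega
      · rw [Set.mem_singleton_iff] at hz; subst hz; simp only; omega)
    (by
      rintro z (hz | ⟨hz, _⟩ | ⟨hz, _⟩)
      · have := bT z hz; omega
      · omega
      · omega) c1 c2 (by omega) (by simp) (by simp) (by simp)
  rcases z1 with z1 | z1 | z1
  · rcases z2 with z2 | ⟨z2, _⟩ | ⟨z2, _⟩
    · exact ⟨z, z1, z2⟩
    · have := bS z z1; omega
    · have := bS z z1; omega
  · exfalso; subst z1
    rcases z2 with z2 | ⟨_, z2, _⟩ | ⟨_, _, z2⟩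
    · have := bT _ z2; simp only at this; omega
    · simp only at z2; omega
    · simp only at z2; omega
  · exfalso; rw [Set.mem_singleton_iff] at z1; subst z1
    rcases z2 with z2 | ⟨z2, _⟩ | ⟨z2, _⟩
    · have := bT _ z2; simp only at this; omega
    · simp at z2
    · simp at z2

lemma cn_pull {g : V → V} {S T : Set V} {u v : V} (h : Cn (pull g A) S u v) (hg : ∀ z ∈ S, g z ∈ T) :
    Cn A T (g u) (g v) := h.map g (fun _ _ _ _ h => h) hg

/-- mirror image of `halfLink` -/
lemma halfLink' (hs : ∀ a b, A a b → A b a) (hA : ∀ a b, A a b → TriAdj a b) {c c' : V} {m s w g0 g8 t t' : ℤ}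
    (hc1 : c'.1 = c.1 - (m - s)) (hc2 : c'.2 = c.2 - w) (hsm : 2 * s ≤ m) (hm : 1 ≤ m)
    (hg0 : g0 + w ≤ t) (hg8 : t' ≤ g8 + w) {l r x1 y1 x2 y2 u e : V}
    (h : Cn A (BoxC c m) r l) (hl : l.1 = c.1 - m) (hr : r.1 = c.1 + m) (hr1 : -t' ≤ l.2 - c.2) (hr2 : l.2 - c.2 ≤ -t)
    (p1 : Cn A (BoxC c' s) x1 y1) (hx1 : x1.1 = c'.1 + s) (hy1 : y1.1 = c'.1 - s) (hy1' : y1.2 - c'.2 ≤ -g8)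
    (p2 : Cn A (BoxC c' s) x2 y2) (hx2 : x2.1 = c'.1 + s) (hy2 : y2.1 = c'.1 - s) (hy2' : -g0 ≤ y2.2 - c'.2)
    (p3 : Cn A (BoxC c' s) u e) (hu : u.2 = c'.2 - s) (he : e.2 = c'.2 + s) :
    Cn A (BoxC c m ∪ BoxC c' s) r u := by
  have mp : ∀ {d : V} {k : ℤ} {a b : V}, Cn A (BoxC d k) a b → Cn (pull (fun z => -z) A) (BoxC (-d) k) (-a) (-b) := by
    intro d k a b hab
    refine hab.map (fun z => -z) (fun _ _ _ _ h => by simpa [pull] using h) ?_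
    intro z hz; rw [mem_BoxC] at hz ⊢; simp only [Prod.fst_neg, Prod.snd_neg]; omega
  have hA' : ∀ a b, pull (fun z => -z) A a b → TriAdj a b := by
    intro a b hab
    have := hA _ _ hab
    rw [triAdj_iff] at this ⊢; simp only [Prod.fst_neg, Prod.snd_neg] at this; omega
  have := halfLink (A := pull (fun z => -z) A) (fun a b h => hs _ _ h) hA' (c := -c) (c' := -c') (m := m) (s := s) (w := w)
    (g0 := g0) (g8 := g8) (t := t) (t' := t')
    (by simp only [Prod.fst_neg]; omega) (by simp only [Prod.snd_neg]; omega) hsm hm hg0 hg8 (mp h)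
    (by simp only [Prod.fst_neg]; omega) (by simp only [Prod.fst_neg]; omega)
    (by simp only [Prod.snd_neg]; omega) (by simp only [Prod.snd_neg]; omega)
    (mp p1) (by simp only [Prod.fst_neg]; omega) (by simp only [Prod.fst_neg]; omega) (by simp only [Prod.snd_neg]; omega)
    (mp p2) (by simp only [Prod.fst_neg]; omega) (by simp only [Prod.fst_neg]; omega) (by simp only [Prod.snd_neg]; omega)
    (mp (p3.symm hs)) (by simp only [Prod.snd_neg]; omega) (by simp only [Prod.snd_neg]; omega)
  have h2 := cn_pull (T := BoxC c m ∪ BoxC c' s) this (by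
    rintro z (hz | hz)
    · left; rw [mem_BoxC] at hz ⊢; simp only [Prod.fst_neg, Prod.snd_neg] at *; omega
    · right; rw [mem_BoxC] at hz ⊢; simp only [Prod.fst_neg, Prod.snd_neg] at *; omega)
  simp only [neg_neg] at h2
  exact h2.trans ((p3.symm hs).mono (fun _ _ h => h) Set.subset_union_right)

end RSWdet
end DaC

namespace DaC
open Relation

section Blocks

/-- rotation of the triangular lattice -/
def rot (z : V) : V := (z.1 - z.2, z.1)

def det (D z : V) : ℤ := D.1 * z.2 - D.2 * z.1

lemma det_rot (D z : V) : det (rot D) (rot z) = det D z := by simp only [det, rot]; ring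

lemma det_rot_iter (j : ℕ) (D z : V) : det (rot^[j] D) (rot^[j] z) = det D z := by
  induction j with
  | zero => rfl
  | succ j ih => rw [Function.iterate_succ_apply', Function.iterate_succ_apply', det_rot, ih]

lemma rot3 (z : V) : rot (rot (rot z)) = -z := by
  ext <;> simp only [rot, Prod.fst_neg, Prod.snd_neg] <;> ring

lemma rot6 (z : V) : rot^[6] z = z := by
  show rot (rot (rot (rot (rot (rot z))))) = z
  rw [rot3, rot3, neg_neg]

lemma rot_adj {a b : V} (h : TriAdj a b) : TriAdj (rot a) (rot b) := by
  rw [triAdj_iff] at *; simp only [rot]; omega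

lemma rot_iter_adj (j : ℕ) {a b : V} (h : TriAdj a b) : TriAdj (rot^[j] a) (rot^[j] b) := by
  induction j with
  | zero => exact h
  | succ j ih => rw [Function.iterate_succ_apply', Function.iterate_succ_apply']; exact rot_adj ih

lemma rot_iter_zero (j : ℕ) : rot^[j] (0 : V) = 0 := by
  induction j with
  | zero => rfl
  | succ j ih => rw [Function.iterate_succ_apply', ih]; rfl

/-- first exit -/
lemma Cn.exit {X : Type*} {A : X → X → Prop} {S : Set X} {u v : X} (h : Cn A S u v) (K : Set X) (hu : u ∈ K) (hv : v ∉ K) :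
    ∃ a b, Cn A (S ∩ K) u a ∧ A a b ∧ b ∈ S ∧ b ∉ K := by
  have : Cn A (S ∩ K) u v ∨ ∃ a b, Cn A (S ∩ K) u a ∧ A a b ∧ b ∈ S ∧ b ∉ K := by
    refine h.ind (P := fun z => Cn A (S ∩ K) u z ∨ ∃ a b, Cn A (S ∩ K) u a ∧ A a b ∧ b ∈ S ∧ b ∉ K)
      (Or.inl (Cn.refl ⟨h.1, hu⟩)) ?_
    rintro b c hb hbc hc (ih | ih)
    · by_cases hcK : c ∈ K
      · exact Or.inl (ih.tail hbc ⟨hc, hcK⟩)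
      · exact Or.inr ⟨b, c, ih, hbc, hc, hcK⟩
    · exact Or.inr ih
  rcases this with h | h
  · exact absurd h.right.2 hv
  · exact h

/-- hexagon -/
def HexK (D : V) (m : ℤ) : Set V := {z | ∀ j < 6, det (rot^[j] D) z ≤ 18 * m ^ 2}

lemma HexK_bound {D z : V} {m : ℤ} (hm : 0 < m) (hD : m ≤ D.1) (hz : z ∈ HexK D m) : |z.1| ≤ 72 * m ∧ |z.2| ≤ 72 * m := by
  obtain ⟨x, y⟩ := D
  obtain ⟨a, b⟩ := z
  have h0 := hz 0 (by norm_num)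
  have h1 := hz 1 (by norm_num)
  have h3 := hz 3 (by norm_num)
  have h4 := hz 4 (by norm_num)
  simp only [det, rot, Function.iterate_succ_apply', Function.iterate_zero, id] at h0 h1 h3 h4
  simp only at hD
  have e0 : |x * b - y * a| ≤ 18 * m ^ 2 := by rw [abs_le]; constructor <;> nlinarith
  have e1 : |(x - y) * b - x * a| ≤ 18 * m ^ 2 := by rw [abs_le]; constructor <;> nlinarith
  set M := max |x| |y| with hM
  have hMm : m ≤ M := le_trans hD (le_trans (le_abs_self x) (le_max_left _ _))
  have hx : |x| ≤ M := le_max_left _ _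
  have hy : |y| ≤ M := le_max_right _ _
  set Q := x ^ 2 - x * y + y ^ 2 with hQ
  have hQM : 3 * M ^ 2 ≤ 4 * Q := by
    rcases max_choice |x| |y| with h | h
    · rw [hM, h, sq_abs]; nlinarith [sq_nonneg (x - 2 * y)]
    · rw [hM, h, sq_abs]; nlinarith [sq_nonneg (y - 2 * x)]
  have hQ0 : 0 < Q := by nlinarith
  have hxy : |x - y| ≤ 2 * M := by have := abs_sub x y; linarith
  have fin : ∀ c : ℤ, |c| * Q ≤ 3 * M * (18 * m ^ 2) → |c| ≤ 72 * m := by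
    intro c hc
    by_contra hcon
    push Not at hcon
    nlinarith [mul_pos hm hm, mul_nonneg (abs_nonneg c) (sub_nonneg.2 hQM), mul_pos hm (lt_of_lt_of_le hm hMm), mul_nonneg (sub_nonneg.2 hMm) hm.le, mul_pos (sub_pos.2 hcon) (pow_pos (lt_of_lt_of_le hm hMm) 2), mul_nonneg (mul_nonneg (sub_nonneg.2 hMm) hm.le) (lt_of_lt_of_le hm hMm).le]
  constructor
  · apply fin
    have : a * Q = (x - y) * (x * b - y * a) - x * ((x - y) * b - x * a) := by rw [hQ]; ring
    calc |a| * Q = |a * Q| := by rw [abs_mul, abs_of_pos hQ0]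
      _ ≤ |x - y| * |x * b - y * a| + |x| * |(x - y) * b - x * a| := by
          rw [this, ← abs_mul, ← abs_mul]; exact abs_sub _ _
      _ ≤ 2 * M * (18 * m ^ 2) + M * (18 * m ^ 2) := by gcongr
      _ = _ := by ring
  · apply fin
    have : b * Q = x * (x * b - y * a) - y * ((x - y) * b - x * a) := by rw [hQ]; ring
    have hM0 : 0 ≤ M := by linarith
    calc |b| * Q = |b * Q| := by rw [abs_mul, abs_of_pos hQ0]
      _ ≤ |x| * |x * b - y * a| + |y| * |(x - y) * b - x * a| := by
          rw [this, ← abs_mul, ← abs_mul]; exact abs_sub _ _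
      _ ≤ M * (18 * m ^ 2) + M * (18 * m ^ 2) := by gcongr
      _ ≤ _ := by nlinarith [mul_nonneg hM0 (sq_nonneg m)]

lemma HexK_rot {D z : V} {m : ℤ} (hz : z ∈ HexK D m) : rot z ∈ HexK D m := by
  intro j hj
  rcases Nat.eq_zero_or_pos j with h | h
  · subst h
    have := hz 5 (by norm_num)
    have e : D = rot (rot^[5] D) := (rot6 D).symm
    show det D (rot z) ≤ _
    rw [e, det_rot]; exact this
  · obtain ⟨k, rfl⟩ : ∃ k, j = k + 1 := ⟨j - 1, by omega⟩
    rw [Function.iterate_succ_apply', det_rot]; exact hz k (by omega)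

lemma HexK_rot_iter {D z : V} {m : ℤ} (k : ℕ) (hz : z ∈ HexK D m) : rot^[k] z ∈ HexK D m := by
  induction k with
  | zero => exact hz
  | succ k ih => rw [Function.iterate_succ_apply']; exact HexK_rot ih

lemma det_zero (D : V) : det D 0 = 0 := by simp [det]

/-- A path from the origin to far away meets one of the six tubes. -/
lemma block_top {m : ℤ} (hm : 1 ≤ m) {D : V} (hD : m ≤ D.1) {P : ℕ → Set V} {Q : Set V} {q : V}
    (hQ : Cn TriAdj Q 0 q) (hq : 72 * m < nrm q)
    (hP : ∀ j < 6, ∃ u v : V, u.1 ≤ -(78 * m) ∧ 78 * m ≤ v.1 ∧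
      Cn TriAdj (P j ∩ {z | 0 < det D z ∧ det D z ≤ 18 * m ^ 2 ∧ nrm z ≤ 301 * m}) u v) :
    ∃ j < 6, ∃ z ∈ P j, rot^[j] z ∈ Q := by
  have hm0 : 0 < m := by omega
  have hqK : q ∉ HexK D m := by
    intro h
    have := HexK_bound hm0 hD h
    simp only [nrm] at hq
    rw [abs_le, abs_le] at this
    omega
  obtain ⟨a, b, hab, hadj, hbQ, hbK⟩ := hQ.exit (HexK D m) (by intro j _; rw [det_zero]; positivity) hqK
  simp only [HexK, Set.mem_ofPred_eq] at hbK
  push Not at hbK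
  obtain ⟨j, hj, hjb⟩ := hbK
  refine ⟨j, hj, ?_⟩
  obtain ⟨u, v, hu, hv, hPp⟩ := hP j hj
  have inv : ∀ z : V, rot^[j] (rot^[6 - j] z) = z := by
    intro z; rw [← Function.iterate_add_apply, show j + (6 - j) = 6 by omega, rot6]
  -- rotated path
  have hpath := hab.map (fun z => rot^[6 - j] z) (A' := TriAdj) (S' := {z | rot^[j] z ∈ Q ∧ z ∈ HexK D m})
    (fun x y _ _ h => rot_iter_adj _ h)
    (fun x hx => ⟨by show rot^[j] (rot^[6-j] x) ∈ Q; rw [inv]; exact hx.1, HexK_rot_iter _ hx.2⟩)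
  simp only [rot_iter_zero] at hpath
  set a' := rot^[6 - j] a with ha'
  set b' := rot^[6 - j] b with hb'
  have hadj' : TriAdj a' b' := rot_iter_adj _ hadj
  have hb'Q : rot^[j] b' ∈ Q := by rw [hb', inv]; exact hbQ
  have hb'd : 18 * m ^ 2 < det D b' := by
    have := det_rot_iter j D b'
    rw [hb', inv] at this; rw [hb', ← this]; exact hjb
  have ha'b := HexK_bound hm0 hD hpath.right.2
  rw [abs_le, abs_le] at ha'b
  have hb'b : -(73 * m) ≤ b'.1 ∧ b'.1 ≤ 73 * m ∧ -(73 * m) ≤ b'.2 ∧ b'.2 ≤ 73 * m := by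
    rw [triAdj_iff] at hadj'; omega
  let T : Set V := {z | rot^[j] z ∈ Q ∧ z.1 > -(78 * m) ∧ z.1 < 78 * m} ∪ {z | z.1 = 0 ∧ z.2 ≤ 0} ∪ {z | z.1 = b'.1 ∧ b'.2 ≤ z.2}
  have c1 : Cn TriAdj T 0 b' := by
    refine (hpath.mono (fun _ _ h => h) ?_).tail hadj' ?_
    · intro z hz
      have := (HexK_bound hm0 hD hz.2).1
      rw [abs_le] at this
      exact Or.inl (Or.inl ⟨hz.1, by omega, by omega⟩)
    · exact Or.inr ⟨rfl, le_refl _⟩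
  have c2 : Cn TriAdj T (0, -(302 * m)) 0 := by
    have := seg_vert 0 (-(302*m)) 0 (by omega)
    exact this.mono (fun _ _ h => h) (fun z hz => Or.inl (Or.inr ⟨hz.1, hz.2.2⟩))
  have c3 : Cn TriAdj T b' (b'.1, 302 * m) := by
    have := seg_vert b'.1 b'.2 (302*m) (by omega)
    exact this.mono (fun _ _ h => h) (fun z hz => Or.inr ⟨hz.1, hz.2.1⟩)
  have c4 := ((c2.trans c1).trans c3).symm (fun _ _ h => h.symm)
  obtain ⟨z, hzS, hzT⟩ := cross_sets (a := -(78 * m)) (b := 78 * m) (c := -(302 * m)) (d := 302 * m)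
    (S := P j ∩ {z | 0 < det D z ∧ det D z ≤ 18 * m ^ 2 ∧ nrm z ≤ 301 * m}) (T := T)
    (by
      rintro z ⟨-, -, -, h⟩
      simp only [nrm] at h
      omega)
    (by
      rintro z ((h | h) | h)
      · exact ⟨h.2.1, h.2.2⟩
      · rw [h.1]; omega
      · rw [h.1]; omega)
    hPp c4 hu hv (le_refl _) (le_refl _)
  refine ⟨z, hzS.1, ?_⟩
  have hD0 : 0 < D.1 := by omega
  rcases hzT with (h | h) | h
  · exact h.1
  · exfalso
    have := hzS.2.1
    simp only [det, h.1] at this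
    nlinarith [h.2]
  · exfalso
    have := hzS.2.2.1
    simp only [det, h.1] at this
    simp only [det] at hb'd
    nlinarith [h.2]

end Blocks
end DaC

namespace DaC
open Relation

section RSW

abbrev Rel := V → V → Prop

def SymTri (A : Rel) : Prop := (∀ a b, A a b → A b a) ∧ (∀ a b, A a b → TriAdj a b)

def IncA (E : Rel → Prop) : Prop := ∀ A B : Rel, (∀ a b, A a b → B a b) → E A → E B

lemma IncA.pull {E : Rel → Prop} (h : IncA E) (g : V → V) : IncA (fun A => E (pull g A)) :=
  fun A B hAB hE => h _ _ (fun _ _ => hAB _ _) hE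

lemma IncA.and {E F : Rel → Prop} (h : IncA E) (h' : IncA F) : IncA (fun A => E A ∧ F A) :=
  fun A B hAB hE => ⟨h _ _ hAB hE.1, h' _ _ hAB hE.2⟩

lemma IncA.all {E : ℕ → Rel → Prop} (k : ℕ) (h : ∀ i, IncA (E i)) : IncA (fun A => ∀ i < k, E i A) :=
  fun A B hAB hE i hi => h i _ _ hAB (hE i hi)

lemma IncA_Cr (S U W : Set V) : IncA (Cr S U W) := by
  rintro A B hAB ⟨u, hu, v, hv, h⟩
  exact ⟨u, hu, v, hv, h.mono hAB (le_refl _)⟩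

structure RLaw (μ : (Rel → Prop) → ℝ) : Prop where
  mono : ∀ E F : Rel → Prop, (∀ A, SymTri A → E A → F A) → μ E ≤ μ F
  or_le : ∀ E F : Rel → Prop, μ (fun A => E A ∨ F A) ≤ μ E + μ F
  fls : μ (fun _ => False) = 0
  tru : μ (fun _ => True) = 1
  fkg : ∀ E F : Rel → Prop, IncA E → IncA F → μ E * μ F ≤ μ (fun A => E A ∧ F A)
  trans : ∀ (c : V) (E : Rel → Prop), μ (fun A => E (pull (fun z => z + c) A)) = μ E
  neg : ∀ (E : Rel → Prop), μ (fun A => E (pull (fun z => -z) A)) = μ E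
  swap : ∀ (E : Rel → Prop), μ (fun A => E (pull Prod.swap A)) = μ E
  rot : ∀ (E : Rel → Prop), μ (fun A => E (pull rot A)) = μ E
  half : ∀ n : ℕ, 1 / 2 ≤ μ (Cr (BoxC 0 n) {z | z.1 = -n} {z | z.1 = n})

/-- left to a window of the right side -/
def EW (m t t' : ℤ) : Rel → Prop := Cr (BoxC 0 m) {z | z.1 = -m} {z | z.1 = m ∧ t ≤ z.2 ∧ z.2 ≤ t'}
def TB (m : ℤ) : Rel → Prop := Cr (BoxC 0 m) {z | z.2 = -m} {z | z.2 = m}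

/-- the frame event -/
def Frm (m s : ℤ) (c' : V) (t t' g0 g8 : ℤ) (A : Rel) : Prop :=
  (EW m t t' A ∧ EW m t t' (pull (fun z => -z) A) ∧ TB m A) ∧
  (EW s g8 s (pull (fun z => z + c') A) ∧ EW s (-s) g0 (pull (fun z => z + c') A) ∧
   EW s g8 s (pull (fun z => -z) (pull (fun z => z + c') A)) ∧ EW s (-s) g0 (pull (fun z => -z) (pull (fun z => z + c') A)) ∧
   TB s (pull (fun z => z + c') A))

variable {A : Rel}

lemma abs_EW {c : V} {m t t' : ℤ} (h : EW m t t' (pull (fun z => z + c) A)) :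
    ∃ l r : V, Cn A (BoxC c m) l r ∧ l.1 = c.1 - m ∧ r.1 = c.1 + m ∧ t ≤ r.2 - c.2 ∧ r.2 - c.2 ≤ t' := by
  obtain ⟨l, hl, r, hr, h⟩ := h
  refine ⟨l + c, r + c, cn_pull h (fun z hz => ?_), ?_, ?_, ?_, ?_⟩
  · rw [mem_BoxC] at *; simp at *; omega
  all_goals simp at *; omega

lemma abs_EWn {c : V} {m t t' : ℤ} (h : EW m t t' (pull (fun z => -z) (pull (fun z => z + c) A))) :
    ∃ r l : V, Cn A (BoxC c m) r l ∧ r.1 = c.1 + m ∧ l.1 = c.1 - m ∧ -t' ≤ l.2 - c.2 ∧ l.2 - c.2 ≤ -t := by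
  obtain ⟨l, hl, r, hr, h⟩ := h
  refine ⟨-l + c, -r + c, cn_pull (cn_pull h (T := BoxC 0 m) (fun z hz => ?_)) (fun z hz => ?_), ?_, ?_, ?_, ?_⟩
  · rw [mem_BoxC] at *; simp at *; omega
  · rw [mem_BoxC] at *; simp at *; omega
  all_goals simp at *; omega

def BTc (A : Rel) (c : V) (m : ℤ) (u : V) : Prop := ∃ e, Cn A (BoxC c m) u e ∧ u.2 = c.2 - m ∧ e.2 = c.2 + m

lemma abs_TB {c : V} {m : ℤ} (h : TB m (pull (fun z => z + c) A)) : ∃ u, BTc A c m u := by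
  obtain ⟨l, hl, r, hr, h⟩ := h
  refine ⟨l + c, r + c, cn_pull h (fun z hz => ?_), ?_, ?_⟩
  · rw [mem_BoxC] at *; simp at *; omega
  all_goals simp at *; omega

lemma link (hs : SymTri A) {m s w t t' g0 g8 : ℤ} {c : V} (hsm : 2 * s ≤ m) (hm : 1 ≤ m)
    (hg0 : g0 + w ≤ t) (hg8 : t' ≤ g8 + w)
    (h : Frm m s (m - s, w) t t' g0 g8 (pull (fun z => z + c) A))
    (h' : Frm m s (m - s, w) t t' g0 g8 (pull (fun z => z + (c + (2 * (m - s), 2 * w))) A)) {u u' : V}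
    (hu : BTc A c m u) (hu' : BTc A (c + (2 * (m - s), 2 * w)) m u') :
    Cn A (BoxC c m ∪ BoxC (c + (m - s, w)) s ∪ BoxC (c + (2 * (m - s), 2 * w)) m) u u' := by
  obtain ⟨⟨a1, -, -⟩, ⟨b1, b2, b3, b4, b5⟩⟩ := h
  obtain ⟨⟨-, d2, -⟩, -⟩ := h'
  have pp : ∀ g : Rel, pull (fun z : V => z + (m - s, w)) (pull (fun z => z + c) A) = pull (fun z => z + (c + (m - s, w))) A := by
    intro _; funext a b; simp only [pull]; rw [show ∀ z : V, z + (m - s, w) + c = z + (c + (m - s, w)) from fun z => by abel]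
    rw [show b + (m - s, w) + c = b + (c + (m - s, w)) by abel]
  have pp := pp A
  rw [pp] at b1 b2 b3 b4 b5
  obtain ⟨l, r, lr, hl, hr, hr1, hr2⟩ := abs_EW a1
  obtain ⟨r', l', lr', hr', hl', hl1, hl2⟩ := abs_EWn d2
  obtain ⟨x1, y1, p1, hx1, hy1, hy1', -⟩ := abs_EW b1
  obtain ⟨x2, y2, p2, hx2, hy2, -, hy2'⟩ := abs_EW b2
  obtain ⟨x3, y3, p3, hx3, hy3, -, hy3'⟩ := abs_EWn b3
  obtain ⟨x4, y4, p4, hx4, hy4, hy4', -⟩ := abs_EWn b4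
  obtain ⟨v, e, p5, hv, he⟩ := abs_TB b5
  obtain ⟨eu, pu, hu1, hu2⟩ := hu
  obtain ⟨eu', pu', hu1', hu2'⟩ := hu'
  have j1 := halfLink hs.1 hs.2 (c := c) (c' := c + (m - s, w)) (by simp) (by simp) hsm hm hg0 hg8 lr hl hr hr1 hr2
    p1 hx1 hy1 hy1' p2 hx2 hy2 hy2' p5 hv he
  have j2 := halfLink' hs.1 hs.2 (c := c + (2 * (m - s), 2 * w)) (c' := c + (m - s, w)) (by simp; ring) (by simp; ring) hsm hm hg0 hg8 lr' hl' hr' hl1 hl2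
    p3 hx3 hy3 hy3' p4 hx4 hy4 (by omega) p5 hv he
  have k1 := (joinBox hs.1 hs.2 lr hl hr pu hu1 hu2)
  have k2 := (joinBox hs.1 hs.2 (lr'.symm hs.1) hl' hr' pu' hu1' hu2')
  have i1 : ∀ z, z ∈ BoxC c m → z ∈ BoxC c m ∪ BoxC (c + (m - s, w)) s ∪ BoxC (c + (2 * (m - s), 2 * w)) m := fun z hz => Or.inl (Or.inl hz)
  have i2 : ∀ z, z ∈ BoxC (c + (2 * (m - s), 2 * w)) m → z ∈ BoxC c m ∪ BoxC (c + (m - s, w)) s ∪ BoxC (c + (2 * (m - s), 2 * w)) m := fun z hz => Or.inr hz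
  have q1 := (k1.symm hs.1).mono (fun _ _ h => h) i1
  have q2 := j1.mono (fun _ _ h => h) (Set.subset_union_left (t := BoxC (c + (2 * (m - s), 2 * w)) m))
  have q3 := (j2.symm hs.1).mono (T := BoxC c m ∪ BoxC (c + (m - s, w)) s ∪ BoxC (c + (2 * (m - s), 2 * w)) m) (fun _ _ h => h) (by
    rintro z (hz | hz)
    · exact Or.inr hz
    · exact Or.inl (Or.inr hz))
  have q4 := (lr'.trans k2).mono (fun _ _ h => h) i2
  exact q1.trans (q2.trans (q3.trans q4))

/-- strip -/
def Strip (m : ℤ) (D : V) : Set V := {z | m ^ 2 ≤ det D z ∧ det D z ≤ 17 * m ^ 2 ∧ nrm z ≤ 300 * m}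

def Tube (m : ℤ) (D : V) (A : Rel) : Prop := ∃ u v : V, u.1 ≤ -(79 * m) ∧ 79 * m ≤ v.1 ∧ Cn A (Strip m D) u v

def Block (m : ℤ) (D : V) (A : Rel) : Prop := ∀ j < 6, Tube m D (pull (rot^[j]) A)

def DOk (m : ℤ) (D : V) : Prop := m ≤ D.1 ∧ D.1 ≤ 2 * m ∧ |D.2| ≤ 3 * m

def frc (m : ℤ) (D : V) (i : ℕ) : V := ((i - 80 : ℤ) * D.1, (i - 80 : ℤ) * D.2 + 6 * m)

lemma tube_of_frames (hs : SymTri A) {m s w t t' g0 g8 : ℤ} (hs1 : 0 ≤ s) (hsm : 2 * s ≤ m) (hm : 1 ≤ m)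
    (hg0 : g0 + w ≤ t) (hg8 : t' ≤ g8 + w) (hD : DOk m (2 * (m - s), 2 * w))
    (h : ∀ i < 161, Frm m s (m - s, w) t t' g0 g8 (pull (fun z => z + frc m (2 * (m - s), 2 * w) i) A)) :
    Tube m (2 * (m - s), 2 * w) A := by
  set D : V := (2 * (m - s), 2 * w) with hDd
  have hD1 : D.1 = 2 * (m - s) := rfl
  have hD2 : D.2 = 2 * w := rfl
  have hfs : ∀ i, frc m D (i + 1) = frc m D i + D := by
    intro i; ext <;> simp [frc] <;> ring
  have hex : ∀ i < 161, ∃ u, BTc A (frc m D i) m u := fun i hi => abs_TB (h i hi).1.2.2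
  choose! u hu using hex
  obtain ⟨d1, d2, d3⟩ := hD
  have hSt : ∀ i < 161, ∀ z : V, (∃ k e : V, (2 * k = D ∨ k = 0) ∧ nrm e ≤ m ∧ z = frc m D i + k + e) → z ∈ Strip m D := by
    rintro i hi z ⟨k, e, hk, he, rfl⟩
    have hk' : det D k = 0 := by
      rcases hk with hk | hk
      · rw [← hk]; simp only [det, Prod.fst_mul, Prod.snd_mul]; simp; ring
      · rw [hk]; simp [det]
    have hdet : det D (frc m D i + k + e) = 6 * m * D.1 + det D e := by
      have : det D (frc m D i + k + e) = det D (frc m D i) + det D k + det D e := by simp only [det, Prod.fst_add, Prod.snd_add]; ring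
      rw [this, hk']; simp only [det, frc]; ring
    have he' : |e.1| ≤ m ∧ |e.2| ≤ m := by simp only [nrm] at he; rw [abs_le, abs_le]; omega
    have hde : |det D e| ≤ 5 * m ^ 2 := by
      have h1 : |D.1 * e.2| ≤ 2 * m * m := by
        rw [abs_mul]
        exact mul_le_mul (by rw [abs_le]; constructor <;> linarith) he'.2 (abs_nonneg _) (by linarith)
      have h2 : |D.2 * e.1| ≤ 3 * m * m := by
        rw [abs_mul]
        exact mul_le_mul d3 he'.1 (abs_nonneg _) (by linarith)
      have := abs_sub (D.1 * e.2) (D.2 * e.1)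
      simp only [det]; nlinarith
    rw [abs_le] at hde
    refine ⟨?_, ?_, ?_⟩
    · rw [hdet]; nlinarith
    · rw [hdet]; nlinarith
    · have hi' : -80 ≤ (i:ℤ) - 80 ∧ (i:ℤ) - 80 ≤ 80 := by omega
      rw [abs_le] at d3
      have f1 : |((i:ℤ) - 80) * D.1| ≤ 80 * (2 * m) := by
        rw [abs_mul]
        exact mul_le_mul (by rw [abs_le]; exact hi') (by rw [abs_le]; constructor <;> linarith) (abs_nonneg _) (by norm_num)
      have f2 : |((i:ℤ) - 80) * D.2| ≤ 80 * (3 * m) := by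
        rw [abs_mul]
        exact mul_le_mul (by rw [abs_le]; exact hi') (by rw [abs_le]; constructor <;> linarith) (abs_nonneg _) (by norm_num)
      rw [abs_le] at f1 f2
      have hk1 : -(2*m) ≤ k.1 ∧ k.1 ≤ 2 * m ∧ -(2*m) ≤ k.2 ∧ k.2 ≤ 2 * m := by
        rcases hk with hk | hk
        · have e1 : 2 * k.1 = D.1 := by rw [← hk]; rfl
          have e2 : 2 * k.2 = D.2 := by rw [← hk]; rfl
          omega
        · rw [hk]; simp; omega
      rw [abs_le, abs_le] at he'
      simp only [nrm, frc, Prod.fst_add, Prod.snd_add]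
      omega
  have chain : ∀ k, k < 161 → Cn A (Strip m D) (u 0) (u k) := by
    intro k
    induction k with
    | zero =>
      intro hk
      obtain ⟨e, he, -⟩ := hu 0 hk
      refine Cn.refl (hSt 0 hk _ ⟨0, u 0 - frc m D 0, Or.inr rfl, ?_, by simp⟩)
      exact he.left
    | succ k ih =>
      intro hk
      refine (ih (by omega)).trans ?_
      have h1 := h (k + 1) hk
      have h2 := hu (k + 1) hk
      rw [hfs k] at h1 h2
      refine (link hs hsm hm hg0 hg8 (h k (by omega)) h1 (hu k (by omega)) h2).mono (fun _ _ h => h) ?_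
      rintro z ((hz | hz) | hz)
      · exact hSt k (by omega) _ ⟨0, z - frc m D k, Or.inr rfl, hz, by simp⟩
      · refine hSt k (by omega) _ ⟨(m - s, w), z - (frc m D k + (m - s, w)), Or.inl ?_, le_trans hz (by omega), by abel⟩
        rw [hDd]; ext <;> simp
      · refine hSt (k + 1) hk _ ⟨0, z - (frc m D k + D), Or.inr rfl, hz, by rw [hfs]; simp⟩
  refine ⟨u 0, u 160, ?_, ?_, chain 160 (by norm_num)⟩
  · obtain ⟨e, he, -⟩ := hu 0 (by norm_num)
    have := he.left
    rw [mem_BoxC] at this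
    simp only [frc] at this
    push_cast at this
    omega
  · obtain ⟨e, he, -⟩ := hu 160 (by norm_num)
    have := he.left
    rw [mem_BoxC] at this
    simp only [frc] at this
    push_cast at this
    omega

end RSW
end DaC

namespace DaC
open Relation

section RSWprob

variable {μ : (Rel → Prop) → ℝ}

def BB : ℕ := 16384
def WW : ℕ := BB ^ 3
noncomputable def kap : ℝ := 1 / (2 * (WW : ℝ) + 4)

lemma WW_pos : 0 < WW := by unfold WW BB; norm_num
lemma kap_pos : 0 < kap := by unfold kap; positivity

lemma RLaw.congr (h : RLaw μ) {E F : Rel → Prop} (he : ∀ A, SymTri A → (E A ↔ F A)) : μ E = μ F :=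
  le_antisymm (h.mono _ _ fun A hA => (he A hA).1) (h.mono _ _ fun A hA => (he A hA).2)

lemma RLaw.nonneg (h : RLaw μ) (E : Rel → Prop) : 0 ≤ μ E := by
  rw [← h.fls]; exact h.mono _ _ (fun _ _ h => h.elim)

lemma RLaw.and (h : RLaw μ) {E F : Rel → Prop} {a b : ℝ} (ha : 0 ≤ a) (hb : 0 ≤ b) (hE : IncA E) (hF : IncA F) (h1 : a ≤ μ E) (h2 : b ≤ μ F) :
    a * b ≤ μ (fun A => E A ∧ F A) :=
  le_trans (mul_le_mul h1 h2 hb (le_trans ha h1)) (h.fkg E F hE hF)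

lemma RLaw.all (h : RLaw μ) {E : ℕ → Rel → Prop} {a : ℝ} (ha : 0 ≤ a) (hE : ∀ i, IncA (E i)) (h1 : ∀ i, a ≤ μ (E i)) (k : ℕ) :
    a ^ k ≤ μ (fun A => ∀ i < k, E i A) := by
  induction k with
  | zero => simp [h.tru]
  | succ k ih =>
    rw [pow_succ]
    refine le_trans (h.and (pow_nonneg ha k) ha (IncA.all k hE) (hE k) ih (h1 k)) (h.mono _ _ ?_)
    rintro A - ⟨h2, h3⟩ i hi
    rcases Nat.lt_succ_iff_lt_or_eq.1 hi with h | h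
    · exact h2 i h
    · rw [h]; exact h3

/-- thresholds -/
lemma thresholds (h : RLaw μ) (n : ℕ) : ∃ g0 g8 t t' : ℤ, -(n:ℤ) ≤ g0 ∧ g0 ≤ t ∧ t ≤ t' ∧ t' ≤ g8 ∧ g8 ≤ n ∧
    (WW : ℤ) * (t' - t) ≤ g8 - g0 ∧ kap ≤ μ (EW n t t') ∧ kap ≤ μ (EW n g8 n) ∧ kap ≤ μ (EW n (-n) g0) := by
  set q : ℤ → ℝ := fun t => μ (EW n t n) with hq
  have hWpos : (0:ℝ) < WW := by exact_mod_cast WW_pos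
  set lam : ℕ → ℝ := fun i => ((WW : ℝ) + 1 - i) / (2 * (WW : ℝ) + 4) with hlam
  have hq0 : 1 / 2 ≤ q (-n) := by
    refine le_trans (h.half n) (h.mono _ _ ?_)
    rintro A - ⟨u, hu, v, hv, huv⟩
    refine ⟨u, hu, v, ⟨hv, ?_⟩, huv⟩
    have := huv.right
    rw [mem_BoxC] at this
    simp at this; omega
  have hqn : ∀ t : ℤ, (n:ℤ) < t → q t = 0 := by
    intro t ht
    rw [← h.fls]
    refine h.congr (fun A _ => ⟨?_, False.elim⟩)
    rintro ⟨u, -, v, hv, -⟩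
    have := hv.2; omega
  have hlam0 : ∀ i, i ≤ WW → kap ≤ lam i := by
    intro i hi
    have : (i:ℝ) ≤ WW := by exact_mod_cast hi
    simp only [hlam, kap]
    gcongr; linarith
  have hlam1 : ∀ i, lam i ≤ 1 / 2 := by
    intro i
    simp only [hlam]
    rw [div_le_div_iff₀ (by positivity) (by norm_num)]
    have : (0:ℝ) ≤ i := by positivity
    linarith
  have hT : ∀ i, i ≤ WW → ∃ t : ℤ, lam i ≤ q t ∧ -(n:ℤ) ≤ t ∧ t ≤ n ∧ ∀ t', lam i ≤ q t' → t' ≤ t := by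
    intro i hi
    have bd : ∀ t, lam i ≤ q t → t ≤ n := by
      intro t ht
      by_contra hc
      push Not at hc
      rw [hqn t hc] at ht
      linarith [hlam0 i hi, kap_pos]
    obtain ⟨t, ht1, ht2⟩ := Int.exists_greatest_of_bdd (P := fun t => lam i ≤ q t) ⟨n, bd⟩ ⟨-n, le_trans (hlam1 i) hq0⟩
    exact ⟨t, ht1, ht2 _ (le_trans (hlam1 i) hq0), bd _ ht1, ht2⟩
  choose! T hT1 hT2 hT3 hT4 using hT
  have hTm : ∀ i, i < WW → T i ≤ T (i + 1) := by
    intro i hi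
    apply hT4 (i + 1) (by omega)
    refine le_trans ?_ (hT1 i (by omega))
    simp only [hlam]; push_cast
    gcongr; linarith
  have hsum : ∀ k, k ≤ WW → T k - T 0 = ∑ i ∈ Finset.range k, (T (i + 1) - T i) := by
    intro k _; rw [Finset.sum_range_sub]
  obtain ⟨i, hi, hiw⟩ : ∃ i, i < WW ∧ (WW : ℤ) * (T (i + 1) - T i) ≤ T WW - T 0 := by
    by_contra hc
    push Not at hc
    have h1 : ∑ i ∈ Finset.range WW, (T WW - T 0) < ∑ i ∈ Finset.range WW, (WW : ℤ) * (T (i + 1) - T i) := by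
      apply Finset.sum_lt_sum_of_nonempty
      · rw [Finset.nonempty_range_iff]; exact WW_pos.ne'
      · intro i hi; exact hc i (Finset.mem_range.1 hi)
    rw [← Finset.mul_sum, ← hsum WW le_rfl] at h1
    simp only [Finset.sum_const, Finset.card_range, nsmul_eq_mul] at h1
    exact lt_irrefl _ h1
  have mono0 : ∀ i, i ≤ WW → T 0 ≤ T i := by
    intro i
    induction i with
    | zero => intro _; rfl
    | succ i ih => intro hi; exact le_trans (ih (by omega)) (hTm i (by omega))
  have mono1 : ∀ k, k ≤ WW → T (WW - k) ≤ T WW := by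
    intro k
    induction k with
    | zero => intro _; rfl
    | succ k ih =>
      intro hi
      refine le_trans ?_ (ih (by omega))
      have := hTm (WW - (k + 1)) (by omega)
      rwa [show WW - (k + 1) + 1 = WW - k by omega] at this
  have hqlt : ∀ i, i ≤ WW → q (T i + 1) < lam i := by
    intro i hi
    by_contra hc
    push Not at hc
    have := hT4 i hi _ hc
    omega
  refine ⟨T 0, T WW, T i, T (i + 1), hT2 0 (by omega), mono0 i hi.le, hTm i hi, ?_, hT3 WW le_rfl, hiw, ?_, ?_, ?_⟩
  · have := mono1 (WW - (i + 1)) (by omega)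
    rwa [show WW - (WW - (i + 1)) = i + 1 by omega] at this
  · have h1 : q (T i) ≤ μ (EW n (T i) (T (i + 1))) + q (T (i + 1) + 1) := by
      refine le_trans (h.mono _ _ ?_) (h.or_le _ _)
      rintro A - ⟨u, hu, v, hv, huv⟩
      by_cases hc : v.2 ≤ T (i + 1)
      · exact Or.inl ⟨u, hu, v, ⟨hv.1, hv.2.1, hc⟩, huv⟩
      · exact Or.inr ⟨u, hu, v, ⟨hv.1, by omega, hv.2.2⟩, huv⟩
    have h2 := hT1 i hi.le
    have h3 := hqlt (i + 1) hi
    have h4 : lam i - lam (i + 1) = kap := by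
      simp only [hlam, kap]; push_cast; field_simp; ring
    linarith
  · exact le_trans (hlam0 WW le_rfl) (hT1 WW le_rfl)
  · have h1 : q (-n) ≤ μ (EW n (-n) (T 0)) + q (T 0 + 1) := by
      refine le_trans (h.mono _ _ ?_) (h.or_le _ _)
      rintro A - ⟨u, hu, v, hv, huv⟩
      by_cases hc : v.2 ≤ T 0
      · exact Or.inl ⟨u, hu, v, ⟨hv.1, hv.2.1, hc⟩, huv⟩
      · exact Or.inr ⟨u, hu, v, ⟨hv.1, by omega, hv.2.2⟩, huv⟩
    have h3 := hqlt 0 (by omega)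
    have h4 : 1 / 2 - lam 0 = kap := by
      simp only [hlam, kap]; push_cast; field_simp; ring
    linarith

lemma kap_half : kap ≤ 1 / 2 := by
  unfold kap
  have : (0:ℝ) ≤ WW := by positivity
  rw [div_le_div_iff₀ (by positivity) (by norm_num)]; linarith

lemma TB_ge (h : RLaw μ) (n : ℕ) : kap ≤ μ (TB n) := by
  refine le_trans kap_half (le_trans (h.half n) ?_)
  rw [← h.swap (TB n)]
  apply h.mono
  rintro A - ⟨u, hu, v, hv, huv⟩
  refine ⟨u.swap, by simpa using hu, v.swap, by simpa using hv, huv.map Prod.swap (fun a b _ _ hab => by simpa [pull] using hab) ?_⟩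
  intro z hz
  rw [mem_BoxC] at *; simp at *; omega

lemma Frm_ge (h : RLaw μ) {m s : ℕ} {t t' g0 g8 : ℤ} (c' : V) (h1 : kap ≤ μ (EW m t t')) (h2 : kap ≤ μ (EW s g8 s))
    (h3 : kap ≤ μ (EW s (-s) g0)) : kap ^ 8 ≤ μ (Frm m s c' t t' g0 g8) ∧ IncA (Frm m s c' t t' g0 g8) := by
  have hk := kap_pos.le
  have iE : ∀ m t t', IncA (EW m t t') := fun m t t' => IncA_Cr _ _ _
  have iT : ∀ m, IncA (TB m) := fun m => IncA_Cr _ _ _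
  have n1 := h1
  rw [← h.neg] at n1
  have a2 := h2
  rw [← h.trans c'] at a2
  have a3 := h3
  rw [← h.trans c'] at a3
  have n2 := h2
  rw [← h.neg, ← h.trans c'] at n2
  have n3 := h3
  rw [← h.neg, ← h.trans c'] at n3
  have b1 := TB_ge h m
  have b2 := TB_ge h s
  rw [← h.trans c'] at b2
  have i1 := ((iE m t t').and (((iE m t t').pull (fun z => -z)).and (iT m)))
  have p1 := h.and hk (by positivity) (iE m t t') (((iE m t t').pull (fun z => -z)).and (iT m)) h1 (h.and hk hk ((iE m t t').pull (fun z => -z)) (iT m) n1 b1)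
  have j5 := (iT s).pull (fun z => z + c')
  have j4 := ((iE s (-s) g0).pull (fun z => -z)).pull (fun z => z + c')
  have j3 := ((iE s g8 s).pull (fun z => -z)).pull (fun z => z + c')
  have j2 := (iE s (-s) g0).pull (fun z => z + c')
  have j1 := (iE s g8 s).pull (fun z => z + c')
  have p5 := h.and hk hk j4 j5 n3 b2
  have p4 := h.and hk (by positivity) j3 (j4.and j5) n2 p5
  have p3 := h.and hk (by positivity) j2 (j3.and (j4.and j5)) a3 p4
  have p2 := h.and hk (by positivity) j1 (j2.and (j3.and (j4.and j5))) a2 p3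
  have i2 := j1.and (j2.and (j3.and (j4.and j5)))
  have pf := h.and (by positivity) (by positivity) i1 i2 p1 p2
  refine ⟨?_, i1.and i2⟩
  refine le_trans (le_of_eq ?_) pf
  ring

noncomputable def kap0 : ℝ := ((kap ^ 8) ^ 161) ^ 6

lemma kap0_pos : 0 < kap0 := by unfold kap0; have := kap_pos; positivity

lemma SymTri.pull_rot {A : Rel} (h : SymTri A) (j : ℕ) : SymTri (pull (rot^[j]) A) := by
  refine ⟨fun a b hab => h.1 _ _ hab, fun a b hab => ?_⟩
  have := rot_iter_adj (5 * j) (h.2 _ _ hab)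
  rw [← Function.iterate_add_apply, ← Function.iterate_add_apply, show 5 * j + j = 6 * j by ring, Function.iterate_mul] at this
  have e : rot^[6] = id := funext rot6
  rwa [e, Function.iterate_id] at this

lemma RLaw.rot_iter (h : RLaw μ) (j : ℕ) (E : Rel → Prop) : μ (fun A => E (pull (DaC.rot^[j]) A)) = μ E := by
  induction j generalizing E with
  | zero => rfl
  | succ j ih =>
    rw [← h.rot E, ← ih (fun A => E (pull DaC.rot A))]
    rfl

lemma block_ge (h : RLaw μ) {m s : ℕ} {t t' g0 g8 w : ℤ} (hs1 : 1 ≤ s) (hsm : 2 * s ≤ m)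
    (hg0 : g0 + w ≤ t) (hg8 : t' ≤ g8 + w) (hw : |2 * w| ≤ 3 * m)
    (h1 : kap ≤ μ (EW m t t')) (h2 : kap ≤ μ (EW s g8 s))
    (h3 : kap ≤ μ (EW s (-s) g0)) : ∃ D : V, DOk m D ∧ kap0 ≤ μ (Block m D) := by
  have hD : DOk m (2 * ((m:ℤ) - s), 2 * w) := ⟨by simp; omega, by simp, hw⟩
  refine ⟨_, hD, ?_⟩
  have hk := kap_pos
  obtain ⟨p, i⟩ := Frm_ge h (m := m) (s := s) ((m:ℤ) - s, w) h1 h2 h3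
  have q := h.all (E := fun k A => Frm m s ((m:ℤ) - s, w) t t' g0 g8 (pull (fun z => z + frc m (2 * ((m:ℤ) - s), 2 * w) k) A))
    (a := kap ^ 8) (by positivity) (fun k => i.pull _) (fun k => by rw [h.trans]; exact p) 161
  have q' : (kap ^ 8) ^ 161 ≤ μ (Tube m (2 * ((m:ℤ) - s), 2 * w)) := by
    refine le_trans q (h.mono _ _ ?_)
    intro A hA hE
    exact tube_of_frames hA (by omega) (by omega) (by omega) hg0 hg8 hD hE
  have iT : IncA (Tube m (2 * ((m:ℤ) - s), 2 * w)) := by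
    rintro A B hAB ⟨u, v, hu, hv, huv⟩
    exact ⟨u, v, hu, hv, huv.mono hAB (le_refl _)⟩
  exact h.all (E := fun j A => Tube m (2 * ((m:ℤ) - s), 2 * w) (pull (rot^[j]) A)) (by positivity) (fun j => iT.pull _)
    (fun j => by rw [h.rot_iter]; exact q') 6

theorem rsw (h : RLaw μ) (I : ℕ) : ∃ F : Finset ℕ, F ⊆ Finset.Icc 1 I ∧ 2 * I ≤ 3 * F.card + 9 ∧
    ∀ i ∈ F, ∃ D : V, DOk (BB ^ i : ℕ) D ∧ kap0 ≤ μ (Block (BB ^ i : ℕ) D) := by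
  classical
  have ht := fun i : ℕ => thresholds h (BB ^ i)
  choose g0 g8 t t' a1 a2 a3 a4 a5 a6 a7 a8 a9 using ht
  let bad : ℕ → Prop := fun i => ∀ j < i, (WW : ℤ) * (g8 j - g0 j) < g8 i - g0 i
  have hB : BB = 16384 := rfl
  refine ⟨(Finset.Icc 1 I).filter (fun i => ¬ bad i), Finset.filter_subset _ _, ?_, ?_⟩
  · have hcard := Finset.card_filter_add_card_filter_not (s := Finset.Icc 1 I) bad
    rw [Nat.card_Icc] at hcard
    have key : ∀ k, ((Finset.Icc 1 k).filter bad).card = 0 ∨ ∃ j ≤ k, (WW:ℤ) ^ (((Finset.Icc 1 k).filter bad).card - 1) ≤ g8 j - g0 j := by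
      intro k
      induction k with
      | zero => left; simp
      | succ k ih =>
        have hIcc : Finset.Icc 1 (k + 1) = insert (k + 1) (Finset.Icc 1 k) := by
          ext x; simp only [Finset.mem_Icc, Finset.mem_insert]; omega
        by_cases hb : bad (k + 1)
        · right
          refine ⟨k + 1, le_rfl, ?_⟩
          rw [hIcc, Finset.filter_insert, if_pos hb, Finset.card_insert_of_notMem (by simp), Nat.add_sub_cancel]
          rcases ih with ih | ⟨j, hj, ih⟩
          · rw [ih, pow_zero]
            have := hb 0 (by omega)
            have h0 : 0 ≤ g8 0 - g0 0 := by linarith [a2 0, a3 0, a4 0]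
            have : (0:ℤ) ≤ (WW:ℤ) * (g8 0 - g0 0) := by positivity
            omega
          · have := hb j (by omega)
            set c := ((Finset.Icc 1 k).filter bad).card
            rcases Nat.eq_zero_or_pos c with hc | hc
            · rw [hc, pow_zero]
              have h0 : 0 ≤ g8 j - g0 j := by linarith [a2 j, a3 j, a4 j]
              have : (0:ℤ) ≤ (WW:ℤ) * (g8 j - g0 j) := by positivity
              omega
            · calc (WW:ℤ) ^ c = WW * WW ^ (c - 1) := by rw [← pow_succ', Nat.sub_add_cancel hc]
                _ ≤ WW * (g8 j - g0 j) := by gcongr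
                _ ≤ _ := this.le
        · rw [hIcc, Finset.filter_insert, if_neg hb]
          rcases ih with ih | ⟨j, hj, ih⟩
          · exact Or.inl ih
          · exact Or.inr ⟨j, by omega, ih⟩
    set c := ((Finset.Icc 1 I).filter bad).card
    have hc : 3 * (c - 1) ≤ I := by
      rcases key I with h0 | ⟨j, hj, h0⟩
      · omega
      · have e1 : g8 j - g0 j ≤ 2 * (BB ^ j : ℕ) := by linarith [a1 j, a5 j]
        have e2 : (WW ^ (c - 1) : ℕ) ≤ 2 * BB ^ j := by
          have : ((WW ^ (c - 1) : ℕ) : ℤ) ≤ ((2 * BB ^ j : ℕ) : ℤ) := by push_cast at *; linarith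
          exact_mod_cast this
        have e3 : BB ^ (3 * (c - 1)) < BB ^ (I + 1) := by
          calc BB ^ (3 * (c - 1)) = WW ^ (c - 1) := by rw [WW, ← pow_mul]
            _ ≤ 2 * BB ^ j := e2
            _ ≤ 2 * BB ^ I := by gcongr; rw [hB]; norm_num
            _ < BB ^ (I + 1) := by
              rw [pow_succ]
              have : 0 < BB ^ I := by rw [hB]; positivity
              rw [mul_comm]
              exact Nat.mul_lt_mul_of_pos_left (by rw [hB]; norm_num) this
        have := (Nat.pow_lt_pow_iff_right (by rw [hB]; norm_num)).1 e3
        omega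
    omega
  · intro i hi
    rw [Finset.mem_filter, Finset.mem_Icc] at hi
    obtain ⟨hi1, hi2⟩ := hi
    simp only [bad] at hi2
    push Not at hi2
    obtain ⟨j, hj, hw⟩ := hi2
    have hwpos : (0:ℤ) < WW := by exact_mod_cast WW_pos
    have hd : t' i - t i ≤ g8 j - g0 j := by
      have := le_trans (a6 i) hw
      exact le_of_mul_le_mul_left this hwpos
    have hsm : 2 * BB ^ j ≤ BB ^ i := by
      calc 2 * BB ^ j ≤ BB * BB ^ j := by gcongr; rw [hB]; norm_num
        _ = BB ^ (j + 1) := by rw [pow_succ']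
        _ ≤ BB ^ i := Nat.pow_le_pow_right (by rw [hB]; norm_num) hj
    have hs1 : 1 ≤ BB ^ j := Nat.one_le_pow _ _ (by rw [hB]; norm_num)
    refine block_ge h (m := BB ^ i) (s := BB ^ j) (w := t i - g0 j) hs1 hsm (by linarith) (by linarith) ?_ (a7 i) (a8 j) (a9 j)
    have := a1 i; have := a2 i; have := a3 i; have := a4 i; have := a5 i
    have := a1 j; have := a2 j; have := a3 j; have := a4 j; have := a5 j
    rw [abs_le]; constructor <;> omega

end RSWprob
end DaC

namespace DaC
open Relation

section Torus
open Classical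

abbrev VN (N : ℕ) := ZMod N × ZMod N

variable {N : ℕ}

def pr (N : ℕ) (z : V) : VN N := ((z.1 : ZMod N), (z.2 : ZMod N))

lemma pr_add (a b : V) : pr N (a + b) = pr N a + pr N b := by ext <;> simp [pr]
lemma pr_neg (a : V) : pr N (-a) = - pr N a := by ext <;> simp [pr]
lemma pr_sub (a b : V) : pr N (a - b) = pr N a - pr N b := by ext <;> simp [pr]

lemma pr_eq_iff (a b : V) : pr N a = pr N b ↔ (N : ℤ) ∣ b.1 - a.1 ∧ (N : ℤ) ∣ b.2 - a.2 := by
  simp only [pr, Prod.ext_iff, ZMod.intCast_eq_intCast_iff_dvd_sub]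

/-- maps of the plane compatible with the torus -/
def TSym (N : ℕ) (g : V → V) : Prop :=
  ∃ e : VN N ≃ VN N, (∀ z, pr N (g z) = e (pr N z)) ∧ ∀ a b, TriAdj (g a) (g b) ↔ TriAdj a b

lemma tsym_add (c : V) : TSym N (fun z => z + c) :=
  ⟨Equiv.addRight (pr N c), fun z => by simp [pr_add], fun a b => by simp only [triAdj_iff, Prod.fst_add, Prod.snd_add]; constructor <;> intro h <;> omega⟩

lemma tsym_neg : TSym N (fun z => -z) :=
  ⟨Equiv.neg _, fun z => by simp [pr_neg], fun a b => by simp only [triAdj_iff, Prod.fst_neg, Prod.snd_neg]; constructor <;> intro h <;> omega⟩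

lemma tsym_swap : TSym N Prod.swap :=
  ⟨Equiv.prodComm _ _, fun z => by simp [pr], fun a b => by simp only [triAdj_iff, Prod.fst_swap, Prod.snd_swap]; constructor <;> intro h <;> omega⟩

lemma tsym_rot : TSym N rot := by
  refine ⟨⟨fun z => (z.1 - z.2, z.1), fun z => (z.2, z.2 - z.1), fun z => by simp, fun z => by simp⟩, fun z => ?_, fun a b => ?_⟩
  · simp [pr, rot]
  · simp only [triAdj_iff, rot]; constructor <;> intro h <;> omega

/-- bond percolation relation on the plane, periodic -/
def BA (ω : Sym2 (VN N) → Bool) : Rel := fun u v => TriAdj u v ∧ ω s(pr N u, pr N v) = true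

lemma BA_symTri (ω : Sym2 (VN N) → Bool) : SymTri (BA ω) :=
  ⟨fun a b h => ⟨h.1.symm, by rw [Sym2.eq_swap]; exact h.2⟩, fun a b h => h.1⟩

def s2 (e : VN N ≃ VN N) : Sym2 (VN N) ≃ Sym2 (VN N) where
  toFun := Sym2.map e
  invFun := Sym2.map e.symm
  left_inv := fun z => by rw [Sym2.map_map]; simp
  right_inv := fun z => by rw [Sym2.map_map]; simp

lemma pull_BA {g : V → V} {e : VN N ≃ VN N} (h1 : ∀ z, pr N (g z) = e (pr N z)) (h2 : ∀ a b, TriAdj (g a) (g b) ↔ TriAdj a b)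
    (ω : Sym2 (VN N) → Bool) : pull g (BA ω) = BA (ω ∘ s2 e) := by
  funext a b
  simp only [pull, BA, h1, h2, s2, Function.comp_apply, Equiv.coe_fn_mk, Sym2.map_mk]

variable [NeZero N]

/-- law of bond percolation -/
noncomputable def bμ (N : ℕ) [NeZero N] (p : ℝ) (E : Rel → Prop) : ℝ := Pr (fun _ : Sym2 (VN N) => p) (fun ω => E (BA ω))

lemma bμ_sym {g : V → V} (hg : TSym N g) (p : ℝ) (E : Rel → Prop) : bμ N p (fun A => E (pull g A)) = bμ N p E := by
  obtain ⟨e, h1, h2⟩ := hg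
  unfold bμ
  rw [← Pr_perm (s2 e) (fun _ => rfl) (fun ω => E (BA ω))]
  apply Pr_congr
  intro ω
  show E (pull g (BA ω)) ↔ _
  rw [pull_BA h1 h2]

lemma BA_mono {ω ω' : Sym2 (VN N) → Bool} (h : ω ≤ ω') : ∀ a b, BA ω a b → BA ω' a b := by
  intro a b hab
  exact ⟨hab.1, h _ hab.2⟩

lemma isP_const {ι : Type*} {p : ℝ} (h0 : 0 ≤ p) (h1 : p ≤ 1) : IsP (fun _ : ι => p) := fun _ => ⟨h0, h1⟩

lemma bμ_law {p : ℝ} (h0 : 0 ≤ p) (h1 : p ≤ 1) (hh : ∀ n : ℕ, 1 / 2 ≤ bμ N p (Cr (BoxC 0 n) {z | z.1 = -n} {z | z.1 = n})) :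
    RLaw (bμ N p) where
  mono E F h := Pr_mono (isP_const h0 h1) fun ω => h _ (BA_symTri ω)
  or_le E F := Pr_or_le (isP_const h0 h1) _ _
  fls := by simp [bμ, Pr, ind, Ex_const]
  tru := by simp [bμ, Pr, ind, Ex_const]
  fkg E F hE hF := Pr_harris (isP_const h0 h1) (fun ω ω' h => hE _ _ (BA_mono h)) (fun ω ω' h => hF _ _ (BA_mono h))
  trans c E := bμ_sym (tsym_add c) p E
  neg E := bμ_sym tsym_neg p E
  swap E := bμ_sym tsym_swap p E
  rot E := bμ_sym tsym_rot p E
  half := hh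

end Torus

section Marginal
open Classical

lemma Ex_marg {ι κ : Type*} [Fintype ι] [Fintype κ] (q : ι → ℝ) (j : κ → ι) (hj : Function.Injective j) (f : (κ → Bool) → ℝ) :
    Ex q (fun ω => f (ω ∘ j)) = Ex (q ∘ j) f := by
  have key : ∀ y : κ → Bool, ∑ ω : ι → Bool, Wt q ω * (if ω ∘ j = y then 1 else 0) = Wt (q ∘ j) y := by
    intro y
    have e1 : ∀ ω : ι → Bool, Wt q ω * (if ω ∘ j = y then 1 else 0) =
        ∏ i, ((if ω i then q i else 1 - q i) * (if ∀ k, j k = i → ω i = y k then 1 else 0)) := by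
      intro ω
      rw [Finset.prod_mul_distrib, Wt]
      congr 1
      rw [Finset.prod_boole]
      congr 1
      simp only [Finset.mem_univ, true_implies, eq_iff_iff, funext_iff, Function.comp_apply]
      constructor
      · rintro h i k rfl; exact h k
      · intro h k; exact h (j k) k rfl
    rw [Finset.sum_congr rfl (fun ω _ => e1 ω)]
    have := Fintype.prod_sum (fun (i : ι) (b : Bool) => ((if b then q i else 1 - q i) * (if ∀ k, j k = i → b = y k then 1 else 0) : ℝ))
    rw [← this]
    rw [← Finset.prod_subset (Finset.subset_univ (Finset.univ.image j))]
    · rw [Finset.prod_image (fun a _ b _ h => hj h), Wt]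
      refine Finset.prod_congr rfl fun k _ => ?_
      have : ∀ b : Bool, (∀ k', j k' = j k → b = y k') ↔ b = y k := by
        intro b
        constructor
        · intro h; exact h k rfl
        · rintro h k' hk; rw [hj hk]; exact h
      simp only [this, Fintype.sum_bool, Function.comp_apply]
      cases y k <;> simp
    · intro i _ hi
      have : ∀ b : Bool, (∀ k', j k' = i → b = y k') ↔ True := by
        intro b
        simp only [iff_true]
        intro k hk; exfalso; apply hi; simp [← hk]
      simp only [this, Fintype.sum_bool]; simp
  have : ∀ ω : ι → Bool, f (ω ∘ j) = ∑ y, (if ω ∘ j = y then 1 else 0) * f y := by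
    intro ω; simp
  simp only [Ex]
  simp only [this, Finset.mul_sum]
  rw [Finset.sum_comm]
  refine Finset.sum_congr rfl fun y _ => ?_
  rw [← key y, Finset.sum_mul]
  refine Finset.sum_congr rfl fun ω _ => by ring

lemma Pr_marg {ι κ : Type*} [Fintype ι] [Fintype κ] (q : ι → ℝ) (j : κ → ι) (hj : Function.Injective j) (E : (κ → Bool) → Prop) :
    Pr q (fun ω => E (ω ∘ j)) = Pr (q ∘ j) E := Ex_marg q j hj (fun ω => ind (E ω))

lemma block_law {κ β γ : Type*} [Fintype κ] [Fintype β] [Fintype γ] (w : β → ℝ) (φ φ' : β → γ)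
    (h : ∀ g : γ → ℝ, ∑ b, w b * g (φ b) = ∑ b, w b * g (φ' b)) (G : (κ → γ) → ℝ) :
    ∑ x : κ → β, (∏ k, w (x k)) * G (fun k => φ (x k)) = ∑ x : κ → β, (∏ k, w (x k)) * G (fun k => φ' (x k)) := by
  have aux : ∀ φ : β → γ, ∑ x : κ → β, (∏ k, w (x k)) * G (fun k => φ (x k)) =
      ∑ c : κ → γ, G c * ∏ k, ∑ b, w b * (if φ b = c k then 1 else 0) := by
    intro φ
    have e : ∀ x : κ → β, (∏ k, w (x k)) * G (fun k => φ (x k)) = ∑ c : κ → γ, G c * ∏ k, (w (x k) * (if φ (x k) = c k then 1 else 0)) := by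
      intro x
      rw [Finset.sum_eq_single (fun k => φ (x k))]
      · simp [mul_comm]
      · intro c _ hc
        have : ∃ k, φ (x k) ≠ c k := by
          by_contra hcon; push Not at hcon; exact hc (funext fun k => (hcon k).symm)
        obtain ⟨k, hk⟩ := this
        rw [Finset.prod_eq_zero (Finset.mem_univ k) (by simp [hk]), mul_zero]
      · simp
    rw [Finset.sum_congr rfl (fun x _ => e x), Finset.sum_comm]
    refine Finset.sum_congr rfl fun c _ => ?_
    rw [← Finset.mul_sum, Fintype.prod_sum (fun k b => w b * (if φ b = c k then (1:ℝ) else 0))]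
  rw [aux, aux]
  refine Finset.sum_congr rfl fun c _ => ?_
  congr 1
  refine Finset.prod_congr rfl fun k _ => ?_
  exact h (fun y => if y = c k then 1 else 0)

end Marginal
end DaC

namespace DaC
open Relation

section StarTri
open Classical

abbrev Tr := Fin 3 → Fin 3 → Bool

/-- vertices of the up triangle at `v` -/
def vo : Fin 3 → V := ![(0, 0), (1, 0), (1, 1)]
def vt (v : V) (k : Fin 3) : V := v + vo k
/-- dual vertices around the up triangle at `v` -/
def dl (v : V) (k : Fin 3) : V := -vt (-v - (1, 0)) k

def ph (x : Fin 3 → Bool) : Tr := fun k l => decide (k ≠ l) && (x (-(k + l)) || (x k && x l))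
def ph' (x : Fin 3 → Bool) : Tr := fun k l => decide (k ≠ l) && (!x k && !x l)

lemma univ8 : (Finset.univ : Finset (Fin 3 → Bool)) = {![true, true, true], ![true, true, false], ![true, false, true], ![false, true, true],
    ![true, false, false], ![false, true, false], ![false, false, true], ![false, false, false]} := by decide

lemma star_block {p : ℝ} (hp : 1 - 3 * p + p ^ 3 = 0) (g : Tr → ℝ) :
    ∑ b : Fin 3 → Bool, (∏ k, if b k then p else 1 - p) * g (ph b) = ∑ b : Fin 3 → Bool, (∏ k, if b k then p else 1 - p) * g (ph' b) := by
  have a1 : ph ![true, true, false] = ph ![true, true, true] := by decide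
  have a2 : ph ![true, false, true] = ph ![true, true, true] := by decide
  have a3 : ph ![false, true, true] = ph ![true, true, true] := by decide
  have b1 : ph' ![true, true, false] = ph' ![true, true, true] := by decide
  have b2 : ph' ![true, false, true] = ph' ![true, true, true] := by decide
  have b3 : ph' ![false, true, true] = ph' ![true, true, true] := by decide
  have c0 : ph' ![false, false, false] = ph ![true, true, true] := by decide
  have c1 : ph' ![true, false, false] = ph ![true, false, false] := by decide
  have c2 : ph' ![false, true, false] = ph ![false, true, false] := by decide
  have c3 : ph' ![false, false, true] = ph ![false, false, true] := by decide
  have c4 : ph' ![true, true, true] = ph ![false, false, false] := by decide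
  rw [univ8]
  iterate 7 rw [Finset.sum_insert (by decide), Finset.sum_insert (by decide)]
  simp only [Finset.sum_singleton, Fin.prod_univ_three]
  rw [a1, a2, a3, b1, b2, b3, c0, c1, c2, c3, c4]
  simp
  linear_combination (-(g (ph ![true, true, true])) + g (ph ![false, false, false])) * hp

variable {N : ℕ}

def voN (N : ℕ) (k : Fin 3) : VN N := pr N (vo k)

/-- edge of the up triangle at `v` opposite to `k` -/
def jE (x : VN N × Fin 3) : Sym2 (VN N) := s(x.1 + voN N (x.2 + 1), x.1 + voN N (x.2 + 2))

lemma jE_inj (hN : 3 ≤ N) : Function.Injective (jE (N := N)) := by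
  have h1 : (1 : ZMod N) ≠ 0 := by
    intro h
    have := (ZMod.natCast_eq_zero_iff 1 N).1 (by exact_mod_cast h)
    have := Nat.le_of_dvd (by norm_num) this; omega
  have h2 : (1 : ZMod N) + 1 ≠ 0 := by
    intro h
    have := (ZMod.natCast_eq_zero_iff 2 N).1 (by push_cast; rw [← h]; norm_num)
    have := Nat.le_of_dvd (by norm_num) this; omega
  have h3 : ∀ a : ZMod N, a + 1 ≠ a := fun a h => h1 (by simpa using h)
  have h4 : ∀ a : ZMod N, a ≠ a + 1 := fun a h => h1 (by simpa using h)
  rintro ⟨⟨a, b⟩, k⟩ ⟨⟨a', b'⟩, k'⟩ h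
  simp only [jE, Sym2.eq_iff] at h
  fin_cases k <;> fin_cases k' <;> simp [voN, vo, pr, Prod.ext_iff] at h ⊢ <;> first | grind | skip
  all_goals (rcases h with ⟨⟨r1, r2⟩, r3, r4⟩ | ⟨⟨r1, r2⟩, r3, r4⟩ <;> subst r2 <;> first | exact absurd r4 (h3 _) | exact absurd r4 (h4 _) | (subst r3; first | exact absurd r1 (h3 _) | exact absurd r1 (h4 _)))

variable [NeZero N]

def xb (ω : Sym2 (VN N) → Bool) (v : VN N) (k : Fin 3) : Bool := ω (jE (v, k))

lemma xb_law (hN : 3 ≤ N) (p : ℝ) (f : (VN N → Fin 3 → Bool) → ℝ) :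
    Ex (fun _ : Sym2 (VN N) => p) (fun ω => f (xb ω)) = ∑ x : VN N → Fin 3 → Bool, (∏ v, ∏ k, if x v k then p else 1 - p) * f x := by
  have := Ex_marg (fun _ : Sym2 (VN N) => p) jE (jE_inj hN) (fun y => f (fun v k => y (v, k)))
  refine Eq.trans this ?_
  rw [Ex]
  have := Fintype.sum_equiv (Equiv.curry (VN N) (Fin 3) Bool) (fun y => Wt ((fun _ => p) ∘ jE) y * f (fun v k => y (v, k)))
    (fun x : VN N → Fin 3 → Bool => (∏ v, ∏ k, if x v k then p else 1 - p) * f x) fun y => by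
      rw [Wt, Fintype.prod_prod_type]
      rfl
  convert this

lemma star_tri (hN : 3 ≤ N) {p : ℝ} (hp : 1 - 3 * p + p ^ 3 = 0) (G : (VN N → Tr) → Prop) :
    Pr (fun _ : Sym2 (VN N) => p) (fun ω => G (fun v => ph' (xb ω (-v - pr N (1, 0))))) =
    Pr (fun _ : Sym2 (VN N) => p) (fun ω => G (fun v => ph (xb ω v))) := by
  unfold Pr
  rw [xb_law hN p (fun x => ind (G (fun v => ph' (x (-v - pr N (1, 0)))))), xb_law hN p (fun x => ind (G (fun v => ph (x v))))]
  let s : VN N ≃ VN N := ⟨fun v => -v - pr N (1, 0), fun v => -v - pr N (1, 0), fun v => by simp, fun v => by simp⟩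
  have e1 : ∑ x : VN N → Fin 3 → Bool, (∏ v, ∏ k, if x v k then p else 1 - p) * ind (G (fun v => ph' (x (-v - pr N (1, 0))))) =
      ∑ x : VN N → Fin 3 → Bool, (∏ v, ∏ k, if x v k then p else 1 - p) * ind (G (fun v => ph' (x v))) := by
    refine Fintype.sum_equiv (Equiv.arrowCongr s.symm (Equiv.refl _)) _ _ fun x => ?_
    congr 1
    exact (Equiv.prod_comp s (fun v => ∏ k, if x v k then p else 1 - p)).symm
  rw [e1]
  convert (block_law (fun b : Fin 3 → Bool => ∏ k, if b k then p else 1 - p) ph ph' (star_block hp) (fun c => ind (G c))).symm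

/-- relation on the plane built from triangle data -/
def RelT (T : VN N → Tr) (X : Set V) : Rel := fun a b => ∃ v ∈ X, ∃ k l, T (pr N v) k l = true ∧ a = vt v k ∧ b = vt v l

/-- dual connections -/
def Ast (ω : Sym2 (VN N) → Bool) (X : Set V) : Rel := fun a b => ∃ v ∈ X, ∃ k l, ph' (xb ω (pr N v)) k l = true ∧ a = dl v k ∧ b = dl v l

lemma Ast_eq (ω : Sym2 (VN N) → Bool) (X : Set V) :
    Ast ω X = pull (fun z => -z) (RelT (fun v => ph' (xb ω (-v - pr N (1, 0)))) {v | -v - (1, 0) ∈ X}) := by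
  funext a b
  simp only [Ast, pull, RelT, dl, eq_iff_iff]
  have e : ∀ v : V, -(-v - (1, 0)) - ((1, 0) : V) = v := fun v => by abel
  constructor
  · rintro ⟨v, hv, k, l, h, rfl, rfl⟩
    refine ⟨-v - (1, 0), ?_, k, l, ?_, by simp, by simp⟩
    · rw [Set.mem_ofPred_eq, e]; exact hv
    · rw [← pr_neg, ← pr_sub, e]; exact h
  · rintro ⟨v, hv, k, l, h, ha, hb⟩
    refine ⟨-v - (1, 0), hv, k, l, ?_, ?_, ?_⟩
    · rw [pr_sub, pr_neg]; exact h
    · rw [e, ← ha]; simp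
    · rw [e, ← hb]; simp

lemma Ast_law (hN : 3 ≤ N) {p : ℝ} (hp : 1 - 3 * p + p ^ 3 = 0) (F : Rel → Prop) (X : Set V) :
    Pr (fun _ : Sym2 (VN N) => p) (fun ω => F (Ast ω X)) =
    Pr (fun _ : Sym2 (VN N) => p) (fun ω => F (pull (fun z => -z) (RelT (fun v => ph (xb ω v)) {v | -v - (1, 0) ∈ X}))) := by
  simp only [Ast_eq]
  exact star_tri hN hp (fun T => F (pull (fun z => -z) (RelT T {v | -v - (1, 0) ∈ X})))

lemma vt_adj (v : V) {k l : Fin 3} (h : k ≠ l) : TriAdj (vt v k) (vt v l) := by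
  rw [triAdj_iff]
  fin_cases k <;> fin_cases l <;> simp [vt, vo] at h ⊢

/-- an open triangle edge is a bond -/
lemma xb_BA (ω : Sym2 (VN N) → Bool) (v : V) {k l : Fin 3} (h : k ≠ l) : BA ω (vt v k) (vt v l) ↔ xb ω (pr N v) (-(k + l)) = true := by
  have e : s(pr N (vt v k), pr N (vt v l)) = jE (pr N v, -(k + l)) := by
    have : (-(k + l) + 1 = k ∧ -(k + l) + 2 = l) ∨ (-(k + l) + 1 = l ∧ -(k + l) + 2 = k) := by
      revert h; revert k l; decide
    simp only [jE, vt, voN, pr_add]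
    rcases this with ⟨h1, h2⟩ | ⟨h1, h2⟩
    · rw [h1, h2]
    · rw [h1, h2, Sym2.eq_swap]
  simp only [BA, e, xb, vt_adj v h, true_and]

lemma tri_of_adj {a b : V} (h : TriAdj a b) : ∃ v k l, k ≠ l ∧ a = vt v k ∧ b = vt v l := by
  rw [triAdj_iff] at h
  rcases h with h | h | h | h | h | h
  · exact ⟨b, 1, 0, by decide, by ext <;> simp [vt, vo] <;> omega, by ext <;> simp [vt, vo]⟩
  · exact ⟨a, 0, 1, by decide, by ext <;> simp [vt, vo], by ext <;> simp [vt, vo] <;> omega⟩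
  · exact ⟨b - (1, 0), 2, 1, by decide, by ext <;> simp [vt, vo] <;> omega, by ext <;> simp [vt, vo] <;> omega⟩
  · exact ⟨a - (1, 0), 1, 2, by decide, by ext <;> simp [vt, vo] <;> omega, by ext <;> simp [vt, vo] <;> omega⟩
  · exact ⟨b, 2, 0, by decide, by ext <;> simp [vt, vo] <;> omega, by ext <;> simp [vt, vo]⟩
  · exact ⟨a, 0, 2, by decide, by ext <;> simp [vt, vo], by ext <;> simp [vt, vo] <;> omega⟩

/-- bonds are triangle connections -/
lemma BA_RelT {ω : Sym2 (VN N) → Bool} {a b : V} (h : BA ω a b) : RelT (fun v => ph (xb ω v)) Set.univ a b := by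
  obtain ⟨v, k, l, hkl, rfl, rfl⟩ := tri_of_adj h.1
  rw [xb_BA ω v hkl] at h
  exact ⟨v, trivial, k, l, by simp only [ph]; rw [h]; simp [hkl], rfl, rfl⟩

/-- triangle connections are connections through bonds -/
lemma RelT_BA {ω : Sym2 (VN N) → Bool} {X S : Set V} {a b : V} (h : RelT (fun v => ph (xb ω v)) X a b)
    (hX : ∀ v ∈ X, ∀ k, vt v k ∈ S) : Cn (BA ω) S a b := by
  obtain ⟨v, hv, k, l, h, rfl, rfl⟩ := h
  simp only [ph, Bool.and_eq_true, Bool.or_eq_true, decide_eq_true_eq] at h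
  obtain ⟨hkl, h | h⟩ := h
  · exact Cn.single (hX v hv k) ((xb_BA ω v hkl).2 h) (hX v hv l)
  · obtain ⟨m, h1, h2, h3, h4⟩ : ∃ m, k ≠ m ∧ m ≠ l ∧ -(k + m) = l ∧ -(m + l) = k := by
      revert hkl; clear h; revert k l; decide
    refine (Cn.single (hX v hv k) ((xb_BA ω v h1).2 ?_) (hX v hv m)).tail ((xb_BA ω v h2).2 ?_) (hX v hv l)
    · rw [h3]; exact h.2
    · rw [h4]; exact h.1

end StarTri
end DaC

namespace DaC
open Relation

section Fine

/-- fine points of edges -/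
def fp (v : V) (a b : Fin 3) : V := (2 * (vt v a).1 + (vt v b).1, 2 * (vt v a).2 + (vt v b).2)
def f0 (v : V) : V := (3 * v.1, 3 * v.2)
def fU (v : V) : V := (3 * v.1 + 2, 3 * v.2 + 1)
def fD (v : V) : V := (3 * v.1 + 1, 3 * v.2 + 2)
def psi (z : V) : V := ((z.1 + 1) / 3, (z.2 + 1) / 3)
def chi (z : V) : V := (z.1 / 3, (z.2 - 1) / 3)

variable (x : V → Fin 3 → Bool)

/-- primal relation -/
def Px : Rel := fun a b => ∃ v k l, k ≠ l ∧ x v (-(k + l)) = true ∧ a = vt v k ∧ b = vt v l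
/-- dual relation -/
def Dx (X : Set V) : Rel := fun a b => ∃ v ∈ X, ∃ k l, ph' (x v) k l = true ∧ a = dl v k ∧ b = dl v l

def Bk (z : V) : Prop := (∃ v, z = f0 v) ∨ ∃ v a b, a ≠ b ∧ x v (-(a + b)) = true ∧ z = fp v a b

lemma fine_class (z : V) : (∃ v, z = f0 v) ∨ (∃ v, z = fU v) ∨ (∃ v, z = fD v) ∨ ∃ v a b, a ≠ b ∧ z = fp v a b := by
  have h1 : z.1 % 3 = 0 ∨ z.1 % 3 = 1 ∨ z.1 % 3 = 2 := by omega
  have h2 : z.2 % 3 = 0 ∨ z.2 % 3 = 1 ∨ z.2 % 3 = 2 := by omega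
  rcases h1 with h1 | h1 | h1 <;> rcases h2 with h2 | h2 | h2
  · left; exact ⟨(z.1 / 3, z.2 / 3), by ext <;> simp [f0] <;> omega⟩
  · right; right; right; exact ⟨(z.1 / 3 - 1, z.2 / 3), 1, 2, by decide, by ext <;> simp [fp, vt, vo] <;> omega⟩
  · right; right; right; exact ⟨(z.1 / 3 - 1, z.2 / 3), 2, 1, by decide, by ext <;> simp [fp, vt, vo] <;> omega⟩
  · right; right; right; exact ⟨(z.1 / 3, z.2 / 3), 0, 1, by decide, by ext <;> simp [fp, vt, vo] <;> omega⟩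
  · right; right; right; exact ⟨(z.1 / 3, z.2 / 3), 0, 2, by decide, by ext <;> simp [fp, vt, vo] <;> omega⟩
  · right; right; left; exact ⟨(z.1 / 3, z.2 / 3), by ext <;> simp [fD] <;> omega⟩
  · right; right; right; exact ⟨(z.1 / 3, z.2 / 3), 1, 0, by decide, by ext <;> simp [fp, vt, vo] <;> omega⟩
  · right; left; exact ⟨(z.1 / 3, z.2 / 3), by ext <;> simp [fU] <;> omega⟩
  · right; right; right; exact ⟨(z.1 / 3, z.2 / 3), 2, 0, by decide, by ext <;> simp [fp, vt, vo] <;> omega⟩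

lemma psi_f0 (v : V) : psi (f0 v) = v := by ext <;> simp [psi, f0] <;> omega
lemma psi_fp (v : V) (a b : Fin 3) : psi (fp v a b) = vt v a := by
  ext <;> fin_cases a <;> fin_cases b <;> simp [psi, fp, vt, vo] <;> omega
lemma chi_fp (v : V) {a b : Fin 3} (h : a ≠ b) : chi (fp v a b) = dl v (-(a + b)) := by
  fin_cases a <;> fin_cases b <;> simp at h <;> simp [chi, fp, dl, vt, vo, Prod.ext_iff] <;> omega
lemma chi_fD (v : V) : chi (fD v) = v := by ext <;> simp [chi, fD] <;> omega

lemma black_num {u v u' v' : V} (h : TriAdj u v) (h' : TriAdj u' v')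
    (hz : TriAdj (2 * u.1 + v.1, 2 * u.2 + v.2) (2 * u'.1 + v'.1, 2 * u'.2 + v'.2)) : u = u' ∨ (u = v' ∧ v = u') := by
  rw [triAdj_iff] at h h' hz
  simp only [Prod.ext_iff] at *
  rcases h with h | h | h | h | h | h <;> rcases h' with h' | h' | h' | h' | h' | h' <;> omega

lemma fp0_num {u v w : V} (h : TriAdj u v) (hz : TriAdj (2 * u.1 + v.1, 2 * u.2 + v.2) (f0 w)) : u = w := by
  rw [triAdj_iff] at h hz
  simp only [Prod.ext_iff, f0] at *
  rcases h with h | h | h | h | h | h <;> omega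

set_option maxHeartbeats 2000000 in
lemma fp_fp {v v' : V} {a b a' b' : Fin 3} (h : a ≠ b) (h' : a' ≠ b') (hz : TriAdj (fp v a b) (fp v' a' b')) :
    v = v' ∨ dl v (-(a + b)) = dl v' (-(a' + b')) := by
  rw [triAdj_iff] at hz
  fin_cases a <;> fin_cases b <;> simp at h <;> fin_cases a' <;> fin_cases b' <;> simp at h' <;>
    simp [fp, vt, vo, dl, Prod.ext_iff] at hz ⊢ <;> omega

lemma fp_fU {v v' : V} {a b : Fin 3} (h : a ≠ b) (hz : TriAdj (fp v a b) (fU v')) : v = v' := by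
  rw [triAdj_iff] at hz
  fin_cases a <;> fin_cases b <;> simp at h <;> 
    simp [fp, vt, vo, fU, Prod.ext_iff] at hz ⊢ <;> omega

lemma fp_fD {v v' : V} {a b : Fin 3} (h : a ≠ b) (hz : TriAdj (fp v a b) (fD v')) : dl v (-(a + b)) = v' := by
  rw [triAdj_iff] at hz
  rw [← chi_fp v h]
  fin_cases a <;> fin_cases b <;> simp at h <;> 
    simp [fp, vt, vo, fD, chi, Prod.ext_iff] at hz ⊢ <;> omega

lemma Px_symm {a b : V} (h : Px x a b) : Px x b a := by
  obtain ⟨v, k, l, hkl, h, h1, h2⟩ := h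
  exact ⟨v, l, k, hkl.symm, by rw [add_comm]; exact h, h2, h1⟩

lemma black_step {z z' : V} (h : Bk x z) (h' : Bk x z') (hz : TriAdj z z') : psi z = psi z' ∨ Px x (psi z) (psi z') := by
  rcases h with ⟨v, rfl⟩ | ⟨v, a, b, hab, hx, rfl⟩ <;> rcases h' with ⟨v', rfl⟩ | ⟨v', a', b', hab', hx', rfl⟩
  · rw [triAdj_iff] at hz; simp [f0] at hz; omega
  · left; rw [psi_f0, psi_fp]; exact (fp0_num (vt_adj v' hab') hz.symm).symm
  · left; rw [psi_f0, psi_fp]; exact (fp0_num (vt_adj v hab) hz)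
  · rw [psi_fp, psi_fp]
    rcases black_num (vt_adj v hab) (vt_adj v' hab') hz with h | ⟨h1, h2⟩
    · exact Or.inl h
    · right; rw [← h2]; exact ⟨v, a, b, hab, hx, rfl, rfl⟩

variable {x}

lemma fine_black {α α' β β' : ℤ} {u v : V} (hu : u.1 = 3 * α) (hv : v.1 = 3 * α')
    (h : Cn TriAdj (Rc (3 * α) (3 * α') (3 * β + 2) (3 * β' + 2) ∩ {z | Bk x z}) u v) :
    ∃ u v : V, u.1 = α ∧ v.1 = α' ∧ Cn (Px x) (Rc α α' (β + 1) (β' + 1)) u v := by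
  refine ⟨psi u, psi v, by simp [psi, hu]; omega, by simp [psi, hv]; omega, ?_⟩
  have hR : ∀ z ∈ Rc (3 * α) (3 * α') (3 * β + 2) (3 * β' + 2), psi z ∈ Rc α α' (β + 1) (β' + 1) := by
    rintro z ⟨h1, h2, h3, h4⟩
    refine ⟨?_, ?_, ?_, ?_⟩ <;> simp only [psi] <;> omega
  refine h.ind (P := fun z => Cn (Px x) (Rc α α' (β + 1) (β' + 1)) (psi u) (psi z)) (Cn.refl (hR _ h.1.1)) ?_
  intro b c hb hbc hc ih
  rcases black_step x hb.right.2 hc.2 hbc with e | e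
  · rw [← e]; exact ih
  · exact ih.tail e (hR _ hc.1)

lemma white_fp {v : V} {a b : Fin 3} (hab : a ≠ b) (h : ¬ Bk x (fp v a b)) : x v (-(a + b)) = false := by
  by_contra hc
  exact h (Or.inr ⟨v, a, b, hab, by simpa using hc, rfl⟩)

/-- two closed edges of the same up triangle -/
lemma dl_link {X S : Set V} {v : V} {k l : Fin 3} (hX : k ≠ l → v ∈ X) (hk : x v k = false) (hl : x v l = false) (h1 : dl v k ∈ S) (h2 : dl v l ∈ S) :
    Cn (Dx x X) S (dl v k) (dl v l) := by
  by_cases h : k = l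
  · subst h; exact Cn.refl h1
  · exact Cn.single h1 ⟨v, hX h, k, l, by simp [ph', h, hk, hl], rfl, rfl⟩ h2

lemma fp_range {v : V} {a b a' b' : Fin 3} (hab : a ≠ b) (hab' : a' ≠ b') {α α' : ℤ} (h : -(a + b) ≠ -(a' + b'))
    (h1 : 3 * α ≤ (fp v a b).1) (h2 : (fp v a b).1 ≤ 3 * α') (h3 : 3 * α ≤ (fp v a' b').1) (h4 : (fp v a' b').1 ≤ 3 * α') :
    α ≤ v.1 ∧ v.1 ≤ α' - 1 := by
  fin_cases a <;> fin_cases b <;> fin_cases a' <;> fin_cases b' <;> simp at h hab hab' <;> simp [fp, vt, vo] at h1 h2 h3 h4 <;> omega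

lemma fine_white {α α' β β' : ℤ} {u v : V} (hu : u.2 = 3 * β + 2) (hv : v.2 = 3 * β' + 2)
    (h : Cn TriAdj (Rc (3 * α) (3 * α') (3 * β + 2) (3 * β' + 2) ∩ {z | ¬ Bk x z}) u v) :
    ∃ u v : V, u.2 = β ∧ v.2 = β' ∧ Cn (Dx x {v | α ≤ v.1 ∧ v.1 ≤ α' - 1}) (Rc α α' β β') u v := by
  refine ⟨chi u, chi v, by simp [chi, hu]; omega, by simp [chi, hv]; omega, ?_⟩
  set X : Set V := {v | α ≤ v.1 ∧ v.1 ≤ α' - 1} with hXd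
  have hR : ∀ z ∈ Rc (3 * α) (3 * α') (3 * β + 2) (3 * β' + 2), chi z ∈ Rc α α' β β' := by
    rintro z ⟨h1, h2, h3, h4⟩
    refine ⟨?_, ?_, ?_, ?_⟩ <;> simp only [chi] <;> omega
  have key : ((∀ w, v ≠ fU w) → Cn (Dx x X) (Rc α α' β β') (chi u) (chi v)) ∧
      ∀ w, v = fU w → ∃ a b, a ≠ b ∧ fp w a b ∈ (Rc (3 * α) (3 * α') (3 * β + 2) (3 * β' + 2) ∩ {z | ¬ Bk x z}) ∧
        Cn (Dx x X) (Rc α α' β β') (chi u) (chi (fp w a b)) := by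
    clear hv
    refine h.ind (P := fun v => ((∀ w, v ≠ fU w) → Cn (Dx x X) (Rc α α' β β') (chi u) (chi v)) ∧
      ∀ w, v = fU w → ∃ a b, a ≠ b ∧ fp w a b ∈ (Rc (3 * α) (3 * α') (3 * β + 2) (3 * β' + 2) ∩ {z | ¬ Bk x z}) ∧
        Cn (Dx x X) (Rc α α' β β') (chi u) (chi (fp w a b))) ⟨fun _ => Cn.refl (hR _ h.1.1), ?_⟩ ?_
    · rintro w rfl; exfalso; simp [fU] at hu; omega
    intro b c hb hbc hc ih
    have nU : ∀ w v' a b, a ≠ b → fp v' a b ≠ fU w := by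
      intro w v' a b hab
      fin_cases a <;> fin_cases b <;> simp at hab <;> simp [fp, vt, vo, fU, Prod.ext_iff] <;> omega
    have nUD : ∀ w v', fD v' ≠ fU w := by
      intro w v'; simp [fD, fU, Prod.ext_iff]; omega
    have nbk : ∀ v, Bk x (f0 v) := fun v => Or.inl ⟨v, rfl⟩
    have hbr := hb.right
    rcases fine_class b with ⟨w, rfl⟩ | ⟨w, rfl⟩ | ⟨w, rfl⟩ | ⟨w, a, a', haa, rfl⟩
    · exact absurd (nbk w) hbr.2
    · rcases fine_class c with ⟨w', rfl⟩ | ⟨w', rfl⟩ | ⟨w', rfl⟩ | ⟨w', d, d', hdd, rfl⟩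
      · exact absurd (nbk w') hc.2
      · rw [triAdj_iff] at hbc; simp [fU] at hbc; omega
      · rw [triAdj_iff] at hbc; simp [fU, fD] at hbc; omega
      · refine ⟨fun _ => ?_, fun w1 h1 => absurd h1 (nU _ _ _ _ hdd)⟩
        obtain ⟨a, b, hab, h1, h2⟩ := ih.2 w rfl
        have := fp_fU hdd hbc.symm
        subst this
        refine h2.trans ?_
        have i1 := hR _ h1.1
        have i2 := hR _ hc.1
        rw [chi_fp _ hab] at *
        rw [chi_fp _ hdd] at *
        exact dl_link (fun hne => fp_range hab hdd hne h1.1.1 h1.1.2.1 hc.1.1 hc.1.2.1) (white_fp hab h1.2) (white_fp hdd hc.2) i1 i2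
    · have ih1 := ih.1 (fun w' => nUD _ _)
      rcases fine_class c with ⟨w', rfl⟩ | ⟨w', rfl⟩ | ⟨w', rfl⟩ | ⟨w', d, d', hdd, rfl⟩
      · exact absurd (nbk w') hc.2
      · rw [triAdj_iff] at hbc; simp [fU, fD] at hbc; omega
      · rw [triAdj_iff] at hbc; simp [fD] at hbc; omega
      · refine ⟨fun _ => ?_, fun w1 h1 => absurd h1 (nU _ _ _ _ hdd)⟩
        rw [chi_fD] at ih1
        rw [chi_fp _ hdd, fp_fD hdd hbc.symm]; exact ih1
    · have ih1 := ih.1 (fun w' => nU _ _ _ _ haa)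
      rcases fine_class c with ⟨w', rfl⟩ | ⟨w', rfl⟩ | ⟨w', rfl⟩ | ⟨w', d, d', hdd, rfl⟩
      · exact absurd (nbk w') hc.2
      · refine ⟨fun h => absurd rfl (h w'), fun w1 h1 => ?_⟩
        have := fp_fU haa hbc
        subst this
        have h1' : w = w1 := by
          simp [fU] at h1; ext <;> omega
        subst h1'
        exact ⟨a, a', haa, hbr, ih1⟩
      · refine ⟨fun _ => ?_, fun w1 h1 => absurd h1 (nUD _ _)⟩
        rw [chi_fD]
        rw [chi_fp _ haa, fp_fD haa hbc] at ih1; exact ih1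
      · refine ⟨fun _ => ?_, fun w1 h1 => absurd h1 (nU _ _ _ _ hdd)⟩
        refine ih1.trans ?_
        have i1 := hR _ hbr.1
        have i2 := hR _ hc.1
        rcases fp_fp haa hdd hbc with e | e
        · subst e
          rw [chi_fp _ haa] at *
          rw [chi_fp _ hdd] at *
          exact dl_link (fun hne => fp_range haa hdd hne hbr.1.1 hbr.1.2.1 hc.1.1 hc.1.2.1) (white_fp haa hbr.2) (white_fp hdd hc.2) i1 i2
        · rw [chi_fp _ haa] at *
          rw [chi_fp _ hdd, ← e] at *
          exact Cn.refl i1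
  refine key.1 ?_
  rintro w rfl; simp [fU] at hv; omega

lemma fine_hex (x : V → Fin 3 → Bool) {α α' β β' : ℤ} (h1 : α ≤ α') (h2 : β ≤ β') :
    (∃ u v : V, u.1 = α ∧ v.1 = α' ∧ Cn (Px x) (Rc α α' (β + 1) (β' + 1)) u v) ∨
    ∃ u v : V, u.2 = β ∧ v.2 = β' ∧ Cn (Dx x {v | α ≤ v.1 ∧ v.1 ≤ α' - 1}) (Rc α α' β β') u v := by
  rcases hex (Bk x) (3 * α) (3 * α') (3 * β + 2) (3 * β' + 2) (by omega) (by omega) with ⟨u, v, hu, hv, h⟩ | ⟨u, v, hu, hv, h⟩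
  · exact Or.inl (fine_black hu hv h)
  · exact Or.inr (fine_white hu hv h)

end Fine
end DaC

namespace DaC
open Relation

section BondHalf
open Classical
variable {N : ℕ} [NeZero N]

/-- plane bits -/
def xp (ω : Sym2 (VN N) → Bool) (v : V) (k : Fin 3) : Bool := xb ω (pr N v) k

lemma Px_BA (ω : Sym2 (VN N) → Bool) : Px (xp ω) = BA ω := by
  funext a b
  rw [eq_iff_iff]
  constructor
  · rintro ⟨v, k, l, hkl, h, rfl, rfl⟩
    exact (xb_BA ω v hkl).2 h
  · intro h
    obtain ⟨v, k, l, hkl, rfl, rfl⟩ := tri_of_adj h.1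
    exact ⟨v, k, l, hkl, (xb_BA ω v hkl).1 h, rfl, rfl⟩

lemma Dx_Ast (ω : Sym2 (VN N) → Bool) (X : Set V) : Dx (xp ω) X = Ast ω X := rfl

lemma trim_vert {A : Rel} (hs : SymTri A) {X : Set V} {u v : V} {c d : ℤ} (hcd : c ≤ d) (hu : u.2 = c) (hv : v.2 = d) (h : Cn A X u v) :
    ∃ u v : V, u.2 = c ∧ v.2 = d ∧ Cn A (X ∩ {z | c ≤ z.2 ∧ z.2 ≤ d}) u v := by
  obtain ⟨w, hw, h1, -⟩ := h.level (fun z => z.2) (fun a b hab => by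
    have := hs.2 a b hab; rw [triAdj_iff] at this; omega) d (by omega) (by omega)
  obtain ⟨w', hw', h2, -⟩ := (h1.symm hs.1).level (fun z => -z.2) (fun a b hab => by
    have := hs.2 a b hab; rw [triAdj_iff] at this; omega) (-c) (by omega) (by omega)
  refine ⟨w', w, by omega, hw, (h2.symm hs.1).mono (fun _ _ h => h) ?_⟩
  rintro z ⟨⟨h1, h2⟩, h3⟩
  refine ⟨h1, ?_, h2⟩
  rw [Set.mem_ofPred_eq] at h3; omega

lemma bond_half (hN : 3 ≤ N) {p : ℝ} (h0 : 0 ≤ p) (h1 : p ≤ 1) (hp : 1 - 3 * p + p ^ 3 = 0) (n : ℕ) :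
    1 / 2 ≤ bμ N p (Cr (BoxC 0 n) {z | z.1 = -n} {z | z.1 = n}) := by
  have hq : IsP (fun _ : Sym2 (VN N) => p) := isP_const h0 h1
  set X : Set V := {v | -(n : ℤ) ≤ v.1 ∧ v.1 ≤ n - 1} with hX
  set F : Rel → Prop := fun A => ∃ u v : V, u.2 = -(n:ℤ) - 1 ∧ v.2 = n - 1 ∧ Cn A (Rc (-n) n (-n-1) (n-1)) u v with hF
  have s1 : 1 ≤ bμ N p (Cr (BoxC 0 n) {z | z.1 = -n} {z | z.1 = n}) + Pr (fun _ : Sym2 (VN N) => p) (fun ω => F (Ast ω X)) := by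
    refine le_trans ?_ (Pr_or_le hq _ _)
    have : Pr (fun _ : Sym2 (VN N) => p) (fun _ => True) = 1 := by simp [Pr, ind, Ex_const]
    rw [← this]
    refine Pr_mono hq fun ω _ => ?_
    rcases fine_hex (xp ω) (α := -(n:ℤ)) (α' := n) (β := -(n:ℤ) - 1) (β' := n - 1) (by omega) (by omega) with ⟨u, v, hu, hv, h⟩ | ⟨u, v, hu, hv, h⟩
    · left
      rw [Px_BA] at h
      refine ⟨u, hu, v, hv, h.mono (fun _ _ h => h) ?_⟩
      rintro z ⟨a, b, c, d⟩
      rw [mem_BoxC]; simp; omega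
    · right
      exact ⟨u, v, hu, hv, h⟩
  have s2 : Pr (fun _ : Sym2 (VN N) => p) (fun ω => F (Ast ω X)) ≤ bμ N p (Cr (BoxC 0 n) {z | z.1 = -n} {z | z.1 = n}) := by
    rw [Ast_law hN hp]
    rw [← bμ_sym tsym_swap, ← bμ_sym (tsym_add (0, 1))]
    refine Pr_mono hq fun ω => ?_
    rintro ⟨u, v, hu, hv, h⟩
    have hch : Cn (BA ω) {z | -(n:ℤ) ≤ z.1 ∧ z.1 ≤ n} (-u) (-v) := by
      have hm := h.right
      refine h.ind (P := fun z => Cn (BA ω) {z | -(n:ℤ) ≤ z.1 ∧ z.1 ≤ n} (-u) (-z)) (Cn.refl ?_) ?_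
      · have := h.left; simp [Rc] at this ⊢; omega
      · intro b c hb hbc hc ih
        refine ih.trans (RelT_BA hbc ?_)
        intro w hw k
        simp only [hX, Set.mem_ofPred_eq] at hw ⊢
        fin_cases k <;> simp [vt, vo] at hw ⊢ <;> omega
    have hch' := hch.symm (BA_symTri ω).1
    obtain ⟨u', v', hu', hv', h'⟩ := trim_vert (BA_symTri ω) (c := 1 - n) (d := n + 1) (by omega) (by simp; omega) (by simp; omega) hch'
    refine ⟨(u' - (0, 1)).swap, by simp; omega, (v' - (0, 1)).swap, by simp; omega, ?_⟩
    refine h'.map (fun z => (z - (0, 1)).swap) ?_ ?_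
    · intro a b _ _ hab
      simp only [pull, Prod.swap_swap]
      simpa using hab
    · rintro z ⟨z1, z2⟩
      rw [mem_BoxC]; simp at z1 z2 ⊢; omega
  linarith

lemma bond_law (hN : 3 ≤ N) {p : ℝ} (h0 : 0 ≤ p) (h1 : p ≤ 1) (hp : 1 - 3 * p + p ^ 3 = 0) : RLaw (bμ N p) :=
  bμ_law h0 h1 (bond_half hN h0 h1 hp)

lemma Tube_inc (m : ℤ) (D : V) : IncA (Tube m D) := by
  rintro A B hAB ⟨u, v, hu, hv, h⟩
  exact ⟨u, v, hu, hv, h.mono hAB (le_refl _)⟩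

lemma Block_inc (m : ℤ) (D : V) : IncA (Block m D) := fun A B hAB h j hj =>
  Tube_inc m D _ _ (fun a b hab => hAB _ _ hab) (h j hj)

/-- dual blocks -/
lemma dual_block_prob (hN : 3 ≤ N) {p : ℝ} (h0 : 0 ≤ p) (h1 : p ≤ 1) (hp : 1 - 3 * p + p ^ 3 = 0) (m : ℤ) (D : V) :
    bμ N p (Block m D) ≤ Pr (fun _ : Sym2 (VN N) => p) (fun ω => Block m D (Ast ω Set.univ)) := by
  rw [Ast_law hN hp, ← bμ_sym tsym_neg]
  refine Pr_mono (isP_const h0 h1) fun ω h => ?_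
  refine Block_inc m D _ _ (fun a b hab => ?_) h
  have : {v : V | -v - (1, 0) ∈ (Set.univ : Set V)} = Set.univ := by ext; simp
  rw [this]
  exact BA_RelT hab

end BondHalf

section Geo

lemma nrm_rot_le (z : V) : nrm (rot z) ≤ 2 * nrm z := by simp only [nrm, rot]; omega

/-- hexagonal norm, invariant -/
def hxn (z : V) : ℤ := max (max (max z.1 (-z.1)) (max z.2 (-z.2))) (max (z.1 - z.2) (z.2 - z.1))
lemma hxn_rot (z : V) : hxn (rot z) = hxn z := by simp only [hxn, rot]; omega
lemma hxn_rot_iter (j : ℕ) (z : V) : hxn (rot^[j] z) = hxn z := by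
  induction j generalizing z with
  | zero => rfl
  | succ j ih => rw [Function.iterate_succ_apply, ih, hxn_rot]
lemma nrm_le_hxn (z : V) : nrm z ≤ hxn z := by simp only [nrm, hxn]; omega
lemma hxn_le_nrm (z : V) : hxn z ≤ 2 * nrm z := by simp only [nrm, hxn]; omega

lemma det_le {m : ℤ} {D : V} (h : DOk m D) (e : V) : |det D e| ≤ 5 * m * nrm e := by
  obtain ⟨d1, d2, d3⟩ := h
  have he' : |e.1| ≤ nrm e ∧ |e.2| ≤ nrm e := by simp only [nrm]; rw [abs_le, abs_le]; omega
  have hm : 0 ≤ m := by have := abs_nonneg D.2; omega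
  have h0 : 0 ≤ nrm e := le_trans (abs_nonneg _) he'.1
  have h1 : |D.1 * e.2| ≤ 2 * m * nrm e := by
    rw [abs_mul]
    exact mul_le_mul (by rw [abs_le]; constructor <;> linarith) he'.2 (abs_nonneg _) (by linarith)
  have h2 : |D.2 * e.1| ≤ 3 * m * nrm e := by
    rw [abs_mul]
    exact mul_le_mul d3 he'.1 (abs_nonneg _) (by linarith)
  have := abs_sub (D.1 * e.2) (D.2 * e.1)
  simp only [det]; linarith

/-- annulus of a block -/
def Ann (m : ℤ) : Set V := {z | m ≤ 10 * nrm z ∧ nrm z ≤ 600 * m}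

lemma strip_ann {m : ℤ} (hm : 1 ≤ m) {D z : V} (h : DOk m D) (hz : z ∈ Strip m D) (j : ℕ) : rot^[j] z ∈ Ann m := by
  obtain ⟨h1, h2, h3⟩ := hz
  have h4 := det_le h z
  have h5 : m ≤ 5 * nrm z := by
    have := le_trans (le_abs_self _) h4
    have h6 : m * m ≤ m * (5 * nrm z) := by nlinarith
    exact le_of_mul_le_mul_left h6 (by omega)
  have a1 := nrm_le_hxn (rot^[j] z)
  have a2 := hxn_le_nrm (rot^[j] z)
  have a3 := hxn_rot_iter j z
  have a4 := nrm_le_hxn z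
  have a5 := hxn_le_nrm z
  exact ⟨by omega, by omega⟩

lemma Block_local {m : ℤ} (hm : 1 ≤ m) {D : V} (hD : DOk m D) {A A' : Rel}
    (h : ∀ a ∈ Ann m, ∀ b ∈ Ann m, A a b → A' a b) (hB : Block m D A) : Block m D A' := by
  intro j hj
  obtain ⟨u, v, hu, hv, hc⟩ := hB j hj
  exact ⟨u, v, hu, hv, hc.map id (fun a b ha hb hab => h _ (strip_ann hm hD ha j) _ (strip_ann hm hD hb j) hab) (fun a ha => ha)⟩

end Geo

section DualBlock
variable {x : V → Fin 3 → Bool}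

lemma fp_inj {v v' : V} {a b a' b' : Fin 3} (h : a ≠ b) (h' : a' ≠ b') (hz : fp v a b = fp v' a' b') : v = v' ∧ -(a + b) = -(a' + b') := by
  fin_cases a <;> fin_cases b <;> simp at h <;> fin_cases a' <;> fin_cases b' <;> simp at h' <;>
    simp [fp, vt, vo, Prod.ext_iff] at hz ⊢ <;> omega

lemma not_Bk_fU (v : V) : ¬ Bk x (fU v) := by
  rintro (⟨w, h⟩ | ⟨w, a, b, hab, -, h⟩)
  · simp [f0, fU] at h; omega
  · fin_cases a <;> fin_cases b <;> simp at hab <;> simp [fp, vt, vo, fU] at h <;> omega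

lemma not_Bk_fD (v : V) : ¬ Bk x (fD v) := by
  rintro (⟨w, h⟩ | ⟨w, a, b, hab, -, h⟩)
  · simp [f0, fD] at h; omega
  · fin_cases a <;> fin_cases b <;> simp at hab <;> simp [fp, vt, vo, fD] at h <;> omega

lemma not_Bk_fp {v : V} {a b : Fin 3} (hab : a ≠ b) (h : x v (-(a + b)) = false) : ¬ Bk x (fp v a b) := by
  rintro (⟨w, h1⟩ | ⟨w, a', b', hab', h2, h1⟩)
  · fin_cases a <;> fin_cases b <;> simp at hab <;> simp [fp, vt, vo, f0] at h1 <;> omega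
  · obtain ⟨e1, e2⟩ := fp_inj hab hab' h1
    rw [e1, e2, h2] at h; cases h

def NearW (x : V → Fin 3 → Bool) (S : Set V) : Set V := {z | ¬ Bk x z} ∩ {z | ∃ c ∈ S, nrm (z - f0 c) ≤ 4}

lemma white_half {S : Set V} {v : V} {k : Fin 3} (hS : dl v k ∈ S) (h : x v k = false) :
    Cn TriAdj (NearW x S) (fD (dl v k)) (fU v) := by
  have hk : k + 1 ≠ k + 2 := (by decide : ∀ k : Fin 3, k + 1 ≠ k + 2) k
  have e : -((k + 1) + (k + 2)) = k := (by decide : ∀ k : Fin 3, -((k + 1) + (k + 2)) = k) k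
  have i1 : fD (dl v k) ∈ NearW x S := ⟨not_Bk_fD _, _, hS, by simp [nrm, fD, f0]⟩
  have i2 : fp v (k + 1) (k + 2) ∈ NearW x S := ⟨not_Bk_fp hk (by rw [e]; exact h), _, hS, by fin_cases k <;> simp [nrm, f0, dl, fp, vt, vo] <;> omega⟩
  have i3 : fU v ∈ NearW x S := ⟨not_Bk_fU _, _, hS, by fin_cases k <;> simp [nrm, f0, dl, fU, vt, vo] <;> omega⟩
  refine ((Cn.refl i1).tail ?_ i2).tail ?_ i3
  · rw [triAdj_iff]; fin_cases k <;> simp [fD, dl, fp, vt, vo] <;> omega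
  · rw [triAdj_iff]; fin_cases k <;> simp [fU, dl, fp, vt, vo] <;> omega

lemma white_step {X S : Set V} {a b : V} (ha : a ∈ S) (hb : b ∈ S) (h : Dx x X a b) : Cn TriAdj (NearW x S) (fD a) (fD b) := by
  obtain ⟨v, -, k, l, h, rfl, rfl⟩ := h
  simp only [ph', Bool.and_eq_true, Bool.not_eq_true', decide_eq_true_eq] at h
  exact (white_half ha h.2.1).trans ((white_half hb h.2.2).symm fun _ _ => TriAdj.symm)

lemma black_path {S : Set V} {a b : V} (h : Cn (Px x) S a b) : Cn TriAdj {z | Bk x z} (f0 a) (f0 b) := by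
  refine h.ind (P := fun z => Cn TriAdj {z | Bk x z} (f0 a) (f0 z)) (Cn.refl (Or.inl ⟨_, rfl⟩)) ?_
  rintro _ _ hb ⟨v, k, l, hkl, hx, rfl, rfl⟩ hc ih
  refine ((ih.tail (w := fp v k l) ?_ (Or.inr ⟨v, k, l, hkl, hx, rfl⟩)).tail (w := fp v l k) ?_ (Or.inr ⟨v, l, k, hkl.symm, by rw [add_comm]; exact hx, rfl⟩)).tail ?_ (Or.inl ⟨_, rfl⟩)
  all_goals
    rw [triAdj_iff]; fin_cases k <;> fin_cases l <;> simp at hkl <;> simp [f0, fp, vt, vo] <;> omega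

lemma rot_add (a b : V) : rot (a + b) = rot a + rot b := by ext <;> simp [rot]; ring
lemma rot_iter_add (j : ℕ) (a b : V) : rot^[j] (a + b) = rot^[j] a + rot^[j] b := by
  induction j generalizing a b with
  | zero => rfl
  | succ j ih => rw [Function.iterate_succ_apply, rot_add, ih]; rfl
lemma rot_f0 (a : V) : rot (f0 a) = f0 (rot a) := by ext <;> simp [rot, f0]; ring
lemma rot_iter_f0 (j : ℕ) (a : V) : rot^[j] (f0 a) = f0 (rot^[j] a) := by
  induction j generalizing a with
  | zero => rfl
  | succ j ih => rw [Function.iterate_succ_apply, rot_f0, ih]; rfl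

lemma dual_block {m : ℤ} (hm : 100 ≤ m) {D : V} (hD : DOk m D) {X S : Set V} (hB : Block m D (Dx x X)) {q : V}
    (hq : Cn (Px x) S 0 q) : nrm q ≤ 72 * m := by
  by_contra hcon
  push Not at hcon
  have hb := black_path hq
  have h00 : f0 0 = 0 := by simp [f0]
  rw [h00] at hb
  have hrot : ∀ j < 6, ∀ z : V, rot^[j] (rot^[6 - j] z) = z := by
    intro j hj z
    rw [← Function.iterate_add_apply, show j + (6 - j) = 6 by omega]; exact rot6 z
  have hrot' : ∀ j < 6, ∀ z : V, rot^[6 - j] (rot^[j] z) = z := by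
    intro j hj z
    rw [← Function.iterate_add_apply, show (6 - j) + j = 6 by omega]; exact rot6 z
  obtain ⟨j, hj, z, hz, hz'⟩ := block_top (m := 3 * m) (by omega) (D := f0 D) (by simp [f0]; exact hD.1) (P := fun j => {z | ¬ Bk x (rot^[j] z)})
    (Q := {z | Bk x z}) (q := f0 q) hb (by
      have : nrm (f0 q) = 3 * nrm q := by simp only [nrm, f0]; omega
      omega) (by
    intro j hj
    obtain ⟨u, v, hu, hv, hc⟩ := hB j hj
    have near : ∀ w : V, ∀ c ∈ Strip m D, nrm (w - f0 (rot^[j] c)) ≤ 4 → ∃ e, rot^[6 - j] w = f0 c + e ∧ nrm e ≤ 8 := by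
      intro w c hc hw
      refine ⟨rot^[6 - j] (w - f0 (rot^[j] c)), ?_, ?_⟩
      · rw [← hrot' j hj c, hrot j hj, ← rot_iter_f0, ← rot_iter_add]; congr 1; abel
      · have a1 := nrm_le_hxn (rot^[6 - j] (w - f0 (rot^[j] c)))
        rw [hxn_rot_iter] at a1
        have := hxn_le_nrm (w - f0 (rot^[j] c))
        omega
    have hfull : Cn TriAdj (NearW x (rot^[j] '' Strip m D)) (fD (rot^[j] u)) (fD (rot^[j] v)) := by
      refine hc.ind (P := fun z => Cn TriAdj (NearW x (rot^[j] '' Strip m D)) (fD (rot^[j] u)) (fD (rot^[j] z))) (Cn.refl ⟨not_Bk_fD _, _, ⟨u, hc.left, rfl⟩, by simp [nrm, fD, f0]⟩) ?_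
      intro b c hb hbc hcS ih
      exact ih.trans (white_step ⟨b, hb.right, rfl⟩ ⟨c, hcS, rfl⟩ hbc)
    obtain ⟨e, he1, he2⟩ := near (fD (rot^[j] u)) u hc.left (by simp [nrm, fD, f0])
    obtain ⟨e', he1', he2'⟩ := near (fD (rot^[j] v)) v hc.right (by simp [nrm, fD, f0])
    refine ⟨rot^[6 - j] (fD (rot^[j] u)), rot^[6 - j] (fD (rot^[j] v)), ?_, ?_, ?_⟩
    · rw [he1]; simp only [nrm] at he2; simp [f0]; omega
    · rw [he1']; simp only [nrm] at he2'; simp [f0]; omega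
    · refine hfull.map (fun z => rot^[6 - j] z) (fun a b _ _ hab => (rot_iter_adj _ hab)) ?_
      rintro z ⟨hz1, c, ⟨c', hc', rfl⟩, hz2⟩
      refine ⟨?_, ?_⟩
      · show ¬ Bk x (rot^[j] (rot^[6 - j] z))
        rw [hrot j hj]; exact hz1
      · obtain ⟨e, he1, he2⟩ := near z c' hc' hz2
        obtain ⟨s1, s2, s3⟩ := hc'
        have hd := det_le hD e
        rw [Set.mem_ofPred_eq, he1]
        have hde : det (f0 D) (f0 c' + e) = 9 * det D c' + 3 * det D e := by simp [det, f0]; ring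
        have : |det D e| ≤ 40 * m := by nlinarith
        rw [abs_le] at this
        refine ⟨?_, ?_, ?_⟩
        · rw [hde]; nlinarith
        · rw [hde]; nlinarith
        · simp only [nrm] at he2 s3; simp [nrm, f0]; omega)
  exact hz hz'

end DualBlock
end DaC

namespace DaC
open Relation

section Indep
variable {ι : Type*} [Fintype ι] {q : ι → ℝ}

lemma Pr_none (hq : IsP q) (F : Finset ℕ) (E : ℕ → (ι → Bool) → Prop) (S : ℕ → Set ι)
    (hd : ∀ i ∈ F, ∀ j ∈ F, i ≠ j → Disjoint (S i) (S j)) (hdep : ∀ i ∈ F, Dep (S i) (E i)) {κ : ℝ} (hκ1 : κ ≤ 1)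
    (hκ : ∀ i ∈ F, κ ≤ Pr q (E i)) : Pr q (fun ω => ∀ i ∈ F, ¬ E i ω) ≤ (1 - κ) ^ F.card := by
  classical
  induction F using Finset.induction_on with
  | empty => simp [Pr, ind, Ex_const]
  | insert a F ha ih =>
    have ih' := ih (fun i hi j hj => hd i (Finset.mem_insert_of_mem hi) j (Finset.mem_insert_of_mem hj))
      (fun i hi => hdep i (Finset.mem_insert_of_mem hi)) (fun i hi => hκ i (Finset.mem_insert_of_mem hi))
    have e : Pr q (fun ω => ∀ i ∈ insert a F, ¬ E i ω) = Pr q (fun ω => (¬ E a ω) ∧ ∀ i ∈ F, ¬ E i ω) :=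
      Pr_congr fun ω => by simp
    rw [e, Pr_indep (S := S a) (T := ⋃ i ∈ F, S i) ?_ ?_ ?_, Pr_not, Finset.card_insert_of_notMem ha, pow_succ, mul_comm]
    · have := hκ a (Finset.mem_insert_self _ _)
      have h2 := Pr_le_one hq (E a)
      refine mul_le_mul ih' (by linarith) (by linarith) (pow_nonneg (by linarith) _)
    · simp only [Set.disjoint_iUnion_right]
      intro i hi
      exact hd a (Finset.mem_insert_self _ _) i (Finset.mem_insert_of_mem hi) (fun h => ha (h ▸ hi))
    · exact (hdep a (Finset.mem_insert_self _ _)).comp Not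
    · intro ω ω' h
      simp only [eq_iff_iff]
      refine forall₂_congr fun i hi => ?_
      rw [hdep i (Finset.mem_insert_of_mem hi) ω ω' (fun j hj => h j (by simp only [Set.mem_iUnion]; exact ⟨i, hi, hj⟩))]

end Indep

lemma pr_inj {N : ℕ} {K : ℤ} (hN : 2 * K < N) {a b : V} (ha : nrm a ≤ K) (hb : nrm b ≤ K) (h : pr N a = pr N b) : a = b := by
  rw [pr_eq_iff] at h
  simp only [nrm] at ha hb
  obtain ⟨⟨c, hc⟩, ⟨d, hd⟩⟩ := h
  have h1 : c = 0 := by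
    by_contra h0
    rcases lt_or_gt_of_ne h0 with h1 | h1
    · nlinarith [show c ≤ -1 by omega, show b.1 - a.1 ≥ -(2 * K) by omega]
    · nlinarith [show 1 ≤ c by omega, show b.1 - a.1 ≤ (2 * K) by omega]
  have h2 : d = 0 := by
    by_contra h0
    rcases lt_or_gt_of_ne h0 with h1 | h1
    · nlinarith [show d ≤ -1 by omega, show b.2 - a.2 ≥ -(2 * K) by omega]
    · nlinarith [show 1 ≤ d by omega, show b.2 - a.2 ≤ (2 * K) by omega]
  subst h1 h2
  ext <;> linarith

/-- thickened annulus -/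
def Zn (m L : ℤ) : Set V := {v | m ≤ 10 * (nrm v + L) ∧ nrm v ≤ 600 * m + L}

lemma BB_pow_lt {i j : ℕ} (h : i < j) : BB * BB ^ i ≤ BB ^ j := by
  rw [← pow_succ']; exact Nat.pow_le_pow_right (by norm_num [BB]) h

lemma zone_disj {i j : ℕ} {L : ℤ} (hL : L ≤ 400 * (BB ^ i : ℕ)) (hL' : L ≤ 400 * (BB ^ j : ℕ)) (hij : i ≠ j) : Disjoint (Zn (BB ^ i : ℕ) L) (Zn (BB ^ j : ℕ) L) := by
  rw [Set.disjoint_left]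
  rintro v ⟨h1, h2⟩ ⟨h3, h4⟩
  rcases lt_or_gt_of_ne hij with h | h
  · have h5 := BB_pow_lt h
    have : (BB : ℕ) = 16384 := rfl
    have h6 : 16384 * ((BB ^ i : ℕ) : ℤ) ≤ ((BB ^ j : ℕ) : ℤ) := by exact_mod_cast h5
    have : 1 ≤ ((BB ^ i : ℕ) : ℤ) := by exact_mod_cast Nat.one_le_pow _ _ (by norm_num [BB])
    omega
  · have h5 := BB_pow_lt h
    have : (BB : ℕ) = 16384 := rfl
    have h6 : 16384 * ((BB ^ j : ℕ) : ℤ) ≤ ((BB ^ i : ℕ) : ℤ) := by exact_mod_cast h5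
    have : 1 ≤ ((BB ^ j : ℕ) : ℤ) := by exact_mod_cast Nat.one_le_pow _ _ (by norm_num [BB])
    omega

section BondPoly
variable {N : ℕ} [NeZero N]

def bS (N : ℕ) (m : ℤ) : Set (Sym2 (VN N)) := {e | ∃ v ∈ Zn m 2, ∃ k, e = jE (pr N v, k)}

lemma dual_dep {m : ℤ} (hm : 1 ≤ m) {D : V} (hD : DOk m D) : Dep (bS N m) (fun ω => Block m D (Ast ω Set.univ)) := by
  have key : ∀ ω ω' : Sym2 (VN N) → Bool, (∀ e ∈ bS N m, ω e = ω' e) → Block m D (Ast ω Set.univ) → Block m D (Ast ω' Set.univ) := by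
    intro ω ω' h
    refine Block_local hm hD ?_
    rintro a ha b hb ⟨v, hv, k, l, hk, rfl, rfl⟩
    refine ⟨v, hv, k, l, ?_, rfl, rfl⟩
    have hz : v ∈ Zn m 2 := by
      obtain ⟨h1, h2⟩ := ha
      have : nrm (dl v k) ≤ nrm v + 2 ∧ nrm v ≤ nrm (dl v k) + 2 := by
        fin_cases k <;> simp [nrm, dl, vt, vo] <;> omega
      exact ⟨by omega, by omega⟩
    have : xb ω' (pr N v) = xb ω (pr N v) := by
      funext k
      exact (h _ ⟨v, hz, k, rfl⟩).symm
    rw [this]; exact hk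
  intro ω ω' h
  exact propext ⟨key ω ω' h, key ω' ω (fun e he => (h e he).symm)⟩

lemma bS_disj (hN3 : 3 ≤ N) {I i j : ℕ} (hN : 2 * (600 * (BB ^ I : ℕ) + 2) < N) (hi : i ∈ Finset.Icc 1 I) (hj : j ∈ Finset.Icc 1 I) (hij : i ≠ j) :
    Disjoint (bS N (BB ^ i : ℕ)) (bS N (BB ^ j : ℕ)) := by
  rw [Set.disjoint_left]
  rintro e ⟨v, hv, k, rfl⟩ ⟨v', hv', k', h⟩
  have h1 := jE_inj hN3 h
  simp only [Prod.mk.injEq] at h1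
  rw [Finset.mem_Icc] at hi hj
  have b : ∀ i ≤ I, ((BB ^ i : ℕ) : ℤ) ≤ (BB ^ I : ℕ) := fun i hi => by exact_mod_cast Nat.pow_le_pow_right (by norm_num [BB]) hi
  have b0 : ∀ i, (1 : ℤ) ≤ (BB ^ i : ℕ) := fun i => by exact_mod_cast Nat.one_le_pow _ _ (by norm_num [BB])
  have e := pr_inj (K := 600 * (BB ^ I : ℕ) + 2) (by exact_mod_cast hN) (by have := hv.2; have := b i hi.2; omega) (by have := hv'.2; have := b j hj.2; omega) h1.1
  subst e
  exact (Set.disjoint_left.1 (zone_disj (L := 2) (by have := b0 i; omega) (by have := b0 j; omega) hij)) hv hv'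

lemma Arm_pull {A : Rel} {x : V} {n : ℤ} : Arm A x n ↔ Arm (pull (fun z => z + x) A) 0 n := by
  constructor
  · rintro ⟨y, hy, h⟩
    refine ⟨y - x, by simpa using hy, ?_⟩
    have := h.map (A' := pull (fun z => z + x) A) (S' := {z | nrm (z - 0) ≤ n}) (fun z => z - x) (fun a b _ _ hab => by simpa [pull] using hab) (fun a ha => by simpa using ha)
    simpa using this
  · rintro ⟨y, hy, h⟩
    refine ⟨y + x, by simpa using hy, ?_⟩
    have := h.map (A' := A) (S' := {z | nrm (z - x) ≤ n}) (fun z => z + x) (fun a b _ _ hab => by simpa [pull] using hab) (fun a ha => by simpa using ha)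
    simpa using this

lemma Arm_trans {p : ℝ} (x : V) (n : ℤ) : Pr (fun _ : Sym2 (VN N) => p) (fun ω => Arm (BA ω) x n) = Pr (fun _ : Sym2 (VN N) => p) (fun ω => Arm (BA ω) 0 n) := by
  have := bμ_sym (N := N) (p := p) (tsym_add x) (fun A => Arm A 0 n)
  simp only [bμ] at this
  rw [← this]
  exact Pr_congr fun ω => Arm_pull

lemma kap0_le_one : kap0 ≤ 1 := by
  have h := kap_pos
  have h1 : kap ≤ 1 := by
    have : (0 : ℝ) ≤ WW := Nat.cast_nonneg _
    unfold kap; rw [div_le_one (by positivity)]; linarith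
  unfold kap0
  exact pow_le_one₀ (by positivity) (pow_le_one₀ (by positivity) (pow_le_one₀ h.le h1))

lemma bond_poly {p : ℝ} (h0 : 0 ≤ p) (h1 : p ≤ 1) (hp : 1 - 3 * p + p ^ 3 = 0) (I : ℕ) (hN : 2 * (600 * (BB ^ I : ℕ) + 2) < N) (x : V) {n : ℤ} (hn : 72 * (BB ^ I : ℕ) < n) :
    ∃ k : ℕ, 2 * I ≤ 3 * k + 9 ∧ Pr (fun _ : Sym2 (VN N) => p) (fun ω => Arm (BA ω) x n) ≤ (1 - kap0) ^ k := by
  have hN3 : 3 ≤ N := by have := Nat.one_le_pow I BB (by norm_num [BB]); omega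
  obtain ⟨F, hF, hc, hB⟩ := rsw (bond_law (N := N) hN3 h0 h1 hp) I
  refine ⟨F.card, hc, ?_⟩
  rw [Arm_trans]
  choose! D hD hDp using hB
  have hq := isP_const (ι := Sym2 (VN N)) h0 h1
  refine le_trans (Pr_mono hq ?_) (Pr_none hq F (fun i ω => Block (BB ^ i : ℕ) (D i) (Ast ω Set.univ)) (fun i => bS N (BB ^ i : ℕ))
    (fun i hi j hj hij => bS_disj hN3 hN (hF hi) (hF hj) hij) (fun i hi => dual_dep ?_ (hD i hi)) kap0_le_one
    (fun i hi => (hDp i hi).trans (dual_block_prob hN3 h0 h1 hp _ _)))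
  · rintro ω ⟨y, hy, h⟩ i hi hbl
    rw [← Dx_Ast] at hbl
    rw [← Px_BA] at h
    have hi' := hF hi
    rw [Finset.mem_Icc] at hi'
    have g1 : ((BB ^ i : ℕ) : ℤ) ≤ (BB ^ I : ℕ) := by exact_mod_cast Nat.pow_le_pow_right (by norm_num [BB]) hi'.2
    have g2 : ((BB ^ 1 : ℕ) : ℤ) ≤ (BB ^ i : ℕ) := by exact_mod_cast Nat.pow_le_pow_right (by norm_num [BB]) hi'.1
    have : ((BB ^ 1 : ℕ) : ℤ) = 16384 := by norm_num [BB]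
    have := dual_block (by omega) (hD i hi) hbl h
    simp only [sub_zero] at hy
    omega
  · exact_mod_cast Nat.one_le_pow _ _ (by norm_num [BB])

end BondPoly
end DaC

namespace DaC
open Relation

section Param
open Classical
variable {ι : Type*} [Fintype ι] {q : ι → ℝ}

/-- discrete derivative with the classical decidability instance -/
noncomputable def DF (i : ι) (f : (ι → Bool) → ℝ) : (ι → Bool) → ℝ := Dif i f

lemma russo (Q : ℝ → ι → ℝ) (Q' : ι → ℝ) (t : ℝ) (hQ : ∀ i, HasDerivAt (fun s => Q s i) (Q' i) t)
    (f : (ι → Bool) → ℝ) : HasDerivAt (fun s => Ex (Q s) f) (∑ i, Q' i * Ex (Q t) (DF i f)) t := Ex_russo Q Q' t hQ f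

lemma DF_nonneg {f : (ι → Bool) → ℝ} (h : Monotone f) (j : ι) (ω : ι → Bool) : 0 ≤ DF j f ω := by
  simp only [DF, Dif, sub_nonneg]
  refine h ?_
  intro i
  by_cases hi : i = j
  · subst hi; simp
  · simp [hi]

lemma Inf_le_Dif (hq : IsP q) (f : (ι → Bool) → ℝ) (j : ι) : Inf q f j ≤ Ex q (fun ω => |DF j f ω|) := by
  refine Ex_mono hq fun ω => ?_
  have h := hq j
  simp only [avg, DF, Dif]
  cases hj : ω j with
  | true =>
    have : Function.update ω j true = ω := by rw [← hj]; exact Function.update_eq_self _ _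
    rw [this]
    have e : f ω - (q j * f ω + (1 - q j) * f (Function.update ω j false)) = (1 - q j) * (f ω - f (Function.update ω j false)) := by ring
    rw [e, abs_mul, abs_of_nonneg (by linarith)]
    exact mul_le_of_le_one_left (abs_nonneg _) (by linarith)
  | false =>
    have : Function.update ω j false = ω := by rw [← hj]; exact Function.update_eq_self _ _
    rw [this]
    have e : f ω - (q j * f (Function.update ω j true) + (1 - q j) * f ω) = -(q j * (f (Function.update ω j true) - f ω)) := by ring
    rw [e, abs_neg, abs_mul, abs_of_nonneg (by linarith)]
    exact mul_le_of_le_one_left (abs_nonneg _) (by linarith)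

lemma param_mono {f f' : ℝ → ℝ} {a b : ℝ} (hab : a ≤ b) (hf : ∀ t ∈ Set.Icc a b, HasDerivAt f (f' t) t) (h : ∀ t ∈ Set.Icc a b, 0 ≤ f' t) : f a ≤ f b := by
  have hm : MonotoneOn f (Set.Icc a b) := by
    refine monotoneOn_of_deriv_nonneg (convex_Icc a b) (fun t ht => (hf t ht).continuousAt.continuousWithinAt) (fun t ht => (hf t (interior_subset ht)).differentiableAt.differentiableWithinAt) (fun t ht => ?_)
    rw [(hf t (interior_subset ht)).deriv]
    exact h t (interior_subset ht)
  exact hm ⟨le_rfl, hab⟩ ⟨hab, le_rfl⟩ hab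

/-- Gronwall type bound -/
lemma param_exp {f f' : ℝ → ℝ} {a b K δ : ℝ} (hab : a ≤ b) (hK : 0 < K) (hf : ∀ t ∈ Set.Icc a b, HasDerivAt f (f' t) t)
    (h : ∀ t ∈ Set.Icc a b, K * f t - δ ≤ f' t) : f a ≤ (f b - δ / K) * Real.exp (-(K * (b - a))) + δ / K := by
  have hd : ∀ t ∈ Set.Icc a b, HasDerivAt (fun t => (f t - δ / K) * Real.exp (-(K * t)))
      (f' t * Real.exp (-(K * t)) + (f t - δ / K) * (Real.exp (-(K * t)) * (-K))) t := by
    intro t ht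
    have h1 : HasDerivAt (fun t : ℝ => -(K * t)) (-K) t := by
      have := ((hasDerivAt_id t).const_mul (-K))
      simpa [neg_mul] using this
    exact ((hf t ht).sub_const _).mul h1.exp
  have := param_mono hab hd (fun t ht => by
    have h2 := h t ht
    have e : f' t * Real.exp (-(K * t)) + (f t - δ / K) * (Real.exp (-(K * t)) * (-K)) = Real.exp (-(K * t)) * (f' t - (K * f t - δ)) := by
      field_simp; ring
    rw [e]
    exact mul_nonneg (Real.exp_pos _).le (by linarith))
  have e : Real.exp (-(K * (b - a))) = Real.exp (-(K * b)) * Real.exp (K * a) := by rw [← Real.exp_add]; congr 1; ring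
  have e2 : Real.exp (-(K * a)) * Real.exp (K * a) = 1 := by rw [← Real.exp_add]; simp
  have h3 := mul_le_mul_of_nonneg_right this (Real.exp_pos (K * a)).le
  rw [mul_assoc, e2, mul_one, mul_assoc, ← e] at h3
  linarith

end Param

/-- decay ratio -/
noncomputable def mu0 : ℝ := 1 - kap0 / 3

lemma mu0_pos : 0 < mu0 := by unfold mu0; linarith [kap0_le_one]
lemma mu0_half : 1 / 2 ≤ mu0 := by unfold mu0; linarith [kap0_le_one]
lemma mu0_lt : mu0 < 1 := by unfold mu0; linarith [kap0_pos]
lemma rho_le : 1 - kap0 ≤ mu0 ^ 3 := by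
  unfold mu0
  nlinarith [kap0_pos, kap0_le_one, mul_pos kap0_pos kap0_pos, mul_nonneg (mul_pos kap0_pos kap0_pos).le (sub_nonneg.2 kap0_le_one)]

lemma rho_pow {J k : ℕ} (hJ : 9 ≤ J) (h : 2 * J ≤ 3 * k + 9) : (1 - kap0) ^ k ≤ mu0 ^ J := by
  calc (1 - kap0) ^ k ≤ (mu0 ^ 3) ^ k := pow_le_pow_left₀ (by linarith [kap0_le_one]) rho_le k
    _ = mu0 ^ (3 * k) := (pow_mul _ _ _).symm
    _ ≤ mu0 ^ J := pow_le_pow_of_le_one mu0_pos.le mu0_lt.le (by omega)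

lemma BBn_pos (i : ℕ) : 1 ≤ BB ^ i := Nat.one_le_pow _ _ (by norm_num [BB])

lemma BB_mu {mu : ℝ} (hm : 1 / 2 ≤ mu) (J : ℕ) : (BB : ℝ) ^ J ≤ (BB : ℝ) ^ (2 * J) * mu ^ J := by
  have h : (1 : ℝ) ≤ BB * mu := by norm_num [BB]; linarith
  have : (BB : ℝ) ^ (2 * J) * mu ^ J = BB ^ J * (BB * mu) ^ J := by rw [mul_pow, two_mul, pow_add]; ring
  rw [this]
  exact le_mul_of_one_le_right (by positivity) (one_le_pow₀ h)

/-- summing a decaying profile -/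
lemma sum_U {mu : ℝ} (hm : 1 / 2 ≤ mu) {U : ℕ → ℝ} {J : ℕ} {C : ℝ} (hC : 1 ≤ C) (h1 : ∀ i, U i ≤ 1) (h2 : ∀ i : ℕ, 72 * BB ^ J < i → U i ≤ C * mu ^ J) :
    ∑ i ∈ Finset.range (BB ^ (2 * J) + 1), U i ≤ 100 * C * ((BB : ℝ) ^ (2 * J) * mu ^ J) := by
  have hle : ∀ i ∈ Finset.range (BB ^ (2 * J) + 1), U i ≤ (if i ∈ Finset.range (72 * BB ^ J + 1) then 1 else 0) + C * mu ^ J := by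
    intro i hi
    have : 0 ≤ C * mu ^ J := mul_nonneg (by linarith) (pow_nonneg (by linarith : (0:ℝ) ≤ mu) _)
    split_ifs with h
    · linarith [h1 i]
    · rw [Finset.mem_range] at h; linarith [h2 i (by omega)]
  refine (Finset.sum_le_sum hle).trans ?_
  rw [Finset.sum_add_distrib, Finset.sum_const, Finset.sum_ite_mem, Finset.sum_const, Finset.card_range, nsmul_eq_mul, nsmul_eq_mul]
  have c1 : ((Finset.range (BB ^ (2 * J) + 1) ∩ Finset.range (72 * BB ^ J + 1)).card : ℝ) ≤ 72 * BB ^ J + 1 := by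
    have := Finset.card_le_card (Finset.inter_subset_right (s₁ := Finset.range (BB ^ (2 * J) + 1)) (s₂ := Finset.range (72 * BB ^ J + 1)))
    rw [Finset.card_range] at this
    exact_mod_cast this
  have c2 := BB_mu hm J
  have c3 : (1 : ℝ) ≤ BB ^ J := by exact_mod_cast BBn_pos J
  have c4 : (1 : ℝ) ≤ BB ^ (2 * J) := by exact_mod_cast BBn_pos (2 * J)
  push_cast
  have c5 : 0 ≤ C * mu ^ J := mul_nonneg (by linarith) (pow_nonneg (by linarith : (0:ℝ) ≤ mu) _)
  have c6 : (BB : ℝ) ^ (2 * J) * mu ^ J ≤ C * (BB ^ (2 * J) * mu ^ J) := le_mul_of_one_le_left (by linarith) hC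
  nlinarith

section BondSharp
variable {N : ℕ} [NeZero N]

lemma Arm_BA_inc (x : V) (n : ℤ) : IncE (fun ω : Sym2 (VN N) → Bool => Arm (BA ω) x n) := fun _ _ h => Arm.mono (BA_mono h)

lemma ind_monotone {ι : Type*} {A : (ι → Bool) → Prop} (h : IncE A) : Monotone (fun ω => ind (A ω)) := fun ω ω' hω => ind_mono (h ω ω' hω)

lemma bond_russo (p : ℝ) (E : (Sym2 (VN N) → Bool) → Prop) :
    HasDerivAt (fun t => Pr (fun _ : Sym2 (VN N) => t) E) (∑ j, Ex (fun _ : Sym2 (VN N) => p) (DF j (fun ω => ind (E ω)))) p := by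
  have := russo (fun t (_ : Sym2 (VN N)) => t) (fun _ => 1) p (fun _ => hasDerivAt_id p) (fun ω => ind (E ω))
  simpa [Pr] using this

lemma bond_mono {a b : ℝ} (h0 : 0 ≤ a) (hab : a ≤ b) (h1 : b ≤ 1) {E : (Sym2 (VN N) → Bool) → Prop} (hE : IncE E) :
    Pr (fun _ : Sym2 (VN N) => a) E ≤ Pr (fun _ : Sym2 (VN N) => b) E := by
  refine param_mono (f := fun t => Pr (fun _ : Sym2 (VN N) => t) E) hab (fun t _ => bond_russo t E) (fun t ht => ?_)
  exact Finset.sum_nonneg fun j _ => Ex_nonneg (isP_const (by linarith [ht.1]) (by linarith [ht.2])) fun ω => DF_nonneg (ind_monotone hE) j ω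

open Classical in
lemma bond_M {n : ℕ} (hN : 2 * (n : ℤ) < N) (j : Sym2 (VN N)) :
    ((Bx n ×ˢ Bx n).filter (fun e : V × V => TriAdj e.1 e.2 ∧ j ∈ ({s(pr N e.1, pr N e.2)} : Finset (Sym2 (VN N))))).card ≤ 2 := by
  classical
  induction j using Sym2.ind with
  | _ u v =>
  have : ((Bx n ×ˢ Bx n).filter (fun e : V × V => TriAdj e.1 e.2 ∧ s(u, v) ∈ ({s(pr N e.1, pr N e.2)} : Finset (Sym2 (VN N))))).card ≤ ({(u, v), (v, u)} : Finset (VN N × VN N)).card := by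
    refine Finset.card_le_card_of_injOn (fun e => (pr N e.1, pr N e.2)) ?_ ?_
    · rintro ⟨a, b⟩ h
      simp only [Finset.coe_filter, Finset.mem_singleton, Set.mem_ofPred_eq, Sym2.eq_iff] at h
      simp only [Finset.coe_insert, Finset.coe_singleton, Set.mem_insert_iff, Set.mem_singleton_iff, Prod.mk.injEq]
      rcases h.2.2 with h | h
      · left; exact ⟨h.1.symm, h.2.symm⟩
      · right; exact ⟨h.2.symm, h.1.symm⟩
    · rintro ⟨a, b⟩ h ⟨c, d⟩ h' he
      simp only [Finset.coe_filter, Finset.mem_product, mem_Bx, Set.mem_ofPred_eq] at h h'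
      simp only [Prod.mk.injEq] at he ⊢
      exact ⟨pr_inj hN h.1.1 h'.1.1 he.1, pr_inj hN h.1.2 h'.1.2 he.2⟩
  exact this.trans Finset.card_le_two

lemma bond_sharp {p p0 : ℝ} (h0 : 0 ≤ p) (hp : p < p0) (h1 : p0 ≤ 1) (hc : 1 - 3 * p0 + p0 ^ 3 = 0) {J : ℕ} (hJ : 9 ≤ J) (hN : 2000 * BB ^ (2 * J) < N) (x : V) :
    Pr (fun _ : Sym2 (VN N) => p) (fun ω => Arm (BA ω) x (BB ^ (2 * J) : ℕ)) ≤ Real.exp (-(kap0 / 1200 * (p0 - p) * (mu0⁻¹) ^ J)) := by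
  classical
  rw [Arm_trans]
  set n := BB ^ (2 * J) with hn
  have hn1 : 1 ≤ n := BBn_pos _
  have hJn : BB ^ J ≤ n := Nat.pow_le_pow_right (by norm_num [BB]) (by omega)
  set U : ℕ → ℝ := fun i => Pr (fun _ : Sym2 (VN N) => p0) (fun ω => Arm (BA ω) 0 i) with hU
  have hq0 := isP_const (ι := Sym2 (VN N)) (by linarith : 0 ≤ p0) h1
  have hpoly : ∀ i : ℕ, 72 * BB ^ J < i → U i ≤ 1 * mu0 ^ J := by
    intro i hi
    obtain ⟨k, hk, h⟩ := bond_poly (N := N) (by linarith) h1 hc J (by omega) 0 (n := i) (by exact_mod_cast hi)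
    rw [one_mul]
    exact h.trans (rho_pow hJ hk)
  have hsum := sum_U mu0_half le_rfl (fun i => Pr_le_one hq0 _) hpoly
  have hmuJ : mu0 ^ J ≤ mu0 ^ 3 := pow_le_pow_of_le_one mu0_pos.le mu0_lt.le (by omega)
  set θ : ℝ → ℝ := fun t => Pr (fun _ : Sym2 (VN N) => t) (fun ω => Arm (BA ω) 0 n) with hθ
  set K : ℝ := kap0 / 1200 * (mu0⁻¹) ^ J with hK
  have hK0 : 0 < K := by have := kap0_pos; have := mu0_pos; positivity
  have hn72 : 72 * BB ^ J < n := by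
    rw [hn, two_mul, pow_add]
    have : BB ^ 1 ≤ BB ^ J := Nat.pow_le_pow_right (by norm_num [BB]) (by omega)
    have h' : BB ^ 1 = 16384 := by norm_num [BB]
    have := BBn_pos J
    nlinarith
  have key : ∀ t ∈ Set.Icc p p0, K * θ t - 0 ≤ ∑ j, Ex (fun _ : Sym2 (VN N) => t) (DF j (fun ω => ind (Arm (BA ω) 0 n))) := by
    rintro t ⟨ht0, ht1⟩
    have hq := isP_const (ι := Sym2 (VN N)) (by linarith : 0 ≤ t) (by linarith : t ≤ 1)
    have ho := osss_arm hq (fun ω => BA ω) (fun ω => (BA_symTri ω).1) (fun ω => (BA_symTri ω).2) (fun a b => {s(pr N a, pr N b)})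
      (fun a b ω ω' h => by simp only [BA]; rw [h _ (by simp)]) n hn1 U (fun i => Pr_nonneg hq0 _)
      (fun x m => by rw [Arm_trans]; exact bond_mono (by linarith) ht1 h1 (Arm_BA_inc 0 m)) 2 (fun j => by convert bond_M (N := N) (n := n) (by exact_mod_cast (by omega : 2 * n < N)) j)
    have hI : ∑ j, Inf (fun _ : Sym2 (VN N) => t) (fun ω => ind (Arm (BA ω) 0 n)) j ≤ ∑ j, Ex (fun _ : Sym2 (VN N) => t) (DF j (fun ω => ind (Arm (BA ω) 0 n))) := by
      refine Finset.sum_le_sum fun j _ => (Inf_le_Dif hq _ j).trans (le_of_eq ?_)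
      congr 1; funext ω
      exact abs_of_nonneg (DF_nonneg (ind_monotone (Arm_BA_inc 0 n)) j ω)
    set I := ∑ j, Inf (fun _ : Sym2 (VN N) => t) (fun ω => ind (Arm (BA ω) 0 n)) j
    have hI0 : 0 ≤ I := Finset.sum_nonneg fun j _ => Inf_nonneg hq _ j
    have hθ1 : θ t ≤ 1 - kap0 / 3 := by
      have a1 : θ t ≤ U n := bond_mono (by linarith) ht1 h1 (Arm_BA_inc 0 n)
      have a2 := hpoly n hn72
      have a3 : mu0 ^ J ≤ mu0 := by simpa using pow_le_pow_of_le_one mu0_pos.le mu0_lt.le (by omega : 1 ≤ J)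
      unfold mu0 at a3 a2; linarith
    have hθ0 : 0 ≤ θ t := Pr_nonneg hq _
    have hnR : (n : ℝ) = (BB : ℝ) ^ (2 * J) := by rw [hn]; push_cast; rfl
    have hnpos : (0 : ℝ) < n := by exact_mod_cast hn1
    rw [sub_zero]
    refine le_trans ?_ hI
    have hs2 : n * (θ t * (1 - θ t)) ≤ 2 * (2 : ℕ) * (100 * 1 * (n * mu0 ^ J)) * I := by
      refine ho.trans ?_
      rw [← hnR] at hsum
      exact mul_le_mul_of_nonneg_right (mul_le_mul_of_nonneg_left hsum (by positivity)) hI0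
    have hs3 : n * (θ t * (kap0 / 3)) ≤ n * (θ t * (1 - θ t)) := by
      refine mul_le_mul_of_nonneg_left (mul_le_mul_of_nonneg_left (by linarith) hθ0) hnpos.le
    have hmu : (0 : ℝ) < mu0 ^ J := pow_pos mu0_pos J
    have hs4 : n * (θ t * (kap0 / 3)) ≤ n * (400 * mu0 ^ J * I) := by push_cast at hs2; linarith
    have hs5 := le_of_mul_le_mul_left hs4 hnpos
    rw [hK, inv_pow]
    have : kap0 / 1200 * (mu0 ^ J)⁻¹ * θ t = (θ t * kap0) / (1200 * mu0 ^ J) := by field_simp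
    rw [this, div_le_iff₀ (by positivity)]
    linarith
  have := param_exp hp.le hK0 (fun t _ => bond_russo t (fun ω => Arm (BA ω) 0 n)) key
  simp only [zero_div, sub_zero, add_zero] at this
  refine this.trans ?_
  have e : kap0 / 1200 * (p0 - p) * (mu0⁻¹) ^ J = K * (p0 - p) := by rw [hK]; ring
  rw [e]
  exact mul_le_of_le_one_left (Real.exp_pos _).le (Pr_le_one hq0 _)

end BondSharp
end DaC

namespace DaC
open Relation

section Gen
open Classical
variable {ι κ : Type*} [Fintype ι] [Fintype κ]

lemma Ex_sumtype (q : ι → ℝ) (q' : κ → ℝ) (f : (ι ⊕ κ → Bool) → ℝ) :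
    Ex (Sum.elim q q') f = Ex q (fun a => Ex q' (fun c => f (Sum.elim a c))) := by
  unfold Ex
  refine (Finset.sum_congr (by ext; simp) fun _ _ => rfl).trans ((Fintype.sum_equiv (Equiv.sumArrowEquivProdArrow ι κ Bool) _ (fun x : (ι → Bool) × (κ → Bool) => Wt (Sum.elim q q') (Sum.elim x.1 x.2) *
    f (Sum.elim x.1 x.2)) ?_).trans ?_)
  · intro ω
    have e : Sum.elim ((Equiv.sumArrowEquivProdArrow ι κ Bool) ω).1 ((Equiv.sumArrowEquivProdArrow ι κ Bool) ω).2 = ω := by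
      funext i; cases i <;> rfl
    rw [e]
  rw [Fintype.sum_prod_type]
  refine Finset.sum_congr rfl fun a _ => ?_
  show _ = _ * ∑ ω, _
  rw [Finset.mul_sum]
  refine Finset.sum_congr rfl fun c _ => ?_
  rw [← mul_assoc]
  congr 1
  unfold Wt
  rw [Fintype.prod_sum_type]
  congr 1

/-- flip some coordinates -/
def flp (T : ι → Bool) (ω : ι → Bool) : ι → Bool := fun i => xor (T i) (ω i)

lemma Ex_flip (T : ι → Bool) (q : ι → ℝ) (f : (ι → Bool) → ℝ) :
    Ex (fun i => if T i then 1 - q i else q i) (fun ω => f (flp T ω)) = Ex q f := by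
  unfold Ex
  have hinv : Function.Involutive (flp T) := fun ω => by funext i; simp [flp]
  rw [← Equiv.sum_comp (Function.Involutive.toPerm (flp T) hinv) (fun ω => Wt q ω * f ω)]
  refine Finset.sum_congr rfl fun ω _ => ?_
  have : (Function.Involutive.toPerm (flp T) hinv) ω = flp T ω := rfl
  rw [this]
  congr 1
  unfold Wt
  refine Finset.prod_congr rfl fun i _ => ?_
  cases h : T i <;> cases h' : ω i <;> simp [flp, h, h']

end Gen

section Flood
open Classical
variable {X : Type*} (G : Set (Sym2 X))

/-- open edges -/
def OE (ω : Sym2 X → Bool) : X → X → Prop := fun u v => s(u, v) ∈ G ∧ ω s(u, v) = true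

variable {G}
lemma OE_symm {ω : Sym2 X → Bool} : ∀ u v, OE G ω u v → OE G ω v u := fun u v h => by
  unfold OE at *; rw [Sym2.eq_swap]; exact h
lemma OE_mono {ω ω' : Sym2 X → Bool} (h : ω ≤ ω') : ∀ u v, OE G ω u v → OE G ω' u v := fun u v huv =>
  ⟨huv.1, h _ huv.2⟩

variable (G)
/-- cluster avoiding `R` -/
def cl (ω : Sym2 X → Bool) (R : Set X) (v : X) : Set X := {w | Cn (OE G ω) Rᶜ v w}

noncomputable def stp (β γ : Sym2 X → Bool) (c : X → Bool) (s : Set X × Set X) (v : X) : Set X × Set X :=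
  if v ∈ s.1 ∪ s.2 then s else if c v = true then (s.1 ∪ cl G β (s.1 ∪ s.2) v, s.2) else (s.1, s.2 ∪ cl G γ (s.1 ∪ s.2) v)

noncomputable def FF (β γ : Sym2 X → Bool) (c : X → Bool) (l : List X) (s : Set X × Set X) : Set X × Set X := l.foldl (stp G β γ c) s

def Inv (β γ : Sym2 X → Bool) (s : Set X × Set X) : Prop :=
  (∀ a ∈ s.1, ∀ b, b ∉ s.2 → OE G β a b → b ∈ s.1) ∧ (∀ a ∈ s.2, ∀ b, b ∉ s.1 → OE G γ a b → b ∈ s.2)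

variable {G}
variable {β γ β' γ' : Sym2 X → Bool} {c c' : X → Bool} {s s' : Set X × Set X}

lemma cl_self {R : Set X} {v : X} (h : v ∉ R) : v ∈ cl G β R v := Cn.refl h

lemma cl_sub {R K W : Set X} {v : X} (hv : v ∈ K) (hW : W ⊆ R) (hK : ∀ a ∈ K, ∀ b, b ∉ W → OE G β' a b → b ∈ K) (hb : β ≤ β') : cl G β R v ⊆ K := by
  intro w hw
  refine Cn.ind (P := fun z => z ∈ K) hw hv ?_
  intro a b _ hab hbR ha
  exact hK a ha b (fun h => hbR (hW h)) (OE_mono hb _ _ hab)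

lemma stp_inv (h : Inv G β γ s) (v : X) : Inv G β γ (stp G β γ c s v) := by
  unfold stp
  split_ifs with h1 h2
  · exact h
  · refine ⟨?_, fun a ha b hb hab => h.2 a ha b (fun hh => hb (Or.inl hh)) hab⟩
    rintro a (ha | ha) b hb hab
    · exact Or.inl (h.1 a ha b hb hab)
    · by_cases hbK : b ∈ s.1
      · exact Or.inl hbK
      · exact Or.inr (Cn.tail ha hab (by rintro (h | h); exacts [hbK h, hb h]))
  · refine ⟨fun a ha b hb hab => h.1 a ha b (fun hh => hb (Or.inl hh)) hab, ?_⟩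
    rintro a (ha | ha) b hb hab
    · exact Or.inl (h.2 a ha b hb hab)
    · by_cases hbK : b ∈ s.2
      · exact Or.inl hbK
      · exact Or.inr (Cn.tail ha hab (by rintro (h | h); exacts [hb h, hbK h]))

lemma stp_fst_sub (v : X) : s.1 ⊆ (stp G β γ c s v).1 := by
  unfold stp; split_ifs <;> simp
lemma stp_snd_sub (v : X) : s.2 ⊆ (stp G β γ c s v).2 := by
  unfold stp; split_ifs <;> simp

lemma stp_mono (hb : β ≤ β') (hg : γ' ≤ γ) (hc : c ≤ c') (hi : Inv G β γ s) (hi' : Inv G β' γ' s') (h1 : s.1 ⊆ s'.1) (h2 : s'.2 ⊆ s.2) (v : X) :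
    (stp G β γ c s v).1 ⊆ (stp G β' γ' c' s' v).1 ∧ (stp G β' γ' c' s' v).2 ⊆ (stp G β γ c s v).2 := by
  have j := stp_inv (c := c) hi v
  have j' := stp_inv (c := c') hi' v
  have m1 := stp_fst_sub (G := G) (β := β') (γ := γ') (c := c') (s := s') v
  have m2 := stp_snd_sub (G := G) (β := β) (γ := γ) (c := c) (s := s) v
  constructor
  · by_cases hv : v ∈ s.1 ∪ s.2
    · have : stp G β γ c s v = s := by unfold stp; rw [if_pos hv]
      rw [this]; exact h1.trans m1
    · by_cases hcv : c v = true
      · have e : (stp G β γ c s v).1 = s.1 ∪ cl G β (s.1 ∪ s.2) v := by unfold stp; rw [if_neg hv, if_pos hcv]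
        rw [e]
        refine Set.union_subset (h1.trans m1) ?_
        have hv2 : v ∉ s'.2 := fun h => hv (Or.inr (h2 h))
        have e2 : (stp G β' γ' c' s' v).2 = s'.2 := by unfold stp; rw [if_pos (hc v hcv)]; split_ifs <;> rfl
        have hvK : v ∈ (stp G β' γ' c' s' v).1 := by
          by_cases hvs : v ∈ s'.1
          · exact m1 hvs
          · unfold stp; rw [if_neg (by rintro (h | h); exacts [hvs h, hv2 h]), if_pos (hc v hcv)]
            exact Or.inr (cl_self (by rintro (h | h); exacts [hvs h, hv2 h]))
        exact cl_sub hvK (W := s'.2) (fun w hw => Or.inr (h2 hw)) (by rw [← e2]; exact j'.1) hb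
      · have e : (stp G β γ c s v).1 = s.1 := by unfold stp; rw [if_neg hv, if_neg hcv]
        rw [e]; exact h1.trans m1
  · by_cases hv : v ∈ s'.1 ∪ s'.2
    · have : stp G β' γ' c' s' v = s' := by unfold stp; rw [if_pos hv]
      rw [this]; exact h2.trans m2
    · by_cases hcv : c' v = true
      · have e : (stp G β' γ' c' s' v).2 = s'.2 := by unfold stp; rw [if_neg hv, if_pos hcv]
        rw [e]; exact h2.trans m2
      · have hcv' : ¬ c v = true := fun h => hcv (hc v h)
        have e : (stp G β' γ' c' s' v).2 = s'.2 ∪ cl G γ' (s'.1 ∪ s'.2) v := by unfold stp; rw [if_neg hv, if_neg hcv]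
        rw [e]
        refine Set.union_subset (h2.trans m2) ?_
        have hv2 : v ∉ s.1 := fun h => hv (Or.inl (h1 h))
        have e2 : (stp G β γ c s v).1 = s.1 := by unfold stp; rw [if_neg hcv']; split_ifs <;> rfl
        have hvK : v ∈ (stp G β γ c s v).2 := by
          by_cases hvs : v ∈ s.2
          · exact m2 hvs
          · unfold stp; rw [if_neg (by rintro (h | h); exacts [hv2 h, hvs h]), if_neg hcv']
            exact Or.inr (cl_self (by rintro (h | h); exacts [hv2 h, hvs h]))
        exact cl_sub hvK (W := s.1) (fun w hw => Or.inl (h1 hw)) (by rw [← e2]; exact j.2) hg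

lemma FF_mono (hb : β ≤ β') (hg : γ' ≤ γ) (hc : c ≤ c') (l : List X) (hi : Inv G β γ s) (hi' : Inv G β' γ' s') (h1 : s.1 ⊆ s'.1) (h2 : s'.2 ⊆ s.2) :
    (FF G β γ c l s).1 ⊆ (FF G β' γ' c' l s').1 := by
  induction l generalizing s s' with
  | nil => exact h1
  | cons v l ih =>
    obtain ⟨a, b⟩ := stp_mono hb hg hc hi hi' h1 h2 v
    exact ih (stp_inv hi v) (stp_inv hi' v) a b

/-- two configurations agreeing off `R` -/
def Agr (R : Set X) (ω ω' : Sym2 X → Bool) : Prop := ∀ u v, u ∉ R → v ∉ R → ω s(u, v) = ω' s(u, v)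

lemma cl_agr {R R' : Set X} (hR : R ⊆ R') {v : X} (h : Agr R β β') : cl G β R' v ⊆ cl G β' R' v := by
  intro w hw
  refine Cn.ind (P := fun z => Cn (OE G β') R'ᶜ v z) hw (Cn.refl hw.left) ?_
  intro a b _ hab hb ih
  refine ih.tail ⟨hab.1, ?_⟩ hb
  rw [← h a b (fun h => ih.right (hR h)) (fun h => hb (hR h))]; exact hab.2

lemma Agr.symm {R : Set X} (h : Agr R β β') : Agr R β' β := fun u v hu hv => (h u v hu hv).symm
lemma Agr.mono {R R' : Set X} (h : Agr R β β') (hR : R ⊆ R') : Agr R' β β' := fun u v hu hv => h u v (fun h => hu (hR h)) (fun h => hv (hR h))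

lemma FF_agr (l : List X) {R : Set X} (hR : R ⊆ s.1 ∪ s.2) (hb : Agr R β β') (hg : Agr R γ γ') (hc : ∀ v, v ∉ R → c v = c' v) :
    FF G β γ c l s = FF G β' γ' c' l s := by
  induction l generalizing s with
  | nil => rfl
  | cons v l ih =>
    have e : stp G β γ c s v = stp G β' γ' c' s v := by
      unfold stp
      by_cases hv : v ∈ s.1 ∪ s.2
      · rw [if_pos hv, if_pos hv]
      · rw [if_neg hv, if_neg hv, hc v (fun h => hv (hR h)), Set.Subset.antisymm (cl_agr hR hb) (cl_agr hR hb.symm),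
          Set.Subset.antisymm (cl_agr hR hg) (cl_agr hR hg.symm)]
    show FF G β γ c l (stp G β γ c s v) = FF G β' γ' c' l (stp G β' γ' c' s v)
    rw [e]
    exact ih (hR.trans (Set.union_subset_union (stp_fst_sub v) (stp_snd_sub v)))

end Flood
end DaC

namespace DaC
open Relation

section FFlaw
open Classical

lemma Ex_coin {J : Type*} [Fintype J] (q : J → ℝ) (i : J) (b : Bool) : Ex q (fun ω => ind (ω i = b)) = if b then q i else 1 - q i := by
  rw [← Ex_avg i]
  have : avg q i (fun ω => ind (ω i = b)) = fun _ => if b then q i else 1 - q i := by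
    funext ω; cases b <;> simp [avg, ind]
  rw [this, Ex_const]

variable {X : Type*} {G : Set (Sym2 X)}

lemma cl_dep {ω ω' : Sym2 X → Bool} {R C : Set X} {v : X} (h : ∀ a ∈ C, ∀ b, ω s(a, b) = ω' s(a, b)) (hC : cl G ω R v = C) : cl G ω' R v = C := by
  by_cases hv : v ∈ R
  · have : ∀ ω : Sym2 X → Bool, cl G ω R v = ∅ := by
      intro ω; ext w; constructor
      · intro hw; exact absurd hv hw.left
      · intro h; exact h.elim
    rw [this] at hC ⊢; exact hC
  have hvC : v ∈ C := by rw [← hC]; exact cl_self hv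
  apply Set.Subset.antisymm
  · intro w hw
    refine Cn.ind (P := fun z => z ∈ C) hw hvC ?_
    intro a b _ hab hb ha
    have h1 := h a ha b
    rw [← hC] at ha ⊢
    exact Cn.tail ha ⟨hab.1, h1.trans hab.2⟩ hb
  · intro w hw
    rw [← hC] at hw
    refine (Cn.ind (P := fun z => z ∈ C ∧ z ∈ cl G ω' R v) hw ⟨hvC, cl_self hv⟩ ?_).2
    rintro a b h0 hab hb ⟨ha, ha'⟩
    refine ⟨?_, Cn.tail ha' ⟨hab.1, (h a ha b).symm.trans hab.2⟩ hb⟩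
    rw [← hC]; exact Cn.tail h0 hab hb

/-- new state -/
def ns (s : Set X × Set X) (b : Bool) (C : Set X) : Set X × Set X := if b then (s.1 ∪ C, s.2) else (s.1, s.2 ∪ C)

lemma ns_un (s : Set X × Set X) (b : Bool) (C : Set X) : (ns s b C).1 ∪ (ns s b C).2 = s.1 ∪ s.2 ∪ C := by
  cases b
  · simp [ns, Set.union_assoc]
  · simp [ns, Set.union_right_comm]

variable [Fintype X]

variable (G) in
/-- the value function -/
noncomputable def Hv (p r : ℝ) (f : Set X × Set X → ℝ) : List X → Set X × Set X → ℝ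
  | [], s => f s
  | v :: l, s => if v ∈ s.1 ∪ s.2 then Hv p r f l s else
      ∑ b : Bool, ∑ C : Set X, ((if b then r else 1 - r) * Pr (fun _ : Sym2 X => p) (fun ω => cl G ω (s.1 ∪ s.2) v = C)) * Hv p r f l (ns s b C)

lemma FF_law {J : Type*} [Fintype J] (q : J → ℝ) (p r : ℝ) (jb : Bool → Sym2 X → J) (jc : X → J) (h1 : ∀ b b' e e', jb b e = jb b' e' → e = e')
    (h2 : Function.Injective jc) (h3 : ∀ b e x, jb b e ≠ jc x) (hp : ∀ b e, q (jb b e) = p) (hr : ∀ x, q (jc x) = r) (f : Set X × Set X → ℝ) (l : List X) (s : Set X × Set X) :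
    Ex q (fun ω => f (FF G (ω ∘ jb true) (ω ∘ jb false) (ω ∘ jc) l s)) = Hv G p r f l s := by
  induction l generalizing s with
  | nil => show Ex q (fun _ => f s) = f s; exact Ex_const _
  | cons v l ih =>
    unfold Hv
    split_ifs with hv
    · rw [← ih s]
      congr 1; funext ω
      show f (FF G _ _ _ l (stp G _ _ _ s v)) = _
      unfold stp; rw [if_pos hv]
    set R := s.1 ∪ s.2 with hR
    have key : ∀ ω : J → Bool, f (FF G (ω ∘ jb true) (ω ∘ jb false) (ω ∘ jc) (v :: l) s) = ∑ b : Bool, ∑ C : Set X,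
        (ind (ω (jc v) = b) * ind (cl G (ω ∘ jb b) R v = C)) * f (FF G (ω ∘ jb true) (ω ∘ jb false) (ω ∘ jc) l (ns s b C)) := by
      intro ω
      have e : FF G (ω ∘ jb true) (ω ∘ jb false) (ω ∘ jc) (v :: l) s = FF G (ω ∘ jb true) (ω ∘ jb false) (ω ∘ jc) l (ns s (ω (jc v)) (cl G (ω ∘ jb (ω (jc v))) R v)) := by
        show FF G _ _ _ l (stp G _ _ _ s v) = _
        unfold stp; rw [if_neg hv]
        congr 1
        cases h : ω (jc v) <;> simp [h, ns, hR]
      rw [e, Finset.sum_eq_single (ω (jc v)), Finset.sum_eq_single (cl G (ω ∘ jb (ω (jc v))) R v)]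
      · simp [ind]
      · intro C _ hC; rw [show ind (cl G (ω ∘ jb (ω (jc v))) R v = C) = 0 from ind_of_not (Ne.symm hC)]; ring
      · simp
      · intro b _ hb
        refine Finset.sum_eq_zero fun C _ => ?_
        rw [show ind (ω (jc v) = b) = 0 from ind_of_not (Ne.symm hb)]; ring
      · simp
    simp only [key]
    rw [Ex_sum]
    refine Finset.sum_congr rfl fun b _ => ?_
    rw [Ex_sum]
    refine Finset.sum_congr rfl fun C _ => ?_
    have hinj : ∀ b, Function.Injective (jb b) := fun b e e' h => h1 b b e e' h
    have hcl : Ex q (fun ω => ind (cl G (ω ∘ jb b) R v = C)) = Pr (fun _ : Sym2 X => p) (fun ω => cl G ω R v = C) := by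
      rw [Ex_marg q (jb b) (hinj b) (fun ω => ind (cl G ω R v = C))]
      unfold Pr; congr 1; funext e; exact hp b e
    have hfac : Ex q (fun ω => ind (ω (jc v) = b) * ind (cl G (ω ∘ jb b) R v = C)) = (if b then r else 1 - r) * Pr (fun _ : Sym2 X => p) (fun ω => cl G ω R v = C) := by
      rw [Ex_indep (S := {jc v}) (T := Set.range (jb b)), hcl, Ex_coin, hr]
      · rw [Set.disjoint_singleton_left]; rintro ⟨e, he⟩; exact h3 _ _ _ he
      · intro ω ω' h; simp only [h (jc v) rfl]
      · intro ω ω' h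
        have : ω ∘ jb b = ω' ∘ jb b := by funext e; exact h _ ⟨e, rfl⟩
        simp only [this]
    by_cases hvC : v ∈ C
    · rw [← ih (ns s b C), ← hfac]
      refine Ex_indep (S := {jc v} ∪ jb b '' {e | ∃ a ∈ C, a ∈ e}) (T := {j | (∃ b', ∃ e, (∀ a ∈ e, a ∉ R ∪ C) ∧ j = jb b' e) ∨ ∃ x, x ∉ R ∪ C ∧ j = jc x}) ?_ ?_ ?_
      · rw [Set.disjoint_left]
        rintro j (rfl | ⟨e, ⟨a, ha, hae⟩, rfl⟩) (⟨b', e', he', hj⟩ | ⟨x, hx, hj⟩)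
        · exact h3 _ _ _ hj.symm
        · exact hx (Or.inr (h2 hj ▸ hvC))
        · have := h1 _ _ _ _ hj; subst this; exact he' a hae (Or.inr ha)
        · exact h3 _ _ _ hj
      · intro ω ω' h
        have e1 := h (jc v) (Or.inl rfl)
        have e2 : ∀ a ∈ C, ∀ b', (ω ∘ jb b) s(a, b') = (ω' ∘ jb b) s(a, b') := fun a ha b' => h _ (Or.inr ⟨_, ⟨a, ha, by simp⟩, rfl⟩)
        have e3 : (cl G (ω ∘ jb b) R v = C) = (cl G (ω' ∘ jb b) R v = C) := propext ⟨cl_dep e2, cl_dep fun a ha b' => (e2 a ha b').symm⟩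
        simp only [e1, e3]
      · intro ω ω' h
        have hE : ∀ b', Agr (R ∪ C) (ω ∘ jb b') (ω' ∘ jb b') := by
          intro b' x y hx hy
          refine h _ (Or.inl ⟨b', s(x, y), ?_, rfl⟩)
          intro a ha; rcases Sym2.mem_iff.1 ha with rfl | rfl <;> assumption
        show f _ = f _
        have hc : ∀ x, x ∉ R ∪ C → (ω ∘ jc) x = (ω' ∘ jc) x := fun x hx => h _ (Or.inr ⟨x, hx, rfl⟩)
        rw [FF_agr (s := ns s b C) (c := ω ∘ jc) (c' := ω' ∘ jc) l (by rw [ns_un]) (hE true) (hE false) hc]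
    · have : ∀ ω : Sym2 X → Bool, ¬ cl G ω R v = C := fun ω h => hvC (h ▸ cl_self hv)
      have e1 : Pr (fun _ : Sym2 X => p) (fun ω => cl G ω R v = C) = 0 := by
        unfold Pr; simp only [ind_of_not (this _)]; exact Ex_const _
      rw [e1]; simp only [ind_of_not (this _)]; rw [mul_zero, zero_mul]; simp [Ex_const]

end FFlaw
end DaC

namespace DaC
open Relation

section Rep
open Classical
variable {X : Type*} {G : Set (Sym2 X)} {rk : X → ℕ}

variable (G rk) in
/-- representative of the cluster of `v` off `R` -/
noncomputable def rp (ω : Sym2 X → Bool) (R : Set X) (v : X) : X :=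
  if h : (cl G ω R v).Nonempty then Function.argminOn rk (cl G ω R v) h else v

variable {ω : Sym2 X → Bool} {R : Set X} {u v w : X}

lemma rp_mem (hv : v ∉ R) : rp G rk ω R v ∈ cl G ω R v := by
  have h : (cl G ω R v).Nonempty := ⟨v, cl_self hv⟩
  unfold rp; rw [dif_pos h]; exact Function.argminOn_mem _ _ _
lemma rp_le (hw : w ∈ cl G ω R v) : rk (rp G rk ω R v) ≤ rk w := by
  have h : (cl G ω R v).Nonempty := ⟨w, hw⟩
  unfold rp; rw [dif_pos h]; exact Function.argminOn_le _ _ hw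
lemma rp_uniq (hi : Function.Injective rk) (hw : w ∈ cl G ω R v) (h : ∀ u ∈ cl G ω R v, rk w ≤ rk u) : rp G rk ω R v = w := by
  have hv : v ∉ R := hw.left
  exact hi (le_antisymm (rp_le hw) (h _ (rp_mem hv)))
lemma cl_eq (h : w ∈ cl G ω R v) : cl G ω R w = cl G ω R v := by
  ext z
  exact ⟨fun hz => Cn.trans h hz, fun hz => (Cn.symm OE_symm h).trans hz⟩
lemma rp_eq (h : w ∈ cl G ω R v) : rp G rk ω R w = rp G rk ω R v := by
  have e := cl_eq h
  have h1 : (cl G ω R v).Nonempty := ⟨w, h⟩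
  unfold rp; simp only [e, h1, dif_pos]
lemma rp_congr {ω' : Sym2 X → Bool} {R' : Set X} (h : cl G ω R v = cl G ω' R' v) : rp G rk ω R v = rp G rk ω' R' v := by
  unfold rp; simp only [h]
lemma rp_idem : rp G rk ω ∅ (rp G rk ω ∅ v) = rp G rk ω ∅ v := rp_eq (rp_mem (by simp))
lemma mem_cl_of_rp (h : rp G rk ω ∅ v = rp G rk ω ∅ w) : w ∈ cl G ω ∅ v := by
  have h1 : rp G rk ω ∅ v ∈ cl G ω ∅ v := rp_mem (by simp)
  have h2 : rp G rk ω ∅ w ∈ cl G ω ∅ w := rp_mem (by simp)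
  rw [h] at h1
  exact Cn.trans h1 (Cn.symm OE_symm h2)

lemma FF_rp (hi : Function.Injective rk) (c : X → Bool) (l : List X) (hl : ∀ l1 v l2, l = l1 ++ v :: l2 → ∀ u, rk u < rk v → u ∈ l1) :
    FF G ω ω c l (∅, ∅) = ({w | rp G rk ω ∅ w ∈ l ∧ c (rp G rk ω ∅ w) = true}, {w | rp G rk ω ∅ w ∈ l ∧ ¬ c (rp G rk ω ∅ w) = true}) := by
  induction l using List.reverseRecOn with
  | nil => simp [FF]
  | append_singleton l v ih =>
    have ih' := ih (fun l1 v' l2 h u hu => hl l1 v' (l2 ++ [v]) (by simp [h]) u hu)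
    have hlt : ∀ u, rk u < rk v → u ∈ l := hl l v [] (by simp)
    have e : FF G ω ω c (l ++ [v]) (∅, ∅) = stp G ω ω c (FF G ω ω c l (∅, ∅)) v := by simp [FF]
    rw [e, ih']
    set K : Set X := {w | rp G rk ω ∅ w ∈ l ∧ c (rp G rk ω ∅ w) = true} with hK
    set W : Set X := {w | rp G rk ω ∅ w ∈ l ∧ ¬ c (rp G rk ω ∅ w) = true} with hW
    have hU : ∀ w, w ∈ K ∪ W ↔ rp G rk ω ∅ w ∈ l := by
      intro w; simp only [hK, hW, Set.mem_union, Set.mem_ofPred_eq]; tauto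
    by_cases hv : rp G rk ω ∅ v ∈ l
    · have hs : stp G ω ω c (K, W) v = (K, W) := by unfold stp; rw [if_pos ((hU v).2 hv)]
      rw [hs]
      have : ∀ w, rp G rk ω ∅ w ∈ l ++ [v] ↔ rp G rk ω ∅ w ∈ l := by
        intro w
        rw [List.mem_append, List.mem_singleton]
        refine ⟨?_, Or.inl⟩
        rintro (h | h)
        · exact h
        · have := rp_idem (G := G) (rk := rk) (ω := ω) (v := w)
          rw [h] at this ⊢; rw [this] at hv; exact hv
      simp only [this]; rfl
    · have hvv : rp G rk ω ∅ v = v := by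
        by_contra hne
        have h1 : rk (rp G rk ω ∅ v) ≤ rk v := rp_le (cl_self (by simp))
        exact hv (hlt _ (lt_of_le_of_ne h1 fun h => hne (hi h)))
      have hcl : cl G ω (K ∪ W) v = {w | rp G rk ω ∅ w = v} := by
        have hcon : ∀ w, rp G rk ω ∅ w = v → w ∉ K ∪ W := fun w hw h => hv (by rw [hvv, ← hw]; exact (hU w).1 h)
        apply Set.Subset.antisymm
        · intro w hw
          have : w ∈ cl G ω ∅ v := Cn.mono hw (fun _ _ h => h) (by simp)
          show rp G rk ω ∅ w = v
          rw [rp_eq this, hvv]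
        · intro w hw
          have h1 : w ∈ cl G ω ∅ v := mem_cl_of_rp (by rw [hvv]; exact (show rp G rk ω ∅ w = v from hw).symm)
          refine (Cn.ind (P := fun z => z ∈ cl G ω (K ∪ W) v) h1 (cl_self (hcon v hvv)) ?_)
          intro a b _ hab _ ha
          have hb : b ∈ cl G ω ∅ v := Cn.tail (Cn.mono ha (fun _ _ h => h) (by simp)) hab (by simp)
          exact Cn.tail ha hab (hcon b (by rw [rp_eq hb, hvv]))
      have hnu : v ∉ K ∪ W := fun h => hv ((hU v).1 h)
      unfold stp; rw [if_neg hnu, hcl]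
      split_ifs with hc
      · ext w <;> simp only [hK, hW, Set.mem_union, Set.mem_ofPred_eq, List.mem_append, List.mem_singleton]
        · constructor
          · rintro (h | h)
            · exact ⟨Or.inl h.1, h.2⟩
            · rw [h]; exact ⟨Or.inr rfl, hc⟩
          · rintro ⟨h | h, h'⟩
            · exact Or.inl ⟨h, h'⟩
            · exact Or.inr h
        · constructor
          · rintro h; exact ⟨Or.inl h.1, h.2⟩
          · rintro ⟨h | h, h'⟩
            · exact ⟨h, h'⟩
            · rw [h] at h'; exact absurd hc h'
      · ext w <;> simp only [hK, hW, Set.mem_union, Set.mem_ofPred_eq, List.mem_append, List.mem_singleton]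
        · constructor
          · rintro h; exact ⟨Or.inl h.1, h.2⟩
          · rintro ⟨h | h, h'⟩
            · exact ⟨h, h'⟩
            · rw [h] at h'; exact absurd h' hc
        · constructor
          · rintro (h | h)
            · exact ⟨Or.inl h.1, h.2⟩
            · rw [h]; exact ⟨Or.inr rfl, hc⟩
          · rintro ⟨h | h, h'⟩
            · exact Or.inl ⟨h, h'⟩
            · exact Or.inr h

/-- the density -/
def dq (p r : ℝ) : Sym2 X ⊕ X → ℝ := Sum.elim (fun _ => p) (fun _ => r)

lemma isP_dq {p r : ℝ} (h0 : 0 ≤ p) (h1 : p ≤ 1) (h2 : 0 ≤ r) (h3 : r ≤ 1) : IsP (dq (X := X) p r) := by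
  rintro (i | i)
  · exact ⟨h0, h1⟩
  · exact ⟨h2, h3⟩

/-- a choice of representatives -/
def IsRep (G : Set (Sym2 X)) (ω : Sym2 X → Bool) (ρ : X → X) : Prop := (∀ v, ρ v ∈ cl G ω ∅ v) ∧ ∀ u v, u ∈ cl G ω ∅ v → ρ u = ρ v

variable [Fintype X]

lemma exists_sorted (rk : X → ℕ) : ∃ l : List X, (∀ v, v ∈ l) ∧ ∀ l1 v l2, l = l1 ++ v :: l2 → ∀ u, rk u < rk v → u ∈ l1 := by
  have hm : ∀ v, v ∈ (Finset.univ.toList : List X).mergeSort (fun a b => decide (rk a ≤ rk b)) := by intro v; simp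
  refine ⟨_, hm, ?_⟩
  intro l1 v l2 h u hu
  have hp := List.pairwise_mergeSort (le := fun a b => decide (rk a ≤ rk b)) (fun a b c => by simp; omega) (fun a b => by simp; omega) (Finset.univ.toList : List X)
  have hmu := hm u
  rw [h] at hp hmu
  rcases List.mem_append.1 hmu with h1 | h1
  · exact h1
  · rcases List.mem_cons.1 h1 with h1 | h1
    · subst h1; omega
    · have := List.pairwise_cons.1 (List.pairwise_append.1 hp).2.1
      have := this.1 u h1
      simp at this; omega

variable (G rk) in
/-- the black set -/
def sg (x : Sym2 X ⊕ X → Bool) : Set X := {v | x (Sum.inr (rp G rk (x ∘ Sum.inl) ∅ v)) = true}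

lemma dac_fkg (hi : Function.Injective rk) {p r : ℝ} (h0 : 0 ≤ p) (h1 : p ≤ 1) (h2 : 0 ≤ r) (h3 : r ≤ 1) {E F : Set X → Prop}
    (hE : ∀ A B, A ⊆ B → E A → E B) (hF : ∀ A B, A ⊆ B → F A → F B) :
    Pr (dq p r) (fun x => E (sg G rk x)) * Pr (dq p r) (fun x => F (sg G rk x)) ≤ Pr (dq p r) (fun x => E (sg G rk x) ∧ F (sg G rk x)) := by
  obtain ⟨l, hl, hl2⟩ := exists_sorted rk
  have hsg : ∀ x : Sym2 X ⊕ X → Bool, sg G rk x = (FF G (x ∘ Sum.inl) (x ∘ Sum.inl) (x ∘ Sum.inr) l (∅, ∅)).1 := by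
    intro x; rw [FF_rp hi _ l hl2]; ext w; simp [sg, hl]
  let q' : (Bool × Sym2 X) ⊕ X → ℝ := Sum.elim (fun _ => p) (fun _ => r)
  let T : (Bool × Sym2 X) ⊕ X → Bool := Sum.elim (fun e => !e.1) (fun _ => false)
  let q'' : (Bool × Sym2 X) ⊕ X → ℝ := fun i => if T i then 1 - q' i else q' i
  let Φ : ((Bool × Sym2 X) ⊕ X → Bool) → Set X := fun y => (FF G (y ∘ fun e => Sum.inl (true, e)) (y ∘ fun e => Sum.inl (false, e)) (y ∘ Sum.inr) l (∅, ∅)).1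
  have key : ∀ E : Set X → Prop, Pr (dq p r) (fun x => E (sg G rk x)) = Pr q'' (fun y => E (Φ (flp T y))) := by
    intro E
    have a1 := FF_law (G := G) (dq (X := X) p r) p r (fun _ => Sum.inl) Sum.inr (fun _ _ e e' h => Sum.inl_injective h) Sum.inr_injective
      (fun _ _ _ h => by cases h) (fun _ _ => rfl) (fun _ => rfl) (fun s => ind (E s.1)) l (∅, ∅)
    have a2 := FF_law (G := G) q' p r (fun b e => Sum.inl (b, e)) Sum.inr (fun _ _ e e' h => by simpa using congrArg Prod.snd (Sum.inl_injective h)) Sum.inr_injective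
      (fun _ _ _ h => by cases h) (fun _ _ => rfl) (fun _ => rfl) (fun s => ind (E s.1)) l (∅, ∅)
    have a3 := Ex_flip T q' (fun y => ind (E (Φ y)))
    unfold Pr
    simp only [hsg]
    exact a1.trans (a2.symm.trans a3.symm)
  have hq : IsP q'' := by
    rintro (⟨b, e⟩ | i)
    · cases b
      · simp [q'', T, q', h0, h1]
      · simp [q'', T, q', h0, h1]
    · simp [q'', T, q', h2, h3]
  have hmono : ∀ y y', y ≤ y' → Φ (flp T y) ⊆ Φ (flp T y') := by
    intro y y' h
    have hinv : ∀ β γ : Sym2 X → Bool, Inv G β γ (∅, ∅) := fun β γ => ⟨fun a ha => ha.elim, fun a ha => ha.elim⟩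
    refine FF_mono (s := (∅, ∅)) (s' := (∅, ∅)) ?_ ?_ ?_ l (hinv _ _) (hinv _ _) subset_rfl subset_rfl
    · intro e; have := h (Sum.inl (true, e)); simpa [flp, T] using this
    · intro e; have := h (Sum.inl (false, e))
      simp only [flp, T, Function.comp, Sum.elim_inl]
      revert this; cases y (Sum.inl (false, e)) <;> cases y' (Sum.inl (false, e)) <;> simp
    · intro e; have := h (Sum.inr e); simpa [flp, T] using this
  rw [key E, key F, key (fun s => E s ∧ F s)]
  exact Pr_harris hq (fun y y' h => hE _ _ (hmono y y' h)) (fun y y' h => hF _ _ (hmono y y' h))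

lemma rep_indep {ρ ρ' : X → X} (h : IsRep G ω ρ) (h' : IsRep G ω ρ') (r : ℝ) (f : (X → Bool) → ℝ) :
    Ex (fun _ : X => r) (fun c => f (c ∘ ρ)) = Ex (fun _ : X => r) (fun c => f (c ∘ ρ')) := by
  have i1 : ∀ v, ρ (ρ v) = ρ v := fun v => h.2 _ _ (h.1 v)
  have i2 : ∀ v, ρ' (ρ' v) = ρ' v := fun v => h'.2 _ _ (h'.1 v)
  have i3 : ∀ v, ρ (ρ' v) = ρ v := fun v => h.2 _ _ (h'.1 v)
  have i4 : ∀ v, ρ' (ρ v) = ρ' v := fun v => h'.2 _ _ (h.1 v)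
  let π : X → X := fun x => if x = ρ x then ρ' x else if x = ρ' x then ρ x else x
  have hinv : Function.Involutive π := by
    intro x
    simp only [π]
    by_cases a : x = ρ x
    · rw [if_pos a, i3, i2, if_pos rfl]
      by_cases b : ρ' x = ρ x
      · rw [if_pos b]; rw [b, ← a]
      · rw [if_neg b, ← a]
    · rw [if_neg a]
      by_cases b : x = ρ' x
      · rw [if_pos b, i1, i4, if_pos rfl, ← b]
      · simp only [if_neg b, if_neg a]
  have hπ : π ∘ ρ = ρ' := by
    funext v; simp only [π, Function.comp, i1, i4, if_true]
  have := Ex_perm (q := fun _ : X => r) (Function.Involutive.toPerm π hinv) (fun _ => rfl) (fun c => f (c ∘ ρ))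
  rw [← this]
  congr 1; funext c
  rw [← hπ]; rfl

end Rep
end DaC

namespace DaC
open Relation

section Sym
open Classical
variable {X : Type*} {G : Set (Sym2 X)} {rk : X → ℕ}

lemma rp_isRep (ω : Sym2 X → Bool) : IsRep G ω (rp G rk ω ∅) := ⟨fun v => rp_mem (by simp), fun u v h => rp_eq h⟩

variable [Fintype X]

lemma Ex_dq (p r : ℝ) (f : (Sym2 X ⊕ X → Bool) → ℝ) : Ex (dq p r) f = Ex (fun _ => p) (fun a => Ex (fun _ => r) (fun c => f (Sum.elim a c))) := by
  rw [← Ex_sumtype]; rfl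

def sE (e : X ≃ X) : Sym2 X ≃ Sym2 X where
  toFun := Sym2.map e
  invFun := Sym2.map e.symm
  left_inv := fun z => by rw [Sym2.map_map]; simp
  right_inv := fun z => by rw [Sym2.map_map]; simp

lemma cl_map (e : X ≃ X) (he : ∀ z, Sym2.map e z ∈ G ↔ z ∈ G) (ω : Sym2 X → Bool) (u v : X) : e u ∈ cl G ω ∅ (e v) ↔ u ∈ cl G (ω ∘ sE e) ∅ v := by
  constructor
  · intro h
    have := Cn.map (A' := OE G (ω ∘ sE e)) (S' := ∅ᶜ) e.symm h (fun a b ha hb hab => ?_) (by simp)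
    · simp only [Equiv.symm_apply_apply] at this; exact this
    · refine ⟨(he _).1 (by simpa using hab.1), by simpa [sE] using hab.2⟩
  · intro h
    exact Cn.map (A' := OE G ω) (S' := ∅ᶜ) e h (fun a b ha hb hab => ⟨(he s(a, b)).2 hab.1, hab.2⟩) (by simp)

lemma sg_sym (e : X ≃ X) (he : ∀ z, Sym2.map e z ∈ G ↔ z ∈ G) (p r : ℝ) (E : Set X → Prop) :
    Pr (dq p r) (fun x => E (e ⁻¹' sg G rk x)) = Pr (dq p r) (fun x => E (sg G rk x)) := by
  unfold Pr
  rw [Ex_dq, Ex_dq]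
  rw [← Ex_perm (q := fun _ : Sym2 X => p) (sE e) (fun _ => rfl) (fun a => Ex (fun _ => r) (fun c => ind (E (sg G rk (Sum.elim a c)))))]
  congr 1; funext ω
  have hrep : IsRep G (ω ∘ sE e) (fun v => e.symm (rp G rk ω ∅ (e v))) := by
    constructor
    · intro v
      rw [← cl_map e he, e.apply_symm_apply]; exact rp_mem (by simp)
    · intro u v h
      rw [← cl_map e he] at h
      simp only [rp_eq h]
  have h1 := rep_indep hrep (rp_isRep (rk := rk) (ω ∘ sE e)) r (fun s => ind (E {v | s v = true}))
  have h2 := Ex_perm (q := fun _ : X => r) e (fun _ => rfl) (fun c => ind (E {v | (c ∘ (fun v => e.symm (rp G rk ω ∅ (e v)))) v = true}))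
  refine Eq.trans ?_ (h2.trans (h1.trans ?_))
  · congr 1; funext c
    congr 2
    simp [sg, Function.comp_def]
  · rfl

lemma sg_flip (p r : ℝ) (E : Set X → Prop) : Pr (dq p (1 - r)) (fun x => E (sg G rk x)ᶜ) = Pr (dq p r) (fun x => E (sg G rk x)) := by
  have := Ex_flip (Sum.elim (fun _ : Sym2 X => false) (fun _ : X => true)) (dq (X := X) p r) (fun x => ind (E (sg G rk x)))
  unfold Pr
  rw [← this]
  congr 1
  · funext i; cases i <;> simp [dq]
  · funext x
    have e : flp (Sum.elim (fun _ : Sym2 X => false) (fun _ : X => true)) x ∘ Sum.inl = x ∘ Sum.inl := by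
      funext z; simp [flp]
    have e2 : (sg G rk x)ᶜ = sg G rk (flp (Sum.elim (fun _ : Sym2 X => false) (fun _ : X => true)) x) := by
      ext v
      simp only [sg, e, Set.mem_compl_iff, Set.mem_ofPred_eq]
      simp [flp]
    show ind (E (sg G rk x)ᶜ) = _
    rw [e2]

end Sym

section TorusD
open Classical
variable {N : ℕ}

variable (N) in
def GT : Set (Sym2 (VN N)) := {z | ∃ a b, TriAdj a b ∧ z = s(pr N a, pr N b)}
/-- lift to the plane -/
def lft (x : VN N) : V := (x.1.valMinAbs, x.2.valMinAbs)
variable (N) in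
def rkT (x : VN N) : ℕ := Encodable.encode (lft x)

lemma pr_lft (x : VN N) : pr N (lft x) = x := by
  ext <;> simp [pr, lft]
lemma rkT_inj : Function.Injective (rkT N) := fun x y h => by
  have := Encodable.encode_injective h
  rw [← pr_lft x, this, pr_lft]
lemma lft_pr [NeZero N] {K : ℤ} (hN : 2 * K < N) {a : V} (ha : nrm a ≤ K) : lft (pr N a) = a := by
  unfold nrm at ha
  ext
  · simp only [lft, pr]; rw [ZMod.valMinAbs_spec]
    exact ⟨rfl, by constructor <;> omega⟩
  · simp only [lft, pr]; rw [ZMod.valMinAbs_spec]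
    exact ⟨rfl, by constructor <;> omega⟩

/-- site relation -/
def SA (S : Set (VN N)) : Rel := fun a b => TriAdj a b ∧ pr N a ∈ S ∧ pr N b ∈ S

lemma SA_symTri (S : Set (VN N)) : SymTri (SA S) := ⟨fun _ _ h => ⟨h.1.symm, h.2.2, h.2.1⟩, fun _ _ h => h.1⟩
lemma SA_mono {S T : Set (VN N)} (h : S ⊆ T) : ∀ a b, SA S a b → SA T a b := fun _ _ hab => ⟨hab.1, h hab.2.1, h hab.2.2⟩

variable [NeZero N]

variable (N) in
noncomputable abbrev sT (x : Sym2 (VN N) ⊕ VN N → Bool) : Set (VN N) := sg (GT N) (rkT N) x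

variable (N) in
noncomputable def dμ (p r : ℝ) (E : Rel → Prop) : ℝ := Pr (dq p r) (fun x => E (SA (sT N x)))

lemma dμ_sym {g : V → V} (hg : TSym N g) (p r : ℝ) (E : Rel → Prop) : dμ N p r (fun A => E (pull g A)) = dμ N p r E := by
  obtain ⟨e, h1, h2⟩ := hg
  have hsub : Sym2.map e '' GT N ⊆ GT N := by
    rintro _ ⟨_, ⟨a, b, hab, rfl⟩, rfl⟩
    exact ⟨g a, g b, (h2 a b).2 hab, by simp [h1]⟩
  have hinj : Function.Injective (Sym2.map e) := Sym2.map.injective e.injective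
  have heq : Sym2.map e '' GT N = GT N := by
    refine Set.eq_of_subset_of_ncard_le hsub ?_ (Set.toFinite _)
    rw [Set.ncard_image_of_injective _ hinj]
  have he : ∀ z, Sym2.map e z ∈ GT N ↔ z ∈ GT N := by
    intro z
    constructor
    · intro h; rw [← heq] at h; obtain ⟨y, hy, hyz⟩ := h; rw [← hinj hyz]; exact hy
    · intro h; rw [← heq]; exact ⟨z, h, rfl⟩
  unfold dμ
  rw [← sg_sym (G := GT N) (rk := rkT N) e he p r (fun S => E (SA S))]
  apply Pr_congr
  intro x
  have : pull g (SA (sT N x)) = SA (e ⁻¹' sT N x) := by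
    funext a b
    simp only [pull, SA, h1, h2]; rfl
  show E (pull g (SA (sT N x))) ↔ _
  rw [this]

lemma dμ_half {p : ℝ} (h0 : 0 ≤ p) (h1 : p ≤ 1) (n : ℕ) : 1 / 2 ≤ dμ N p (1 / 2) (Cr (BoxC 0 n) {z | z.1 = -n} {z | z.1 = n}) := by
  set E : Rel → Prop := Cr (BoxC 0 n) {z | z.1 = -n} {z | z.1 = n} with hE
  have hq := isP_dq (X := VN N) h0 h1 (r := 1 / 2) (by norm_num) (by norm_num)
  have key : ∀ x : Sym2 (VN N) ⊕ VN N → Bool, E (SA (sT N x)) ∨ E (pull Prod.swap (SA (sT N x)ᶜ)) := by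
    intro x
    rcases hex (fun z => pr N z ∈ sT N x) (-n) n (-n) n (by omega) (by omega) with ⟨u, v, hu, hv, h⟩ | ⟨u, v, hu, hv, h⟩
    · left
      refine ⟨u, hu, v, hv, ?_⟩
      refine Cn.map (A' := SA (sT N x)) (S' := BoxC 0 n) id h ?_ ?_
      · intro a b ha hb hab; exact ⟨hab, ha.2, hb.2⟩
      · rintro a ⟨ha, _⟩; rw [mem_BoxC]; simp [Rc] at ha ⊢; omega
    · right
      refine ⟨u.swap, hu, v.swap, hv, ?_⟩
      refine Cn.map (A' := pull Prod.swap (SA (sT N x)ᶜ)) (S' := BoxC 0 n) Prod.swap h ?_ ?_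
      · intro a b ha hb hab; exact ⟨by simpa using hab, by simpa using ha.2, by simpa using hb.2⟩
      · rintro a ⟨ha, _⟩; rw [mem_BoxC]; simp [Rc] at ha ⊢; omega
  have h2 : (1 : ℝ) ≤ dμ N p (1 / 2) E + Pr (dq p (1 / 2)) (fun x => E (pull Prod.swap (SA (sT N x)ᶜ))) := by
    refine le_trans ?_ (Pr_or_le hq _ _)
    refine le_trans (le_of_eq (show (1 : ℝ) = Pr (dq (X := VN N) p (1 / 2)) (fun _ => True) by simp [Pr, ind, Ex_const])) ?_
    exact Pr_mono hq fun x _ => key x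
  have h3 : Pr (dq p (1 / 2)) (fun x => E (pull Prod.swap (SA (sT N x)ᶜ))) = dμ N p (1 / 2) E := by
    rw [← dμ_sym tsym_swap]
    have := sg_flip (G := GT N) (rk := rkT N) p (1 / 2) (fun S => E (pull Prod.swap (SA S)))
    rw [show (1 : ℝ) - 1 / 2 = 1 / 2 by norm_num] at this
    exact this
  linarith

lemma dμ_law {p : ℝ} (h0 : 0 ≤ p) (h1 : p ≤ 1) : RLaw (dμ N p (1 / 2)) where
  mono E F h := Pr_mono (isP_dq h0 h1 (by norm_num) (by norm_num)) fun ω => h _ (SA_symTri _)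
  or_le E F := Pr_or_le (isP_dq h0 h1 (by norm_num) (by norm_num)) _ _
  fls := by simp [dμ, Pr, ind, Ex_const]
  tru := by simp [dμ, Pr, ind, Ex_const]
  fkg E F hE hF := dac_fkg rkT_inj h0 h1 (by norm_num) (by norm_num) (E := fun S => E (SA S)) (F := fun S => F (SA S))
    (fun A B h => hE _ _ (SA_mono h)) (fun A B h => hF _ _ (SA_mono h))
  trans c E := dμ_sym (tsym_add c) p _ E
  neg E := dμ_sym tsym_neg p _ E
  swap E := dμ_sym tsym_swap p _ E
  rot E := dμ_sym tsym_rot p _ E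
  half := dμ_half h0 h1

end TorusD
end DaC

namespace DaC
open Relation

section Trunc
open Classical
variable {N : ℕ}

variable (N) in
/-- torus ball -/
def Bl (L : ℤ) (w : VN N) : Set (VN N) := {z | ∃ d : V, nrm d ≤ L ∧ z = w + pr N d}

lemma nrm_neg (d : V) : nrm (-d) = nrm d := by simp only [nrm, Prod.fst_neg, Prod.snd_neg]; omega
lemma nrm_add_le (a b : V) : nrm (a + b) ≤ nrm a + nrm b := by simp only [nrm, Prod.fst_add, Prod.snd_add]; omega
lemma nrm_sub_le (a b : V) : nrm (a - b) ≤ nrm a + nrm b := by simp only [nrm, Prod.fst_sub, Prod.snd_sub]; omega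
lemma nrm_zero : nrm 0 = 0 := by simp [nrm]
lemma nrm_nonneg (a : V) : 0 ≤ nrm a := by simp only [nrm]; omega
lemma Bl_self {L : ℤ} (hL : 0 ≤ L) (w : VN N) : w ∈ Bl N L w := ⟨0, by rw [nrm_zero]; exact hL, by simp [pr]⟩
lemma Bl_symm {L : ℤ} {z w : VN N} (h : z ∈ Bl N L w) : w ∈ Bl N L z := by
  obtain ⟨d, hd, rfl⟩ := h
  exact ⟨-d, by rw [nrm_neg]; exact hd, by rw [pr_neg]; simp⟩

/-- lifting one step -/
lemma lift_step {ω : Sym2 (VN N) → Bool} {a : V} {w : VN N} (h : OE (GT N) ω (pr N a) w) : ∃ b, pr N b = w ∧ BA ω a b := by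
  obtain ⟨⟨c, d, hcd, he⟩, ho⟩ := h
  rw [Sym2.eq_iff] at he
  rcases he with ⟨h1, h2⟩ | ⟨h1, h2⟩
  · refine ⟨a + (d - c), by rw [pr_add, pr_sub, h1, h2]; abel, ?_, ?_⟩
    · rw [triAdj_iff] at hcd ⊢; simp only [Prod.fst_add, Prod.snd_add, Prod.fst_sub, Prod.snd_sub]; omega
    · rw [pr_add, pr_sub, ← h1, ← h2]; simpa using ho
  · refine ⟨a + (c - d), by rw [pr_add, pr_sub, h1, h2]; abel, ?_, ?_⟩
    · rw [triAdj_iff] at hcd ⊢; simp only [Prod.fst_add, Prod.snd_add, Prod.fst_sub, Prod.snd_sub]; omega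
    · rw [pr_add, pr_sub, ← h1, ← h2]; simpa using ho

lemma OE_of_BA {ω : Sym2 (VN N) → Bool} {a b : V} (h : BA ω a b) : OE (GT N) ω (pr N a) (pr N b) := ⟨⟨a, b, h.1, rfl⟩, h.2⟩

lemma cl_trunc {ω : Sym2 (VN N) → Bool} {a : V} {L : ℤ} (h : ¬ Arm (BA ω) a L) (hL : 0 ≤ L) :
    cl (GT N) ω ∅ (pr N a) = cl (GT N) ω (Bl N L (pr N a))ᶜ (pr N a) := by
  apply Set.Subset.antisymm
  · intro w hw
    have : ∃ b, pr N b = w ∧ nrm (b - a) ≤ L ∧ Cn (BA ω) {z | nrm (z - a) ≤ L} a b ∧ w ∈ cl (GT N) ω (Bl N L (pr N a))ᶜ (pr N a) := by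
      refine Cn.ind (P := fun w => ∃ b, pr N b = w ∧ nrm (b - a) ≤ L ∧ Cn (BA ω) {z | nrm (z - a) ≤ L} a b ∧ w ∈ cl (GT N) ω (Bl N L (pr N a))ᶜ (pr N a)) hw ?_ ?_
      · refine ⟨a, rfl, by simp [nrm]; exact hL, Cn.refl (by simp [nrm]; exact hL), cl_self (by simpa using Bl_self hL _)⟩
      · rintro u v _ huv _ ⟨b, rfl, hb, hc, hm⟩
        obtain ⟨c, rfl, hbc⟩ := lift_step huv
        have h1 := nrm_step a hbc.1
        have h2 : nrm (b - a) ≠ L := fun h2 => h ⟨b, h2, hc⟩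
        have h3 : nrm (c - a) ≤ L := by omega
        refine ⟨c, rfl, h3, hc.tail hbc h3, Cn.tail hm huv ?_⟩
        rw [compl_compl]
        exact ⟨c - a, h3, by rw [pr_sub]; simp⟩
    obtain ⟨_, _, _, _, h⟩ := this
    exact h
  · intro w hw
    exact Cn.mono hw (fun _ _ h => h) (by simp)

/-- truncated black set -/
def sL (L : ℤ) (x : Sym2 (VN N) ⊕ VN N → Bool) : Set (VN N) :=
  {v | x (Sum.inr (rp (GT N) (rkT N) (x ∘ Sum.inl) (Bl N L v)ᶜ v)) = true}

lemma sL_eq [NeZero N] {x : Sym2 (VN N) ⊕ VN N → Bool} {a : V} {L : ℤ} (h : ¬ Arm (BA (x ∘ Sum.inl)) a L) (hL : 0 ≤ L) : pr N a ∈ sL L x ↔ pr N a ∈ sT N x := by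
  simp only [sL, sT, sg, Set.mem_ofPred_eq, rp_congr (cl_trunc h hL)]

/-- bits seen -/
def tbs (L : ℤ) (v : VN N) : Set (Sym2 (VN N) ⊕ VN N) :=
  {i | Sum.elim (fun e => ∀ z ∈ e, z ∈ Bl N L v) (fun z => z ∈ Bl N L v) i}

lemma sL_dep {L : ℤ} (hL : 0 ≤ L) (v : VN N) : Dep (tbs L v) (fun x : Sym2 (VN N) ⊕ VN N → Bool => v ∈ sL L x) := by
  intro x y h
  have hv : v ∉ (Bl N L v)ᶜ := by simpa using Bl_self hL v
  have key : ∀ x y : Sym2 (VN N) ⊕ VN N → Bool, (∀ i ∈ tbs L v, x i = y i) → cl (GT N) (x ∘ Sum.inl) (Bl N L v)ᶜ v ⊆ cl (GT N) (y ∘ Sum.inl) (Bl N L v)ᶜ v := by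
    intro x y h w hw
    refine Cn.transfer hw ?_
    intro a b ha hb hab
    have h1 := ha.right
    rw [compl_compl] at h1 hb
    refine ⟨hab.1, ?_⟩
    have := h (Sum.inl s(a, b)) (by
      show ∀ z ∈ s(a, b), z ∈ Bl N L v
      intro z hz; rcases Sym2.mem_iff.1 hz with rfl | rfl <;> assumption)
    show y (Sum.inl s(a, b)) = true
    rw [← this]; exact hab.2
  have e : cl (GT N) (x ∘ Sum.inl) (Bl N L v)ᶜ v = cl (GT N) (y ∘ Sum.inl) (Bl N L v)ᶜ v :=
    Set.Subset.antisymm (key x y h) (key y x fun i hi => (h i hi).symm)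
  have e2 := rp_congr (rk := rkT N) e
  have hm : rp (GT N) (rkT N) (y ∘ Sum.inl) (Bl N L v)ᶜ v ∈ Bl N L v := by
    have h1 := (show Cn _ _ _ _ from rp_mem (G := GT N) (rk := rkT N) (ω := y ∘ Sum.inl) hv).right
    rwa [compl_compl] at h1
  simp only [sL, Set.mem_ofPred_eq, e2]
  rw [h (Sum.inr _) hm]

/-- site paths -/
lemma site_cn {S : Set (VN N)} {T : Set V} {u v : V} (h : Cn (SA S) T u v) (hne : u ≠ v) : Cn TriAdj (T ∩ {z | pr N z ∈ S}) u v := by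
  have hu : pr N u ∈ S := by
    by_contra hc
    have : u = v := Cn.ind (P := fun z => u = z) h rfl (by
      rintro a b _ hab _ rfl; exact absurd hab.2.1 hc)
    exact hne this
  exact Cn.ind (P := fun z => Cn TriAdj (T ∩ {z | pr N z ∈ S}) u z) h (Cn.refl ⟨h.left, hu⟩)
    (fun a b _ hab hb ih => ih.tail hab.1 ⟨hb, hab.2.2⟩)

lemma rot_adj_iff (j : ℕ) (a b : V) : TriAdj (rot^[j] a) (rot^[j] b) ↔ TriAdj a b := by
  induction j generalizing a b with
  | zero => rfl
  | succ j ih =>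
    rw [Function.iterate_succ_apply, Function.iterate_succ_apply, ih]
    simp only [triAdj_iff, rot]; constructor <;> intro h <;> omega

lemma pull_SA_cn {S : Set (VN N)} {T : Set V} {j : ℕ} {u v : V} (h : Cn (pull rot^[j] (SA S)) T u v) (hne : u ≠ v) : Cn TriAdj (T ∩ {z | pr N (rot^[j] z) ∈ S}) u v := by
  have hu : pr N (rot^[j] u) ∈ S := by
    by_contra hc
    have : u = v := Cn.ind (P := fun z => u = z) h rfl (by
      rintro a b _ hab _ rfl; exact absurd hab.2.1 hc)
    exact hne this
  exact Cn.ind (P := fun z => Cn TriAdj (T ∩ {z | pr N (rot^[j] z) ∈ S}) u z) h (Cn.refl ⟨h.left, hu⟩)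
    (fun a b _ hab hb ih => ih.tail ((rot_adj_iff j a b).1 hab.1) ⟨hb, hab.2.2⟩)

lemma site_block {m : ℤ} (hm : 1 ≤ m) {D : V} (hD : DOk m D) {S S' : Set (VN N)} {R : Set V} (hS : ∀ v, nrm v ≤ 600 * m → pr N v ∈ S → pr N v ∈ S' → False)
    (hB : Block m D (SA S')) {q : V} (h : Cn (SA S) R 0 q) : nrm q ≤ 72 * m := by
  by_contra hq
  push Not at hq
  have hne : (0 : V) ≠ q := by rintro rfl; rw [nrm_zero] at hq; omega
  obtain ⟨j, hj, z, hz1, hz2⟩ := block_top hm hD.1 (site_cn h hne) hq (P := fun j => Strip m D ∩ {z | pr N (rot^[j] z) ∈ S'}) (by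
    intro j hj
    obtain ⟨u, v, hu, hv, hc⟩ := hB j hj
    refine ⟨u, v, by omega, by omega, ?_⟩
    have := pull_SA_cn hc (by rintro rfl; omega)
    refine this.mono (fun _ _ h => h) ?_
    rintro z ⟨hz, hz'⟩
    refine ⟨⟨hz, hz'⟩, ?_⟩
    obtain ⟨h1, h2, h3⟩ := hz
    refine ⟨by nlinarith, by nlinarith, by omega⟩)
  exact hS _ (strip_ann hm hD hz1.1 j).2 hz2.2 hz1.2

end Trunc
end DaC

namespace DaC
open Relation

section Poly
open Classical
variable {N : ℕ} [NeZero N]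

/-- some long bond arm -/
def Bad (L : ℤ) (x : Sym2 (VN N) ⊕ VN N → Bool) : Prop := ∃ v : VN N, Arm (BA (x ∘ Sum.inl)) (lft v) L

lemma sL_of_not_bad {L : ℤ} (hL : 0 ≤ L) {x : Sym2 (VN N) ⊕ VN N → Bool} (h : ¬ Bad L x) : sL L x = sT N x := by
  ext v
  have := sL_eq (x := x) (a := lft v) (fun hA => h ⟨v, hA⟩) hL
  rwa [pr_lft] at this

lemma Pr_inl (p r : ℝ) (E : (Sym2 (VN N) → Bool) → Prop) : Pr (dq p r) (fun x => E (x ∘ Sum.inl)) = Pr (fun _ => p) E := by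
  exact Pr_marg (dq p r) Sum.inl Sum.inl_injective E

lemma Bad_le {p r τ : ℝ} {L : ℤ} (h0 : 0 ≤ p) (h1 : p ≤ 1) (h2 : 0 ≤ r) (h3 : r ≤ 1)
    (hτ : ∀ a, Pr (fun _ : Sym2 (VN N) => p) (fun ω => Arm (BA ω) a L) ≤ τ) : Pr (dq p r) (Bad (N := N) L) ≤ (N : ℝ) ^ 2 * τ := by
  have hq := isP_dq (X := VN N) h0 h1 h2 h3
  have := Pr_exists_le hq (Finset.univ : Finset (VN N)) (fun v x => Arm (BA (x ∘ Sum.inl)) (lft v) L)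
  refine le_trans (Pr_mono hq (B := fun x => ∃ v ∈ (Finset.univ : Finset (VN N)), Arm (BA (x ∘ Sum.inl)) (lft v) L) ?_) (this.trans ?_)
  · rintro x ⟨v, hv⟩; exact ⟨v, Finset.mem_univ _, hv⟩
  · refine (Finset.sum_le_sum (g := fun _ => τ) fun v _ => ?_).trans ?_
    · rw [Pr_inl p r (fun ω => Arm (BA ω) (lft v) L)]; exact hτ _
    · simp [VN, ZMod.card, sq]

/-- zone bits -/
def zS (N : ℕ) (m L : ℤ) : Set (Sym2 (VN N) ⊕ VN N) :=
  {i | Sum.elim (fun e => ∀ z ∈ e, z ∈ pr N '' Zn m L) (fun z => z ∈ pr N '' Zn m L) i}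

lemma Bl_zone {m L : ℤ} {a : V} (ha : a ∈ Ann m) : Bl N L (pr N a) ⊆ pr N '' Zn m L := by
  rintro _ ⟨d, hd, rfl⟩
  refine ⟨a + d, ?_, pr_add a d⟩
  obtain ⟨h1, h2⟩ := ha
  have h3 := nrm_add_le a d
  have h4 := nrm_sub_le (a + d) d
  rw [add_sub_cancel_right] at h4
  exact ⟨by omega, by omega⟩

lemma tbs_zone {m L : ℤ} {a : V} (ha : a ∈ Ann m) : tbs L (pr N a) ⊆ zS N m L := by
  rintro (e | z) h
  · intro z hz; exact Bl_zone ha (h z hz)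
  · exact Bl_zone ha h

lemma dac_dep {m L : ℤ} (hL : 0 ≤ L) (hm : 1 ≤ m) {D : V} (hD : DOk m D) : Dep (zS N m L) (fun x => Block m D (SA (sL L x)ᶜ)) := by
  have key : ∀ x y : Sym2 (VN N) ⊕ VN N → Bool, (∀ e ∈ zS N m L, x e = y e) → Block m D (SA (sL L x)ᶜ) → Block m D (SA (sL L y)ᶜ) := by
    intro x y h
    refine Block_local hm hD ?_
    rintro a ha b hb ⟨hab, h1, h2⟩
    have e : ∀ c ∈ Ann m, (pr N c ∈ sL L x) = (pr N c ∈ sL L y) := fun c hc => sL_dep hL (pr N c) x y fun i hi => h i (tbs_zone hc hi)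
    refine ⟨hab, ?_, ?_⟩
    · rw [Set.mem_compl_iff, ← e a ha]; exact h1
    · rw [Set.mem_compl_iff, ← e b hb]; exact h2
  intro ω ω' h
  exact propext ⟨key ω ω' h, key ω' ω (fun e he => (h e he).symm)⟩

lemma zS_disj {I i j : ℕ} {L : ℤ} (hN : 2 * (600 * (BB ^ I : ℕ) + L) < N) (hi : i ≤ I) (hj : j ≤ I) (hij : i ≠ j)
    (hLi : L ≤ 400 * (BB ^ i : ℕ)) (hLj : L ≤ 400 * (BB ^ j : ℕ)) :
    Disjoint (zS N (BB ^ i : ℕ) L) (zS N (BB ^ j : ℕ) L) := by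
  have b : ∀ i ≤ I, ((BB ^ i : ℕ) : ℤ) ≤ (BB ^ I : ℕ) := fun i hi => by exact_mod_cast Nat.pow_le_pow_right (by norm_num [BB]) hi
  have key : ∀ z : VN N, z ∈ pr N '' Zn (BB ^ i : ℕ) L → z ∈ pr N '' Zn (BB ^ j : ℕ) L → False := by
    rintro _ ⟨v, hv, rfl⟩ ⟨v', hv', h1⟩
    have e := pr_inj (K := 600 * (BB ^ I : ℕ) + L) hN (by have := hv.2; have := b i hi; omega) (by have := hv'.2; have := b j hj; omega) h1.symm
    subst e
    exact (Set.disjoint_left.1 (zone_disj (L := L) hLi hLj hij)) hv hv'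
  rw [Set.disjoint_left]
  rintro (e | z) h h'
  · induction e using Sym2.ind with
    | _ u v => exact key u (h u (by simp)) (h' u (by simp))
  · exact key z h h'

lemma dac_trans {p r : ℝ} (x : V) (n : ℤ) : Pr (dq p r) (fun ω => Arm (SA (sT N ω)) x n) = Pr (dq p r) (fun ω => Arm (SA (sT N ω)) 0 n) := by
  have := dμ_sym (N := N) (p := p) (r := r) (tsym_add x) (fun A => Arm A 0 n)
  simp only [dμ] at this
  rw [← this]
  exact Pr_congr fun ω => Arm_pull

lemma Pr_bad_le {ι : Type*} [Fintype ι] {q : ι → ℝ} (hq : IsP q) {A B C : (ι → Bool) → Prop} (h : ∀ x, ¬ C x → A x → B x) {ε : ℝ} (hC : Pr q C ≤ ε) : Pr q A ≤ Pr q B + ε := by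
  have := Pr_or_le hq B C
  have h2 : Pr q A ≤ Pr q (fun x => B x ∨ C x) := Pr_mono hq fun x hx => by
    by_cases hc : C x
    · exact Or.inr hc
    · exact Or.inl (h x hc hx)
  linarith

lemma dac_poly {p ε : ℝ} {L : ℤ} (h0 : 0 ≤ p) (h1 : p ≤ 1) (hL : 0 ≤ L) (hε : Pr (dq p (1 / 2)) (Bad (N := N) L) ≤ ε) (hε2 : ε ≤ kap0 / 2) {I i0 : ℕ}
    (hN : 2 * (600 * (BB ^ I : ℕ) + L) < N) (hLi : L ≤ 400 * (BB ^ i0 : ℕ)) (x : V) {n : ℤ} (hn : 72 * (BB ^ I : ℕ) < n) :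
    ∃ k : ℕ, 2 * I ≤ 3 * (k + i0) + 9 ∧ Pr (dq p (1 / 2)) (fun ω => Arm (SA (sT N ω)) x n) ≤ (1 - kap0 / 2) ^ k + ε := by
  obtain ⟨F, hF, hc, hB⟩ := rsw (dμ_law (N := N) h0 h1) I
  have hq := isP_dq (X := VN N) h0 h1 (r := 1 / 2) (by norm_num) (by norm_num)
  set F' := F.filter (fun i => i0 ≤ i) with hF'
  refine ⟨F'.card, ?_, ?_⟩
  · have h1 : F.card ≤ F'.card + i0 := by
      have e := Finset.card_filter_add_card_filter_not (s := F) (fun i => i0 ≤ i)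
      have : (F.filter (fun i => ¬ i0 ≤ i)).card ≤ (Finset.range i0).card := Finset.card_le_card (by intro i; simp)
      rw [Finset.card_range] at this
      have e2 : F.filter (fun i => ¬ i0 ≤ i) = F.filter (fun i => ¬ i0 ≤ i) := rfl
      rw [← hF'] at e
      linarith
    omega
  rw [dac_trans]
  choose! D hD hDp using hB
  have hsub : ∀ i ∈ F', i ∈ F ∧ i0 ≤ i := fun i hi => by simpa [hF'] using hi
  have hI : ∀ i ∈ F', 1 ≤ i ∧ i ≤ I := fun i hi => by have := hF (hsub i hi).1; rwa [Finset.mem_Icc] at this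
  have hLL : ∀ i ∈ F', L ≤ 400 * (BB ^ i : ℕ) := fun i hi => by
    have : ((BB ^ i0 : ℕ) : ℤ) ≤ (BB ^ i : ℕ) := by exact_mod_cast Nat.pow_le_pow_right (by norm_num [BB]) (hsub i hi).2
    omega
  have hm : ∀ i : ℕ, (1 : ℤ) ≤ (BB ^ i : ℕ) := fun i => by exact_mod_cast BBn_pos i
  have main := Pr_none hq F' (fun i x => Block (BB ^ i : ℕ) (D i) (SA (sL L x)ᶜ)) (fun i => zS N (BB ^ i : ℕ) L)
    (fun i hi j hj hij => zS_disj hN (hI i hi).2 (hI j hj).2 hij (hLL i hi) (hLL j hj)) (fun i hi => dac_dep hL (hm i) (hD i (hsub i hi).1)) (κ := kap0 / 2) (by linarith [kap0_le_one, kap0_pos])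
    (fun i hi => by
      have g1 := hDp i (hsub i hi).1
      have g2 : Pr (dq p (1 / 2)) (fun x => Block (BB ^ i : ℕ) (D i) (SA (sT N x)ᶜ)) = dμ N p (1 / 2) (Block (BB ^ i : ℕ) (D i)) := by
        have := sg_flip (G := GT N) (rk := rkT N) p (1 / 2) (fun S => Block (BB ^ i : ℕ) (D i) (SA S))
        rw [show (1 : ℝ) - 1 / 2 = 1 / 2 by norm_num] at this
        exact this
      have g3 := Pr_bad_le hq (A := fun x => Block (BB ^ i : ℕ) (D i) (SA (sT N x)ᶜ)) (B := fun x => Block (BB ^ i : ℕ) (D i) (SA (sL L x)ᶜ)) (C := Bad L)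
        (fun x hx h => by rw [sL_of_not_bad hL hx]; exact h) hε
      linarith)
  refine le_trans (Pr_bad_le hq (B := fun x => ∀ i ∈ F', ¬ Block (BB ^ i : ℕ) (D i) (SA (sL L x)ᶜ)) (C := Bad L) ?_ hε) (by linarith)
  rintro x hx ⟨y, hy, h⟩ i hi hbl
  rw [← sL_of_not_bad hL hx] at h
  have := site_block (hm i) (hD i (hsub i hi).1) (S := sL L x) (S' := (sL L x)ᶜ) (fun v _ h1 h2 => h2 h1) hbl h
  have : ((BB ^ i : ℕ) : ℤ) ≤ (BB ^ I : ℕ) := by exact_mod_cast Nat.pow_le_pow_right (by norm_num [BB]) (hI i hi).2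
  rw [sub_zero] at hy
  omega

/-- decay ratio for the colouring -/
noncomputable def mu1 : ℝ := 1 - kap0 / 4

lemma mu1_half : 1 / 2 ≤ mu1 := by unfold mu1; linarith [kap0_le_one]
lemma mu1_pos : 0 < mu1 := by linarith [mu1_half]
lemma mu1_lt : mu1 < 1 := by unfold mu1; linarith [kap0_pos]

lemma dac_poly' {p ε : ℝ} {L : ℤ} (h0 : 0 ≤ p) (h1 : p ≤ 1) (hL : 0 ≤ L) (hε : Pr (dq p (1 / 2)) (Bad (N := N) L) ≤ ε) (hε2 : ε ≤ kap0 / 2) {I i0 : ℕ}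
    (hN : 2 * (600 * (BB ^ I : ℕ) + L) < N) (hLi : L ≤ 400 * (BB ^ i0 : ℕ)) (hI : 18 + 6 * i0 ≤ I) (x : V) {n : ℤ} (hn : 72 * (BB ^ I : ℕ) < n) :
    Pr (dq p (1 / 2)) (fun ω => Arm (SA (sT N ω)) x n) ≤ mu1 ^ I + ε := by
  obtain ⟨k, hk, h⟩ := dac_poly h0 h1 hL hε hε2 hN hLi x hn
  refine h.trans ?_
  have a : (1 - kap0 / 2) ^ k ≤ (mu1 ^ 2) ^ k := pow_le_pow_left₀ (by linarith [kap0_le_one]) (by unfold mu1; nlinarith [kap0_pos]) k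
  have b : (mu1 ^ 2) ^ k ≤ mu1 ^ I := by
    rw [← pow_mul]; exact pow_le_pow_of_le_one mu1_pos.le mu1_lt.le (by omega)
  linarith

end Poly
end DaC

namespace DaC
open Relation

section Infl
open Classical

/-- update with classical decidability -/
noncomputable def upd {ι : Type*} (x : ι → Bool) (i : ι) (b : Bool) : ι → Bool := Function.update x i b

lemma upd_same {ι : Type*} (x : ι → Bool) (i : ι) (b : Bool) : upd x i b i = b := Function.update_self _ _ _

lemma upd_ne {ι : Type*} {x : ι → Bool} {i j : ι} (h : j ≠ i) (b : Bool) : upd x i b j = x j := Function.update_of_ne h _ _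

lemma upd_eq_self {ι : Type*} (x : ι → Bool) (i : ι) : upd x i (x i) = x := Function.update_eq_self _ _

lemma DF_def {ι : Type*} (i : ι) (f : (ι → Bool) → ℝ) (x : ι → Bool) : DF i f x = f (upd x i true) - f (upd x i false) := rfl

variable {X : Type*} {G : Set (Sym2 X)} {rk : X → ℕ}

lemma cl_upd_sub {ω : Sym2 X → Bool} {z w v : X} (hv1 : v ∉ cl G ω ∅ z) (hv2 : v ∉ cl G ω ∅ w) :
    cl G (Function.update ω s(z, w) true) ∅ v ⊆ cl G ω ∅ v := by
  intro u hu
  refine Cn.ind (P := fun u => u ∈ cl G ω ∅ v) hu (cl_self (by simp)) ?_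
  intro a b _ hab _ ha
  by_cases he : s(a, b) = s(z, w)
  · rw [Sym2.eq_iff] at he
    rcases he with ⟨rfl, rfl⟩ | ⟨rfl, rfl⟩
    · exact absurd (Cn.symm OE_symm ha) hv1
    · exact absurd (Cn.symm OE_symm ha) hv2
  · have h2 := hab.2
    rw [Function.update_of_ne he] at h2
    exact Cn.tail ha ⟨hab.1, h2⟩ (by simp)

lemma cl_upd_sub2 {ω : Sym2 X → Bool} {z w v : X} (hv : v ∈ cl G ω ∅ z ∨ v ∈ cl G ω ∅ w) :
    cl G (Function.update ω s(z, w) true) ∅ v ⊆ cl G ω ∅ z ∪ cl G ω ∅ w := by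
  intro u hu
  refine Cn.ind (P := fun u => u ∈ cl G ω ∅ z ∪ cl G ω ∅ w) hu hv ?_
  intro a b _ hab _ ha
  by_cases he : s(a, b) = s(z, w)
  · rw [Sym2.eq_iff] at he
    rcases he with ⟨rfl, rfl⟩ | ⟨rfl, rfl⟩
    · exact Or.inr (cl_self (by simp))
    · exact Or.inl (cl_self (by simp))
  · have h2 := hab.2
    rw [Function.update_of_ne he] at h2
    rcases ha with ha | ha
    · exact Or.inl (Cn.tail ha ⟨hab.1, h2⟩ (by simp))
    · exact Or.inr (Cn.tail ha ⟨hab.1, h2⟩ (by simp))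

lemma cl_upd_mono {ω : Sym2 X → Bool} {e : Sym2 X} {v : X} : cl G ω ∅ v ⊆ cl G (Function.update ω e true) ∅ v := by
  intro u hu
  refine Cn.mono hu (OE_mono ?_) (le_refl _)
  intro i
  by_cases h : i = e
  · subst h; simp
  · simp [h]

lemma rp_upd_out {ω : Sym2 X → Bool} {z w v : X} (hv1 : v ∉ cl G ω ∅ z) (hv2 : v ∉ cl G ω ∅ w) :
    rp G rk (Function.update ω s(z, w) true) ∅ v = rp G rk ω ∅ v :=
  rp_congr (Set.Subset.antisymm (cl_upd_sub hv1 hv2) cl_upd_mono)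

lemma rp_upd_in (hi : Function.Injective rk) {ω : Sym2 X → Bool} {z w v : X} (hG : s(z, w) ∈ G) (hv : v ∈ cl G ω ∅ z ∨ v ∈ cl G ω ∅ w)
    (hle : rk (rp G rk ω ∅ z) ≤ rk (rp G rk ω ∅ w)) :
    rp G rk (Function.update ω s(z, w) true) ∅ v = rp G rk ω ∅ z := by
  have hzw : w ∈ cl G (Function.update ω s(z, w) true) ∅ z := Cn.single (by simp) ⟨hG, by simp⟩ (by simp)
  refine rp_uniq hi ?_ ?_
  · have h1 : rp G rk ω ∅ z ∈ cl G (Function.update ω s(z, w) true) ∅ z := cl_upd_mono (rp_mem (by simp))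
    rcases hv with hv | hv
    · exact Cn.trans (Cn.symm OE_symm (cl_upd_mono hv)) h1
    · exact Cn.trans (Cn.symm OE_symm (Cn.trans hzw (cl_upd_mono hv))) h1
  · intro u hu
    rcases cl_upd_sub2 hv hu with h | h
    · exact rp_le h
    · exact hle.trans (rp_le h)

lemma sg_upd_aux (hi : Function.Injective rk) {x : Sym2 X ⊕ X → Bool} {z w : X} (hG : s(z, w) ∈ G)
    (hle : rk (rp G rk (x ∘ Sum.inl) ∅ z) ≤ rk (rp G rk (x ∘ Sum.inl) ∅ w)) :
    sg G rk (upd x (Sum.inl s(z, w)) true) = sg G rk (upd x (Sum.inr (rp G rk (x ∘ Sum.inl) ∅ w)) (x (Sum.inr (rp G rk (x ∘ Sum.inl) ∅ z)))) := by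
  have e1 : upd x (Sum.inl s(z, w)) true ∘ Sum.inl = Function.update (x ∘ Sum.inl) s(z, w) true := by
    funext i; by_cases h : i = s(z, w)
    · subst h; simp [upd_same]
    · simp [h, upd_ne]
  have e2 : ∀ a b, upd x (Sum.inr a) b ∘ Sum.inl = x ∘ Sum.inl := by intro a b; funext i; simp [upd_ne]
  ext v
  simp only [sg, Set.mem_ofPred_eq, e1, e2]
  rw [upd_ne (by simp)]
  by_cases hw : v ∈ cl G (x ∘ Sum.inl) ∅ w
  · rw [rp_upd_in hi hG (Or.inr hw) hle, rp_eq hw]; simp [upd_same]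
  · have hne : rp G rk (x ∘ Sum.inl) ∅ v ≠ rp G rk (x ∘ Sum.inl) ∅ w := fun h => hw (Cn.symm OE_symm (mem_cl_of_rp h))
    rw [upd_ne (by simpa using hne)]
    by_cases hz : v ∈ cl G (x ∘ Sum.inl) ∅ z
    · rw [rp_upd_in hi hG (Or.inl hz) hle, rp_eq hz]
    · rw [rp_upd_out hz hw]

lemma sg_upd (hi : Function.Injective rk) {x : Sym2 X ⊕ X → Bool} {z w : X} (hG : s(z, w) ∈ G) :
    ∃ a b, (a = z ∨ a = w) ∧ sg G rk (upd x (Sum.inl s(z, w)) true) = sg G rk (upd x (Sum.inr (rp G rk (x ∘ Sum.inl) ∅ a)) b) := by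
  rcases le_total (rk (rp G rk (x ∘ Sum.inl) ∅ z)) (rk (rp G rk (x ∘ Sum.inl) ∅ w)) with h | h
  · exact ⟨w, _, Or.inr rfl, sg_upd_aux hi hG h⟩
  · refine ⟨z, x (Sum.inr (rp G rk (x ∘ Sum.inl) ∅ w)), Or.inl rfl, ?_⟩
    rw [Sym2.eq_swap]
    exact sg_upd_aux hi (by rw [Sym2.eq_swap]; exact hG) h

lemma upd_diff {ι : Type*} (g : (ι → Bool) → ℝ) (x : ι → Bool) (i : ι) (b : Bool) : |g (upd x i b) - g x| ≤ |DF i g x| := by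
  have hx : x = upd x i (x i) := (upd_eq_self _ _).symm
  have h : g x = g (upd x i (x i)) := by rw [← hx]
  rw [h]
  simp only [DF_def]
  cases b <;> cases x i
  · simp
  · rw [abs_sub_comm]
  · exact le_rfl
  · simp

variable [Fintype X]

/-- colour functionals -/
noncomputable def gE (G : Set (Sym2 X)) (rk : X → ℕ) (E : Set X → Prop) (x : Sym2 X ⊕ X → Bool) : ℝ := ind (E (sg G rk x))

lemma gE_DF_nonneg {E : Set X → Prop} (hE : ∀ A B, A ⊆ B → E A → E B) (v : X) (x : Sym2 X ⊕ X → Bool) : 0 ≤ DF (Sum.inr v) (gE G rk E) x := by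
  have e2 : ∀ a b, upd x (Sum.inr a) b ∘ Sum.inl = x ∘ Sum.inl := by intro a b; funext i; simp [upd_ne]
  simp only [DF_def, sub_nonneg, gE]
  refine ind_mono (hE _ _ ?_)
  intro u hu
  simp only [sg, Set.mem_ofPred_eq, e2] at hu ⊢
  by_cases h : rp G rk (x ∘ Sum.inl) ∅ u = v
  · rw [h]; simp [upd_same]
  · rw [upd_ne (by simpa using h)] at hu ⊢; exact hu

lemma gE_DF_le {E : Set X → Prop} (i : Sym2 X ⊕ X) (x : Sym2 X ⊕ X → Bool) : |DF i (gE G rk E) x| ≤ 1 := by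
  simp only [DF_def, gE]
  rw [abs_le]
  constructor <;> linarith [ind_nonneg (E (sg G rk (upd x i true))), ind_nonneg (E (sg G rk (upd x i false))), ind_le_one (E (sg G rk (upd x i true))), ind_le_one (E (sg G rk (upd x i false)))]

lemma edge_DF (hi : Function.Injective rk) {E : Set X → Prop} (hE : ∀ A B, A ⊆ B → E A → E B) {z w : X} (hG : s(z, w) ∈ G) {x : Sym2 X ⊕ X → Bool} (hx : x (Sum.inl s(z, w)) = false) :
    |DF (Sum.inl s(z, w)) (gE G rk E) x| ≤ DF (Sum.inr (rp G rk (x ∘ Sum.inl) ∅ z)) (gE G rk E) x + DF (Sum.inr (rp G rk (x ∘ Sum.inl) ∅ w)) (gE G rk E) x := by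
  obtain ⟨a, b, ha, h⟩ := sg_upd (rk := rk) (x := x) hi hG
  have h1 : |DF (Sum.inl s(z, w)) (gE G rk E) x| ≤ |DF (Sum.inr (rp G rk (x ∘ Sum.inl) ∅ a)) (gE G rk E) x| := by
    have e : upd x (Sum.inl s(z, w)) false = x := by rw [← hx]; exact upd_eq_self _ _
    have : DF (Sum.inl s(z, w)) (gE G rk E) x = gE G rk E (upd x (Sum.inr (rp G rk (x ∘ Sum.inl) ∅ a)) b) - gE G rk E x := by
      simp only [DF_def, e]
      simp only [gE, h]
    rw [this]
    exact upd_diff _ _ _ _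
  rw [abs_of_nonneg (gE_DF_nonneg hE _ _)] at h1
  have hz := gE_DF_nonneg (G := G) (rk := rk) hE (rp G rk (x ∘ Sum.inl) ∅ z) x
  have hw := gE_DF_nonneg (G := G) (rk := rk) hE (rp G rk (x ∘ Sum.inl) ∅ w) x
  rcases ha with rfl | rfl <;> linarith

lemma edge_zero {E : Set X → Prop} {e : Sym2 X} (hG : e ∉ G) (x : Sym2 X ⊕ X → Bool) : DF (Sum.inl e) (gE G rk E) x = 0 := by
  have key : ∀ b c, cl G (upd x (Sum.inl e) b ∘ Sum.inl) ∅ c = cl G (x ∘ Sum.inl) ∅ c := by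
    intro b c
    have : OE G (upd x (Sum.inl e) b ∘ Sum.inl) = OE G (x ∘ Sum.inl) := by
      funext u v
      simp only [OE, Function.comp_apply, eq_iff_iff]
      refine and_congr_right fun h => ?_
      rw [upd_ne (by rintro h'; exact hG (by rw [← Sum.inl_injective h']; exact h))]
    simp only [cl, this]
  have : ∀ b, sg G rk (upd x (Sum.inl e) b) = sg G rk x := by
    intro b; ext v
    simp only [sg, Set.mem_ofPred_eq, rp_congr (key b v)]
    rw [upd_ne (by simp)]
  simp only [DF_def, gE, this, sub_self]

lemma Ex_closed {ι : Type*} [Fintype ι] (q : ι → ℝ) (j : ι) (f : (ι → Bool) → ℝ) : (1 - q j) * Ex q (fun x => |DF j f x|) = Ex q (fun x => if x j = false then |DF j f x| else 0) := by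
  rw [← Ex_avg j (fun x => if x j = false then |DF j f x| else 0), ← Ex_mul_left]
  congr 1; funext x
  simp [avg, DF, Dif]

lemma edge_Ex (hi : Function.Injective rk) {E : Set X → Prop} (hE : ∀ A B, A ⊆ B → E A → E B) {p r : ℝ} (hq : IsP (dq (X := X) p r)) {z w : X} (hG : s(z, w) ∈ G) :
    (1 - p) * Ex (dq p r) (fun x => |DF (Sum.inl s(z, w)) (gE G rk E) x|) ≤
      Ex (dq p r) (fun x => DF (Sum.inr (rp G rk (x ∘ Sum.inl) ∅ z)) (gE G rk E) x) + Ex (dq p r) (fun x => DF (Sum.inr (rp G rk (x ∘ Sum.inl) ∅ w)) (gE G rk E) x) := by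
  rw [← Ex_add]
  have := Ex_closed (dq (X := X) p r) (Sum.inl s(z, w)) (gE G rk E)
  refine (le_of_eq this).trans (Ex_mono hq fun x => ?_)
  split_ifs with h
  · exact edge_DF hi hE hG h
  · exact add_nonneg (gE_DF_nonneg hE _ _) (gE_DF_nonneg hE _ _)

lemma dac_russo (p t : ℝ) (E : Set X → Prop) :
    HasDerivAt (fun t => Pr (dq (X := X) p t) (fun x => E (sg G rk x))) (∑ v, Ex (dq (X := X) p t) (DF (Sum.inr v) (gE G rk E))) t := by
  have := russo (fun t => dq (X := X) p t) (Sum.elim (fun _ => 0) (fun _ => 1)) t (by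
    rintro (i | i)
    · exact hasDerivAt_const _ _
    · exact hasDerivAt_id _) (gE G rk E)
  simp only [Fintype.sum_sum_type, Sum.elim_inl, Sum.elim_inr, zero_mul, Finset.sum_const_zero, zero_add, one_mul] at this
  exact this

lemma dac_mono {p a b : ℝ} (h0 : 0 ≤ p) (h1 : p ≤ 1) (ha : 0 ≤ a) (hab : a ≤ b) (hb : b ≤ 1) {E : Set X → Prop} (hE : ∀ A B, A ⊆ B → E A → E B) :
    Pr (dq (X := X) p a) (fun x => E (sg G rk x)) ≤ Pr (dq (X := X) p b) (fun x => E (sg G rk x)) := by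
  refine param_mono (f := fun t => Pr (dq (X := X) p t) (fun x => E (sg G rk x))) hab (fun t _ => dac_russo p t E) (fun t ht => ?_)
  exact Finset.sum_nonneg fun j _ => Ex_nonneg (isP_dq h0 h1 (by linarith [ht.1]) (by linarith [ht.2])) fun ω => gE_DF_nonneg hE j ω

end Infl

section InflT
open Classical
variable {N : ℕ} [NeZero N]

lemma rep_local {E : Set (VN N) → Prop} (hE : ∀ A B, A ⊆ B → E A → E B) {L : ℤ} (hL : 0 ≤ L) (a : VN N) (x : Sym2 (VN N) ⊕ VN N → Bool) :
    DF (Sum.inr (rp (GT N) (rkT N) (x ∘ Sum.inl) ∅ a)) (gE (GT N) (rkT N) E) x ≤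
      ∑ d ∈ Bx L, DF (Sum.inr (a + pr N d)) (gE (GT N) (rkT N) E) x + ind (Arm (BA (x ∘ Sum.inl)) (lft a) L) := by
  by_cases h : Arm (BA (x ∘ Sum.inl)) (lft a) L
  · rw [ind_of h]
    have h1 := gE_DF_le (G := GT N) (rk := rkT N) (E := E) (Sum.inr (rp (GT N) (rkT N) (x ∘ Sum.inl) ∅ a)) x
    have h2 := le_abs_self (DF (Sum.inr (rp (GT N) (rkT N) (x ∘ Sum.inl) ∅ a)) (gE (GT N) (rkT N) E) x)
    have h3 : 0 ≤ ∑ d ∈ Bx L, DF (Sum.inr (a + pr N d)) (gE (GT N) (rkT N) E) x := Finset.sum_nonneg fun d _ => gE_DF_nonneg hE _ _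
    linarith
  · rw [ind_of_not h, add_zero]
    have h1 : rp (GT N) (rkT N) (x ∘ Sum.inl) ∅ a ∈ cl (GT N) (x ∘ Sum.inl) ∅ a := rp_mem (by simp)
    have h2 := cl_trunc h hL
    rw [pr_lft] at h2
    rw [h2] at h1
    have h3 := (show Cn _ _ _ _ from h1).right
    rw [compl_compl] at h3
    obtain ⟨d, hd, he⟩ := h3
    rw [he]
    exact Finset.single_le_sum (f := fun d => DF (Sum.inr (a + pr N d)) (gE (GT N) (rkT N) E) x) (fun d _ => gE_DF_nonneg hE _ _) (mem_Bx.2 hd)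

lemma card_Bx {n : ℤ} (hn : 0 ≤ n) : ((Bx n).card : ℝ) = (2 * n + 1) ^ 2 := by
  have : (2 * n + 1).toNat = 2 * n + 1 := by omega
  have h2 : ((2 * n + 1).toNat : ℝ) = 2 * n + 1 := by exact_mod_cast this
  simp only [Bx, Finset.card_product, Int.card_Icc]
  push_cast
  rw [show n + 1 - -n = 2 * n + 1 by ring, h2]; ring

lemma rep_sum {p r τ : ℝ} (hq : IsP (dq (X := VN N) p r)) {E : Set (VN N) → Prop} (hE : ∀ A B, A ⊆ B → E A → E B) {L : ℤ} (hL : 0 ≤ L)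
    (hτ : ∀ a, Pr (fun _ : Sym2 (VN N) => p) (fun ω => Arm (BA ω) a L) ≤ τ) :
    ∑ a, Ex (dq p r) (fun x => DF (Sum.inr (rp (GT N) (rkT N) (x ∘ Sum.inl) ∅ a)) (gE (GT N) (rkT N) E) x) ≤
      (2 * L + 1) ^ 2 * ∑ v, Ex (dq p r) (DF (Sum.inr v) (gE (GT N) (rkT N) E)) + (N : ℝ) ^ 2 * τ := by
  have h1 : ∀ a : VN N, Ex (dq p r) (fun x => DF (Sum.inr (rp (GT N) (rkT N) (x ∘ Sum.inl) ∅ a)) (gE (GT N) (rkT N) E) x) ≤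
      ∑ d ∈ Bx L, Ex (dq p r) (DF (Sum.inr (a + pr N d)) (gE (GT N) (rkT N) E)) + τ := by
    intro a
    refine (Ex_mono hq (rep_local hE hL a)).trans ?_
    rw [Ex_add, Ex_sum]
    have := hτ (lft a)
    rw [← Pr_inl p r] at this
    exact add_le_add le_rfl this
  refine (Finset.sum_le_sum fun a _ => h1 a).trans ?_
  rw [Finset.sum_add_distrib, Finset.sum_comm]
  have h2 : ∀ d ∈ Bx L, ∑ a, Ex (dq p r) (DF (Sum.inr (a + pr N d)) (gE (GT N) (rkT N) E)) = ∑ v, Ex (dq p r) (DF (Sum.inr v) (gE (GT N) (rkT N) E)) := fun d _ =>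
    Equiv.sum_comp (Equiv.addRight (pr N d)) (fun v => Ex (dq p r) (DF (Sum.inr v) (gE (GT N) (rkT N) E)))
  rw [Finset.sum_congr rfl h2, Finset.sum_const, nsmul_eq_mul, card_Bx hL]
  simp [VN, ZMod.card, sq]

lemma GT_dir {e : Sym2 (VN N)} (h : e ∈ GT N) : ∃ a : VN N, ∃ d ∈ Bx 1, e = s(a, a + pr N d) := by
  obtain ⟨a, b, hab, rfl⟩ := h
  refine ⟨pr N a, b - a, mem_Bx.2 ?_, by rw [pr_sub]; simp⟩
  have := nrm_step a hab
  simp only [sub_self, nrm_zero] at this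
  linarith

lemma Inf_total {p r τ : ℝ} (hp1 : p < 1) (hq : IsP (dq (X := VN N) p r)) {E : Set (VN N) → Prop} (hE : ∀ A B, A ⊆ B → E A → E B) {L : ℤ} (hL : 0 ≤ L)
    (hτ : ∀ a, Pr (fun _ : Sym2 (VN N) => p) (fun ω => Arm (BA ω) a L) ≤ τ) :
    ∑ j, Inf (dq p r) (gE (GT N) (rkT N) E) j ≤ ∑ v, Ex (dq p r) (DF (Sum.inr v) (gE (GT N) (rkT N) E)) +
      18 / (1 - p) * ((2 * L + 1) ^ 2 * ∑ v, Ex (dq p r) (DF (Sum.inr v) (gE (GT N) (rkT N) E)) + (N : ℝ) ^ 2 * τ) := by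
  set g := gE (GT N) (rkT N) E with hg
  set T : VN N → ℝ := fun a => Ex (dq p r) (fun x => DF (Sum.inr (rp (GT N) (rkT N) (x ∘ Sum.inl) ∅ a)) g x) with hT
  have hT0 : ∀ a, 0 ≤ T a := fun a => Ex_nonneg hq fun x => gE_DF_nonneg hE _ _
  have hpp : 0 < 1 - p := by linarith
  rw [Fintype.sum_sum_type, add_comm]
  have c1 : ∑ v : VN N, Inf (dq p r) g (Sum.inr v) ≤ ∑ v, Ex (dq p r) (DF (Sum.inr v) g) := by
    refine Finset.sum_le_sum fun v _ => (Inf_le_Dif hq g _).trans (le_of_eq ?_)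
    congr 1; funext x
    exact abs_of_nonneg (gE_DF_nonneg hE _ _)
  have c2 : ∑ e : Sym2 (VN N), Inf (dq p r) g (Sum.inl e) ≤ ∑ a, ∑ d ∈ Bx 1, (T a + T (a + pr N d)) / (1 - p) := by
    have c3 : ∀ e : Sym2 (VN N), Inf (dq p r) g (Sum.inl e) ≤ ∑ a, ∑ d ∈ Bx 1, if e = s(a, a + pr N d) then (T a + T (a + pr N d)) / (1 - p) else 0 := by
      intro e
      have hnn : ∀ a : VN N, ∀ d ∈ Bx 1, 0 ≤ if e = s(a, a + pr N d) then (T a + T (a + pr N d)) / (1 - p) else 0 := by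
        intro a d _; split_ifs
        · exact div_nonneg (add_nonneg (hT0 _) (hT0 _)) hpp.le
        · exact le_rfl
      by_cases he : e ∈ GT N
      · obtain ⟨a, d, hd, hed⟩ := GT_dir he
        have h1 : Inf (dq p r) g (Sum.inl e) ≤ (T a + T (a + pr N d)) / (1 - p) := by
          rw [le_div_iff₀ hpp, mul_comm]
          have := edge_Ex (rk := rkT N) rkT_inj hE hq (hed ▸ he)
          rw [← hed] at this
          exact (mul_le_mul_of_nonneg_left (Inf_le_Dif hq g _) hpp.le).trans this
        have h2 : (T a + T (a + pr N d)) / (1 - p) = if e = s(a, a + pr N d) then (T a + T (a + pr N d)) / (1 - p) else 0 := by rw [if_pos hed]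
        refine h1.trans (h2.le.trans ?_)
        refine (Finset.single_le_sum (f := fun d => if e = s(a, a + pr N d) then (T a + T (a + pr N d)) / (1 - p) else 0) (hnn a) hd).trans ?_
        exact Finset.single_le_sum (f := fun a => ∑ d ∈ Bx 1, if e = s(a, a + pr N d) then (T a + T (a + pr N d)) / (1 - p) else 0) (fun a _ => Finset.sum_nonneg (hnn a)) (Finset.mem_univ a)
      · have : Inf (dq p r) g (Sum.inl e) ≤ 0 := by
          refine (Inf_le_Dif hq g _).trans (le_of_eq ?_)
          simp only [hg, edge_zero he, abs_zero]; exact Ex_const _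
        exact this.trans (Finset.sum_nonneg fun a _ => Finset.sum_nonneg (hnn a))
    refine (Finset.sum_le_sum fun e _ => c3 e).trans ?_
    rw [Finset.sum_comm]
    refine Finset.sum_le_sum fun a _ => ?_
    rw [Finset.sum_comm]
    refine Finset.sum_le_sum fun d _ => ?_
    rw [Finset.sum_ite_eq']; simp
  have c4 : ∑ a : VN N, ∑ d ∈ Bx 1, (T a + T (a + pr N d)) / (1 - p) = 18 / (1 - p) * ∑ a, T a := by
    rw [Finset.sum_comm]
    have : ∀ d ∈ Bx 1, ∑ a : VN N, (T a + T (a + pr N d)) / (1 - p) = 2 / (1 - p) * ∑ a, T a := by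
      intro d _
      have e : ∑ a : VN N, T (a + pr N d) = ∑ a, T a := Equiv.sum_comp (Equiv.addRight (pr N d)) T
      rw [← Finset.sum_div, Finset.sum_add_distrib, e]; ring
    rw [Finset.sum_congr rfl this, Finset.sum_const, nsmul_eq_mul, card_Bx (by norm_num)]
    push_cast; ring
  have c5 := rep_sum hq hE hL hτ
  refine add_le_add c1 (c2.trans (c4.le.trans ?_))
  exact mul_le_mul_of_nonneg_left c5 (by positivity)

end InflT
end DaC

namespace DaC
open Relation

section Sharp
open Classical

lemma Inf_pert {ι : Type*} [Fintype ι] {q : ι → ℝ} (hq : IsP q) {f g : (ι → Bool) → ℝ} {B : (ι → Bool) → Prop} (h : ∀ x, |f x - g x| ≤ ind (B x)) (j : ι) :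
    Inf q f j ≤ Inf q g j + 2 * Pr q B := by
  have e : Inf q g j + 2 * Pr q B = Ex q (fun x => (|g x - avg q j g x| + ind (B x)) + avg q j (fun x => ind (B x)) x) := by
    rw [Ex_add, Ex_add, Ex_avg]; simp only [Inf, Pr]; ring
  rw [e]
  refine Ex_mono hq fun x => ?_
  have h1 := h x
  have hq1 := hq j
  have a1 : |f x - avg q j f x| ≤ |g x - avg q j g x| + |f x - g x| + |avg q j f x - avg q j g x| := by
    have : f x - avg q j f x = (g x - avg q j g x) + (f x - g x) - (avg q j f x - avg q j g x) := by ring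
    rw [this]
    exact (abs_sub _ _).trans (add_le_add (abs_add_le _ _) le_rfl)
  have a2 : |avg q j f x - avg q j g x| ≤ avg q j (fun x => ind (B x)) x := by
    simp only [avg]
    have h2 := abs_le.1 (h (Function.update x j true))
    have h3 := abs_le.1 (h (Function.update x j false))
    rw [abs_le]
    constructor <;> nlinarith [hq1.1, hq1.2]
  linarith

variable {N : ℕ} [NeZero N]

lemma card_bits : (Fintype.card (Sym2 (VN N) ⊕ VN N) : ℝ) ≤ 2 * (N : ℝ) ^ 4 := by
  have hV : Fintype.card (VN N) = N ^ 2 := by simp [VN, ZMod.card, sq]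
  have hN : 1 ≤ N := Nat.one_le_iff_ne_zero.2 (NeZero.ne N)
  have h1 : Fintype.card (Sym2 (VN N)) ≤ (N ^ 2) * (N ^ 2) := by
    rw [← hV, ← Fintype.card_prod]
    exact Fintype.card_le_of_surjective _ (Sym2.mk_surjective)
  rw [Fintype.card_sum, hV]
  have h2 : N ^ 2 ≤ N ^ 2 * N ^ 2 := Nat.le_mul_of_pos_left _ (by positivity)
  have : Fintype.card (Sym2 (VN N)) + N ^ 2 ≤ 2 * N ^ 4 := by
    have : N ^ 4 = N ^ 2 * N ^ 2 := by ring
    omega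
  exact_mod_cast this

/-- bits seen by a bond -/
noncomputable def tbF (N L : ℕ) [NeZero N] (a b : V) : Finset (Sym2 (VN N) ⊕ VN N) := (tbs (L : ℤ) (pr N a) ∪ tbs (L : ℤ) (pr N b)).toFinset

lemma mem_tbF {L : ℕ} {a b : V} {j : Sym2 (VN N) ⊕ VN N} : j ∈ tbF N L a b ↔ j ∈ tbs (L : ℤ) (pr N a) ∨ j ∈ tbs (L : ℤ) (pr N b) := by
  simp [tbF]

lemma dac_M {n : ℕ} {L : ℕ} (hN : 2 * (n : ℤ) < N) (j : Sym2 (VN N) ⊕ VN N) (dec : DecidablePred (fun e : V × V => TriAdj e.1 e.2 ∧ j ∈ tbF N L e.1 e.2)) :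
    (@Finset.filter _ (fun e : V × V => TriAdj e.1 e.2 ∧ j ∈ tbF N L e.1 e.2) dec (Bx n ×ˢ Bx n)).card ≤ 18 * (2 * L + 1) ^ 2 := by
  obtain ⟨z, hz⟩ : ∃ z : VN N, ∀ v, j ∈ tbs (L : ℤ) v → z ∈ Bl N L v := by
    rcases j with e | z
    · induction e using Sym2.ind with
      | _ u w => exact ⟨u, fun v h => h u (by simp)⟩
    · exact ⟨z, fun v h => h⟩
  have cB : ∀ m : ℕ, (Bx m).card = (2 * m + 1) ^ 2 := fun m => by
    have := card_Bx (n := m) (by positivity)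
    exact_mod_cast this
  have hd : ∀ a : V, z ∈ Bl N L (pr N a) → ∃ d ∈ Bx L, pr N a = z + pr N d := fun a h => by
    obtain ⟨d, hd, h⟩ := Bl_symm h
    exact ⟨d, mem_Bx.2 hd, h⟩
  set T : Finset (Bool × VN N × V) := Finset.univ ×ˢ ((Bx L).image (fun d => z + pr N d)) ×ˢ Bx 1 with hT
  have hTc : T.card ≤ 18 * (2 * L + 1) ^ 2 := by
    rw [hT, Finset.card_product, Finset.card_product]
    have h1 : ((Bx L).image (fun d => z + pr N d)).card ≤ (2 * L + 1) ^ 2 := by rw [← cB]; exact Finset.card_image_le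
    have h2 : (Bx 1).card = 9 := by have := cB 1; simpa using this
    rw [h2]; simp; omega
  refine le_trans ?_ hTc
  refine Finset.card_le_card_of_injOn (fun e => if z ∈ Bl N L (pr N e.1) then (true, pr N e.1, e.2 - e.1) else (false, pr N e.2, e.2 - e.1)) ?_ ?_
  · rintro ⟨a, b⟩ h
    simp only [Finset.coe_filter, Set.mem_ofPred_eq, mem_tbF] at h
    have hab : b - a ∈ Bx 1 := mem_Bx.2 (by
      have := nrm_step a h.2.1
      simp only [sub_self, nrm_zero] at this
      linarith)
    simp only [Finset.mem_coe]
    split_ifs with hc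
    · obtain ⟨d, hd1, hd2⟩ := hd a hc
      simp only [hT, Finset.mem_product, Finset.mem_univ, true_and, Finset.mem_image]
      exact ⟨⟨d, hd1, hd2.symm⟩, hab⟩
    · obtain ⟨d, hd1, hd2⟩ := hd b (by rcases h.2.2 with h | h; exacts [absurd (hz _ h) hc, hz _ h])
      simp only [hT, Finset.mem_product, Finset.mem_univ, true_and, Finset.mem_image]
      exact ⟨⟨d, hd1, hd2.symm⟩, hab⟩
  · rintro ⟨a, b⟩ h ⟨c, d⟩ h' he
    simp only [Finset.coe_filter, Finset.mem_product, mem_Bx, Set.mem_ofPred_eq] at h h'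
    simp only at he
    split_ifs at he with h1 h2
    · simp only [Prod.mk.injEq] at he
      obtain ⟨_, e1, e2⟩ := he
      have := pr_inj hN h.1.1 h'.1.1 e1
      subst this
      exact Prod.ext rfl (by simpa using e2)
    · simp at he
    · simp at he
    · simp only [Prod.mk.injEq] at he
      obtain ⟨_, e1, e2⟩ := he
      have := pr_inj hN h.1.2 h'.1.2 e1
      subst this
      exact Prod.ext (by simpa using e2) rfl

lemma SL_dep {L : ℕ} (a b : V) : Dep (tbF N L a b : Set (Sym2 (VN N) ⊕ VN N)) (fun x => SA (sL (L : ℤ) x) a b) := by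
  intro x y h
  have h1 := sL_dep (N := N) (L := L) (by positivity) (pr N a) x y fun i hi => h i (mem_tbF.2 (Or.inl hi))
  have h2 := sL_dep (N := N) (L := L) (by positivity) (pr N b) x y fun i hi => h i (mem_tbF.2 (Or.inr hi))
  simp only [SA, h1, h2]

lemma armS_mono (x : V) (n : ℤ) : ∀ A B : Set (VN N), A ⊆ B → Arm (SA A) x n → Arm (SA B) x n := fun _ _ h => Arm.mono (SA_mono h)

set_option maxHeartbeats 1000000 in
lemma dac_sharp {p r τ A : ℝ} {L J i0 : ℕ} (h0 : 0 ≤ p) (h1 : p < 1) (hr0 : 0 ≤ r) (hr : r ≤ 1 / 2)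
    (hτ : ∀ a, Pr (fun _ : Sym2 (VN N) => p) (fun ω => Arm (BA ω) a L) ≤ τ)
    (hε1 : (N : ℝ) ^ 2 * τ ≤ mu1 ^ J) (hε2 : (N : ℝ) ^ 2 * τ ≤ kap0 / 2) (hN : 2000 * BB ^ (2 * J) + 2 * L < N)
    (hLi : L ≤ 400 * BB ^ i0) (hI : 18 + 6 * i0 ≤ J) (hA : A = 500000 * (2 * L + 1) ^ 4 * mu1 ^ J / (1 - p)) (hA1 : A ≤ 1) (x : V) :
    Pr (dq p r) (fun ω => Arm (SA (sT N ω)) x (BB ^ (2 * J) : ℕ)) ≤ Real.exp (-((1 / 2 - r) / A)) + 6 * (N : ℝ) ^ 6 * τ := by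
  rw [dac_trans]
  set n := BB ^ (2 * J) with hn
  have hn1 : 1 ≤ n := BBn_pos _
  have hJn : BB ^ J ≤ n := Nat.pow_le_pow_right (by norm_num [BB]) (by omega)
  have hN1 : (1 : ℝ) ≤ N := by exact_mod_cast (by omega : 1 ≤ N)
  have hpp : 0 < 1 - p := by linarith
  have hmu : 0 < mu1 ^ J := pow_pos mu1_pos J
  have hl1 : (1 : ℝ) ≤ 2 * L + 1 := by have : (0 : ℝ) ≤ L := by positivity
                                       linarith
  set ℓ : ℝ := 2 * L + 1 with hℓ
  have hA0 : 0 < A := by rw [hA]; positivity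
  have hip : 1 ≤ 1 / (1 - p) := by rw [le_div_iff₀ hpp]; linarith
  have hmuA : 500000 * mu1 ^ J ≤ A := by
    rw [hA, mul_div_assoc, mul_assoc]
    have : mu1 ^ J ≤ mu1 ^ J / (1 - p) := by rw [le_div_iff₀ hpp]; nlinarith
    have h4 : (1 : ℝ) ≤ ℓ ^ 4 := one_le_pow₀ hl1
    nlinarith
  set ε : ℝ := (N : ℝ) ^ 2 * τ with hε
  have hτ0 : 0 ≤ τ := (Pr_nonneg (isP_const h0 h1.le) _).trans (hτ 0)
  have hε0 : 0 ≤ ε := by positivity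
  have hbad : ∀ t, 0 ≤ t → t ≤ 1 → Pr (dq p t) (Bad (N := N) L) ≤ ε := fun t ht0 ht1 => Bad_le h0 h1.le ht0 ht1 hτ
  set U : ℕ → ℝ := fun i => if 72 * BB ^ J < i then 3 * mu1 ^ J else 1 with hU
  have hU1 : ∀ i, U i ≤ 1 := fun i => by simp only [hU]; split_ifs <;> linarith
  have hsum := sum_U mu1_half (U := U) (J := J) (C := 3) (by norm_num) hU1 (fun i hi => by simp only [hU, if_pos hi]; exact le_rfl)
  set E : Set (VN N) → Prop := fun S => Arm (SA S) 0 n with hE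
  have hEm : ∀ A B, A ⊆ B → E A → E B := armS_mono 0 n
  set θ : ℝ → ℝ := fun t => Pr (dq (X := VN N) p t) (fun x => E (sg (GT N) (rkT N) x)) with hθ
  have hn72 : 72 * BB ^ J < n := by
    rw [hn, two_mul, pow_add]
    have : BB ^ 1 ≤ BB ^ J := Nat.pow_le_pow_right (by norm_num [BB]) (by omega)
    have h' : BB ^ 1 = 16384 := by norm_num [BB]
    have := BBn_pos J
    nlinarith
  set δ : ℝ := ε / A + 5 * (N : ℝ) ^ 4 * ε with hδ
  have key : ∀ t ∈ Set.Icc r (1 / 2), (1 / A) * θ t - δ ≤ ∑ v, Ex (dq (X := VN N) p t) (DF (Sum.inr v) (gE (GT N) (rkT N) E)) := by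
    rintro t ⟨ht0, ht1⟩
    have ht00 : 0 ≤ t := hr0.trans ht0
    have hq := isP_dq (X := VN N) h0 h1.le ht00 (by linarith : t ≤ 1)
    have hb := hbad t ht00 (by linarith)
    have hUb : ∀ x (m : ℕ), Pr (dq p t) (fun ω => Arm (SA (sL (N := N) L ω)) x m) ≤ U m := by
      intro x m
      simp only [hU]
      split_ifs with hm
      · have a1 := Pr_bad_le hq (A := fun ω => Arm (SA (sL (N := N) L ω)) x m) (B := fun ω => Arm (SA (sT N ω)) x m) (C := Bad (N := N) L)
          (fun x hx h => by rw [← sL_of_not_bad (by positivity) hx]; exact h) hb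
        have a2 := dac_mono (G := GT N) (rk := rkT N) h0 h1.le ht00 ht1 (by norm_num) (armS_mono (N := N) x m)
        have a3 := dac_poly' (N := N) (p := p) (L := L) (I := J) (i0 := i0) h0 h1.le (by positivity) (hbad (1 / 2) (by norm_num) (by norm_num)) hε2
          (by have : 2 * (600 * BB ^ J + L) < N := by omega
              exact_mod_cast this) (by exact_mod_cast hLi) hI x (n := m) (by exact_mod_cast hm)
        have a4 : Pr (dq p t) (fun ω => Arm (SA (sT N ω)) x m) ≤ mu1 ^ J + ε := le_trans a2 a3
        linarith
      · exact Pr_le_one hq _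
    have ho := osss_arm hq (fun x => SA (sL (N := N) L x)) (fun x => (SA_symTri _).1) (fun x => (SA_symTri _).2)
      (tbF N L) (fun a b => SL_dep a b) n hn1 U
      (fun i => by simp only [hU]; split_ifs <;> positivity) hUb (18 * (2 * L + 1) ^ 2)
      (fun j => dac_M (N := N) (n := n) (L := L) (by exact_mod_cast (by omega : 2 * n < N)) j _)
    set I := ∑ j, Inf (dq p t) (fun x => ind (Arm (SA (sL (N := N) L x)) 0 n)) j
    set S := ∑ v, Ex (dq (X := VN N) p t) (DF (Sum.inr v) (gE (GT N) (rkT N) E))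
    set u := Pr (dq p t) (fun ω => Arm (SA (sL (N := N) L ω)) 0 n) with hu
    have hS0 : 0 ≤ S := Finset.sum_nonneg fun j _ => Ex_nonneg hq fun ω => gE_DF_nonneg hEm j ω
    have hI1 : I ≤ ∑ j, Inf (dq p t) (gE (GT N) (rkT N) E) j + 4 * (N : ℝ) ^ 4 * ε := by
      have : ∀ j ∈ (Finset.univ : Finset (Sym2 (VN N) ⊕ VN N)), Inf (dq p t) (fun x => ind (Arm (SA (sL (N := N) L x)) 0 n)) j ≤ Inf (dq p t) (gE (GT N) (rkT N) E) j + 2 * ε := by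
        intro j _
        refine (Inf_pert hq (B := Bad (N := N) L) (g := gE (GT N) (rkT N) E) ?_ j).trans (by linarith)
        intro x
        by_cases hx : Bad (N := N) L x
        · rw [ind_of hx, abs_le]
          simp only [gE]
          constructor <;> linarith [ind_nonneg (Arm (SA (sL (N := N) L x)) 0 n), ind_le_one (Arm (SA (sL (N := N) L x)) 0 n), ind_nonneg (E (sg (GT N) (rkT N) x)), ind_le_one (E (sg (GT N) (rkT N) x))]
        · rw [ind_of_not hx, sL_of_not_bad (by positivity) hx]
          have : gE (GT N) (rkT N) E x = ind (Arm (SA (sT N x)) 0 n) := rfl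
          rw [this]; simp
      refine (Finset.sum_le_sum this).trans ?_
      rw [Finset.sum_add_distrib, Finset.sum_const, nsmul_eq_mul, Finset.card_univ]
      have c := mul_le_mul_of_nonneg_right (card_bits (N := N)) (by positivity : 0 ≤ 2 * ε)
      linarith
    have hI2 := Inf_total (N := N) (L := L) (τ := τ) h1 hq hEm (by positivity) hτ
    rw [show (2 * ((L : ℤ) : ℝ) + 1) = ℓ by rw [hℓ]; push_cast; rfl] at hI2
    have hI3 : I ≤ 19 * ℓ ^ 2 / (1 - p) * (S + 5 * (N : ℝ) ^ 4 * ε) := by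
      have hl2 : (1 : ℝ) ≤ ℓ ^ 2 := one_le_pow₀ hl1
      have hN4 : (1 : ℝ) ≤ (N : ℝ) ^ 4 := one_le_pow₀ hN1
      have e1 : 19 * ℓ ^ 2 / (1 - p) * (S + 5 * (N : ℝ) ^ 4 * ε) = 19 * (1 / (1 - p)) * (ℓ ^ 2 * (S + 5 * (N : ℝ) ^ 4 * ε)) := by ring
      have e2 : 18 / (1 - p) * (ℓ ^ 2 * S + ε) = 18 * (1 / (1 - p)) * (ℓ ^ 2 * S + ε) := by ring
      have hI4 : I ≤ S + 18 * (1 / (1 - p)) * (ℓ ^ 2 * S + ε) + 4 * (N : ℝ) ^ 4 * ε := by rw [← e2]; linarith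
      rw [e1]
      set w := 1 / (1 - p)
      have hNε : 0 ≤ (N : ℝ) ^ 4 * ε := by positivity
      have g1 : ε ≤ (N : ℝ) ^ 4 * ε := le_mul_of_one_le_left hε0 hN4
      have g2 : S ≤ ℓ ^ 2 * S := le_mul_of_one_le_left hS0 hl2
      have g3 : (N : ℝ) ^ 4 * ε ≤ ℓ ^ 2 * ((N : ℝ) ^ 4 * ε) := le_mul_of_one_le_left hNε hl2
      set a := (N : ℝ) ^ 4 * ε
      set b := ℓ ^ 2 * S
      set c := ℓ ^ 2 * a
      have g4 : ℓ ^ 2 * (S + 5 * (N : ℝ) ^ 4 * ε) = b + 5 * c := by simp only [a, b, c]; ring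
      rw [g4]
      have g5 : 4 * (N : ℝ) ^ 4 * ε = 4 * a := by simp only [a]; ring
      rw [g5] at hI4
      have w1 : b ≤ w * b := le_mul_of_one_le_left (by linarith) hip
      have w2 : c ≤ w * c := le_mul_of_one_le_left (by linarith) hip
      have w3 : w * ε ≤ w * c := mul_le_mul_of_nonneg_left (by linarith) (by linarith)
      have w4 : 18 * w * (b + ε) = 18 * (w * b) + 18 * (w * ε) := by ring
      have w5 : 19 * w * (b + 5 * c) = 19 * (w * b) + 95 * (w * c) := by ring
      rw [w4] at hI4
      rw [w5]
      linarith
    have hu1 : u ≤ 1 / 2 := by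
      have := hUb 0 n
      simp only [hU, if_pos hn72] at this
      linarith
    have hu0 : 0 ≤ u := Pr_nonneg hq _
    have hθu : θ t ≤ u + ε := Pr_bad_le hq (A := fun ω => E (sg (GT N) (rkT N) ω)) (B := fun ω => Arm (SA (sL (N := N) L ω)) 0 n) (C := Bad (N := N) L)
          (fun x hx h => by rw [sL_of_not_bad (by positivity) hx]; exact h) hb
    have hI0 : 0 ≤ I := Finset.sum_nonneg fun j _ => Inf_nonneg hq _ j
    have hnR : (n : ℝ) = (BB : ℝ) ^ (2 * J) := by rw [hn]; push_cast; rfl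
    have hnpos : (0 : ℝ) < n := by exact_mod_cast hn1
    rw [← hnR] at hsum
    have hs2 : n * (u * (1 - u)) ≤ n * (2 * (18 * ℓ ^ 2) * (100 * 3 * mu1 ^ J) * I) := by
      refine ho.trans ?_
      have := mul_le_mul_of_nonneg_right (mul_le_mul_of_nonneg_left hsum (by positivity : (0 : ℝ) ≤ 2 * (18 * ℓ ^ 2))) hI0
      refine le_trans (le_of_eq ?_) (this.trans (le_of_eq (by ring)))
      push_cast; ring
    have hs3 := le_of_mul_le_mul_left hs2 hnpos
    have hs4 : u ≤ 21600 * ℓ ^ 2 * mu1 ^ J * I := by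
      have := mul_le_mul_of_nonneg_left (by linarith : 1 / 2 ≤ 1 - u) hu0
      linarith
    have hs5 : u ≤ A * (S + 5 * (N : ℝ) ^ 4 * ε) := by
      have h5 : 0 ≤ S + 5 * (N : ℝ) ^ 4 * ε := by positivity
      have h6 := mul_le_mul_of_nonneg_left hI3 (by positivity : 0 ≤ 21600 * ℓ ^ 2 * mu1 ^ J)
      have h7 : 21600 * ℓ ^ 2 * mu1 ^ J * (19 * ℓ ^ 2 / (1 - p)) ≤ A := by
        rw [hA, mul_div_assoc', div_le_div_iff_of_pos_right hpp]
        have : 0 ≤ ℓ ^ 4 * mu1 ^ J := by positivity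
        linarith
      have h8 := mul_le_mul_of_nonneg_right h7 h5
      linarith
    rw [one_div, hδ]
    have : A⁻¹ * θ t ≤ A⁻¹ * (A * (S + 5 * (N : ℝ) ^ 4 * ε) + ε) := mul_le_mul_of_nonneg_left (by linarith) (by positivity)
    have e : A⁻¹ * (A * (S + 5 * (N : ℝ) ^ 4 * ε) + ε) = S + 5 * (N : ℝ) ^ 4 * ε + ε / A := by field_simp
    linarith
  have := param_exp hr (by positivity : 0 < 1 / A) (fun t _ => dac_russo p t E) key
  refine this.trans ?_
  have hδA : δ / (1 / A) ≤ 6 * (N : ℝ) ^ 6 * τ := by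
    have hN4 : (1 : ℝ) ≤ (N : ℝ) ^ 4 := one_le_pow₀ hN1
    have e : δ / (1 / A) = ε + A * (5 * (N : ℝ) ^ 4 * ε) := by rw [hδ]; field_simp
    have e2 : 6 * (N : ℝ) ^ 6 * τ = (N : ℝ) ^ 4 * ε + 5 * (N : ℝ) ^ 4 * ε := by rw [hε]; ring
    rw [e, e2]
    refine add_le_add (le_mul_of_one_le_left hε0 hN4) (mul_le_of_le_one_left (by positivity) hA1)
  have hδ0 : 0 ≤ δ / (1 / A) := by positivity
  have hθ1 : θ (1 / 2) ≤ 1 := Pr_le_one (isP_dq h0 h1.le (by norm_num) (by norm_num)) _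
  have e : 1 / A * (1 / 2 - r) = (1 / 2 - r) / A := by ring
  rw [e]
  have : (θ (1 / 2) - δ / (1 / A)) * Real.exp (-((1 / 2 - r) / A)) ≤ Real.exp (-((1 / 2 - r) / A)) :=
    mul_le_of_le_one_left (Real.exp_pos _).le (by linarith)
  linarith

end Sharp
end DaC

namespace DaC

section BitLaw
open Classical

lemma boolOf_true {P : Prop} : boolOf P = true ↔ P := by simp [boolOf]

lemma base_Ico : base = volume.restrict (Set.Ico (0 : ℝ) 1) := Measure.restrict_congr_set Ico_ae_eq_Ioc.symm

instance base_prob : IsProbabilityMeasure base := ⟨by simp [base]⟩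

lemma meas_bit (n : ℕ) : Measurable (bit n) := by
  refine measurable_to_bool ?_
  have : bit n ⁻¹' {true} = (fun x : ℝ => ⌊x * 2 ^ (n + 1)⌋) ⁻¹' {z | z % 2 = 1} := by
    ext x; simp [bit, boolOf_true]
  rw [this]
  exact (Int.measurable_floor.comp (measurable_id.mul_const _)) (MeasurableSet.of_discrete)

lemma bit_succ (n : ℕ) (x : ℝ) : bit (n + 1) x = bit n (Int.fract (2 * x)) := by
  have e : Int.fract (2 * x) * 2 ^ (n + 1) = x * 2 ^ (n + 1 + 1) - ((⌊2 * x⌋ * 2 ^ (n + 1) : ℤ) : ℝ) := by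
    rw [Int.fract]; push_cast; ring
  simp only [bit]
  rw [e, Int.floor_sub_intCast]
  congr 1
  have : (⌊2 * x⌋ * 2 ^ (n + 1) : ℤ) = 2 * (⌊2 * x⌋ * 2 ^ n) := by ring
  rw [this]
  apply propext
  omega

/-- fair coin -/
noncomputable def fair : Measure Bool := (2⁻¹ : ℝ≥0∞) • Measure.dirac true + (2⁻¹ : ℝ≥0∞) • Measure.dirac false

instance fair_prob : IsProbabilityMeasure fair := ⟨by simp [fair, ENNReal.inv_two_add_inv_two]⟩

lemma half_true (A : Set ℝ) : volume (Set.Ico (0 : ℝ) 1 ∩ {x | bit 0 x = true ∧ Int.fract (2 * x) ∈ A}) = 2⁻¹ * volume (Set.Ico (0 : ℝ) 1 ∩ A) := by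
  have : Set.Ico (0 : ℝ) 1 ∩ {x | bit 0 x = true ∧ Int.fract (2 * x) ∈ A} = (fun x => 2 * x) ⁻¹' ((fun x => x + (-1)) ⁻¹' (Set.Ico (0 : ℝ) 1 ∩ A)) := by
    ext x
    simp only [Set.mem_inter_iff, Set.mem_Ico, Set.mem_ofPred_eq, bit, boolOf_true, Set.mem_preimage]
    constructor
    · rintro ⟨⟨h1, h2⟩, h3, h4⟩
      have h5 : ⌊2 * x⌋ = 1 := by
        have a1 : 0 ≤ ⌊2 * x⌋ := Int.floor_nonneg.2 (by linarith)
        have a2 : ⌊2 * x⌋ < 2 := Int.floor_lt.2 (by push_cast; linarith)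
        rw [show x * 2 ^ (0 + 1) = 2 * x by ring] at h3
        omega
      have h6 := Int.floor_eq_iff.1 h5
      rw [Int.fract, h5] at h4
      push_cast at h6 h4
      exact ⟨⟨by linarith [h6.1], by linarith [h6.2]⟩, h4⟩
    · rintro ⟨⟨h1, h2⟩, h3⟩
      have h5 : ⌊2 * x⌋ = 1 := Int.floor_eq_iff.2 ⟨by push_cast; linarith, by push_cast; linarith⟩
      refine ⟨⟨by linarith, by linarith⟩, ?_, ?_⟩
      · rw [show x * 2 ^ (0 + 1) = 2 * x by ring, h5]; rfl
      · rw [Int.fract, h5]; push_cast; exact h3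
  rw [this, Real.volume_preimage_mul_left (by norm_num), measure_preimage_add_right]
  congr 1
  rw [abs_of_pos (by norm_num), ENNReal.ofReal_inv_of_pos (by norm_num)]; simp

lemma half_false (A : Set ℝ) : volume (Set.Ico (0 : ℝ) 1 ∩ {x | bit 0 x = false ∧ Int.fract (2 * x) ∈ A}) = 2⁻¹ * volume (Set.Ico (0 : ℝ) 1 ∩ A) := by
  have : Set.Ico (0 : ℝ) 1 ∩ {x | bit 0 x = false ∧ Int.fract (2 * x) ∈ A} = (fun x => 2 * x) ⁻¹' (Set.Ico (0 : ℝ) 1 ∩ A) := by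
    ext x
    simp only [Set.mem_inter_iff, Set.mem_Ico, Set.mem_ofPred_eq, Set.mem_preimage]
    rw [← Bool.not_eq_true]
    simp only [bit, boolOf_true]
    constructor
    · rintro ⟨⟨h1, h2⟩, h3, h4⟩
      have h5 : ⌊2 * x⌋ = 0 := by
        have a1 : 0 ≤ ⌊2 * x⌋ := Int.floor_nonneg.2 (by linarith)
        have a2 : ⌊2 * x⌋ < 2 := Int.floor_lt.2 (by push_cast; linarith)
        rw [show x * 2 ^ (0 + 1) = 2 * x by ring] at h3
        omega
      have h6 := Int.floor_eq_iff.1 h5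
      rw [Int.fract, h5] at h4
      push_cast at h6 h4
      rw [sub_zero] at h4
      exact ⟨⟨by linarith [h6.1], by linarith [h6.2]⟩, h4⟩
    · rintro ⟨⟨h1, h2⟩, h3⟩
      have h5 : ⌊2 * x⌋ = 0 := Int.floor_eq_iff.2 ⟨by push_cast; linarith, by push_cast; linarith⟩
      refine ⟨⟨by linarith, by linarith⟩, ?_, ?_⟩
      · rw [show x * 2 ^ (0 + 1) = 2 * x by ring, h5]; norm_num
      · rw [Int.fract, h5]; push_cast; rw [sub_zero]; exact h3
  rw [this, Real.volume_preimage_mul_left (by norm_num)]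
  congr 1
  rw [abs_of_pos (by norm_num), ENNReal.ofReal_inv_of_pos (by norm_num)]; simp

lemma half_set (t : Set Bool) (A : Set ℝ) : volume (Set.Ico (0 : ℝ) 1 ∩ {x | bit 0 x ∈ t ∧ Int.fract (2 * x) ∈ A}) = fair t * volume (Set.Ico (0 : ℝ) 1 ∩ A) := by
  have hm : MeasurableSet {x | bit 0 x = true} := meas_bit 0 (measurableSet_singleton true)
  rw [← measure_inter_add_sdiff (Set.Ico (0 : ℝ) 1 ∩ {x | bit 0 x ∈ t ∧ Int.fract (2 * x) ∈ A}) hm]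
  have e1 : (Set.Ico (0 : ℝ) 1 ∩ {x | bit 0 x ∈ t ∧ Int.fract (2 * x) ∈ A}) ∩ {x | bit 0 x = true} = if true ∈ t then Set.Ico (0 : ℝ) 1 ∩ {x | bit 0 x = true ∧ Int.fract (2 * x) ∈ A} else ∅ := by
    ext x; split_ifs with h <;> simp <;> grind
  have e2 : (Set.Ico (0 : ℝ) 1 ∩ {x | bit 0 x ∈ t ∧ Int.fract (2 * x) ∈ A}) \ {x | bit 0 x = true} = if false ∈ t then Set.Ico (0 : ℝ) 1 ∩ {x | bit 0 x = false ∧ Int.fract (2 * x) ∈ A} else ∅ := by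
    ext x; split_ifs with h <;> simp <;> grind
  rw [e1, e2]
  simp only [fair, Measure.coe_add, Measure.coe_smul, Pi.add_apply, Pi.smul_apply, smul_eq_mul, Measure.dirac_apply, add_mul]
  by_cases h1 : true ∈ t <;> by_cases h2 : false ∈ t <;> simp [h1, h2, half_true, half_false]

lemma cyl_vol (n : ℕ) : ∀ t : ℕ → Set Bool, volume (Set.Ico (0 : ℝ) 1 ∩ {x | ∀ i < n, bit i x ∈ t i}) = ∏ i ∈ Finset.range n, fair (t i) := by
  induction n with
  | zero => intro t; simp
  | succ n ih =>
    intro t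
    rw [Finset.prod_range_succ', mul_comm, ← ih (fun i => t (i + 1)), ← half_set]
    congr 2
    ext x
    simp only [Set.mem_ofPred_eq]
    constructor
    · intro h
      exact ⟨h 0 (by omega), fun i hi => by rw [← bit_succ]; exact h (i + 1) (by omega)⟩
    · rintro ⟨h1, h2⟩ i hi
      rcases i with _ | i
      · exact h1
      · rw [bit_succ]; exact h2 i (by omega)

lemma meas_bits : Measurable (fun (x : ℝ) (n : ℕ) => bit n x) := measurable_pi_lambda _ fun n => meas_bit n

lemma bits_law : base.map (fun (x : ℝ) (n : ℕ) => bit n x) = Measure.infinitePi (fun _ : ℕ => fair) := by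
  refine Measure.eq_infinitePi _ fun s t ht => ?_
  rw [Measure.map_apply meas_bits (.pi s.countable_toSet fun i _ => ht i)]
  obtain ⟨n, hn⟩ : ∃ n, ∀ i ∈ s, i < n := ⟨s.sup id + 1, fun i hi => Nat.lt_succ_of_le (Finset.le_sup (f := id) hi)⟩
  have key := cyl_vol n (fun i => if i ∈ s then t i else Set.univ)
  have e1 : (fun (x : ℝ) (n : ℕ) => bit n x) ⁻¹' (Set.pi (s : Set ℕ) t) = {x | ∀ i < n, bit i x ∈ if i ∈ s then t i else Set.univ} := by
    ext x
    simp only [Set.mem_preimage, Set.mem_pi, Finset.mem_coe, Set.mem_ofPred_eq]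
    constructor
    · intro h i _; split_ifs with hi
      · exact h i hi
      · trivial
    · intro h i hi
      have := h i (hn i hi)
      rwa [if_pos hi] at this
  have hm : MeasurableSet {x : ℝ | ∀ i < n, bit i x ∈ if i ∈ s then t i else Set.univ} := by
    rw [← e1]; exact meas_bits (.pi s.countable_toSet fun i _ => ht i)
  rw [e1, base_Ico, Measure.restrict_apply hm, Set.inter_comm, key]
  have : ∀ i, fair (if i ∈ s then t i else Set.univ) = if i ∈ s then fair (t i) else 1 := fun i => by
    split_ifs
    · rfl
    · exact measure_univ
  simp only [this]
  rw [Finset.prod_ite_mem]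
  congr 1
  ext i; simp only [Finset.mem_inter, Finset.mem_range]; exact ⟨fun h => h.2, fun h => ⟨hn i h, h⟩⟩

/-- binary expansion -/
noncomputable def Phi (b : ℕ → Bool) : ℝ := ∑' k : ℕ, if b k then ((2 : ℝ)⁻¹) ^ (k + 1) else 0

lemma Phi_summable (b : ℕ → Bool) : Summable (fun k => if b k then ((2 : ℝ)⁻¹) ^ (k + 1) else 0) := by
  refine Summable.of_nonneg_of_le (fun k => by split_ifs <;> positivity) (fun k => ?_) ((summable_geometric_of_lt_one (r := (2 : ℝ)⁻¹) (by norm_num) (by norm_num)).mul_left 2⁻¹)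
  split_ifs
  · rw [pow_succ, mul_comm]
  · positivity

lemma Phi_tendsto (b : ℕ → Bool) : Filter.Tendsto (fun n => ∑ k ∈ Finset.range n, if b k then ((2 : ℝ)⁻¹) ^ (k + 1) else 0) Filter.atTop (nhds (Phi b)) :=
  (Phi_summable b).hasSum.tendsto_sum_nat

lemma meas_Phi : Measurable Phi := by
  refine measurable_of_tendsto_metrizable (f := fun n b => ∑ k ∈ Finset.range n, if b k then ((2 : ℝ)⁻¹) ^ (k + 1) else 0) (fun n => ?_) (tendsto_pi_nhds.2 Phi_tendsto)
  refine Finset.measurable_sum _ fun k _ => ?_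
  have : (fun b : ℕ → Bool => if b k then ((2 : ℝ)⁻¹) ^ (k + 1) else 0) = (fun c : Bool => if c then ((2 : ℝ)⁻¹) ^ (k + 1) else 0) ∘ (fun b => b k) := rfl
  rw [this]
  exact (measurable_of_countable _).comp (measurable_pi_apply k)

lemma partial_sum (x : ℝ) (n : ℕ) : ∑ k ∈ Finset.range n, (if bit k x then ((2 : ℝ)⁻¹) ^ (k + 1) else 0) = ⌊x * 2 ^ n⌋ / 2 ^ n - ⌊x⌋ := by
  induction n with
  | zero => simp
  | succ n ih =>
    rw [Finset.sum_range_succ, ih]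
    have h1 : ⌊x * 2 ^ (n + 1)⌋ / 2 = ⌊x * 2 ^ n⌋ := by
      have := Int.floor_div_natCast (x * 2 ^ (n + 1)) 2
      rw [show x * 2 ^ (n + 1) / ((2 : ℕ) : ℝ) = x * 2 ^ n by push_cast; rw [pow_succ]; ring] at this
      rw [this]; rfl
    by_cases hb : ⌊x * 2 ^ (n + 1)⌋ % 2 = 1
    · have hb' : bit n x = true := boolOf_true.2 hb
      have h2 : ⌊x * 2 ^ (n + 1)⌋ = 2 * ⌊x * 2 ^ n⌋ + 1 := by omega
      rw [if_pos hb', h2, inv_pow, pow_succ]; push_cast; field_simp; ring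
    · have hb' : ¬ bit n x = true := fun h => hb (boolOf_true.1 h)
      have h2 : ⌊x * 2 ^ (n + 1)⌋ = 2 * ⌊x * 2 ^ n⌋ := by omega
      rw [if_neg hb', h2, pow_succ]; push_cast; field_simp; ring

lemma Phi_bits {x : ℝ} (hx : x ∈ Set.Ico (0 : ℝ) 1) : Phi (fun n => bit n x) = x := by
  refine tendsto_nhds_unique (Phi_tendsto _) ?_
  have h0 : ⌊x⌋ = 0 := Int.floor_eq_iff.2 ⟨by simpa using hx.1, by simpa using hx.2⟩
  simp only [partial_sum, h0]
  have h2 : Filter.Tendsto (fun n : ℕ => x - ((2 : ℝ)⁻¹) ^ n) Filter.atTop (nhds x) := by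
    have := (tendsto_const_nhds (x := x)).sub (tendsto_pow_atTop_nhds_zero_of_lt_one (r := (2 : ℝ)⁻¹) (by norm_num) (by norm_num))
    simpa using this
  refine tendsto_of_tendsto_of_tendsto_of_le_of_le h2 tendsto_const_nhds (fun n => ?_) (fun n => ?_)
  · have h3 := Int.lt_floor_add_one (x * 2 ^ n)
    have h4 : (0 : ℝ) < 2 ^ n := by positivity
    simp only [Int.cast_zero, sub_zero]
    rw [le_div_iff₀ h4, sub_mul, inv_pow, inv_mul_cancel₀ h4.ne']; linarith
  · have h3 := Int.floor_le (x * 2 ^ n)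
    have h4 : (0 : ℝ) < 2 ^ n := by positivity
    simp only [Int.cast_zero, sub_zero]
    rw [div_le_iff₀ h4]; exact h3

lemma Phi_law : (Measure.infinitePi (fun _ : ℕ => fair)).map Phi = base := by
  rw [← bits_law, Measure.map_map meas_Phi meas_bits]
  conv_rhs => rw [← Measure.map_id (μ := base)]
  refine Measure.map_congr ?_
  rw [base_Ico]
  exact (ae_restrict_mem measurableSet_Ico).mono fun x hx => Phi_bits hx

lemma meas_unif (i : ℕ) : Measurable (unif i) := by
  have : unif i = Phi ∘ (fun x k => bit (Nat.pair i k) x) := rfl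
  rw [this]
  exact meas_Phi.comp (measurable_pi_lambda _ fun k => meas_bit _)

lemma unif_law : base.map (fun (x : ℝ) (i : ℕ) => unif i x) = Measure.infinitePi (fun _ : ℕ => base) := by
  have hinj : Function.Injective (fun z : ℕ × ℕ => Nat.pair z.1 z.2) := fun a b h => by
    have := Nat.pair_eq_pair.1 h
    exact Prod.ext this.1 this.2
  have h1 := Measure.map_infinitePi_infinitePi_of_inj (P := fun _ : ℕ => fair) hinj
  have h2 := Measure.infinitePi_map_curry (ι := ℕ) (κ := ℕ) (fun _ _ => fair)
  have h3 := Measure.infinitePi_map_pi (fun _ : ℕ => Measure.infinitePi (fun _ : ℕ => fair)) (f := fun _ => Phi) (fun _ => meas_Phi)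
  rw [Phi_law] at h3
  have hP : Measurable (fun (x : ℕ → ℕ → Bool) i => Phi (x i)) := measurable_pi_lambda _ fun i => meas_Phi.comp (measurable_pi_apply i)
  have hC := (MeasurableEquiv.curry ℕ ℕ Bool).measurable
  have hJ : Measurable (fun (ω : ℕ → Bool) (i : ℕ × ℕ) => ω (Nat.pair i.1 i.2)) := by fun_prop
  rw [← h3, ← h2, ← h1, ← bits_law, Measure.map_map hP hC, Measure.map_map (hP.comp hC) hJ, Measure.map_map ((hP.comp hC).comp hJ) meas_bits]
  rfl

lemma meas_thr (q : ℝ) : Measurable (fun u : ℝ => boolOf (u < q)) := by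
  refine measurable_to_bool ?_
  have : (fun u : ℝ => boolOf (u < q)) ⁻¹' {true} = Set.Iio q := by ext u; simp [boolOf_true]
  rw [this]; exact measurableSet_Iio

lemma base_thr {q : ℝ} (h0 : 0 ≤ q) (h1 : q ≤ 1) (b : Bool) : base ((fun u : ℝ => boolOf (u < q)) ⁻¹' {b}) = ENNReal.ofReal (if b then q else 1 - q) := by
  rw [base_Ico, Measure.restrict_apply (meas_thr q (measurableSet_singleton b))]
  cases b
  · have : (fun u : ℝ => boolOf (u < q)) ⁻¹' {false} ∩ Set.Ico 0 1 = Set.Ico q 1 := by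
      ext u
      simp only [Set.mem_inter_iff, Set.mem_preimage, Set.mem_singleton_iff, Set.mem_Ico]
      rw [← Bool.not_eq_true, boolOf_true]
      constructor
      · rintro ⟨a, b, c⟩; exact ⟨not_lt.1 a, c⟩
      · rintro ⟨a, b⟩; exact ⟨not_lt.2 a, by linarith, b⟩
    rw [this, Real.volume_Ico]; simp
  · have : (fun u : ℝ => boolOf (u < q)) ⁻¹' {true} ∩ Set.Ico 0 1 = Set.Ico 0 q := by
      ext u
      simp only [Set.mem_inter_iff, Set.mem_preimage, Set.mem_singleton_iff, Set.mem_Ico, boolOf_true]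
      constructor
      · rintro ⟨a, b, c⟩; exact ⟨b, a⟩
      · rintro ⟨a, b⟩; exact ⟨b, a, by linarith⟩
    rw [this, Real.volume_Ico]; simp

/-- finite-dimensional law of the thresholded labels -/
lemma thr_law {ι : Type*} [Fintype ι] (idx : ι → ℕ) (hi : Function.Injective idx) {q : ι → ℝ} (hq : IsP q) (E : (ι → Bool) → Prop) :
    base.real {x | E (fun j => boolOf (unif (idx j) x < q j))} = Pr q E := by
  have h1 := Measure.map_infinitePi_infinitePi_of_inj (P := fun _ : ℕ => base) hi
  have h2 := Measure.infinitePi_map_pi (fun _ : ι => base) (f := fun j u => boolOf (u < q j)) (fun j => meas_thr (q j))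
  have hmu : Measurable (fun (x : ℝ) (i : ℕ) => unif i x) := measurable_pi_lambda _ fun i => meas_unif i
  have hmi : Measurable (fun (ω : ℕ → ℝ) (i : ι) => ω (idx i)) := by fun_prop
  have hmt : Measurable (fun (ω : ι → ℝ) (i : ι) => boolOf (ω i < q i)) := measurable_pi_lambda _ fun i => (meas_thr (q i)).comp (measurable_pi_apply i)
  rw [← h1, ← unif_law, Measure.map_map hmi hmu, Measure.map_map hmt (hmi.comp hmu)] at h2
  have h3 : ∀ b : ι → Bool, base.real ((fun x j => boolOf (unif (idx j) x < q j)) ⁻¹' {b}) = Wt q b := by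
    intro b
    have h4 := congrArg (fun m => m.real {b}) h2
    simp only [Measure.real] at h4
    rw [Measure.map_apply (hmt.comp (hmi.comp hmu)) (measurableSet_singleton b)] at h4
    refine Eq.trans h4 ?_
    have (i : ι) : IsProbabilityMeasure (base.map (fun u => boolOf (u < q i))) := Measure.isProbabilityMeasure_map (meas_thr _).aemeasurable
    rw [Measure.infinitePi_singleton_of_fintype, ENNReal.toReal_prod]
    simp only [Wt]
    refine Finset.prod_congr rfl fun i _ => ?_
    rw [Measure.map_apply (meas_thr _) (measurableSet_singleton _), base_thr (hq i).1 (hq i).2, ENNReal.toReal_ofReal]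
    split_ifs <;> linarith [(hq i).1, (hq i).2]
  have hm : Measurable (fun (x : ℝ) (j : ι) => boolOf (unif (idx j) x < q j)) := hmt.comp (hmi.comp hmu)
  have h5 : {x | E (fun j => boolOf (unif (idx j) x < q j))} = ⋃ b ∈ Finset.univ.filter (fun b => E b), (fun x j => boolOf (unif (idx j) x < q j)) ⁻¹' {b} := by
    ext x; simp
  rw [h5, measureReal_biUnion_finset]
  · simp only [h3, Pr, Ex, ind]
    rw [Finset.sum_filter]
    refine Finset.sum_congr rfl fun b _ => ?_
    split_ifs <;> simp
  · intro a _ b _ hab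
    exact Disjoint.preimage _ (by simpa using hab)
  · intro b _; exact hm (measurableSet_singleton b)

end BitLaw
end DaC

namespace DaC
open Relation

section Plane
open Classical
variable {N : ℕ}

/-- the black vertices -/
def blk (p r x : ℝ) : Set V := {v | colourCfg TriAdj p r x v = true}
/-- site percolation relation -/
def SV (S : Set V) : Rel := fun a b => TriAdj a b ∧ a ∈ S ∧ b ∈ S

lemma eIdx_symm (a b : V) : eIdx a b = eIdx b a := by unfold eIdx; rw [min_comm]

lemma eIdx_inj {a b c d : V} (h : eIdx a b = eIdx c d) : s(a, b) = s(c, d) := by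
  unfold eIdx at h
  have key : ∀ {u v : V × V}, Encodable.encode u = Encodable.encode v → u = v := fun h => Encodable.encode_injective h
  rw [Sym2.eq_iff]
  rcases min_choice (Encodable.encode (a, b)) (Encodable.encode (b, a)) with h1 | h1 <;>
  rcases min_choice (Encodable.encode (c, d)) (Encodable.encode (d, c)) with h2 | h2 <;>
  · rw [h1, h2] at h
    have := key h
    simp only [Prod.mk.injEq] at this
    tauto

/-- index of the label used for each torus bit -/
noncomputable def idxN : Sym2 (VN N) ⊕ VN N → ℕ :=
  Sum.elim (fun e => 2 * Sym2.lift ⟨fun a b => eIdx (lft a) (lft b), fun _ _ => eIdx_symm _ _⟩ e) (fun v => 2 * Encodable.encode (lft v) + 1)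

lemma lft_inj : Function.Injective (lft (N := N)) := fun a b h => by rw [← pr_lft a, h, pr_lft]

lemma idxN_inj : Function.Injective (idxN (N := N)) := by
  rintro (e | v) (e' | v') h
  · induction e using Sym2.ind with | _ a b => ?_
    induction e' using Sym2.ind with | _ c d => ?_
    simp only [idxN, Sum.elim_inl, Sym2.lift_mk] at h
    have := eIdx_inj (Nat.eq_of_mul_eq_mul_left (by norm_num) h)
    rw [Sym2.eq_iff] at this
    congr 1
    rw [Sym2.eq_iff]
    rcases this with ⟨h1, h2⟩ | ⟨h1, h2⟩
    · exact Or.inl ⟨lft_inj h1, lft_inj h2⟩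
    · exact Or.inr ⟨lft_inj h1, lft_inj h2⟩
  · simp only [idxN, Sum.elim_inl, Sum.elim_inr] at h; omega
  · simp only [idxN, Sum.elim_inl, Sum.elim_inr] at h; omega
  · simp only [idxN, Sum.elim_inr] at h
    congr 1
    exact lft_inj (Encodable.encode_injective (by omega))

/-- torus configuration read off from the plane -/
noncomputable def TX (N : ℕ) (p r x : ℝ) : Sym2 (VN N) ⊕ VN N → Bool := fun j => boolOf (unif (idxN j) x < dq p r j)

lemma TX_law [NeZero N] {p r : ℝ} (h0 : 0 ≤ p) (h1 : p ≤ 1) (h2 : 0 ≤ r) (h3 : r ≤ 1) (E : (Sym2 (VN N) ⊕ VN N → Bool) → Prop) :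
    base.real {x | E (TX N p r x)} = Pr (dq p r) E := thr_law idxN idxN_inj (isP_dq h0 h1 h2 h3) E

variable {p r x : ℝ}

lemma edge_true {a b : V} : edgeCfg TriAdj p x a b = true ↔ TriAdj a b ∧ edgeU a b x < p := by
  simp only [edgeCfg, Bool.and_eq_true, boolOf_true]

lemma clusterRep_spec (η : EdgeCfg) (v : V) : clusterRep η v ∈ pCluster η v ∧ ∀ w ∈ pCluster η v, Encodable.encode (clusterRep η v) ≤ Encodable.encode w := by
  have hne : (Encodable.encode '' pCluster η v).Nonempty := ⟨_, v, ReflTransGen.refl, rfl⟩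
  obtain ⟨c, hc, he⟩ := Nat.sInf_mem hne
  have : clusterRep η v = c := by unfold clusterRep; rw [← he, Encodable.encodek]; rfl
  rw [this]
  refine ⟨hc, fun w hw => ?_⟩
  rw [he]; exact Nat.sInf_le ⟨w, hw, rfl⟩

/-- without a long open path the colour is the same in the torus -/
lemma blk_iff [NeZero N] {K L : ℤ} (hN : 2 * K < N) {a : V} (ha : nrm a + L ≤ K) (hL : 0 ≤ L)
    (h : ¬ Arm (BA (TX N p r x ∘ Sum.inl)) a L) : pr N a ∈ sT N (TX N p r x) ↔ a ∈ blk p r x := by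
  set ω := TX N p r x ∘ Sum.inl with hω
  set η := edgeCfg TriAdj p x with hη
  have hlt : ∀ b, Cn (BA ω) {z | nrm (z - a) ≤ L} a b → nrm (b - a) < L := fun b hb => lt_of_le_of_ne hb.right fun he => h ⟨b, he, hb⟩
  have hK : ∀ b, nrm (b - a) ≤ L → nrm b ≤ K := fun b hb => by
    have := nrm_add_le (b - a) a
    rw [sub_add_cancel] at this; omega
  have hl : ∀ b, nrm (b - a) ≤ L → lft (pr N b) = b := fun b hb => lft_pr hN (hK b hb)
  have hst : ∀ b c, nrm (b - a) ≤ L → nrm (c - a) ≤ L → (BA ω b c ↔ η b c = true) := fun b c hb hc => by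
    rw [edge_true]
    simp only [BA, hω, TX, Function.comp_apply, boolOf_true, idxN, Sum.elim_inl, Sym2.lift_mk, hl b hb, hl c hc, dq, edgeU]
  have hstep : ∀ {b c}, TriAdj b c → nrm (b - a) < L → nrm (c - a) ≤ L := fun {b c} hbc hb => by
    have := nrm_step a hbc; omega
  have h1 : ∀ w ∈ pCluster η a, Cn (BA ω) {z | nrm (z - a) ≤ L} a w := by
    intro w hw
    refine ReflTransGen.rec (motive := fun w _ => Cn (BA ω) {z | nrm (z - a) ≤ L} a w) (Cn.refl (by simpa [nrm_zero] using hL)) ?_ hw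
    intro b c _ hbc ih
    have hc := hstep (edge_true.1 hbc).1 (hlt b ih)
    exact ih.tail ((hst b c ih.right hc).2 hbc) hc
  have h2 : ∀ w ∈ cl (GT N) ω ∅ (pr N a), ∃ b ∈ pCluster η a, pr N b = w := by
    intro w hw
    refine Cn.ind (P := fun w => ∃ b ∈ pCluster η a, pr N b = w) hw ⟨a, ReflTransGen.refl, rfl⟩ ?_
    rintro _ c _ hbc _ ⟨b, hb, rfl⟩
    obtain ⟨d, rfl, hd⟩ := lift_step hbc
    have hb' := h1 b hb
    exact ⟨d, ReflTransGen.tail hb ((hst b d hb'.right (hstep hd.1 (hlt b hb'))).1 hd), rfl⟩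
  obtain ⟨hc, hmin⟩ := clusterRep_spec η a
  set c := clusterRep η a with hcd
  have hrp : rp (GT N) (rkT N) ω ∅ (pr N a) = pr N c := by
    refine rp_uniq rkT_inj ?_ ?_
    · exact Cn.map (pr N) (h1 c hc) (fun u v _ _ huv => OE_of_BA huv) (by simp)
    · intro u hu
      obtain ⟨b, hb, rfl⟩ := h2 u hu
      simp only [rkT, hl b (h1 b hb).right, hl c (h1 c hc).right]
      exact hmin b hb
  simp only [sT, sg, Set.mem_ofPred_eq, ← hω, hrp, blk, colourCfg, ← hη, ← hcd, boolOf_true, vtxU]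
  simp only [TX, boolOf_true, idxN, Sum.elim_inr, hl c (h1 c hc).right, dq]

/-- events depending on a box -/
def Loc (v : V) (m : ℤ) (E : Set V → Prop) : Prop := ∀ S T : Set V, (∀ a, nrm (a - v) ≤ m → (a ∈ S ↔ a ∈ T)) → E S → E T

lemma Loc_arm (v : V) (m : ℤ) : Loc v m (fun S => Arm (SV S) v m) := by
  rintro S T h ⟨y, hy, hc⟩
  refine ⟨y, hy, hc.transfer fun a b ha hb hab => ⟨hab.1, ?_, ?_⟩⟩
  · exact (h a ha.right).1 hab.2.1
  · exact (h b hb).1 hab.2.2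

lemma Loc.compl {v : V} {m : ℤ} {E : Set V → Prop} (h : Loc v m E) : Loc v m (fun S => E Sᶜ) := fun S T hST =>
  h _ _ fun a ha => not_congr (hST a ha)

lemma transfer [NeZero N] (h0 : 0 ≤ p) (h1 : p ≤ 1) (h2 : 0 ≤ r) (h3 : r ≤ 1) {v : V} {m : ℤ} {L : ℤ} (hm : 0 ≤ m) (hL : 0 ≤ L) (hN : 2 * (nrm v + m + L) < N)
    {τ : ℝ} (hτ : ∀ a, Pr (fun _ : Sym2 (VN N) => p) (fun ω => Arm (BA ω) a L) ≤ τ) {E : Set V → Prop} (hE : Loc v m E) :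
    |base.real {x | E (blk p r x)} - Pr (dq p r) (fun ω => E (pr N ⁻¹' sT N ω))| ≤ (2 * m + 1) ^ 2 * τ := by
  have hq := isP_dq (X := VN N) h0 h1 h2 h3
  set B : (Sym2 (VN N) ⊕ VN N → Bool) → Prop := fun ω => ∃ d ∈ Bx m, Arm (BA (ω ∘ Sum.inl)) (v + d) L with hB
  have hBp : Pr (dq p r) B ≤ (2 * m + 1) ^ 2 * τ := by
    refine (Pr_exists_le hq _ _).trans ?_
    rw [← card_Bx hm, ← nsmul_eq_mul]
    refine Finset.sum_le_card_nsmul _ _ _ fun d _ => ?_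
    rw [Pr_inl p r (fun ω => Arm (BA ω) (v + d) L)]; exact hτ _
  have key : ∀ x, ¬ B (TX N p r x) → ∀ a, nrm (a - v) ≤ m → (a ∈ pr N ⁻¹' sT N (TX N p r x) ↔ a ∈ blk p r x) := by
    intro x hx a ha
    refine blk_iff hN ?_ hL fun hA => hx ⟨a - v, mem_Bx.2 ha, by rwa [add_sub_cancel]⟩
    have := nrm_add_le (a - v) v
    rw [sub_add_cancel] at this; omega
  haveI := base_prob
  rw [abs_le]
  rw [← TX_law h0 h1 h2 h3] at hBp
  rw [← TX_law h0 h1 h2 h3]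
  constructor
  · have : base.real {x | E (pr N ⁻¹' sT N (TX N p r x))} ≤ base.real ({x | E (blk p r x)} ∪ {x | B (TX N p r x)}) := by
      refine measureReal_mono fun x hx => ?_
      by_cases hb : B (TX N p r x)
      · exact Or.inr hb
      · exact Or.inl (hE _ _ (key x hb) hx)
    have h' := measureReal_union_le (μ := base) {x | E (blk p r x)} {x | B (TX N p r x)}
    linarith
  · have : base.real {x | E (blk p r x)} ≤ base.real ({x | E (pr N ⁻¹' sT N (TX N p r x))} ∪ {x | B (TX N p r x)}) := by
      refine measureReal_mono fun x hx => ?_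
      by_cases hb : B (TX N p r x)
      · exact Or.inr hb
      · exact Or.inl (hE _ _ (fun a ha => (key x hb a ha).symm) hx)
    have h' := measureReal_union_le (μ := base) {x | E (pr N ⁻¹' sT N (TX N p r x))} {x | B (TX N p r x)}
    linarith

end Plane
end DaC

namespace DaC
open Relation

section Asymp
open Classical Filter

lemma dexp_tendsto {c lam D : ℝ} (hc : 0 < c) (hl : 1 < lam) (hD : 0 ≤ D) : Tendsto (fun l : ℕ => D ^ l * Real.exp (-(c * lam ^ l))) atTop (nhds 0) := by
  obtain ⟨k, hk⟩ := pow_unbounded_of_one_lt D hl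
  have h1 : Tendsto (fun l : ℕ => c * lam ^ l) atTop atTop := (tendsto_pow_atTop_atTop_of_one_lt hl).const_mul_atTop hc
  have h2 := ((Real.tendsto_pow_mul_exp_neg_atTop_nhds_zero k).comp h1).const_mul ((c ^ k)⁻¹)
  rw [mul_zero] at h2
  refine squeeze_zero (fun l => by positivity) (fun l => ?_) h2
  simp only [Function.comp_apply]
  rw [← mul_assoc, mul_pow, ← mul_assoc, inv_mul_cancel₀ (by positivity), one_mul]
  refine mul_le_mul_of_nonneg_right ?_ (Real.exp_nonneg _)
  rw [← pow_mul, mul_comm l k, pow_mul]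
  exact pow_le_pow_left₀ hD hk.le l

/-- critical value data -/
def Crit (p0 : ℝ) : Prop := p0 ≤ 1 ∧ 1 - 3 * p0 + p0 ^ 3 = 0

noncomputable def tau (p p0 : ℝ) (l : ℕ) : ℝ := Real.exp (-(kap0 / 1200 * (p0 - p) * (mu0⁻¹) ^ l))

variable {p p0 r : ℝ}

lemma tau_tendsto (hp : p < p0) {D : ℝ} (hD : 0 ≤ D) : Tendsto (fun l : ℕ => D ^ l * tau p p0 l) atTop (nhds 0) :=
  dexp_tendsto (mul_pos (div_pos kap0_pos (by norm_num)) (sub_pos.2 hp)) ((one_lt_inv₀ mu0_pos).2 mu0_lt) hD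

lemma near (h0 : 0 ≤ p) (hp : p < p0) (hc : Crit p0) {v : V} {m : ℤ} (hm : 0 ≤ m) {ε : ℝ} (hε : 0 < ε) :
    ∃ N0 : ℕ, ∀ N ≥ N0, ∀ [NeZero N], ∀ r : ℝ, 0 ≤ r → r ≤ 1 → ∀ E, Loc v m E → |base.real {x | E (blk p r x)} - Pr (dq p r) (fun ω => E (pr N ⁻¹' sT N ω))| ≤ ε := by
  have ht := (tau_tendsto hp (D := 1) (by norm_num)).const_mul (((2 * m + 1 : ℝ)) ^ 2)
  rw [mul_zero] at ht
  obtain ⟨l, hl, hl9⟩ := ((ht.eventually (eventually_le_nhds hε)).and (eventually_ge_atTop 9)).exists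
  rw [one_pow, one_mul] at hl
  refine ⟨2000 * BB ^ (2 * l) + (2 * (nrm v + m + (BB ^ (2 * l) : ℕ))).toNat + 1, fun N hN _ r hr0 hr1 E hE => ?_⟩
  have hn := nrm_nonneg v
  refine (transfer h0 (hp.le.trans hc.1) hr0 hr1 hm (L := (BB ^ (2 * l) : ℕ)) (by positivity) ?_ (fun a => bond_sharp h0 hp hc.1 hc.2 hl9 (by omega) a) hE).trans hl
  omega

lemma base_trans (h0 : 0 ≤ p) (hp : p < p0) (hc : Crit p0) (hr0 : 0 ≤ r) (hr1 : r ≤ 1) (v : V) {m : ℤ} (hm : 0 ≤ m) :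
    base.real {x | Arm (SV (blk p r x)) v m} = base.real {x | Arm (SV (blk p r x)) 0 m} := by
  refine eq_of_abs_sub_nonpos (le_of_forall_pos_le_add fun ε hε => ?_)
  obtain ⟨N1, h1⟩ := near h0 hp hc (v := v) hm (half_pos hε)
  obtain ⟨N2, h2⟩ := near h0 hp hc (v := 0) hm (half_pos hε)
  haveI : NeZero (max (max N1 N2) 1) := ⟨by omega⟩
  have a1 := h1 (max (max N1 N2) 1) (by omega) r hr0 hr1 _ (Loc_arm v m)
  have a2 := h2 (max (max N1 N2) 1) (by omega) r hr0 hr1 _ (Loc_arm 0 m)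
  have e := dac_trans (N := max (max N1 N2) 1) (p := p) (r := r) v m
  change Pr _ (fun ω => Arm (SV (pr _ ⁻¹' sT _ ω)) v m) = Pr _ (fun ω => Arm (SV (pr _ ⁻¹' sT _ ω)) 0 m) at e
  rw [abs_le] at *
  rw [e] at a1
  constructor <;> linarith [a1.1, a1.2, a2.1, a2.2]

lemma base_flip (h0 : 0 ≤ p) (hp : p < p0) (hc : Crit p0) (hr0 : 0 ≤ r) (hr1 : r ≤ 1) (v : V) {m : ℤ} (hm : 0 ≤ m) :
    base.real {x | Arm (SV (blk p r x)ᶜ) v m} = base.real {x | Arm (SV (blk p (1 - r) x)) v m} := by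
  refine eq_of_abs_sub_nonpos (le_of_forall_pos_le_add fun ε hε => ?_)
  obtain ⟨N1, h1⟩ := near h0 hp hc (v := v) hm (half_pos hε)
  haveI : NeZero (max N1 1) := ⟨by omega⟩
  have a1 := h1 (max N1 1) (by omega) r hr0 hr1 _ (Loc_arm v m).compl
  have a2 := h1 (max N1 1) (by omega) (1 - r) (by linarith) (by linarith) _ (Loc_arm v m)
  have e := sg_flip (G := GT (max N1 1)) (rk := rkT (max N1 1)) p (1 - r) (fun S => Arm (SV (pr _ ⁻¹' S)) v m)
  rw [show (1 : ℝ) - (1 - r) = r by ring] at e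
  change Pr _ (fun ω => Arm (SV (pr _ ⁻¹' sT _ ω)ᶜ) v m) = Pr _ (fun ω => Arm (SV (pr _ ⁻¹' sT _ ω)) v m) at e
  rw [abs_le] at *
  rw [e] at a1
  constructor <;> linarith [a1.1, a1.2, a2.1, a2.2]

/-- decay along a geometric sequence of scales -/
lemma decay_seq (h0 : 0 ≤ p) (hp : p < p0) (hc : Crit p0) (hp01 : p < 1) (hr0 : 0 ≤ r) (hr : r < 1 / 2) :
    ∃ R l0 : ℕ, 1 ≤ R ∧ ∀ l ≥ l0, base.real {x | Arm (SV (blk p r x)) 0 (BB ^ (2 * (R * l)) : ℕ)} ≤ ((((BB ^ (2 * (R * (l + 1))) : ℕ) : ℝ)) ^ 2)⁻¹ := by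
  obtain ⟨R1, hR1⟩ := exists_pow_lt_of_lt_one (show (0 : ℝ) < 1 / (2 * BB ^ 8) by norm_num [BB]) mu1_lt
  set R := R1 + 13 with hR
  have hmR : (BB : ℝ) ^ 8 * mu1 ^ R ≤ 1 / 2 := by
    have h1 : mu1 ^ R ≤ mu1 ^ R1 := pow_le_pow_of_le_one mu1_pos.le mu1_lt.le (by omega)
    have h2 : (0 : ℝ) < BB ^ 8 := by norm_num [BB]
    calc (BB : ℝ) ^ 8 * mu1 ^ R ≤ BB ^ 8 * (1 / (2 * BB ^ 8)) := mul_le_mul_of_nonneg_left (h1.trans hR1.le) h2.le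
      _ = 1 / 2 := by rw [mul_one_div, div_eq_iff (by positivity)]; ring
  have hB1 : (1 : ℝ) ≤ BB := by norm_num [BB]
  set C : ℝ := 500000 * 81 / (1 - p) with hC
  have hCp : 0 < C := div_pos (by norm_num) (by linarith)
  set c' : ℝ := (1 / 2 - r) / C with hc'
  have hc'p : 0 < c' := div_pos (by linarith) hCp
  -- the four asymptotic conditions
  have t1 := tau_tendsto hp (D := (BB : ℝ) ^ (6 * R) / mu1 ^ R) (div_nonneg (by positivity) (pow_nonneg mu1_pos.le _))
  have t2 := tau_tendsto hp (D := (BB : ℝ) ^ (6 * R)) (by positivity)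
  have t3 := (tendsto_pow_atTop_nhds_zero_of_lt_one (r := (1 / 2 : ℝ)) (by norm_num) (by norm_num)).const_mul C
  have t4 := ((dexp_tendsto hc'p (lam := 2) (by norm_num) (D := (BB : ℝ) ^ (4 * R)) (by positivity)).const_mul ((BB : ℝ) ^ (4 * R))).add
    ((tau_tendsto hp (D := (BB : ℝ) ^ (4 * R) * BB ^ (18 * R)) (by positivity)).const_mul (15 * (BB : ℝ) ^ (4 * R)))
  simp only [mul_zero, add_zero] at t3 t4
  have hev := (t1.eventually (eventually_le_nhds one_pos)).and ((t2.eventually (eventually_le_nhds (half_pos kap0_pos))).and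
    ((t3.eventually (eventually_le_nhds one_pos)).and ((t4.eventually (eventually_le_nhds one_pos)).and (eventually_ge_atTop 18))))
  obtain ⟨l0, hl0⟩ := eventually_atTop.1 hev
  refine ⟨R, l0, by omega, fun l hl => ?_⟩
  obtain ⟨c1, c2, c3, c4, hl18⟩ := hl0 l hl
  set τ := tau p p0 l with hτd
  have hτ0 : 0 ≤ τ := Real.exp_nonneg _
  set J := R * l with hJ
  have hJl : 13 * l ≤ J := Nat.mul_le_mul_right l (by omega)
  set L := BB ^ (2 * l) with hL
  set N := BB ^ (3 * J) with hNd
  set n := BB ^ (2 * J) with hn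
  have hL1 : 1 ≤ L := BBn_pos _
  have hn1 : 1 ≤ n := BBn_pos _
  haveI : NeZero N := ⟨by have := BBn_pos (3 * J); omega⟩
  have hLn : L ≤ n := Nat.pow_le_pow_right (by norm_num [BB]) (by omega)
  have hnN : 16384 * n ≤ N := by
    have h1 : N = BB ^ J * n := by rw [hNd, hn, ← pow_add]; congr 1; omega
    have h2 : BB ^ 1 ≤ BB ^ J := Nat.pow_le_pow_right (by norm_num [BB]) (by omega)
    rw [h1]; exact Nat.mul_le_mul_right _ (by simpa [BB] using h2)
  have hbs : ∀ a, Pr (fun _ : Sym2 (VN N) => p) (fun ω => Arm (BA ω) a L) ≤ τ := fun a => bond_sharp h0 hp hc.1 hc.2 (by omega) (by omega) a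
  have hN2 : (N : ℝ) ^ 2 = (BB ^ (6 * R)) ^ l := by
    rw [hNd]; push_cast; rw [← pow_mul, ← pow_mul]; congr 1; rw [hJ]; ring
  have hN6 : (N : ℝ) ^ 6 = (BB ^ (18 * R)) ^ l := by
    rw [hNd]; push_cast; rw [← pow_mul, ← pow_mul]; congr 1; rw [hJ]; ring
  have hmJ : mu1 ^ J = (mu1 ^ R) ^ l := by rw [hJ, pow_mul]
  have hmJ0 : 0 < mu1 ^ J := pow_pos mu1_pos J
  set A := 500000 * (2 * (L : ℝ) + 1) ^ 4 * mu1 ^ J / (1 - p) with hA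
  have hA0 : 0 < A := div_pos (by positivity) (by linarith)
  have hAC : A ≤ C * (1 / 2) ^ l := by
    have hL1' : (1 : ℝ) ≤ L := by exact_mod_cast hL1
    have h1 : (2 * (L : ℝ) + 1) ^ 4 ≤ (3 * L) ^ 4 := pow_le_pow_left₀ (by positivity) (by linarith) 4
    have h2 : (L : ℝ) ^ 4 * mu1 ^ J ≤ (1 / 2) ^ l := by
      have : (L : ℝ) ^ 4 * mu1 ^ J = (BB ^ 8 * mu1 ^ R) ^ l := by
        have h4 : (L : ℝ) ^ 4 = (BB ^ 8) ^ l := by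
          rw [hL]; push_cast; rw [← pow_mul, ← pow_mul]; congr 1; ring
        rw [mul_pow, hmJ, h4]
      rw [this]; exact pow_le_pow_left₀ (mul_nonneg (by positivity) (pow_nonneg mu1_pos.le _)) hmR l
    have h3 : C * (1 / 2) ^ l = 500000 * 81 * (1 / 2) ^ l / (1 - p) := by rw [hC]; ring
    rw [h3, hA]
    refine div_le_div_of_nonneg_right ?_ (by linarith)
    calc 500000 * (2 * (L : ℝ) + 1) ^ 4 * mu1 ^ J ≤ 500000 * (3 * L) ^ 4 * mu1 ^ J := by gcongr
      _ = 500000 * 81 * ((L : ℝ) ^ 4 * mu1 ^ J) := by ring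
      _ ≤ _ := by gcongr
  have hds := dac_sharp (N := N) (r := r) (τ := τ) (A := A) (L := L) (J := J) (i0 := 2 * l) h0 hp01 hr0 hr.le hbs ?_ ?_ (by omega) (by omega) (by omega) hA (hAC.trans c3) 0
  · have htr := transfer (N := N) (r := r) h0 hp01.le hr0 (by linarith) (v := 0) (m := (n : ℕ)) (L := (L : ℕ)) (by positivity) (by positivity) (by rw [nrm_zero]; omega) hbs (Loc_arm 0 _)
    have h1 := (abs_le.1 htr).2
    change Pr (dq p r) (fun ω => Arm (SV (pr N ⁻¹' sT N ω)) 0 n) ≤ _ at hds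
    have hexp : Real.exp (-((1 / 2 - r) / A)) ≤ Real.exp (-(c' * 2 ^ l)) := by
      rw [Real.exp_le_exp, neg_le_neg_iff, le_div_iff₀ hA0]
      calc c' * 2 ^ l * A ≤ c' * 2 ^ l * (C * (1 / 2) ^ l) := mul_le_mul_of_nonneg_left hAC (by positivity)
        _ = c' * C * (2 * (1 / 2)) ^ l := by rw [mul_pow]; ring
        _ = 1 / 2 - r := by rw [hc']; field_simp; norm_num
    have hn9 : (2 * ((n : ℤ) : ℝ) + 1) ^ 2 ≤ 9 * (N : ℝ) ^ 6 := by
      have a1 : (1 : ℝ) ≤ n := by exact_mod_cast hn1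
      have a2 : (n : ℝ) ≤ N := by exact_mod_cast (by omega : n ≤ N)
      have a3 : (N : ℝ) ^ 2 ≤ N ^ 6 := pow_le_pow_right₀ (by linarith) (by norm_num)
      have a4 : (2 * (n : ℝ) + 1) ^ 2 ≤ (3 * N) ^ 2 := pow_le_pow_left₀ (by positivity) (by linarith) 2
      rw [Int.cast_natCast]
      calc (2 * (n : ℝ) + 1) ^ 2 ≤ 9 * (N : ℝ) ^ 2 := by linarith [a4, mul_pow (3 : ℝ) (N : ℝ) 2]
        _ ≤ _ := by linarith
    have h2 : base.real {x | Arm (SV (blk p r x)) 0 (n : ℕ)} ≤ Real.exp (-(c' * 2 ^ l)) + 15 * ((N : ℝ) ^ 6 * τ) := by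
      have := mul_le_mul_of_nonneg_right hn9 hτ0
      linarith
    refine h2.trans ?_
    have hD : (((BB ^ (2 * (R * (l + 1))) : ℕ) : ℝ)) ^ 2 = BB ^ (4 * R) * (BB ^ (4 * R)) ^ l := by
      push_cast; rw [← pow_mul, ← pow_mul, ← pow_add]; congr 1; ring
    have hDp : (0 : ℝ) < BB ^ (4 * R) * (BB ^ (4 * R)) ^ l := by positivity
    rw [hD, ← one_div, le_div_iff₀ hDp, hN6]
    refine le_trans (le_of_eq ?_) c4
    rw [mul_pow]; ring
  · rw [hN2, hmJ]
    rw [div_pow, div_mul_eq_mul_div, div_le_one (by rw [← hmJ]; exact hmJ0)] at c1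
    exact c1
  · rw [hN2]; exact c2

lemma decay_black (h0 : 0 ≤ p) (hp : p < p0) (hc : Crit p0) (hp01 : p < 1) (hr0 : 0 ≤ r) (hr : r < 1 / 2) :
    ∃ m0 : ℕ, ∀ m : ℕ, m0 ≤ m → ∀ v, base.real {x | Arm (SV (blk p r x)) v m} ≤ ((m : ℝ) ^ 2)⁻¹ := by
  obtain ⟨R, l0, hR, h⟩ := decay_seq h0 hp hc hp01 hr0 hr
  have hb : 1 < BB ^ (2 * R) := Nat.one_lt_pow (by omega) (by norm_num [BB])
  refine ⟨(BB ^ (2 * R)) ^ l0, fun m hm v => ?_⟩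
  have hm0 : m ≠ 0 := by
    have : 0 < (BB ^ (2 * R)) ^ l0 := by positivity
    omega
  have h1 := Nat.pow_log_le_self (BB ^ (2 * R)) hm0
  have h2 := Nat.lt_pow_succ_log_self hb m
  have h3 : l0 ≤ Nat.log (BB ^ (2 * R)) m := (Nat.le_log_iff_pow_le hb hm0).2 hm
  have h4 := h _ h3
  rw [base_trans h0 hp hc hr0 (by linarith) v (by positivity)]
  haveI := base_prob
  rw [← pow_mul, mul_assoc] at h1 h2
  refine le_trans (measureReal_mono fun x hx => ?_) (h4.trans ?_)
  · exact Arm.anti (fun a b hab => hab.1) (by positivity) (by exact_mod_cast h1) hx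
  · have : 0 < m := Nat.pos_of_ne_zero hm0
    gcongr

lemma decay_white (h0 : 0 ≤ p) (hp : p < p0) (hc : Crit p0) (hp01 : p < 1) (hr : 1 / 2 < r) (hr1 : r ≤ 1) :
    ∃ m0 : ℕ, ∀ m : ℕ, m0 ≤ m → ∀ v, base.real {x | Arm (SV (blk p r x)ᶜ) v m} ≤ ((m : ℝ) ^ 2)⁻¹ := by
  obtain ⟨m0, h⟩ := decay_black (r := 1 - r) h0 hp hc hp01 (by linarith) (by linarith)
  refine ⟨m0, fun m hm v => ?_⟩
  rw [base_flip h0 hp hc (by linarith) hr1 v (by positivity)]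
  exact h m hm v

end Asymp
end DaC

namespace DaC
open Relation

section Final
open Classical Filter

lemma quad (S : Set V) {n M : ℤ} (hn : 0 ≤ n) (hM : n < M) :
    (∃ a z : V, nrm a ≤ n + 1 ∧ M ≤ nrm z ∧ Cn TriAdj (Rc 0 M 0 M ∩ S) a z) ∨
    (∃ k j : ℤ, n < k ∧ k ≤ M ∧ Cn TriAdj (Rc 0 M 0 M ∩ Sᶜ) (k, 0) (0, j)) := by
  by_contra hcon
  rw [not_or] at hcon
  obtain ⟨hb, hw⟩ := hcon
  set s : V → Prop := fun z => (z ∈ Rc 0 M 0 M ∧ z ∈ S) ∨ (z.1 = -1 ∧ z.2 ≤ n) ∨ (z.2 = -1 ∧ z.1 ≤ n) ∨ z.1 = M + 1 ∨ (z.2 = M + 1 ∧ 0 ≤ z.1) with hs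
  rcases hex s (-1) (M + 1) (-1) (M + 1) (by omega) (by omega) with ⟨u, v, hu, hv, h⟩ | ⟨u, v, hu, hv, h⟩
  · set P : V → Prop := fun z => ((z.1 = -1 ∧ z.2 ≤ n) ∨ (z.2 = -1 ∧ z.1 ≤ n)) ∨ ∃ a, nrm a ≤ n + 1 ∧ Cn TriAdj (Rc 0 M 0 M ∩ S) a z with hP
    have hPv : P v := by
      refine h.ind (P := P) ?_ ?_
      · have h1 := h.left.2
        simp only [hs, Set.mem_ofPred_eq, Rc] at h1
        exact Or.inl (by omega)
      · intro z z' _ hzz hz' hz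
        have h1 := hz'.2
        simp only [hs, Set.mem_ofPred_eq] at h1
        rw [triAdj_iff] at hzz
        rcases h1 with h1 | h1 | h1 | h1
        · right
          rcases hz with hz | ⟨a, ha, hz⟩
          · refine ⟨z', ?_, Cn.refl h1⟩
            have := h1.1
            simp only [Rc, Set.mem_ofPred_eq] at this
            simp only [nrm]; omega
          · exact ⟨a, ha, hz.tail ((triAdj_iff _ _).2 hzz) h1⟩
        · exact Or.inl (Or.inl h1)
        · exact Or.inl (Or.inr h1)
        · exfalso
          rcases hz with hz | ⟨a, ha, hz⟩
          · omega
          · refine hb ⟨a, z, ha, ?_, hz⟩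
            have := hz.right.1
            simp only [Rc, Set.mem_ofPred_eq] at this
            simp only [nrm]; omega
    rcases hPv with h1 | ⟨a, ha, h1⟩
    · omega
    · have := h1.right.1
      simp only [Rc, Set.mem_ofPred_eq] at this; omega
  · set P : V → Prop := fun z => (z.2 = -1 ∧ n < z.1 ∧ z.1 ≤ M) ∨ ∃ k, n < k ∧ k ≤ M ∧ Cn TriAdj (Rc 0 M 0 M ∩ Sᶜ) (k, 0) z with hP
    have hPv : P v := by
      refine h.ind (P := P) ?_ ?_
      · have h1 := h.left.2
        have h2 := h.left.1
        simp only [hs, Set.mem_ofPred_eq, Rc, not_or] at h1 h2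
        exact Or.inl (by omega)
      · intro z z' _ hzz hz' hz
        have h1 := hz'.2
        have h2 := hz'.1
        simp only [hs, Set.mem_ofPred_eq, not_or] at h1
        obtain ⟨h3, h1⟩ := h1
        rw [triAdj_iff] at hzz
        by_cases hin : z' ∈ Rc 0 M 0 M
        · right
          have h4 : z' ∈ Rc 0 M 0 M ∩ Sᶜ := ⟨hin, fun hS => h3 ⟨hin, hS⟩⟩
          rcases hz with hz | ⟨k, hk, hk', hz⟩
          · simp only [Rc, Set.mem_ofPred_eq] at hin
            have e : z' = (z'.1, 0) := Prod.ext rfl (by simp only; omega)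
            exact ⟨z'.1, by omega, by omega, by rw [← e]; exact Cn.refl h4⟩
          · exact ⟨k, hk, hk', hz.tail ((triAdj_iff _ _).2 hzz) h4⟩
        · simp only [Rc, Set.mem_ofPred_eq] at hin h2
          by_cases hbot : z'.2 = -1
          · left; omega
          · exfalso
            rcases hz with hz | ⟨k, hk, hk', hz⟩
            · omega
            · have h5 := hz.right.1
              simp only [Rc, Set.mem_ofPred_eq] at h5
              have e : z = (0, z.2) := Prod.ext (by simp only; omega) rfl
              rw [e] at hz
              exact hw ⟨k, z.2, hk, hk', hz⟩
    rcases hPv with h1 | ⟨a, ha, _, h1⟩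
    · omega
    · have := h1.right.1
      simp only [Rc, Set.mem_ofPred_eq] at this; omega

lemma cn_SV {R S : Set V} {a z : V} (h : Cn TriAdj (R ∩ S) a z) : Cn (SV S) Set.univ a z :=
  h.map id (fun _ _ ha hb hab => ⟨hab, ha.2, hb.2⟩) (by simp)

variable {p p0 r : ℝ}

lemma perc_lower (h0 : 0 ≤ p) (hp : p < p0) (hc : Crit p0) (hp01 : p < 1) (hr : 1 / 2 < r) (hr1 : r ≤ 1) :
    ∃ c : ℝ, 0 < c ∧ ∀ m : ℕ, c ≤ base.real {x | Arm (SV (blk p r x)) 0 m} := by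
  have := base_prob
  obtain ⟨m0, hm0⟩ := decay_white h0 hp hc hp01 hr hr1
  set n : ℕ := m0 + 2 with hn
  have hcard : 0 < ((Bx (n + 1)).card : ℝ) := by
    rw [card_Bx (by positivity)]; positivity
  refine ⟨1 / 2 / (Bx (n + 1)).card, by positivity, fun m => ?_⟩
  rw [div_le_iff₀ hcard]
  set M : ℕ := n + 1 + m with hMd
  have hcov : (Set.univ : Set ℝ) ⊆ (⋃ a ∈ Bx (n + 1), {x | Arm (SV (blk p r x)) a m}) ∪ ⋃ k ∈ Finset.Ioc n M, {x | Arm (SV (blk p r x)ᶜ) ((k : ℤ), 0) k} := by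
    intro x _
    rcases quad (blk p r x) (n := n) (M := M) (by positivity) (by omega) with ⟨a, z, ha, hz, h⟩ | ⟨k, j, hk, hkM, h⟩
    · left
      refine Set.mem_biUnion (mem_Bx.2 ha) (arm_of_cn (fun a b hab => hab.1) (by positivity) (cn_SV h) ?_)
      have := nrm_add_le (z - a) a
      rw [sub_add_cancel] at this; omega
    · right
      have h1 := arm_of_cn (n := k) (fun a b hab => hab.1) (by omega) (cn_SV h) (by simp only [nrm, Prod.fst_sub, Prod.snd_sub]; omega)
      obtain ⟨k', rfl⟩ : ∃ k' : ℕ, k = k' := ⟨k.toNat, by omega⟩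
      refine Set.mem_biUnion (Finset.mem_Ioc.2 ⟨by omega, by omega⟩) h1
  have h1 : (1 : ℝ) ≤ base.real ((⋃ a ∈ Bx (n + 1), {x | Arm (SV (blk p r x)) a m}) ∪ ⋃ k ∈ Finset.Ioc n M, {x | Arm (SV (blk p r x)ᶜ) ((k : ℤ), 0) k}) := by
    have := measureReal_mono (μ := base) hcov
    rwa [probReal_univ] at this
  have h2 := measureReal_union_le (μ := base) (⋃ a ∈ Bx (n + 1), {x | Arm (SV (blk p r x)) a m}) (⋃ k ∈ Finset.Ioc n M, {x | Arm (SV (blk p r x)ᶜ) ((k : ℤ), 0) k})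
  have h3 := measureReal_biUnion_finset_le (μ := base) (Bx (n + 1)) (fun a => {x | Arm (SV (blk p r x)) a m})
  have h4 := measureReal_biUnion_finset_le (μ := base) (Finset.Ioc n M) (fun k : ℕ => {x | Arm (SV (blk p r x)ᶜ) ((k : ℤ), 0) k})
  have h5 : ∑ a ∈ Bx (n + 1), base.real {x | Arm (SV (blk p r x)) a m} = base.real {x | Arm (SV (blk p r x)) 0 m} * (Bx (n + 1)).card := by
    rw [Finset.sum_congr rfl fun a _ => base_trans h0 hp hc (by linarith) hr1 a (by positivity), Finset.sum_const, nsmul_eq_mul, mul_comm]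
  have h6 : ∑ k ∈ Finset.Ioc n M, base.real {x | Arm (SV (blk p r x)ᶜ) ((k : ℤ), 0) k} ≤ 1 / 2 := by
    refine (Finset.sum_le_sum fun k hk => hm0 k (by have := (Finset.mem_Ioc.1 hk).1; omega) _).trans ?_
    refine (sum_Ioc_inv_sq_le_sub (by omega) (by omega)).trans ?_
    have h7 : ((n : ℕ) : ℝ)⁻¹ ≤ 2⁻¹ := by
      gcongr
      rw [hn]; push_cast; linarith [(Nat.cast_nonneg m0 : (0 : ℝ) ≤ m0)]
    have h8 : (0 : ℝ) ≤ ((M : ℕ) : ℝ)⁻¹ := by positivity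
    linarith
  linarith

/-- paths of a given length -/
def itr (R : V → V → Prop) (u : V) : ℕ → V → Prop
  | 0, v => u = v
  | n + 1, v => ∃ w, itr R u n w ∧ R w v

lemma itr_iff {R : V → V → Prop} {u v : V} : ReflTransGen R u v ↔ ∃ n, itr R u n v := by
  constructor
  · intro h
    induction h with
    | refl => exact ⟨0, rfl⟩
    | tail _ hbc ih => obtain ⟨n, hn⟩ := ih; exact ⟨n + 1, _, hn, hbc⟩
  · rintro ⟨n, hn⟩
    induction n generalizing v with
    | zero => rw [show u = v from hn]
    | succ n ih => obtain ⟨w, h1, h2⟩ := hn; exact (ih h1).tail h2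

/-- measurability of connection events -/
lemma meas_rtg {Ω : Type*} [MeasurableSpace Ω] {R : Ω → V → V → Prop} (h : ∀ a b, MeasurableSet {x | R x a b}) (u v : V) :
    MeasurableSet {x | ReflTransGen (R x) u v} := by
  have key : ∀ (n : ℕ) (v : V), MeasurableSet {x | itr (R x) u n v} := by
    intro n
    induction n with
    | zero => intro v; exact MeasurableSet.const _
    | succ n ih =>
      intro v
      have : {x | itr (R x) u (n + 1) v} = ⋃ w : V, {x | itr (R x) u n w} ∩ {x | R x w v} := by
        ext x; simp only [Set.mem_iUnion, Set.mem_inter_iff]; rfl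
      rw [this]
      exact MeasurableSet.iUnion fun w => (ih w).inter (h w v)
  have : {x | ReflTransGen (R x) u v} = ⋃ n : ℕ, {x | itr (R x) u n v} := by
    ext x; simp only [Set.mem_iUnion]; exact itr_iff
  rw [this]
  exact MeasurableSet.iUnion fun n => key n v

lemma meas_arm {Ω : Type*} [MeasurableSpace Ω] {S : Ω → Set V} (h : ∀ a, MeasurableSet {x | a ∈ S x}) (v : V) (m : ℤ) : MeasurableSet {x | Arm (SV (S x)) v m} := by
  have : {x | Arm (SV (S x)) v m} = ⋃ y : V, {x | nrm (y - v) = m} ∩ ({x | v ∈ {z | nrm (z - v) ≤ m}} ∩ {x | ReflTransGen (fun a b => SV (S x) a b ∧ b ∈ {z | nrm (z - v) ≤ m}) v y}) := by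
    ext x; simp only [Set.mem_iUnion, Set.mem_inter_iff]; rfl
  rw [this]
  refine MeasurableSet.iUnion fun y => (MeasurableSet.const _).inter ((MeasurableSet.const _).inter (meas_rtg (fun a b => ?_) _ _))
  exact ((MeasurableSet.const _).inter ((h a).inter (h b))).inter (MeasurableSet.const _)

lemma meas_edge (u v : V) : Measurable (fun x => edgeCfg TriAdj p x u v) := by
  unfold edgeCfg
  exact (measurable_of_countable (fun b : Bool => boolOf (TriAdj u v) && b)).comp ((meas_thr p).comp (meas_unif _))

lemma meas_colour (v : V) : Measurable (fun x => colourCfg TriAdj p r x v) := by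
  have hcl : ∀ w, MeasurableSet {x | w ∈ pCluster (edgeCfg TriAdj p x) v} := fun w =>
    meas_rtg (R := fun x a b => edgeCfg TriAdj p x a b = true) (fun a b => meas_edge a b (measurableSet_singleton true)) v w
  refine measurable_to_bool ?_
  have : (fun x => colourCfg TriAdj p r x v) ⁻¹' {true} =
      ⋃ w : V, ({x | w ∈ pCluster (edgeCfg TriAdj p x) v} ∩ ⋂ u : V, ({x | u ∈ pCluster (edgeCfg TriAdj p x) v}ᶜ ∪ {x | Encodable.encode w ≤ Encodable.encode u})) ∩ {x | vtxU w x < r} := by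
    ext x
    simp only [Set.mem_preimage, Set.mem_singleton_iff, colourCfg, boolOf_true, Set.mem_iUnion, Set.mem_inter_iff, Set.mem_iInter, Set.mem_union, Set.mem_compl_iff, Set.mem_ofPred_eq]
    obtain ⟨h1, h2⟩ := clusterRep_spec (edgeCfg TriAdj p x) v
    constructor
    · intro h
      exact ⟨_, ⟨h1, fun u => or_iff_not_imp_left.2 fun hu => h2 u (not_not.1 hu)⟩, h⟩
    · rintro ⟨w, ⟨h3, h4⟩, h5⟩
      have : clusterRep (edgeCfg TriAdj p x) v = w :=
        Encodable.encode_injective (le_antisymm (h2 w h3) ((h4 _).resolve_left (not_not.2 h1)))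
      rwa [this]
  rw [this]
  refine MeasurableSet.iUnion fun w => ((hcl w).inter (MeasurableSet.iInter fun u => (hcl u).compl.union (MeasurableSet.const _))).inter ?_
  exact measurableSet_lt (meas_unif _) measurable_const

lemma meas_cfg : Measurable (fun x => ((edgeCfg TriAdj p x, colourCfg TriAdj p r x) : Config)) :=
  (measurable_pi_lambda _ fun u => measurable_pi_lambda _ fun v => meas_edge u v).prodMk (measurable_pi_lambda _ fun v => meas_colour v)

lemma meas_blk (a : V) : MeasurableSet {x | a ∈ blk p r x} := meas_colour a (measurableSet_singleton true)

lemma arm_of_inf {ξ : ColourCfg} (h : (monoCluster TriAdj ξ true origin).Infinite) (m : ℕ) : Arm (SV {v | ξ v = true}) 0 m := by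
  obtain ⟨w, hw, hn⟩ := h.exists_notMem_finset (Bx m)
  rw [mem_Bx, not_le] at hn
  refine arm_of_cn (S := Set.univ) (y := w) (fun a b hab => hab.1) (by positivity) ⟨trivial, ?_⟩ (by rw [sub_zero]; exact hn.le)
  exact ReflTransGen.mono (fun a b hab => ⟨⟨hab.1, hab.2.1, hab.2.2⟩, trivial⟩) _ _ hw.2

lemma inf_of_arm {ξ : ColourCfg} (h : ∀ m : ℕ, Arm (SV {v | ξ v = true}) 0 m) : (monoCluster TriAdj ξ true origin).Infinite := by
  have hcn : ∀ m : ℕ, ∃ y, nrm y = m ∧ MonoConn TriAdj ξ true origin y := by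
    intro m
    obtain ⟨y, hy, hc⟩ := h m
    rw [sub_zero] at hy
    exact ⟨y, hy, ReflTransGen.mono (fun a b hab => ⟨hab.1.1, hab.1.2.1, hab.1.2.2⟩) _ _ hc.2⟩
  have h0 : ξ origin = true := by
    obtain ⟨y, hy, hc⟩ := hcn 1
    rcases ReflTransGen.cases_head hc with he | ⟨c, hc, _⟩
    · exfalso
      rw [← he] at hy
      have : nrm origin = 0 := nrm_zero
      omega
    · exact hc.2.1
  intro hfin
  obtain ⟨B, hB⟩ : ∃ B : ℕ, ∀ y ∈ monoCluster TriAdj ξ true origin, nrm y ≤ B := by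
    refine ⟨(hfin.toFinset.sup fun y => (nrm y).toNat), fun y hy => ?_⟩
    have : (nrm y).toNat ≤ hfin.toFinset.sup fun y => (nrm y).toNat :=
      Finset.le_sup (f := fun y => (nrm y).toNat) (hfin.mem_toFinset.2 hy)
    omega
  obtain ⟨y, hy, hc⟩ := hcn (B + 1)
  have := hB y ⟨h0, hc⟩
  push_cast at hy
  omega

lemma theta_zero (h0 : 0 ≤ p) (hp : p < p0) (hc : Crit p0) (hp01 : p < 1) (hr0 : 0 ≤ r) (hr : r < 1 / 2) : thetaTri p r = 0 := by
  have := base_prob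
  obtain ⟨m0, hm0⟩ := decay_black h0 hp hc hp01 hr0 hr
  have hle : ∀ m : ℕ, m0 ≤ m → thetaTri p r ≤ ENNReal.ofReal (((m : ℝ) ^ 2)⁻¹) := by
    intro m hm
    have hS : MeasurableSet {ω : Config | Arm (SV {v | ω.2 v = true}) 0 m} :=
      meas_arm (fun a => (measurable_pi_apply a).comp measurable_snd (measurableSet_singleton true)) 0 m
    calc thetaTri p r ≤ DaCMeasure TriAdj p r {ω : Config | Arm (SV {v | ω.2 v = true}) 0 m} := measure_mono fun ω hω => arm_of_inf hω m
      _ = base {x | Arm (SV (blk p r x)) 0 m} := by rw [DaCMeasure, Measure.map_apply meas_cfg hS]; rfl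
      _ = ENNReal.ofReal (base.real {x | Arm (SV (blk p r x)) 0 m}) := by rw [ofReal_measureReal]
      _ ≤ _ := ENNReal.ofReal_le_ofReal (hm0 m hm 0)
  have ht : Tendsto (fun m : ℕ => ENNReal.ofReal (((m : ℝ) ^ 2)⁻¹)) atTop (nhds 0) := by
    rw [← ENNReal.ofReal_zero]
    refine ENNReal.tendsto_ofReal ?_
    exact tendsto_inv_atTop_zero.comp ((tendsto_pow_atTop (by norm_num)).comp tendsto_natCast_atTop_atTop)
  exact le_antisymm (ge_of_tendsto ht (eventually_atTop.2 ⟨m0, hle⟩)) bot_le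

lemma theta_pos (h0 : 0 ≤ p) (hp : p < p0) (hc : Crit p0) (hp01 : p < 1) (hr : 1 / 2 < r) (hr1 : r ≤ 1) : thetaTri p r ≠ 0 := by
  have := base_prob
  obtain ⟨c, hc0, hcm⟩ := perc_lower h0 hp hc hp01 hr hr1
  have hanti : Antitone (fun m : ℕ => {x | Arm (SV (blk p r x)) 0 (m : ℤ)}) := fun m m' hmm x hx =>
    Arm.anti (fun a b hab => hab.1) (by positivity) (by exact_mod_cast hmm) hx
  have h1 := hanti.measure_iInter (μ := base) (fun m => (meas_arm meas_blk 0 m).nullMeasurableSet) ⟨0, measure_ne_top _ _⟩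
  have h2 : ENNReal.ofReal c ≤ base (⋂ m : ℕ, {x | Arm (SV (blk p r x)) 0 (m : ℤ)}) := by
    rw [h1]
    refine le_iInf fun m => ?_
    rw [← ofReal_measureReal (μ := base)]
    exact ENNReal.ofReal_le_ofReal (hcm m)
  have h3 : base (⋂ m : ℕ, {x | Arm (SV (blk p r x)) 0 (m : ℤ)}) ≤ thetaTri p r := by
    refine le_trans (measure_mono ?_) (Measure.le_map_apply (μ := base) (meas_cfg (p := p) (r := r)).aemeasurable _)
    intro x hx
    exact inf_of_arm fun m => Set.mem_iInter.1 hx m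
  have h4 : 0 < ENNReal.ofReal c := ENNReal.ofReal_pos.2 hc0
  exact (lt_of_lt_of_le h4 (h2.trans h3)).ne'

lemma crit_sin : Crit (2 * Real.sin (Real.pi / 18)) := by
  have h := Real.sin_three_mul (Real.pi / 18)
  rw [show 3 * (Real.pi / 18) = Real.pi / 6 by ring, Real.sin_pi_div_six] at h
  have h1 : Real.sin (Real.pi / 18) ≤ 1 / 2 := by
    rw [← Real.sin_pi_div_six]
    exact Real.sin_le_sin_of_le_of_le_pi_div_two (by linarith [Real.pi_pos]) (by linarith [Real.pi_pos]) (by linarith [Real.pi_pos])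
  exact ⟨by linarith, by
    have e : (2 * Real.sin (Real.pi / 18)) ^ 3 = 8 * Real.sin (Real.pi / 18) ^ 3 := by ring
    rw [e]
    linarith⟩

end Final

theorem rcTri_eq_half (p : ℝ) (hp0 : 0 ≤ p) (hp : p < 2 * Real.sin (Real.pi / 18)) :
    rcTri p = 1 / 2 := by
  have hc := crit_sin
  have hp1 : p < 1 := lt_of_lt_of_le hp hc.1
  unfold rcTri
  refine csSup_eq_of_forall_le_of_forall_lt_exists_gt ⟨0, ⟨le_refl _, zero_le_one⟩, theta_zero hp0 hp hc hp1 le_rfl (by norm_num)⟩ ?_ ?_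
  · rintro r ⟨hr, ht⟩
    by_contra hlt
    exact theta_pos hp0 hp hc hp1 (not_le.1 hlt) hr.2 ht
  · intro w hw
    have h1 : max 0 ((w + 1 / 2) / 2) < 1 / 2 := max_lt (by norm_num) (by linarith)
    refine ⟨max 0 ((w + 1 / 2) / 2), ⟨⟨le_max_left _ _, by linarith⟩, theta_zero hp0 hp hc hp1 (le_max_left _ _) h1⟩, ?_⟩
    exact lt_of_lt_of_le (by linarith) (le_max_right _ _)

end DaC
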